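/- For every integer n ≥ 0, writing N_i = N(i,11,11n+4) and M_i = M(i,11,11n+4), the following hold: 4N_1 + 3N_3 + 5M_1 ≥ 2N_0 + 3N_2 + N_4 + N_5 + 5M_0; 4N_0 + 5N_2 + 3M_0 ≥ 5N_1 + 2N_3 + N_4 + N_5 + 3M_1; 3N_1 + N_2 + M_0 ≥ 2N_0 + 2N_3 + M_1; and 3N_0 + N_4 + N_5 + M_1 ≥ 3N_2 + 2N_3 + M_0. -/

import Mathlib

/-- `p n`: the number of partitions of `n`. -/
def partitionCount (n : ℕ) : ℕ := Fintype.card (Nat.Partition n)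

/-- The rank of a partition: its largest part minus its number of parts
(the empty partition has rank 0). -/
def partitionRank {n : ℕ} (π : Nat.Partition n) : ℤ :=
  (π.parts.sup : ℤ) - (Multiset.card π.parts : ℤ)

/-- The crank of a partition `π`: if `π` has no parts equal to 1, it is the largest part;
otherwise it is (number of parts larger than the number of ones) − (number of ones). -/
def partitionCrank {n : ℕ} (π : Nat.Partition n) : ℤ :=
  if π.parts.count 1 = 0 then (π.parts.sup : ℤ)
  else ((π.parts.filter fun x => π.parts.count 1 < x).card : ℤ) - (π.parts.count 1 : ℤ)

/-- `rankCount a r n` = `N(a,r,n)`: the number of partitions of `n` whose rank is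
congruent to `a` modulo `r`. -/
def rankCount (a r : ℤ) (n : ℕ) : ℕ :=
  (Finset.univ.filter fun π : Nat.Partition n => partitionRank π % r = a % r).card

/-- `crankCount a n` = `M(a,11,n)`: for `n ≠ 1`, the number of partitions of `n` whose crank
is congruent to `a` modulo 11; at `n = 1` the standard convention `M(0,11,1) = −1`,
`M(1,11,1) = M(10,11,1) = 1`, and `M(a,11,1) = 0` otherwise. -/
def crankCount (a : ℤ) (n : ℕ) : ℤ :=
  if n = 1 then
    if a % 11 = 0 then -1
    else if a % 11 = 1 ∨ a % 11 = 10 then 1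
    else 0
  else ((Finset.univ.filter fun π : Nat.Partition n => partitionCrank π % 11 = a % 11).card : ℤ)

namespace RankCrank

open Filter Topology

set_option linter.unusedSectionVars false

section Pochhammer

variable {𝕜 : Type*} [NormedField 𝕜] [CompleteSpace 𝕜]

/-- The infinite `q`-Pochhammer symbol `(u; y)_∞`. -/
noncomputable def poch (y u : 𝕜) : 𝕜 := ∏' m : ℕ, (1 - u * y ^ m)

/-- The finite `q`-Pochhammer symbol `(u; y)_n`. -/
def fpoch (y u : 𝕜) (n : ℕ) : 𝕜 := ∏ m ∈ Finset.range n, (1 - u * y ^ m)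

lemma fpoch_succ (y u : 𝕜) (n : ℕ) : fpoch y u (n + 1) = fpoch y u n * (1 - u * y ^ n) :=
  Finset.prod_range_succ _ _

lemma fpoch_zero (y u : 𝕜) : fpoch y u 0 = 1 := Finset.prod_range_zero _

lemma summable_norm_mul_pow {y : 𝕜} (hy : ‖y‖ < 1) (u : 𝕜) :
    Summable fun m : ℕ ↦ ‖-(u * y ^ m)‖ := by
  simpa [norm_mul, norm_pow] using (summable_geometric_of_lt_one (norm_nonneg y) hy).mul_left ‖u‖

lemma multipliable_poch {y : 𝕜} (hy : ‖y‖ < 1) (u : 𝕜) :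
    Multipliable fun m : ℕ ↦ (1 - u * y ^ m) := by
  simpa [sub_eq_add_neg] using multipliable_one_add_of_summable (summable_norm_mul_pow hy u)

lemma tendsto_fpoch {y : 𝕜} (hy : ‖y‖ < 1) (u : 𝕜) :
    Tendsto (fpoch y u) atTop (𝓝 (poch y u)) :=
  (multipliable_poch hy u).tendsto_prod_tprod_nat

lemma poch_eq_mul {y : 𝕜} (hy : ‖y‖ < 1) (u : 𝕜) : poch y u = (1 - u) * poch y (u * y) := by
  unfold poch
  rw [tprod_eq_zero_mul']
  · simp [pow_succ', mul_assoc]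
  · simpa [pow_succ', mul_assoc] using multipliable_poch hy (u * y)

lemma poch_eq_fpoch_mul {y : 𝕜} (hy : ‖y‖ < 1) (u : 𝕜) (n : ℕ) :
    poch y u = fpoch y u n * poch y (u * y ^ n) := by
  induction n with
  | zero => simp [fpoch_zero]
  | succ n ih => rw [ih, fpoch_succ, poch_eq_mul hy (u * y ^ n), pow_succ]; ring_nf

lemma poch_ne_zero {y u : 𝕜} (hy : ‖y‖ < 1) (h : ∀ m : ℕ, u * y ^ m ≠ 1) : poch y u ≠ 0 := by
  unfold poch
  have := tprod_one_add_ne_zero_of_summable (f := fun m : ℕ ↦ -(u * y ^ m))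
    (fun m hm ↦ h m (by linear_combination -hm)) (summable_norm_mul_pow hy u)
  simpa [sub_eq_add_neg] using this

lemma poch_zero {y : 𝕜} : poch y 0 = 1 := by simp [poch]

lemma fpoch_ne_zero {y u : 𝕜} (h : ∀ m : ℕ, u * y ^ m ≠ 1) (n : ℕ) : fpoch y u n ≠ 0 :=
  Finset.prod_ne_zero_iff.2 fun m _ ↦ sub_ne_zero.2 (h m).symm

lemma pow_ne_one_of_norm_lt_one {y : 𝕜} (hy : ‖y‖ < 1) (m : ℕ) : y * y ^ m ≠ 1 := by
  intro h
  have h1 : ‖y ^ (m + 1)‖ < 1 := by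
    rw [norm_pow]; exact pow_lt_one₀ (norm_nonneg _) hy (by omega)
  rw [pow_succ', h, norm_one] at h1
  exact lt_irrefl _ h1

/-- Two functional equations of the same shape force a power series to be a product. -/
lemma eq_of_functional_equation {y : 𝕜} (hy : ‖y‖ < 1) (a b : 𝕜) (F : 𝕜 → 𝕜)
    (hF : Tendsto F (𝓝 0) (𝓝 1)) (z : 𝕜)
    (h : ∀ n : ℕ, (1 - b * (z * y ^ n)) * F (z * y ^ n)
        = (1 - a * (z * y ^ n)) * F (z * y ^ (n + 1))) :
    poch y (b * z) * F z = poch y (a * z) := by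
  have key : ∀ n : ℕ, fpoch y (b * z) n * F z = fpoch y (a * z) n * F (z * y ^ n) := by
    intro n
    induction n with
    | zero => simp [fpoch_zero]
    | succ n ih =>
      rw [fpoch_succ, fpoch_succ]
      linear_combination (1 - b * z * y ^ n) * ih + fpoch y (a * z) n * h n
  have h0 : Tendsto (fun n : ℕ ↦ z * y ^ n) atTop (𝓝 0) := by
    simpa using (tendsto_pow_atTop_nhds_zero_of_norm_lt_one hy).const_mul z
  have h1 := (tendsto_fpoch hy (b * z)).mul_const (F z)
  have h2 := (tendsto_fpoch hy (a * z)).mul (hF.comp h0)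
  rw [mul_one] at h2
  exact tendsto_nhds_unique h1 (h2.congr fun n ↦ (key n).symm)

/-- A power series with coefficients `c n` satisfying a ratio recursion converges normally. -/
lemma summable_norm_of_ratio {c : ℕ → 𝕜} {r : ℕ → 𝕜} (hc : ∀ n, c (n + 1) = r n * c n) {l : 𝕜}
    (hr : Tendsto r atTop (𝓝 l)) {z : 𝕜} (hz : ‖l‖ * ‖z‖ < 1) :
    Summable fun n ↦ ‖c n * z ^ n‖ := by
  obtain ⟨ρ, h1, h2⟩ := exists_between hz
  have hev : ∀ᶠ n in atTop, ‖r n‖ * ‖z‖ < ρ := (hr.norm.mul_const ‖z‖).eventually_lt_const h1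
  refine summable_of_ratio_norm_eventually_le h2 ?_
  filter_upwards [hev] with n hn
  rw [hc, norm_norm, norm_norm, pow_succ]
  calc ‖r n * c n * (z ^ n * z)‖ = ‖r n‖ * ‖z‖ * ‖c n * z ^ n‖ := by
        simp only [norm_mul]; ring
    _ ≤ ρ * ‖c n * z ^ n‖ := by gcongr

lemma tendsto_tsum_zero {c : ℕ → 𝕜} {R : 𝕜} (hR : R ≠ 0) (hc : Summable fun n ↦ ‖c n * R ^ n‖) :
    Tendsto (fun z ↦ ∑' n, c n * z ^ n) (𝓝 0) (𝓝 (c 0)) := by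
  have hlim : (c 0) = ∑' n, (if n = 0 then c 0 else 0) := by simp
  rw [hlim]
  refine tendsto_tsum_of_dominated_convergence hc ?_ ?_
  · intro n
    rcases Nat.eq_zero_or_pos n with rfl | hn
    · simp
    · have : Tendsto (fun z : 𝕜 ↦ c n * z ^ n) (𝓝 0) (𝓝 (c n * 0 ^ n)) :=
        (Continuous.tendsto (by fun_prop) 0)
      simpa [hn.ne'] using this
  · have : ∀ᶠ z : 𝕜 in 𝓝 0, ‖z‖ < ‖R‖ := by
      have := (continuous_norm (E := 𝕜)).tendsto 0
      rw [norm_zero] at this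
      exact this.eventually_lt_const (norm_pos_iff.2 hR)
    filter_upwards [this] with z hz n
    rw [norm_mul, norm_mul, norm_pow, norm_pow]
    gcongr

end Pochhammer

section QBinomial

variable {𝕜 : Type*} [NormedField 𝕜] [CompleteSpace 𝕜]

lemma tendsto_ratio {y : 𝕜} (hy : ‖y‖ < 1) (α β : 𝕜) :
    Tendsto (fun n : ℕ ↦ (β - α * y ^ n) / (1 - y * y ^ n)) atTop (𝓝 β) := by
  have h0 : Tendsto (fun n : ℕ ↦ y ^ n) atTop (𝓝 0) :=
    tendsto_pow_atTop_nhds_zero_of_norm_lt_one hy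
  simpa [Pi.div_def] using Tendsto.div (f := fun n : ℕ ↦ β - α * y ^ n)
      (g := fun n : ℕ ↦ 1 - y * y ^ n)
    ((h0.const_mul α).const_sub β) ((h0.const_mul y).const_sub 1) (by simp)

lemma ratio_eq {y : 𝕜} (hy : ‖y‖ < 1) {α β : 𝕜} {c : ℕ → 𝕜}
    (hc : ∀ n, c (n + 1) * (1 - y * y ^ n) = (β - α * y ^ n) * c n) (n : ℕ) :
    c (n + 1) = (β - α * y ^ n) / (1 - y * y ^ n) * c n := by
  have := sub_ne_zero.2 (pow_ne_one_of_norm_lt_one hy n).symm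
  rw [div_mul_eq_mul_div, eq_div_iff this, hc]

lemma summable_norm_of_qrec {y : 𝕜} (hy : ‖y‖ < 1) {α β : 𝕜} {c : ℕ → 𝕜}
    (hc : ∀ n, c (n + 1) * (1 - y * y ^ n) = (β - α * y ^ n) * c n) {z : 𝕜}
    (hz : ‖β‖ * ‖z‖ < 1) : Summable fun n ↦ ‖c n * z ^ n‖ :=
  summable_norm_of_ratio (ratio_eq hy hc) (tendsto_ratio hy α β) hz

/-- A uniform version of the `q`-binomial theorem and of Euler's two product expansions. -/
theorem poch_mul_tsum {y : 𝕜} (hy : ‖y‖ < 1) {α β : 𝕜} {c : ℕ → 𝕜} (h0 : c 0 = 1)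
    (hc : ∀ n, c (n + 1) * (1 - y * y ^ n) = (β - α * y ^ n) * c n) {z : 𝕜}
    (hz : ‖β‖ * ‖z‖ < 1) : poch y (β * z) * ∑' n, c n * z ^ n = poch y (α * z) := by
  rcases eq_or_ne z 0 with rfl | hz0
  · rw [mul_zero, mul_zero, poch_zero, one_mul, tsum_eq_single 0 (fun n hn ↦ by simp [hn])]
    simp [h0]
  have hs : ∀ {w : 𝕜}, ‖β‖ * ‖w‖ < 1 → Summable fun n ↦ c n * w ^ n := fun h ↦
    (summable_norm_of_qrec hy hc h).of_norm
  have hlim : Tendsto (fun w ↦ ∑' n, c n * w ^ n) (𝓝 0) (𝓝 1) := by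
    rw [← h0]
    exact tendsto_tsum_zero hz0 (summable_norm_of_qrec hy hc hz)
  have hmul : ∀ {w : 𝕜}, ‖β‖ * ‖w‖ < 1 → ∀ n : ℕ, ‖β‖ * ‖w * y ^ n‖ < 1 := fun {w} h n ↦ by
    refine lt_of_le_of_lt ?_ h
    rw [norm_mul, norm_pow]
    gcongr
    exact mul_le_of_le_one_right (norm_nonneg _) (pow_le_one₀ (norm_nonneg _) hy.le)
  refine eq_of_functional_equation hy α β _ hlim z fun n ↦ ?_
  have hw := hmul hz n
  have hw' := hmul hz (n + 1)
  set w := z * y ^ n with hwdef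
  have hwy : z * y ^ (n + 1) = w * y := by rw [hwdef, pow_succ]; ring
  rw [hwy] at hw' ⊢
  have e1 : ∑' n, c n * w ^ n = c 0 + ∑' n, c (n + 1) * w ^ (n + 1) := by
    simpa using (hs hw).tsum_eq_zero_add
  have e2 : ∑' n, c n * (w * y) ^ n = c 0 + ∑' n, c (n + 1) * (w * y) ^ (n + 1) := by
    simpa using (hs hw').tsum_eq_zero_add
  have s1 := (summable_nat_add_iff 1).2 (hs hw)
  have s2 := (summable_nat_add_iff 1).2 (hs hw')
  have e3 : ∑' n, c (n + 1) * w ^ (n + 1) - ∑' n, c (n + 1) * (w * y) ^ (n + 1)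
      = β * w * ∑' n, c n * w ^ n - α * w * ∑' n, c n * (w * y) ^ n := by
    rw [← s1.tsum_sub s2, ← tsum_mul_left, ← tsum_mul_left,
      ← ((hs hw).mul_left _).tsum_sub ((hs hw').mul_left _)]
    refine tsum_congr fun m ↦ ?_
    have := hc m
    rw [mul_pow, mul_pow, pow_succ w, pow_succ y]
    linear_combination w ^ m * w * this
  linear_combination e1 - e2 + e3

lemma fpoch_self_ne_zero {y : 𝕜} (hy : ‖y‖ < 1) (n : ℕ) : fpoch y y n ≠ 0 :=
  fpoch_ne_zero (pow_ne_one_of_norm_lt_one hy) n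

lemma poch_self_ne_zero {y : 𝕜} (hy : ‖y‖ < 1) : poch y y ≠ 0 :=
  poch_ne_zero hy (pow_ne_one_of_norm_lt_one hy)

lemma qbinomial_rec {y : 𝕜} (hy : ‖y‖ < 1) (a : 𝕜) (n : ℕ) :
    fpoch y a (n + 1) / fpoch y y (n + 1) * (1 - y * y ^ n)
      = (1 - a * y ^ n) * (fpoch y a n / fpoch y y n) := by
  have h1 := fpoch_self_ne_zero hy n
  have h2 := sub_ne_zero.2 (pow_ne_one_of_norm_lt_one hy n).symm
  rw [fpoch_succ, fpoch_succ, div_mul_eq_mul_div, mul_div_assoc',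
      div_eq_div_iff (mul_ne_zero h1 h2) h1]
  ring

/-- The `q`-binomial theorem. -/
theorem qbinomial {y : 𝕜} (hy : ‖y‖ < 1) (a : 𝕜) {z : 𝕜} (hz : ‖z‖ < 1) :
    poch y z * ∑' n, fpoch y a n / fpoch y y n * z ^ n = poch y (a * z) := by
  have := poch_mul_tsum hy (α := a) (β := 1) (c := fun n ↦ fpoch y a n / fpoch y y n)
    (by simp [fpoch_zero]) (qbinomial_rec hy a) (z := z) (by simpa)
  simpa using this

lemma euler_inv_rec {y : 𝕜} (hy : ‖y‖ < 1) (n : ℕ) :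
    1 / fpoch y y (n + 1) * (1 - y * y ^ n) = (1 - 0 * y ^ n) * (1 / fpoch y y n) := by
  have h1 := fpoch_self_ne_zero hy n
  have h2 := sub_ne_zero.2 (pow_ne_one_of_norm_lt_one hy n).symm
  rw [fpoch_succ]
  field_simp
  ring

/-- Euler's expansion of `1 / (z; y)_∞`. -/
theorem euler_inv {y : 𝕜} (hy : ‖y‖ < 1) {z : 𝕜} (hz : ‖z‖ < 1) :
    poch y z * ∑' n, 1 / fpoch y y n * z ^ n = 1 := by
  have := poch_mul_tsum hy (α := 0) (β := 1) (c := fun n ↦ 1 / fpoch y y n)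
    (by simp [fpoch_zero]) (euler_inv_rec hy) (z := z) (by simpa)
  simpa [poch_zero] using this

lemma summable_norm_euler_inv {y : 𝕜} (hy : ‖y‖ < 1) {z : 𝕜} (hz : ‖z‖ < 1) :
    Summable fun n ↦ ‖1 / fpoch y y n * z ^ n‖ :=
  summable_norm_of_qrec hy (α := 0) (β := 1) (euler_inv_rec hy) (by simpa)

/-- The coefficients in Euler's expansion of `(z; y)_∞`. -/
def eulerCoeff (y : 𝕜) (n : ℕ) : 𝕜 := (-1) ^ n * y ^ (n.choose 2) / fpoch y y n

lemma euler_rec {y : 𝕜} (hy : ‖y‖ < 1) (n : ℕ) :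
    eulerCoeff y (n + 1) * (1 - y * y ^ n) = (0 - 1 * y ^ n) * eulerCoeff y n := by
  have h1 := fpoch_self_ne_zero hy n
  have h2 := sub_ne_zero.2 (pow_ne_one_of_norm_lt_one hy n).symm
  have h3 : (n + 1).choose 2 = n.choose 2 + n := by
    rw [Nat.choose_succ_succ' n 1, Nat.choose_one_right, add_comm]
  rw [eulerCoeff, eulerCoeff, fpoch_succ, h3, pow_add, pow_succ]
  field_simp
  ring

/-- Euler's expansion of `(z; y)_∞`. -/
theorem euler {y : 𝕜} (hy : ‖y‖ < 1) (z : 𝕜) : ∑' n, eulerCoeff y n * z ^ n = poch y z := by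
  have := poch_mul_tsum hy (α := 1) (β := 0) (c := eulerCoeff y)
    (by simp [eulerCoeff, fpoch_zero]) (euler_rec hy) (z := z) (by simp)
  simpa [poch_zero] using this

lemma summable_norm_euler {y : 𝕜} (hy : ‖y‖ < 1) (z : 𝕜) :
    Summable fun n ↦ ‖eulerCoeff y n * z ^ n‖ :=
  summable_norm_of_qrec hy (α := 1) (β := 0) (euler_rec hy) (by simp)

end QBinomial

section JacobiTripleProduct

/-- The triangular exponent `n (n - 1) / 2`. -/
def tri (n : ℤ) : ℤ := n * (n - 1) / 2

lemma two_mul_tri (n : ℤ) : 2 * tri n = n * (n - 1) :=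
  Int.mul_ediv_cancel' (by simpa [mul_comm] using (Int.even_mul_pred_self n).two_dvd)

lemma tri_add_one (n : ℤ) : tri (n + 1) = tri n + n := by
  linarith [two_mul_tri n, two_mul_tri (n + 1)]

lemma tri_zero : tri 0 = 0 := rfl

lemma tri_neg (n : ℤ) : tri (-n) = tri n + n := by
  linarith [two_mul_tri n, two_mul_tri (-n)]

lemma tri_add (m n : ℤ) : tri (m + n) = tri m + tri n + m * n := by
  linarith [two_mul_tri m, two_mul_tri n, two_mul_tri (m + n)]

lemma tri_one_sub (n : ℤ) : tri (1 - n) = tri n := by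
  linarith [two_mul_tri n, two_mul_tri (1 - n)]

lemma tri_natCast (n : ℕ) : tri n = (n.choose 2 : ℕ) := by
  induction n with
  | zero => rfl
  | succ n ih =>
    rw [Nat.cast_succ, tri_add_one, ih, Nat.choose_succ_succ' n 1, Nat.choose_one_right]
    push_cast
    ring

lemma summable_norm_theta_nat {y : ℂ} (hy : ‖y‖ < 1) (x : ℂ) :
    Summable fun n : ℕ ↦ ‖y ^ tri n * x ^ n‖ := by
  refine summable_norm_of_ratio (c := fun n : ℕ ↦ y ^ tri n) (r := fun n ↦ y ^ n) (l := 0)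
    (fun n ↦ ?_) (tendsto_pow_atTop_nhds_zero_of_norm_lt_one hy) (by simp)
  rw [tri_natCast, tri_natCast, zpow_natCast, zpow_natCast, Nat.choose_succ_succ' n 1,
    Nat.choose_one_right, pow_add]

lemma summable_norm_theta {y : ℂ} (hy0 : y ≠ 0) (hy : ‖y‖ < 1) (x : ℂ) :
    Summable fun n : ℤ ↦ ‖y ^ tri n * x ^ n‖ := by
  refine Summable.of_nat_of_neg (by simpa using summable_norm_theta_nat hy x) ?_
  refine (summable_norm_theta_nat hy (y * x⁻¹)).congr fun n ↦ ?_
  rw [tri_neg, zpow_add₀ hy0, mul_pow, zpow_neg, zpow_natCast, zpow_natCast, inv_pow, mul_assoc]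

/-- The theta function. -/
noncomputable def theta (y x : ℂ) : ℂ := ∑' n : ℤ, (-1) ^ n * (y ^ tri n * x ^ n)

lemma norm_neg_one_zpow (n : ℤ) : ‖(-1 : ℂ) ^ n‖ = 1 := by simp

lemma summable_norm_theta' {y : ℂ} (hy0 : y ≠ 0) (hy : ‖y‖ < 1) (x : ℂ) :
    Summable fun n : ℤ ↦ ‖(-1) ^ n * (y ^ tri n * x ^ n)‖ := by
  simpa only [norm_mul, norm_neg_one_zpow, one_mul] using summable_norm_theta hy0 hy x

lemma summable_theta {y : ℂ} (hy0 : y ≠ 0) (hy : ‖y‖ < 1) (x : ℂ) :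
    Summable fun n : ℤ ↦ (-1) ^ n * (y ^ tri n * x ^ n) := (summable_norm_theta' hy0 hy x).of_norm

/-- The coefficients of the finite product `(z; y)_M`. -/
noncomputable def cauchyCoeff (y : ℂ) (M k : ℕ) : ℂ :=
  if k ≤ M then (-1) ^ k * y ^ (k.choose 2) * (fpoch y y M / (fpoch y y k * fpoch y y (M - k)))
  else 0

lemma cauchyCoeff_rec {y : ℂ} (hy : ‖y‖ < 1) (M k : ℕ) :
    cauchyCoeff y M (k + 1) * (1 - y * y ^ k) = (y ^ M - 1 * y ^ k) * cauchyCoeff y M k := by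
  unfold cauchyCoeff
  rcases lt_trichotomy k M with h | rfl | h
  · obtain ⟨d, rfl⟩ := Nat.exists_eq_add_of_lt h
    rw [if_pos (by omega), if_pos (by omega), show k + d + 1 - (k + 1) = d by omega,
      show k + d + 1 - k = d + 1 by omega, fpoch_succ y y k, fpoch_succ y y d,
      Nat.choose_succ_succ' k 1, Nat.choose_one_right]
    have h1 := fpoch_self_ne_zero hy k
    have h2 := fpoch_self_ne_zero hy d
    have h3 := sub_ne_zero.2 (pow_ne_one_of_norm_lt_one hy k).symm
    have h4 := sub_ne_zero.2 (pow_ne_one_of_norm_lt_one hy d).symm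
    rw [← pow_succ'] at h3 h4 ⊢
    rw [← pow_succ']
    field_simp
    ring
  · rw [if_neg (by omega)]; simp
  · rw [if_neg (by omega), if_neg (by omega)]; simp

/-- Cauchy's finite `q`-binomial theorem. -/
lemma fpoch_eq_sum {y : ℂ} (hy : ‖y‖ < 1) (M : ℕ) {z : ℂ} (hz : ‖y ^ M * z‖ < 1) :
    fpoch y z M = ∑ k ∈ Finset.range (M + 1), cauchyCoeff y M k * z ^ k := by
  have h := poch_mul_tsum hy (α := 1) (β := y ^ M) (c := cauchyCoeff y M)
    (by simp [cauchyCoeff, fpoch_zero, fpoch_self_ne_zero hy]) (cauchyCoeff_rec hy M) (z := z)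
    (by rwa [← norm_mul])
  rw [tsum_eq_sum (s := Finset.range (M + 1)) fun k hk ↦ by
    simp [cauchyCoeff, show ¬ k ≤ M by simpa using hk]] at h
  rw [one_mul, poch_eq_fpoch_mul hy z M, mul_comm, mul_comm (y ^ M) z] at h
  have h0 : poch y (z * y ^ M) ≠ 0 := by
    refine poch_ne_zero hy fun m hm ↦ ?_
    have : ‖z * y ^ M * y ^ m‖ < 1 := by
      rw [norm_mul, norm_pow, mul_comm z]
      exact mul_lt_one_of_nonneg_of_lt_one_left (norm_nonneg _) hz
        (pow_le_one₀ (norm_nonneg _) hy.le)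
    rw [hm, norm_one] at this
    exact lt_irrefl _ this
  exact (mul_right_cancel₀ h0 h).symm

lemma fpoch_shift {y : ℂ} (hy0 : y ≠ 0) {x : ℂ} (hx : x ≠ 0) (N : ℕ) :
    fpoch y (x * y⁻¹ ^ N) (2 * N) * y ^ ((N + 1).choose 2)
      = (-x) ^ N * (fpoch y (y / x) N * fpoch y x N) := by
  induction N with
  | zero => simp [fpoch_zero]
  | succ N ih =>
    have e : fpoch y (x * y⁻¹ ^ (N + 1)) (2 * (N + 1))
        = (1 - x * y⁻¹ ^ (N + 1)) * fpoch y (x * y⁻¹ ^ N) (2 * N) * (1 - x * y ^ N) := by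
      rw [show 2 * (N + 1) = 2 * N + 1 + 1 by ring, fpoch_succ]
      congr 1
      · unfold fpoch
        rw [Finset.prod_range_succ', mul_comm, pow_zero, mul_one]
        congr 1
        refine Finset.prod_congr rfl fun m _ ↦ ?_
        rw [pow_succ y m, pow_succ]
        field_simp
      · rw [show 2 * N + 1 = (N + 1) + N by ring, pow_add, inv_pow]
        field_simp
        ring
    rw [e, fpoch_succ, fpoch_succ, Nat.choose_succ_succ' (N + 1) 1, Nat.choose_one_right, pow_add]
    have h : (1 - x * y⁻¹ ^ (N + 1)) * y ^ (N + 1) = -x * (1 - y / x * y ^ N) := by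
      rw [inv_pow]
      field_simp
      ring
    linear_combination (1 - x * y⁻¹ ^ (N + 1)) * y ^ (N + 1) * (1 - x * y ^ N) * ih
      + (-x) ^ N * (fpoch y (y / x) N * fpoch y x N) * (1 - x * y ^ N) * h

/-- The terms of the finite form of the Jacobi triple product. -/
noncomputable def finiteTheta (y x : ℂ) (N : ℕ) (n : ℤ) : ℂ :=
  if n ∈ Finset.Icc (-N : ℤ) N then
    (-1) ^ n * (y ^ tri n * x ^ n) *
      (fpoch y y (2 * N) / (fpoch y y (N + n).toNat * fpoch y y (N - n).toNat))
  else 0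

lemma tsum_finiteTheta {y : ℂ} (hy0 : y ≠ 0) (hy : ‖y‖ < 1) {x : ℂ} (hx : x ≠ 0) {N : ℕ}
    (hN : ‖x * y ^ N‖ < 1) :
    ∑' n, finiteTheta y x N n = fpoch y (y / x) N * fpoch y x N := by
  rw [tsum_eq_sum (f := finiteTheta y x N)
    (s := Finset.Icc (-N : ℤ) N) fun n hn ↦ if_neg hn]
  have h1 := fpoch_shift hy0 hx N
  have hpow : y ^ (2 * N) * (x * y⁻¹ ^ N) = x * y ^ N := by
    rw [two_mul, pow_add, inv_pow]
    field_simp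
  rw [fpoch_eq_sum hy (2 * N) (z := x * y⁻¹ ^ N) (by rwa [hpow])] at h1
  have hne : (-x) ^ N ≠ 0 := pow_ne_zero _ (neg_ne_zero.2 hx)
  refine mul_left_cancel₀ hne (Eq.trans ?_ h1)
  rw [Finset.mul_sum, Finset.sum_mul]
  refine Finset.sum_nbij' (fun n ↦ (N + n).toNat) (fun k ↦ (k : ℤ) - N) ?_ ?_ ?_ ?_ ?_
  · intro n hn; simp only [Finset.mem_Icc, Finset.mem_range] at hn ⊢; omega
  · intro n hn; simp only [Finset.mem_Icc, Finset.mem_range] at hn ⊢; omega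
  · intro n hn; simp only [Finset.mem_Icc] at hn; omega
  · intro n hn; simp
  · intro n hn
    have hn' := hn
    simp only [Finset.mem_Icc] at hn'
    obtain ⟨k, hk⟩ : ∃ k : ℕ, (N + n) = k := ⟨(N + n).toNat, by omega⟩
    rw [finiteTheta, if_pos hn, cauchyCoeff, if_pos (by omega), hk, Int.toNat_natCast,
      show (N - n).toNat = 2 * N - k by omega]
    have hnk : n = (k : ℤ) + -N := by omega
    have e1 : (-x) ^ N * ((-1) ^ n * (y ^ tri n * x ^ n)) =
        (-1) ^ k * y ^ (k.choose 2) * (x * y⁻¹ ^ N) ^ k * y ^ ((N + 1).choose 2) := by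
      have e2 : tri n = (k.choose 2 : ℕ) + ((N + 1).choose 2 : ℕ) - k * N := by
        rw [hnk, tri_add, tri_neg, ← tri_natCast, ← tri_natCast, Nat.cast_succ, tri_add_one]
        ring
      rw [e2, hnk, zpow_add₀ (neg_ne_zero.2 one_ne_zero), zpow_add₀ hx, zpow_sub₀ hy0,
        zpow_add₀ hy0, neg_pow x, zpow_neg, zpow_neg, mul_pow, ← pow_mul, inv_pow,
        ← Nat.cast_mul, mul_comm N k]
      simp only [zpow_natCast]
      have : ((-1 : ℂ) ^ N) ≠ 0 := pow_ne_zero _ (neg_ne_zero.2 one_ne_zero)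
      field_simp
    rw [← mul_assoc, e1]
    ring

lemma exists_bounds_fpoch {y : ℂ} (hy : ‖y‖ < 1) :
    ∃ C : ℝ, ∀ n, ‖fpoch y y n‖ ≤ C ∧ ‖(fpoch y y n)⁻¹‖ ≤ C := by
  obtain ⟨A, hA⟩ := (Metric.isBounded_range_of_tendsto _ (tendsto_fpoch hy y)).exists_norm_le
  obtain ⟨B, hB⟩ := (Metric.isBounded_range_of_tendsto _
    ((tendsto_fpoch hy y).inv₀ (poch_self_ne_zero hy))).exists_norm_le
  exact ⟨max A B, fun n ↦ ⟨(hA _ ⟨n, rfl⟩).trans (le_max_left _ _),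
    (hB _ ⟨n, rfl⟩).trans (le_max_right _ _)⟩⟩

lemma tendsto_toNat_add (n : ℤ) : Tendsto (fun N : ℕ ↦ ((N : ℤ) + n).toNat) atTop atTop := by
  refine tendsto_atTop.2 fun b ↦ ?_
  filter_upwards [eventually_ge_atTop (b + n.natAbs)] with N hN
  omega

/-- The Jacobi triple product. -/
theorem theta_eq {y : ℂ} (hy0 : y ≠ 0) (hy : ‖y‖ < 1) {x : ℂ} (hx : x ≠ 0) :
    theta y x = poch y y * poch y x * poch y (y / x) := by
  have hP := poch_self_ne_zero hy
  obtain ⟨C, hC⟩ := exists_bounds_fpoch hy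
  have hC0 : 0 ≤ C := (norm_nonneg _).trans (hC 0).1
  have h1 : Tendsto (fun N ↦ ∑' n, finiteTheta y x N n) atTop
      (𝓝 (∑' n : ℤ, (-1) ^ n * (y ^ tri n * x ^ n) * (poch y y)⁻¹)) := by
    refine tendsto_tsum_of_dominated_convergence
      ((summable_norm_theta' hy0 hy x).mul_right (C * (C * C))) ?_ ?_
    · intro n
      have h2 : Tendsto (fun N : ℕ ↦ (-1) ^ n * (y ^ tri n * x ^ n) *
          (fpoch y y (2 * N) / (fpoch y y ((N : ℤ) + n).toNat * fpoch y y ((N : ℤ) + -n).toNat)))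
          atTop (𝓝 ((-1) ^ n * (y ^ tri n * x ^ n) * (poch y y / (poch y y * poch y y)))) := by
        refine Tendsto.const_mul _ (Tendsto.div ?_ (Tendsto.mul ?_ ?_) (mul_ne_zero hP hP))
        · exact (tendsto_fpoch hy y).comp
            (tendsto_id.const_mul_atTop' two_pos)
        · exact (tendsto_fpoch hy y).comp (tendsto_toNat_add n)
        · exact (tendsto_fpoch hy y).comp (tendsto_toNat_add (-n))
      have e : poch y y / (poch y y * poch y y) = (poch y y)⁻¹ := by field_simp
      rw [e] at h2
      refine h2.congr' ?_
      filter_upwards [eventually_ge_atTop n.natAbs] with N hN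
      rw [finiteTheta, if_pos (by rw [Finset.mem_Icc]; omega), sub_eq_add_neg]
    · refine Eventually.of_forall fun N n ↦ ?_
      rw [finiteTheta]
      split_ifs with h
      · rw [norm_mul]
        refine mul_le_mul_of_nonneg_left ?_ (norm_nonneg _)
        rw [div_eq_mul_inv, mul_inv, norm_mul, norm_mul]
        exact mul_le_mul (hC _).1 (mul_le_mul (hC _).2 (hC _).2 (norm_nonneg _) hC0)
          (by positivity) hC0
      · rw [norm_zero]; positivity
  have h3 : Tendsto (fun N ↦ ∑' n, finiteTheta y x N n) atTop
      (𝓝 (poch y (y / x) * poch y x)) := by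
    refine ((tendsto_fpoch hy (y / x)).mul (tendsto_fpoch hy x)).congr' ?_
    have h4 : Tendsto (fun N : ℕ ↦ ‖x * y ^ N‖) atTop (𝓝 0) := by
      simpa using ((tendsto_pow_atTop_nhds_zero_of_norm_lt_one hy).const_mul x).norm
    filter_upwards [h4.eventually_lt_const one_pos] with N hN
    exact (tsum_finiteTheta hy0 hy hx hN).symm
  have h5 := tendsto_nhds_unique h1 h3
  rw [tsum_mul_right, mul_inv_eq_iff_eq_mul₀ hP] at h5
  rw [theta, h5]
  ring

end JacobiTripleProduct

section Theta

lemma theta_mul_self {y : ℂ} (hy0 : y ≠ 0) {x : ℂ} (hx : x ≠ 0) :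
    x * theta y (x * y) = -theta y x := by
  unfold theta
  rw [← (Equiv.addRight (1 : ℤ)).tsum_eq fun n : ℤ ↦ (-1 : ℂ) ^ n * (y ^ tri n * x ^ n),
    ← tsum_mul_left, ← tsum_neg]
  refine tsum_congr fun n ↦ ?_
  rw [Equiv.coe_addRight, tri_add_one, zpow_add₀ (neg_ne_zero.2 one_ne_zero), zpow_add₀ hy0,
    zpow_add₀ hx, mul_zpow, zpow_one, zpow_one]
  ring

lemma theta_inv {y : ℂ} {x : ℂ} (hx : x ≠ 0) :
    x * theta y x⁻¹ = -theta y x := by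
  unfold theta
  rw [← (Equiv.subLeft (1 : ℤ)).tsum_eq fun n : ℤ ↦ (-1 : ℂ) ^ n * (y ^ tri n * x ^ n),
    ← tsum_mul_left, ← tsum_neg]
  refine tsum_congr fun n ↦ ?_
  rw [Equiv.subLeft_apply, tri_one_sub, zpow_sub₀ (neg_ne_zero.2 one_ne_zero), zpow_sub₀ hx,
    inv_zpow]
  have : ((-1 : ℂ) ^ n)⁻¹ = (-1) ^ n := by rw [← inv_zpow, inv_neg_one]
  rw [zpow_one, div_eq_mul_inv, this]
  simp only [zpow_one]
  ring

lemma theta_one {y : ℂ} : theta y 1 = 0 := by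
  have := theta_inv (y := y) one_ne_zero
  rw [inv_one, one_mul] at this
  linear_combination (1 / 2) * this

lemma theta_ne_zero {y : ℂ} (hy0 : y ≠ 0) (hy : ‖y‖ < 1) {x : ℂ} (hx : x ≠ 0)
    (h : ∀ n : ℤ, x ≠ y ^ n) : theta y x ≠ 0 := by
  rw [theta_eq hy0 hy hx]
  refine mul_ne_zero (mul_ne_zero (poch_self_ne_zero hy) (poch_ne_zero hy fun m hm ↦ ?_))
    (poch_ne_zero hy fun m hm ↦ ?_)
  · refine h (-m) ?_
    rw [zpow_neg, zpow_natCast]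
    exact eq_inv_of_mul_eq_one_left hm
  · refine h (m + 1) ?_
    rw [zpow_add_one₀ hy0, zpow_natCast]
    field_simp at hm
    linear_combination -hm

/-- The even part in the Weierstrass addition formula. -/
noncomputable def evenTheta (y x : ℂ) : ℂ := ∑' n : ℤ, y ^ (n * n) * x ^ (2 * n)

/-- The odd part in the Weierstrass addition formula. -/
noncomputable def oddTheta (y x : ℂ) : ℂ := ∑' n : ℤ, y ^ (n * n + n) * x ^ (2 * n + 1)

lemma summable_evenTheta {y : ℂ} (hy0 : y ≠ 0) (hy : ‖y‖ < 1) (x : ℂ) :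
    Summable fun n : ℤ ↦ ‖y ^ (n * n) * x ^ (2 * n)‖ := by
  refine (summable_norm_theta (pow_ne_zero 2 hy0) (?_ : ‖y ^ 2‖ < 1) (y * x ^ 2)).congr fun n ↦ ?_
  · rw [norm_pow]; exact pow_lt_one₀ (norm_nonneg _) hy two_ne_zero
  · rw [mul_zpow, ← zpow_natCast, ← zpow_natCast, ← zpow_mul, ← zpow_mul, ← mul_assoc,
      ← zpow_add₀ hy0, Nat.cast_two, two_mul_tri]
    ring_nf

lemma summable_oddTheta {y : ℂ} (hy0 : y ≠ 0) (hy : ‖y‖ < 1) {x : ℂ} (hx : x ≠ 0) :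
    Summable fun n : ℤ ↦ ‖y ^ (n * n + n) * x ^ (2 * n + 1)‖ := by
  refine ((summable_norm_theta (pow_ne_zero 2 hy0) (?_ : ‖y ^ 2‖ < 1) (y ^ 2 * x ^ 2)).mul_right
    ‖x‖).congr fun n ↦ ?_
  · rw [norm_pow]; exact pow_lt_one₀ (norm_nonneg _) hy two_ne_zero
  · rw [mul_zpow, ← zpow_natCast, ← zpow_natCast, ← zpow_mul, ← zpow_mul, ← zpow_mul, ← mul_assoc,
      ← zpow_add₀ hy0, Nat.cast_two, two_mul_tri, ← norm_mul, mul_assoc, ← zpow_add_one₀ hx]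
    ring_nf

/-- Summation over a set decomposed into two injective images. -/
lemma tsum_eq_add_of_isCompl {α β γ : Type*} {f : α → ℂ} (hf : Summable f) {i : β → α} {j : γ → α}
    (hi : i.Injective) (hj : j.Injective) (h : IsCompl (Set.range i) (Set.range j)) :
    ∑' a, f a = ∑' b, f (i b) + ∑' c, f (j c) :=
  (((hi.hasSum_range_iff (f := f)).2 (hf.comp_injective hi).hasSum).add_isCompl h
    ((hj.hasSum_range_iff (f := f)).2 (hf.comp_injective hj).hasSum)).tsum_eq

/-- The bracket in the Weierstrass addition formula. -/
noncomputable def bracket (y x a : ℂ) : ℂ :=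
  oddTheta y x * evenTheta y a - evenTheta y x * oddTheta y a

/-- The Weierstrass addition formula. -/
theorem theta_mul_theta {y : ℂ} (hy0 : y ≠ 0) (hy : ‖y‖ < 1) {x a : ℂ} (hx : x ≠ 0) (ha : a ≠ 0) :
    theta y (x * a) * theta y (x / a) = x * bracket y x a := by
  have hs := summable_mul_of_summable_norm (summable_norm_theta' hy0 hy (x * a))
    (summable_norm_theta' hy0 hy (x / a))
  unfold theta
  rw [tsum_mul_tsum_of_summable_norm (summable_norm_theta' hy0 hy (x * a))
    (summable_norm_theta' hy0 hy (x / a))]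
  rw [tsum_eq_add_of_isCompl hs (i := fun p : ℤ × ℤ ↦ (p.1 + p.2 + 1, p.1 - p.2 + 1))
    (j := fun p : ℤ × ℤ ↦ (p.1 + p.2 + 1, p.1 - p.2))]
  · have he : x * (oddTheta y x * evenTheta y a) = ∑' p : ℤ × ℤ,
        x * ((y ^ (p.1 * p.1 + p.1) * x ^ (2 * p.1 + 1)) * (y ^ (p.2 * p.2) * a ^ (2 * p.2))) := by
      rw [tsum_mul_left, oddTheta, evenTheta, tsum_mul_tsum_of_summable_norm
        (summable_oddTheta hy0 hy hx) (summable_evenTheta hy0 hy a)]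
    have ho : x * (evenTheta y x * oddTheta y a) = ∑' p : ℤ × ℤ,
        x * ((y ^ (p.1 * p.1) * x ^ (2 * p.1)) *
          (y ^ (p.2 * p.2 + p.2) * a ^ (2 * p.2 + 1))) := by
      rw [tsum_mul_left, oddTheta, evenTheta, tsum_mul_tsum_of_summable_norm
        (summable_evenTheta hy0 hy x) (summable_oddTheta hy0 hy ha)]
    have key : ∀ m n : ℤ, (-1 : ℂ) ^ m * (y ^ tri m * (x * a) ^ m) *
        ((-1) ^ n * (y ^ tri n * (x / a) ^ n))
        = (-1) ^ (m + n) * (y ^ (tri m + tri n) * (x ^ (m + n) * a ^ (m - n))) := fun m n ↦ by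
      rw [zpow_add₀ (neg_ne_zero.2 one_ne_zero), zpow_add₀ hy0, zpow_add₀ hx, zpow_sub₀ ha,
        mul_zpow, div_zpow]
      ring
    rw [bracket, mul_sub, he, ho, sub_eq_add_neg, ← tsum_neg]
    congr 1
    · refine tsum_congr fun ⟨s, d⟩ ↦ ?_
      simp only
      rw [key, show tri (s + d + 1) + tri (s - d + 1) = s * s + s + d * d by
          linarith [two_mul_tri (s + d + 1), two_mul_tri (s - d + 1)],
        show s + d + 1 + (s - d + 1) = 2 * s + 1 + 1 by ring,
        show s + d + 1 - (s - d + 1) = 2 * d by ring, zpow_add₀ hy0, zpow_add_one₀ hx (2 * s + 1),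
        Even.neg_one_zpow ⟨s + 1, by ring⟩]
      ring
    · refine tsum_congr fun ⟨s, d⟩ ↦ ?_
      simp only
      rw [key, show tri (s + d + 1) + tri (s - d) = s * s + (d * d + d) by
          linarith [two_mul_tri (s + d + 1), two_mul_tri (s - d)],
        show s + d + 1 + (s - d) = 2 * s + 1 by ring,
        show s + d + 1 - (s - d) = 2 * d + 1 by ring, zpow_add₀ hy0, zpow_add_one₀ hx (2 * s),
        Odd.neg_one_zpow ⟨s, by ring⟩]
      ring
  · rintro ⟨s, d⟩ ⟨s', d'⟩ h
    simp only [Prod.mk.injEq] at h ⊢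
    omega
  · rintro ⟨s, d⟩ ⟨s', d'⟩ h
    simp only [Prod.mk.injEq] at h ⊢
    omega
  · constructor
    · rw [Set.disjoint_left]
      rintro _ ⟨⟨s, d⟩, rfl⟩ ⟨⟨s', d'⟩, h⟩
      simp only [Prod.mk.injEq] at h
      omega
    · rw [codisjoint_iff_le_sup]
      rintro ⟨m, n⟩ -
      rcases Int.even_or_odd' (m + n) with ⟨s, h | h⟩
      · exact Or.inl ⟨(s - 1, m - s), by simp only [Prod.mk.injEq]; omega⟩
      · exact Or.inr ⟨(s, m - s - 1), by simp only [Prod.mk.injEq]; omega⟩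

lemma bracket_relation (y a b c d : ℂ) :
    bracket y a b * bracket y c d - bracket y a c * bracket y b d
      + bracket y a d * bracket y b c = 0 := by
  unfold bracket
  ring

/-- The exponent `s (s - 11) / 2 + 15`. -/
def texp (s : ℤ) : ℤ := tri s - 5 * s + 15

lemma two_mul_texp (s : ℤ) : 2 * texp s = s * (s - 11) + 30 := by
  unfold texp; linarith [two_mul_tri s]

/-- The normalized theta functions of level eleven. -/
noncomputable def tau (q : ℂ) (k : ℤ) : ℂ := q ^ texp k * theta (q ^ 121) (q ^ (11 * k))

lemma pow_121_ne_zero {q : ℂ} (hq0 : q ≠ 0) : q ^ 121 ≠ 0 := pow_ne_zero _ hq0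

lemma norm_pow_121 {q : ℂ} (hq : ‖q‖ < 1) : ‖q ^ 121‖ < 1 := by
  rw [norm_pow]; exact pow_lt_one₀ (norm_nonneg _) hq (by norm_num)

lemma tau_add {q : ℂ} (hq0 : q ≠ 0) (k : ℤ) : tau q (k + 11) = -tau q k := by
  have h := theta_mul_self (pow_121_ne_zero hq0) (zpow_ne_zero (11 * k) hq0)
  have e : q ^ (11 * (k + 11)) = q ^ (11 * k) * q ^ 121 := by
    rw [← zpow_natCast, ← zpow_add₀ hq0]; congr 1; push_cast; ring
  have e2 : texp (k + 11) = texp k + 11 * k := by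
    linarith [two_mul_texp k, two_mul_texp (k + 11)]
  rw [tau, tau, e, e2, zpow_add₀ hq0]
  linear_combination q ^ texp k * h

lemma tau_neg {q : ℂ} (hq0 : q ≠ 0) (k : ℤ) : tau q (-k) = -tau q k := by
  have h := theta_inv (y := q ^ 121) (zpow_ne_zero (11 * k) hq0)
  have e : q ^ (11 * (-k)) = (q ^ (11 * k))⁻¹ := by rw [← zpow_neg]; congr 1; ring
  have e2 : texp (-k) = texp k + 11 * k := by
    linarith [two_mul_texp k, two_mul_texp (-k)]
  rw [tau, tau, e, e2, zpow_add₀ hq0]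
  linear_combination q ^ texp k * h

lemma zpow_injective_of_norm {q : ℂ} (hq0 : q ≠ 0) (hq : ‖q‖ < 1) {m n : ℤ} (h : q ^ m = q ^ n) :
    m = n := by
  have h1 := congrArg norm h
  rw [norm_zpow, norm_zpow] at h1
  exact zpow_right_injective₀ (norm_pos_iff.2 hq0) hq.ne h1

lemma tau_ne_zero {q : ℂ} (hq0 : q ≠ 0) (hq : ‖q‖ < 1) {k : ℤ} (hk : ¬ (11 : ℤ) ∣ k) :
    tau q k ≠ 0 := by
  refine mul_ne_zero (zpow_ne_zero _ hq0) (theta_ne_zero (pow_121_ne_zero hq0) (norm_pow_121 hq)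
    (zpow_ne_zero _ hq0) fun n hn ↦ hk ?_)
  rw [← zpow_natCast, ← zpow_mul] at hn
  have := zpow_injective_of_norm hq0 hq hn
  exact ⟨n, by push_cast at this; linarith⟩

lemma tau_mul_tau {q : ℂ} (hq0 : q ≠ 0) (hq : ‖q‖ < 1) (a b : ℤ) :
    tau q (a + b) * tau q (a - b) = q ^ (30 : ℤ) * q ^ (a * a) * q ^ (b * b) *
      bracket (q ^ 121) (q ^ (11 * a)) (q ^ (11 * b)) := by
  have h := theta_mul_theta (pow_121_ne_zero hq0) (norm_pow_121 hq)
    (zpow_ne_zero (11 * a) hq0) (zpow_ne_zero (11 * b) hq0)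
  rw [← zpow_add₀ hq0, ← zpow_sub₀ hq0, ← mul_add, ← mul_sub] at h
  have e : texp (a + b) + texp (a - b) = 30 + a * a + b * b - 11 * a := by
    linarith [two_mul_texp (a + b), two_mul_texp (a - b)]
  have e2 : q ^ texp (a + b) * q ^ texp (a - b) * q ^ (11 * a)
      = q ^ (30 : ℤ) * q ^ (a * a) * q ^ (b * b) := by
    simp only [← zpow_add₀ hq0]
    congr 1
    linarith
  unfold tau
  linear_combination q ^ texp (a + b) * q ^ texp (a - b) * h +
    bracket (q ^ 121) (q ^ (11 * a)) (q ^ (11 * b)) * e2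

/-- Three-term relations between the functions `tau`. -/
theorem tau_relation {q : ℂ} (hq0 : q ≠ 0) (hq : ‖q‖ < 1) (a b c d : ℤ) :
    tau q (a + b) * tau q (a - b) * (tau q (c + d) * tau q (c - d))
      - tau q (a + c) * tau q (a - c) * (tau q (b + d) * tau q (b - d))
      + tau q (a + d) * tau q (a - d) * (tau q (b + c) * tau q (b - c)) = 0 := by
  simp only [tau_mul_tau hq0 hq]
  linear_combination q ^ (30 : ℤ) * q ^ (30 : ℤ) * q ^ (a * a) * q ^ (b * b) * q ^ (c * c) *
    q ^ (d * d) * bracket_relation (q ^ 121) (q ^ (11 * a)) (q ^ (11 * b)) (q ^ (11 * c))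
      (q ^ (11 * d))

end Theta

section Curve

/-- The relations between the theta functions of level eleven. -/
structure LevelEleven (s1 s2 s3 s4 s5 : ℂ) : Prop where
  ne1 : s1 ≠ 0
  ne2 : s2 ≠ 0
  ne3 : s3 ≠ 0
  ne4 : s4 ≠ 0
  ne5 : s5 ≠ 0
  rel1 : s2 ^ 2 * s3 * s5 + s1 ^ 2 * s2 * s5 = s1 * s3 * s4 ^ 2
  rel2 : s2 ^ 2 * s4 * s5 + s1 * s3 * s5 ^ 2 = s1 ^ 2 * s3 * s4
  rel3 : s2 ^ 3 * s4 - s1 ^ 3 * s5 = s1 * s3 ^ 3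

lemma tau_add_mul {q : ℂ} (hq0 : q ≠ 0) (k w : ℤ) : tau q (k + 22 * w) = tau q k := by
  have h : Function.Periodic (tau q) 22 := fun k ↦ by
    rw [show k + 22 = k + 11 + 11 by ring, tau_add hq0, tau_add hq0, neg_neg]
  rw [mul_comm]
  exact h.int_mul w k

lemma levelEleven_tau {q : ℂ} (hq0 : q ≠ 0) (hq : ‖q‖ < 1) {z : ℤ} (hz : Even z)
    (hz' : ¬ (11 : ℤ) ∣ z) :
    LevelEleven (tau q z) (tau q (2 * z)) (tau q (3 * z)) (tau q (4 * z)) (tau q (5 * z)) := by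
  have p : ∀ {k l : ℤ}, k + l = 11 * z → tau q k = -tau q l := fun {k l} h ↦ by
    obtain ⟨w, rfl⟩ := hz
    rw [← tau_neg hq0, ← tau_add_mul hq0 k (-w)]
    congr 1
    linarith
  have n0 : tau q 0 = 0 := by simp [tau, theta_one]
  have r := fun a b c d : ℤ ↦ tau_relation hq0 hq (z * a) (z * b) (z * c) (z * d)
  refine ⟨tau_ne_zero hq0 hq hz', tau_ne_zero hq0 hq (by omega), tau_ne_zero hq0 hq (by omega),
    tau_ne_zero hq0 hq (by omega), tau_ne_zero hq0 hq (by omega), ?_, ?_, ?_⟩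
  · have h := r 0 1 2 4
    simp only [← mul_add, ← mul_sub] at h
    norm_num at h
    simp only [mul_comm z, tau_neg hq0, p (show 6 * z + 5 * z = 11 * z by ring)] at h
    linear_combination -h
  · have h := r 0 1 2 5
    simp only [← mul_add, ← mul_sub] at h
    norm_num at h
    simp only [mul_comm z, tau_neg hq0, p (show 6 * z + 5 * z = 11 * z by ring),
      p (show 7 * z + 4 * z = 11 * z by ring)] at h
    linear_combination h
  · have h := r 0 1 2 3
    simp only [← mul_add, ← mul_sub] at h
    norm_num at h
    simp only [mul_comm z, tau_neg hq0] at h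
    linear_combination -h

/-- Coordinates on the modular curve of level eleven. -/
structure Coords (s1 s2 s3 s4 s5 x y : ℂ) : Prop extends LevelEleven s1 s2 s3 s4 s5 where
  hx : x = -s1 ^ 2 / (s2 * s3)
  hy : y = s1 * s3 * s5 / (s2 ^ 2 * s4)
  hu : 1 - x = s1 * s4 ^ 2 / (s2 ^ 2 * s5)
  hv : 1 + y = s1 ^ 2 * s3 / (s2 ^ 2 * s5)
  hw : 1 + x * y = s1 * s3 ^ 3 / (s2 ^ 3 * s4)
  nex : x ≠ 0
  ney : y ≠ 0
  neu : 1 - x ≠ 0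
  nev : 1 + y ≠ 0
  curve : y ^ 2 + (x ^ 2 + 1) * y + x = 0

lemma LevelEleven.coords {s1 s2 s3 s4 s5 : ℂ} (h : LevelEleven s1 s2 s3 s4 s5) :
    Coords s1 s2 s3 s4 s5 (-s1 ^ 2 / (s2 * s3)) (s1 * s3 * s5 / (s2 ^ 2 * s4)) := by
  have h1 := h.ne1
  have h2 := h.ne2
  have h3 := h.ne3
  have h4 := h.ne4
  have h5 := h.ne5
  have hu : 1 - (-s1 ^ 2 / (s2 * s3)) = s1 * s4 ^ 2 / (s2 ^ 2 * s5) := by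
    field_simp
    linear_combination h.rel1
  have hv : 1 + s1 * s3 * s5 / (s2 ^ 2 * s4) = s1 ^ 2 * s3 / (s2 ^ 2 * s5) := by
    field_simp
    linear_combination h.rel2
  have hw : 1 + -s1 ^ 2 / (s2 * s3) * (s1 * s3 * s5 / (s2 ^ 2 * s4))
      = s1 * s3 ^ 3 / (s2 ^ 3 * s4) := by
    field_simp
    linear_combination h.rel3
  refine ⟨h, rfl, rfl, hu, hv, hw, by simp [*], by simp [*], by rw [hu]; simp [*],
    by rw [hv]; simp [*], ?_⟩
  have key : (1 + s1 * s3 * s5 / (s2 ^ 2 * s4)) * (s1 * s3 * s5 / (s2 ^ 2 * s4))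
      + (1 + -s1 ^ 2 / (s2 * s3) * (s1 * s3 * s5 / (s2 ^ 2 * s4))) * (-s1 ^ 2 / (s2 * s3)) = 0 := by
    rw [hv, hw]
    field_simp
    ring
  linear_combination key

/-- The function whose divisor is the product over the cusps. -/
def curveUnit (x y : ℂ) : ℂ := 1 + 2 * y + 4 * x + x * y - x ^ 2

/-- Numerator of a component of the dissected quotient. -/
noncomputable def comp0 (s2 s3 s4 x y : ℂ) : ℂ :=
  s3 / (s2 * s4) * (-11 * y - 22 * x ^ 2)

/-- Numerator of a component of the dissected quotient. -/
noncomputable def comp1 (s2 s3 s5 x y : ℂ) : ℂ :=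
  s5 / (s2 * s3) * (-19 - 16 * y + x - 8 * x * y - 3 * x ^ 2)

/-- Numerator of a component of the dissected quotient. -/
noncomputable def comp2 (s3 x y : ℂ) : ℂ :=
  1 / (s3) * (-1 - 13 * y + 7 * x + 10 * x * y + x ^ 2)

/-- Numerator of a component of the dissected quotient. -/
noncomputable def comp3 (s1 s3 s4 x y : ℂ) : ℂ :=
  s3 / (s1 * s4) * (-5 + y + 2 * x - 5 * x * y + 16 * x ^ 2 - 11 * x ^ 3)

/-- Numerator of a component of the dissected quotient. -/
noncomputable def comp4 (s1 s2 s3 s4 s5 x y : ℂ) : ℂ :=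
  s2 * s3 / (s1 * s4 * s5) * (-15 * y - 4 * y ^ 2 - 11 * x - 3 * x * y - 6 * x ^ 2 + 7 * x ^ 3)

/-- Numerator of a component of the dissected quotient. -/
noncomputable def comp5 (s1 s2 s3 x y : ℂ) : ℂ :=
  s2 / (s1 * s3) * (-2 - 4 * y - 11 * y ^ 2 + 3 * x - 2 * x * y + 2 * x ^ 2)

/-- Numerator of a component of the dissected quotient. -/
noncomputable def comp6 (s4 x y : ℂ) : ℂ :=
  1 / (s4) * (-9 + 4 * y - 3 * x - 9 * x * y + 9 * x ^ 2)

/-- Numerator of a component of the dissected quotient. -/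
noncomputable def comp7 (s2 x y : ℂ) : ℂ :=
  1 / (s2) * (-7 - 3 * y - 6 * x + 4 * x * y - 4 * x ^ 2)

/-- Numerator of a component of the dissected quotient. -/
noncomputable def comp8 (s1 s2 s3 s5 x y : ℂ) : ℂ :=
  s2 * s3 / (s1 ^ 2 * s5) * (6 * y - 5 * y ^ 2 + 11 * x - 23 * x * y - 2 * x ^ 2 - 5 * x ^ 3)

/-- Numerator of a component of the dissected quotient. -/
noncomputable def comp9 (s1 s2 s3 s4 s5 x y : ℂ) : ℂ :=
  s2 ^ 2 * s4 ^ 2 / (s1 * s3 ^ 3 * s5)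
      * (1 - 13 * y - 5 * y ^ 2 - y ^ 3 + 2 * x * y - 19 * x * y ^ 2)

/-- Numerator of a component of the dissected quotient. -/
noncomputable def comp10 (s1 x y : ℂ) : ℂ :=
  1 / (s1) * (-3 - 6 * y - x - 14 * x * y - 8 * x ^ 2)

lemma comp_eq0 {s1 s2 s3 s4 s5 x y : ℂ} (h : Coords s1 s2 s3 s4 s5 x y) :
    comp0 s2 s3 s4 x y +
    (s2 / s1) * comp8 s1 s2 s3 s5 x y +
    (s4 / s2) * comp10 s1 x y +
    (-(s5 / s3)) * comp6 s4 x y +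
    (-(s3 / s4)) * comp7 s2 x y +
    (-(s1 / s5)) * comp2 s3 x y
    = 11 * curveUnit x y * ((-8 / 11) * (s2 ^ 3 / (s1 ^ 3 * s3)) + (13 / 11) * (s1 * s4 / (s2 ^ 2 * s3)) + (-15 / 11) * (s1 ^ 2 * s5 / (s2 * s3 ^ 2 * s4)) + (-9 / 11) * (s1 ^ 2 / (s4 ^ 2 * s5)) + (3 / 11) * (s1 ^ 3 / (s4 * s5 ^ 3))) := by
  have h1 := h.ne1
  have h2 := h.ne2
  have h3 := h.ne3
  have h4 := h.ne4
  have h5 := h.ne5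
  have t1 : s2 / s1 * (s2 * s3 / (s1 ^ 2 * s5)) * (x * y ^ 2 * (1 - x) * (1 + y)) = -(s3 / (s2 * s4)) * (y * (1 - x) * (1 + y)) := by
    simp only [h.hu, h.hv]
    simp only [h.hx, h.hy]
    field_simp
  have t2 : s4 / s2 * (1 / (s1)) * (x * y ^ 2 * (1 - x) * (1 + y)) = (s3 / (s2 * s4)) * (x * y ^ 2 * (1 - x) ^ 2) := by
    simp only [h.hu, h.hv]
    simp only [h.hx, h.hy]
    field_simp
  have t3 : (-(s5 / s3)) * (1 / (s4)) * (x * y ^ 2 * (1 - x) * (1 + y)) = (s3 / (s2 * s4)) * (x ^ 2 * y ^ 2 * (1 - x)) := by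
    simp only [h.hu, h.hv]
    simp only [h.hx, h.hy]
    field_simp
  have t4 : (-(s3 / s4)) * (1 / (s2)) * (x * y ^ 2 * (1 - x) * (1 + y)) = -(s3 / (s2 * s4)) * (x * y ^ 2 * (1 - x) * (1 + y)) := by
    field_simp
  have t5 : (-(s1 / s5)) * (1 / (s3)) * (x * y ^ 2 * (1 - x) * (1 + y)) = (s3 / (s2 * s4)) * (x ^ 2 * y * (1 - x) * (1 + y)) := by
    simp only [h.hu, h.hv]
    simp only [h.hx, h.hy]
    field_simp
  have t6 : s2 ^ 3 / (s1 ^ 3 * s3) * (x * y ^ 2 * (1 - x) * (1 + y)) = (s3 / (s2 * s4)) * (x * y * (1 - x)) := by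
    simp only [h.hu, h.hv]
    simp only [h.hx, h.hy]
    field_simp
  have t7 : s1 * s4 / (s2 ^ 2 * s3) * (x * y ^ 2 * (1 - x) * (1 + y)) = -(s3 / (s2 * s4)) * (x ^ 2 * y ^ 2 * (1 - x) ^ 2) := by
    simp only [h.hu, h.hv]
    simp only [h.hx, h.hy]
    field_simp
  have t8 : s1 ^ 2 * s5 / (s2 * s3 ^ 2 * s4) * (x * y ^ 2 * (1 - x) * (1 + y)) = (s3 / (s2 * s4)) * (x ^ 3 * y ^ 2 * (1 - x)) := by
    simp only [h.hu, h.hv]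
    simp only [h.hx, h.hy]
    field_simp
  have t9 : s1 ^ 2 / (s4 ^ 2 * s5) * (x * y ^ 2 * (1 - x) * (1 + y)) = -(s3 / (s2 * s4)) * (x ^ 2 * y * (1 + y) ^ 2) := by
    simp only [h.hu, h.hv]
    simp only [h.hx, h.hy]
    field_simp
  have t10 : s1 ^ 3 / (s4 * s5 ^ 3) * (x * y ^ 2 * (1 - x) * (1 + y)) = -(s3 / (s2 * s4)) * (x ^ 2 * (1 + y) ^ 3) := by
    simp only [h.hu, h.hv]
    simp only [h.hx, h.hy]
    field_simp
  have hD : x * y ^ 2 * (1 - x) * (1 + y) ≠ 0 := by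
    have := h.nex; have := h.ney; have := h.neu; have := h.nev
    simp [*]
  refine mul_right_cancel₀ hD ?_
  unfold comp0 comp8 comp10 comp6 comp7 comp2 curveUnit
  linear_combination (6 * y - 5 * y ^ 2 + 11 * x - 23 * x * y - 2 * x ^ 2 - 5 * x ^ 3) * t1 +
    (-3 - 6 * y - x - 14 * x * y - 8 * x ^ 2) * t2 +
    (-9 + 4 * y - 3 * x - 9 * x * y + 9 * x ^ 2) * t3 +
    (-7 - 3 * y - 6 * x + 4 * x * y - 4 * x ^ 2) * t4 +
    (-1 - 13 * y + 7 * x + 10 * x * y + x ^ 2) * t5 +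
    -11 * (-8 / 11) * (1 + 2 * y + 4 * x + x * y - x ^ 2) * t6 +
    -11 * (13 / 11) * (1 + 2 * y + 4 * x + x * y - x ^ 2) * t7 +
    -11 * (-15 / 11) * (1 + 2 * y + 4 * x + x * y - x ^ 2) * t8 +
    -11 * (-9 / 11) * (1 + 2 * y + 4 * x + x * y - x ^ 2) * t9 +
    -11 * (3 / 11) * (1 + 2 * y + 4 * x + x * y - x ^ 2) * t10 +
    (s3 / (s2 * s4)) * (-6 * y + 5 * y ^ 2 + 3 * x + 30 * x * y - 13 * x * y ^ 2 + 12 * x ^ 2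
        - 26 * x ^ 2 * y - 8 * x ^ 2 * y ^ 2 - 3 * x ^ 3 - 15 * x ^ 3 * y - 2 * x ^ 3 * y ^ 2
        + 2 * x ^ 4 * y) * h.curve

lemma comp_eq1 {s1 s2 s3 s4 s5 x y : ℂ} (h : Coords s1 s2 s3 s4 s5 x y) :
    comp1 s2 s3 s5 x y +
    (s2 / s1) * comp9 s1 s2 s3 s4 s5 x y +
    (s4 / s2) * comp0 s2 s3 s4 x y +
    (-(s5 / s3)) * comp7 s2 x y +
    (-(s3 / s4)) * comp8 s1 s2 s3 s5 x y +
    (-(s1 / s5)) * comp3 s1 s3 s4 x y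
    = 11 * curveUnit x y * ((1) * (s4 / (s1 * s5))) := by
  have h1 := h.ne1
  have h2 := h.ne2
  have h3 := h.ne3
  have h4 := h.ne4
  have h5 := h.ne5
  have t1 : s2 / s1 * (s2 ^ 2 * s4 ^ 2 / (s1 * s3 ^ 3 * s5)) * (x ^ 2 * y ^ 2 * (1 - x)) = (s5 / (s2 * s3)) * (x ^ 2 * (1 - x)) := by
    simp only [h.hu]
    simp only [h.hx, h.hy]
    field_simp
  have t2 : s4 / s2 * (s3 / (s2 * s4)) * (x ^ 2 * y ^ 2 * (1 - x)) = -(s5 / (s2 * s3)) * (x * y ^ 2 * (1 - x) * (1 + y)) := by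
    simp only [h.hu, h.hv]
    simp only [h.hx, h.hy]
    field_simp
  have t3 : (-(s5 / s3)) * (1 / (s2)) * (x ^ 2 * y ^ 2 * (1 - x)) = -(s5 / (s2 * s3)) * (x ^ 2 * y ^ 2 * (1 - x)) := by
    field_simp
  have t4 : (-(s3 / s4)) * (s2 * s3 / (s1 ^ 2 * s5)) * (x ^ 2 * y ^ 2 * (1 - x)) = -(s5 / (s2 * s3)) * (y * (1 + y) ^ 2) := by
    simp only [h.hu, h.hv]
    simp only [h.hx, h.hy]
    field_simp
  have t5 : (-(s1 / s5)) * (s3 / (s1 * s4)) * (x ^ 2 * y ^ 2 * (1 - x)) = (s5 / (s2 * s3)) * (x * y * (1 + y) ^ 2) := by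
    simp only [h.hu, h.hv]
    simp only [h.hx, h.hy]
    field_simp
  have t6 : s4 / (s1 * s5) * (x ^ 2 * y ^ 2 * (1 - x)) = -(s5 / (s2 * s3)) * (x * y * (1 - x) * (1 + y)) := by
    simp only [h.hu, h.hv]
    simp only [h.hx, h.hy]
    field_simp
  have hD : x ^ 2 * y ^ 2 * (1 - x) ≠ 0 := by
    have := h.nex; have := h.ney; have := h.neu; have := h.nev
    simp [*]
  refine mul_right_cancel₀ hD ?_
  unfold comp1 comp9 comp0 comp7 comp8 comp3 curveUnit
  linear_combination (1 - 13 * y - 5 * y ^ 2 - y ^ 3 + 2 * x * y - 19 * x * y ^ 2) * t1 +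
    (-11 * y - 22 * x ^ 2) * t2 +
    (-7 - 3 * y - 6 * x + 4 * x * y - 4 * x ^ 2) * t3 +
    (6 * y - 5 * y ^ 2 + 11 * x - 23 * x * y - 2 * x ^ 2 - 5 * x ^ 3) * t4 +
    (-5 + y + 2 * x - 5 * x * y + 16 * x ^ 2 - 11 * x ^ 3) * t5 +
    -11 * (1) * (1 + 2 * y + 4 * x + x * y - x ^ 2) * t6 +
    (s5 / (s2 * s3)) * (-6 * y - y ^ 2 + 5 * y ^ 3 + x + 25 * x * y + 35 * x * y ^ 2 - x ^ 2
        - 20 * x ^ 2 * y - 21 * x ^ 2 * y ^ 2 - x ^ 3 * y) * h.curve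

lemma comp_eq2 {s1 s2 s3 s4 s5 x y : ℂ} (h : Coords s1 s2 s3 s4 s5 x y) :
    comp2 s3 x y +
    (s2 / s1) * comp10 s1 x y +
    (s4 / s2) * comp1 s2 s3 s5 x y +
    (-(s5 / s3)) * comp8 s1 s2 s3 s5 x y +
    (-(s3 / s4)) * comp9 s1 s2 s3 s4 s5 x y +
    (-(s1 / s5)) * comp4 s1 s2 s3 s4 s5 x y
    = 11 * curveUnit x y * ((1) * (s3 * s5 / (s1 * s2 * s4))) := by
  have h1 := h.ne1
  have h2 := h.ne2
  have h3 := h.ne3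
  have h4 := h.ne4
  have h5 := h.ne5
  have t1 : s2 / s1 * (1 / (s1)) * (x * y * (1 - x) * (1 + y)) = -(1 / (s3)) * (y * (1 - x) * (1 + y)) := by
    simp only [h.hu, h.hv]
    simp only [h.hx, h.hy]
    field_simp
  have t2 : s4 / s2 * (s5 / (s2 * s3)) * (x * y * (1 - x) * (1 + y)) = (1 / (s3)) * (x * y ^ 2 * (1 - x) ^ 2) := by
    simp only [h.hu, h.hv]
    simp only [h.hx, h.hy]
    field_simp
  have t3 : (-(s5 / s3)) * (s2 * s3 / (s1 ^ 2 * s5)) * (x * y * (1 - x) * (1 + y)) = (1 / (s3)) * (y * (1 - x) * (1 + y)) := by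
    simp only [h.hu, h.hv]
    simp only [h.hx, h.hy]
    field_simp
  have t4 : (-(s3 / s4)) * (s2 ^ 2 * s4 ^ 2 / (s1 * s3 ^ 3 * s5)) * (x * y * (1 - x) * (1 + y)) = -(1 / (s3)) * (x * (1 - x) * (1 + y)) := by
    simp only [h.hu, h.hv]
    simp only [h.hx, h.hy]
    field_simp
  have t5 : (-(s1 / s5)) * (s2 * s3 / (s1 * s4 * s5)) * (x * y * (1 - x) * (1 + y)) = (1 / (s3)) * ((1 + y) ^ 3) := by
    simp only [h.hu, h.hv]
    simp only [h.hx, h.hy]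
    field_simp
  have t6 : s3 * s5 / (s1 * s2 * s4) * (x * y * (1 - x) * (1 + y)) = -(1 / (s3)) * (y ^ 2 * (1 - x) * (1 + y)) := by
    simp only [h.hu, h.hv]
    simp only [h.hx, h.hy]
    field_simp
  have hD : x * y * (1 - x) * (1 + y) ≠ 0 := by
    have := h.nex; have := h.ney; have := h.neu; have := h.nev
    simp [*]
  refine mul_right_cancel₀ hD ?_
  unfold comp2 comp10 comp1 comp8 comp9 comp4 curveUnit
  linear_combination (-3 - 6 * y - x - 14 * x * y - 8 * x ^ 2) * t1 +
    (-19 - 16 * y + x - 8 * x * y - 3 * x ^ 2) * t2 +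
    (6 * y - 5 * y ^ 2 + 11 * x - 23 * x * y - 2 * x ^ 2 - 5 * x ^ 3) * t3 +
    (1 - 13 * y - 5 * y ^ 2 - y ^ 3 + 2 * x * y - 19 * x * y ^ 2) * t4 +
    (-15 * y - 4 * y ^ 2 - 11 * x - 3 * x * y - 6 * x ^ 2 + 7 * x ^ 3) * t5 +
    -11 * (1) * (1 + 2 * y + 4 * x + x * y - x ^ 2) * t6 +
    (1 / (s3)) * (-12 - 11 * y - 6 * y ^ 2 - 4 * y ^ 3 - 5 * x - 25 * x * y - 8 * x * y ^ 2
        + 7 * x ^ 2 + 11 * x ^ 2 * y - 8 * x ^ 2 * y ^ 2 - 3 * x ^ 3 * y) * h.curve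

lemma comp_eq3 {s1 s2 s3 s4 s5 x y : ℂ} (h : Coords s1 s2 s3 s4 s5 x y) :
    comp3 s1 s3 s4 x y +
    (s2 / s1) * comp0 s2 s3 s4 x y +
    (s4 / s2) * comp2 s3 x y +
    (-(s5 / s3)) * comp9 s1 s2 s3 s4 s5 x y +
    (-(s3 / s4)) * comp10 s1 x y +
    (-(s1 / s5)) * comp5 s1 s2 s3 x y
    = 0 := by
  have h1 := h.ne1
  have h2 := h.ne2
  have h3 := h.ne3
  have h4 := h.ne4
  have h5 := h.ne5
  have t1 : s2 / s1 * (s3 / (s2 * s4)) * (y * (1 + y) ^ 2) = (s3 / (s1 * s4)) * (y * (1 + y) ^ 2) := by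
    field_simp
  have t2 : s4 / s2 * (1 / (s3)) * (y * (1 + y) ^ 2) = -(s3 / (s1 * s4)) * (x * y * (1 - x) * (1 + y)) := by
    simp only [h.hu, h.hv]
    simp only [h.hx, h.hy]
    field_simp
  have t3 : (-(s5 / s3)) * (s2 ^ 2 * s4 ^ 2 / (s1 * s3 ^ 3 * s5)) * (y * (1 + y) ^ 2) = -(s3 / (s1 * s4)) * (x ^ 2 * (1 - x)) := by
    simp only [h.hu, h.hv]
    simp only [h.hx, h.hy]
    field_simp
  have t4 : (-(s3 / s4)) * (1 / (s1)) * (y * (1 + y) ^ 2) = -(s3 / (s1 * s4)) * (y * (1 + y) ^ 2) := by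
    field_simp
  have t5 : (-(s1 / s5)) * (s2 / (s1 * s3)) * (y * (1 + y) ^ 2) = (s3 / (s1 * s4)) * (x * (1 + y) ^ 2) := by
    simp only [h.hv]
    simp only [h.hx, h.hy]
    field_simp
  have hD : y * (1 + y) ^ 2 ≠ 0 := by
    have := h.nex; have := h.ney; have := h.neu; have := h.nev
    simp [*]
  refine mul_right_cancel₀ hD ?_
  unfold comp3 comp0 comp2 comp9 comp10 comp5
  linear_combination (-11 * y - 22 * x ^ 2) * t1 +
    (-1 - 13 * y + 7 * x + 10 * x * y + x ^ 2) * t2 +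
    (1 - 13 * y - 5 * y ^ 2 - y ^ 3 + 2 * x * y - 19 * x * y ^ 2) * t3 +
    (-3 - 6 * y - x - 14 * x * y - 8 * x ^ 2) * t4 +
    (-2 - 4 * y - 11 * y ^ 2 + 3 * x - 2 * x * y + 2 * x ^ 2) * t5 +
    (s3 / (s1 * s4)) * (-2 - 6 * y - 4 * y ^ 2 + 2 * x + 10 * x * y - 2 * x * y ^ 2 + 3 * x ^ 2
        - 18 * x ^ 2 * y) * h.curve

lemma comp_eq4 {s1 s2 s3 s4 s5 x y : ℂ} (h : Coords s1 s2 s3 s4 s5 x y) :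
    comp4 s1 s2 s3 s4 s5 x y +
    (s2 / s1) * comp1 s2 s3 s5 x y +
    (s4 / s2) * comp3 s1 s3 s4 x y +
    (-(s5 / s3)) * comp10 s1 x y +
    (-(s3 / s4)) * comp0 s2 s3 s4 x y +
    (-(s1 / s5)) * comp6 s4 x y
    = 0 := by
  have h1 := h.ne1
  have h2 := h.ne2
  have h3 := h.ne3
  have h4 := h.ne4
  have h5 := h.ne5
  have t1 : s2 / s1 * (s5 / (s2 * s3)) * ((1 + y) ^ 2) = -(s2 * s3 / (s1 * s4 * s5)) * (x * y * (1 - x)) := by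
    simp only [h.hu, h.hv]
    simp only [h.hx, h.hy]
    field_simp
  have t2 : s4 / s2 * (s3 / (s1 * s4)) * ((1 + y) ^ 2) = (s2 * s3 / (s1 * s4 * s5)) * (y * (1 - x) * (1 + y)) := by
    simp only [h.hu, h.hv]
    simp only [h.hy]
    field_simp
  have t3 : (-(s5 / s3)) * (1 / (s1)) * ((1 + y) ^ 2) = (s2 * s3 / (s1 * s4 * s5)) * (x * y * (1 - x)) := by
    simp only [h.hu, h.hv]
    simp only [h.hx, h.hy]
    field_simp
  have t4 : (-(s3 / s4)) * (s3 / (s2 * s4)) * ((1 + y) ^ 2) = -(s2 * s3 / (s1 * s4 * s5)) * (y * (1 + y) ^ 2) := by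
    simp only [h.hv]
    simp only [h.hy]
    field_simp
  have t5 : (-(s1 / s5)) * (1 / (s4)) * ((1 + y) ^ 2) = (s2 * s3 / (s1 * s4 * s5)) * (x * (1 + y) ^ 2) := by
    simp only [h.hv]
    simp only [h.hx]
    field_simp
  have hD : (1 + y) ^ 2 ≠ 0 := by
    have := h.nex; have := h.ney; have := h.neu; have := h.nev
    simp [*]
  refine mul_right_cancel₀ hD ?_
  unfold comp4 comp1 comp3 comp10 comp0 comp6
  linear_combination (-19 - 16 * y + x - 8 * x * y - 3 * x ^ 2) * t1 +
    (-5 + y + 2 * x - 5 * x * y + 16 * x ^ 2 - 11 * x ^ 3) * t2 +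
    (-3 - 6 * y - x - 14 * x * y - 8 * x ^ 2) * t3 +
    (-11 * y - 22 * x ^ 2) * t4 +
    (-9 + 4 * y - 3 * x - 9 * x * y + 9 * x ^ 2) * t5 +
    (s2 * s3 / (s1 * s4 * s5))
        * (-20 - 7 * y + 7 * y ^ 2 - 9 * x - 5 * x * y + 16 * x ^ 2 + 11 * x ^ 2 * y) * h.curve

lemma comp_eq5 {s1 s2 s3 s4 s5 x y : ℂ} (h : Coords s1 s2 s3 s4 s5 x y) :
    comp5 s1 s2 s3 x y +
    (s2 / s1) * comp2 s3 x y +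
    (s4 / s2) * comp4 s1 s2 s3 s4 s5 x y +
    (-(s5 / s3)) * comp0 s2 s3 s4 x y +
    (-(s3 / s4)) * comp1 s2 s3 s5 x y +
    (-(s1 / s5)) * comp7 s2 x y
    = 0 := by
  have h1 := h.ne1
  have h2 := h.ne2
  have h3 := h.ne3
  have h4 := h.ne4
  have h5 := h.ne5
  have t1 : s2 / s1 * (1 / (s3)) * (x) = (s2 / (s1 * s3)) * (x) := by
    field_simp
  have t2 : s4 / s2 * (s2 * s3 / (s1 * s4 * s5)) * (x) = -(s2 / (s1 * s3)) * ((1 + y)) := by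
    simp only [h.hv]
    simp only [h.hx]
    field_simp
  have t3 : (-(s5 / s3)) * (s3 / (s2 * s4)) * (x) = -(s2 / (s1 * s3)) * (x * y) := by
    simp only [h.hx, h.hy]
    field_simp
  have t4 : (-(s3 / s4)) * (s5 / (s2 * s3)) * (x) = -(s2 / (s1 * s3)) * (x * y) := by
    simp only [h.hx, h.hy]
    field_simp
  have t5 : (-(s1 / s5)) * (1 / (s2)) * (x) = -(s2 / (s1 * s3)) * (x * (1 + y)) := by
    simp only [h.hv]
    simp only [h.hx]
    field_simp
  have hD : x ≠ 0 := by
    have := h.nex; have := h.ney; have := h.neu; have := h.nev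
    simp [*]
  refine mul_right_cancel₀ hD ?_
  unfold comp5 comp2 comp4 comp0 comp1 comp7
  linear_combination (-1 - 13 * y + 7 * x + 10 * x * y + x ^ 2) * t1 +
    (-15 * y - 4 * y ^ 2 - 11 * x - 3 * x * y - 6 * x ^ 2 + 7 * x ^ 3) * t2 +
    (-11 * y - 22 * x ^ 2) * t3 +
    (-19 - 16 * y + x - 8 * x * y - 3 * x ^ 2) * t4 +
    (-7 - 3 * y - 6 * x + 4 * x * y - 4 * x ^ 2) * t5 +
    (s2 / (s1 * s3)) * (15 + 4 * y + 22 * x) * h.curve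

lemma comp_eq6 {s1 s2 s3 s4 s5 x y : ℂ} (h : Coords s1 s2 s3 s4 s5 x y) :
    comp6 s4 x y +
    (s2 / s1) * comp3 s1 s3 s4 x y +
    (s4 / s2) * comp5 s1 s2 s3 x y +
    (-(s5 / s3)) * comp1 s2 s3 s5 x y +
    (-(s3 / s4)) * comp2 s3 x y +
    (-(s1 / s5)) * comp8 s1 s2 s3 s5 x y
    = 11 * curveUnit x y * ((-1) * (1 / (s4))) := by
  have h1 := h.ne1
  have h2 := h.ne2
  have h3 := h.ne3
  have h4 := h.ne4
  have h5 := h.ne5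
  have t1 : s2 / s1 * (s3 / (s1 * s4)) * (x * y * (1 + y) ^ 2) = -(1 / (s4)) * (y * (1 + y) ^ 2) := by
    simp only [h.hv]
    simp only [h.hx, h.hy]
    field_simp
  have t2 : s4 / s2 * (s2 / (s1 * s3)) * (x * y * (1 + y) ^ 2) = (1 / (s4)) * (x * y * (1 - x) * (1 + y)) := by
    simp only [h.hu, h.hv]
    simp only [h.hx, h.hy]
    field_simp
  have t3 : (-(s5 / s3)) * (s5 / (s2 * s3)) * (x * y * (1 + y) ^ 2) = (1 / (s4)) * (x ^ 2 * y ^ 2 * (1 - x)) := by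
    simp only [h.hu, h.hv]
    simp only [h.hx, h.hy]
    field_simp
  have t4 : (-(s3 / s4)) * (1 / (s3)) * (x * y * (1 + y) ^ 2) = -(1 / (s4)) * (x * y * (1 + y) ^ 2) := by
    field_simp
  have t5 : (-(s1 / s5)) * (s2 * s3 / (s1 ^ 2 * s5)) * (x * y * (1 + y) ^ 2) = (1 / (s4)) * ((1 + y) ^ 3) := by
    simp only [h.hv]
    simp only [h.hx, h.hy]
    field_simp
  have t6 : 1 / (s4) * (x * y * (1 + y) ^ 2) = (1 / (s4)) * (x * y * (1 + y) ^ 2) := by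
    field_simp
  have hD : x * y * (1 + y) ^ 2 ≠ 0 := by
    have := h.nex; have := h.ney; have := h.neu; have := h.nev
    simp [*]
  refine mul_right_cancel₀ hD ?_
  unfold comp6 comp3 comp5 comp1 comp2 comp8 curveUnit
  linear_combination (-5 + y + 2 * x - 5 * x * y + 16 * x ^ 2 - 11 * x ^ 3) * t1 +
    (-2 - 4 * y - 11 * y ^ 2 + 3 * x - 2 * x * y + 2 * x ^ 2) * t2 +
    (-19 - 16 * y + x - 8 * x * y - 3 * x ^ 2) * t3 +
    (-1 - 13 * y + 7 * x + 10 * x * y + x ^ 2) * t4 +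
    (6 * y - 5 * y ^ 2 + 11 * x - 23 * x * y - 2 * x ^ 2 - 5 * x ^ 3) * t5 +
    -11 * (-1) * (1 + 2 * y + 4 * x + x * y - x ^ 2) * t6 +
    (1 / (s4)) * (11 + 11 * y - 5 * y ^ 2 - 5 * y ^ 3 - 2 * x + 11 * x * y + 10 * x * y ^ 2
        - 5 * x ^ 2 - 6 * x ^ 2 * y + 8 * x ^ 2 * y ^ 2 + 3 * x ^ 3 * y) * h.curve

lemma comp_eq7 {s1 s2 s3 s4 s5 x y : ℂ} (h : Coords s1 s2 s3 s4 s5 x y) :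
    comp7 s2 x y +
    (s2 / s1) * comp4 s1 s2 s3 s4 s5 x y +
    (s4 / s2) * comp6 s4 x y +
    (-(s5 / s3)) * comp2 s3 x y +
    (-(s3 / s4)) * comp3 s1 s3 s4 x y +
    (-(s1 / s5)) * comp9 s1 s2 s3 s4 s5 x y
    = 0 := by
  have h1 := h.ne1
  have h2 := h.ne2
  have h3 := h.ne3
  have h4 := h.ne4
  have h5 := h.ne5
  have t1 : s2 / s1 * (s2 * s3 / (s1 * s4 * s5)) * (x * y ^ 2 * (1 - x) * (1 + y)) = -(1 / (s2)) * (y * (1 + y) ^ 2) := by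
    simp only [h.hu, h.hv]
    simp only [h.hx, h.hy]
    field_simp
  have t2 : s4 / s2 * (1 / (s4)) * (x * y ^ 2 * (1 - x) * (1 + y)) = (1 / (s2)) * (x * y ^ 2 * (1 - x) * (1 + y)) := by
    field_simp
  have t3 : (-(s5 / s3)) * (1 / (s3)) * (x * y ^ 2 * (1 - x) * (1 + y)) = (1 / (s2)) * (x ^ 2 * y ^ 2 * (1 - x)) := by
    simp only [h.hu, h.hv]
    simp only [h.hx, h.hy]
    field_simp
  have t4 : (-(s3 / s4)) * (s3 / (s1 * s4)) * (x * y ^ 2 * (1 - x) * (1 + y)) = (1 / (s2)) * (y ^ 2 * (1 + y) ^ 2) := by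
    simp only [h.hu, h.hv]
    simp only [h.hx, h.hy]
    field_simp
  have t5 : (-(s1 / s5)) * (s2 ^ 2 * s4 ^ 2 / (s1 * s3 ^ 3 * s5)) * (x * y ^ 2 * (1 - x) * (1 + y)) = (1 / (s2)) * (x ^ 2 * (1 - x) * (1 + y)) := by
    simp only [h.hu, h.hv]
    simp only [h.hx, h.hy]
    field_simp
  have hD : x * y ^ 2 * (1 - x) * (1 + y) ≠ 0 := by
    have := h.nex; have := h.ney; have := h.neu; have := h.nev
    simp [*]
  refine mul_right_cancel₀ hD ?_
  unfold comp7 comp4 comp6 comp2 comp3 comp9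
  linear_combination (-15 * y - 4 * y ^ 2 - 11 * x - 3 * x * y - 6 * x ^ 2 + 7 * x ^ 3) * t1 +
    (-9 + 4 * y - 3 * x - 9 * x * y + 9 * x ^ 2) * t2 +
    (-1 - 13 * y + 7 * x + 10 * x * y + x ^ 2) * t3 +
    (-5 + y + 2 * x - 5 * x * y + 16 * x ^ 2 - 11 * x ^ 3) * t4 +
    (1 - 13 * y - 5 * y ^ 2 - y ^ 3 + 2 * x * y - 19 * x * y ^ 2) * t5 +
    (1 / (s2)) * (10 * y + 15 * y ^ 2 + 5 * y ^ 3 + x - 5 * x * y + x * y ^ 2 - 5 * x * y ^ 3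
        - x ^ 2 + 6 * x ^ 2 * y + 4 * x ^ 2 * y ^ 2 - x ^ 3 * y) * h.curve

lemma comp_eq8 {s1 s2 s3 s4 s5 x y : ℂ} (h : Coords s1 s2 s3 s4 s5 x y) :
    comp8 s1 s2 s3 s5 x y +
    (s2 / s1) * comp5 s1 s2 s3 x y +
    (s4 / s2) * comp7 s2 x y +
    (-(s5 / s3)) * comp3 s1 s3 s4 x y +
    (-(s3 / s4)) * comp4 s1 s2 s3 s4 s5 x y +
    (-(s1 / s5)) * comp10 s1 x y
    = 0 := by
  have h1 := h.ne1
  have h2 := h.ne2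
  have h3 := h.ne3
  have h4 := h.ne4
  have h5 := h.ne5
  have t1 : s2 / s1 * (s2 / (s1 * s3)) * ((1 - x) * (1 + y)) = -(s2 * s3 / (s1 ^ 2 * s5)) * (x * (1 - x)) := by
    simp only [h.hu, h.hv]
    simp only [h.hx]
    field_simp
  have t2 : s4 / s2 * (1 / (s2)) * ((1 - x) * (1 + y)) = -(s2 * s3 / (s1 ^ 2 * s5)) * (x * y * (1 - x) ^ 2) := by
    simp only [h.hu, h.hv]
    simp only [h.hx, h.hy]
    field_simp
  have t3 : (-(s5 / s3)) * (s3 / (s1 * s4)) * ((1 - x) * (1 + y)) = (s2 * s3 / (s1 ^ 2 * s5)) * (x * y * (1 - x)) := by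
    simp only [h.hu, h.hv]
    simp only [h.hx, h.hy]
    field_simp
  have t4 : (-(s3 / s4)) * (s2 * s3 / (s1 * s4 * s5)) * ((1 - x) * (1 + y)) = -(s2 * s3 / (s1 ^ 2 * s5)) * ((1 + y) ^ 2) := by
    simp only [h.hu, h.hv]
    field_simp
  have t5 : (-(s1 / s5)) * (1 / (s1)) * ((1 - x) * (1 + y)) = (s2 * s3 / (s1 ^ 2 * s5)) * (x * (1 - x) * (1 + y)) := by
    simp only [h.hu, h.hv]
    simp only [h.hx]
    field_simp
  have hD : (1 - x) * (1 + y) ≠ 0 := by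
    have := h.nex; have := h.ney; have := h.neu; have := h.nev
    simp [*]
  refine mul_right_cancel₀ hD ?_
  unfold comp8 comp5 comp7 comp3 comp4 comp10
  linear_combination (-2 - 4 * y - 11 * y ^ 2 + 3 * x - 2 * x * y + 2 * x ^ 2) * t1 +
    (-7 - 3 * y - 6 * x + 4 * x * y - 4 * x ^ 2) * t2 +
    (-5 + y + 2 * x - 5 * x * y + 16 * x ^ 2 - 11 * x ^ 3) * t3 +
    (-15 * y - 4 * y ^ 2 - 11 * x - 3 * x * y - 6 * x ^ 2 + 7 * x ^ 3) * t4 +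
    (-3 - 6 * y - x - 14 * x * y - 8 * x ^ 2) * t5 +
    (s2 * s3 / (s1 ^ 2 * s5)) * (21 + 14 * y + 4 * y ^ 2 - 10 * x + 8 * x * y - 16 * x ^ 2
        - 4 * x ^ 2 * y + 15 * x ^ 3) * h.curve

lemma comp_eq9 {s1 s2 s3 s4 s5 x y : ℂ} (h : Coords s1 s2 s3 s4 s5 x y) :
    comp9 s1 s2 s3 s4 s5 x y +
    (s2 / s1) * comp6 s4 x y +
    (s4 / s2) * comp8 s1 s2 s3 s5 x y +
    (-(s5 / s3)) * comp4 s1 s2 s3 s4 s5 x y +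
    (-(s3 / s4)) * comp5 s1 s2 s3 x y +
    (-(s1 / s5)) * comp0 s2 s3 s4 x y
    = 11 * curveUnit x y * ((-1) * (s2 * s4 / (s1 ^ 2 * s3))) := by
  have h1 := h.ne1
  have h2 := h.ne2
  have h3 := h.ne3
  have h4 := h.ne4
  have h5 := h.ne5
  have t1 : s2 / s1 * (1 / (s4)) * (x ^ 2 * (1 - x)) = -(s2 ^ 2 * s4 ^ 2 / (s1 * s3 ^ 3 * s5)) * (x * y * (1 + y)) := by
    simp only [h.hu, h.hv]
    simp only [h.hx, h.hy]
    field_simp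
  have t2 : s4 / s2 * (s2 * s3 / (s1 ^ 2 * s5)) * (x ^ 2 * (1 - x)) = (s2 ^ 2 * s4 ^ 2 / (s1 * s3 ^ 3 * s5)) * (y * (1 - x) * (1 + y)) := by
    simp only [h.hu, h.hv]
    simp only [h.hx, h.hy]
    field_simp
  have t3 : (-(s5 / s3)) * (s2 * s3 / (s1 * s4 * s5)) * (x ^ 2 * (1 - x)) = (s2 ^ 2 * s4 ^ 2 / (s1 * s3 ^ 3 * s5)) * (x * y * (1 + y)) := by
    simp only [h.hu, h.hv]
    simp only [h.hx, h.hy]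
    field_simp
  have t4 : (-(s3 / s4)) * (s2 / (s1 * s3)) * (x ^ 2 * (1 - x)) = (s2 ^ 2 * s4 ^ 2 / (s1 * s3 ^ 3 * s5)) * (x * y * (1 + y)) := by
    simp only [h.hu, h.hv]
    simp only [h.hx, h.hy]
    field_simp
  have t5 : (-(s1 / s5)) * (s3 / (s2 * s4)) * (x ^ 2 * (1 - x)) = (s2 ^ 2 * s4 ^ 2 / (s1 * s3 ^ 3 * s5)) * (x * y * (1 + y) ^ 2) := by
    simp only [h.hu, h.hv]
    simp only [h.hx, h.hy]
    field_simp
  have t6 : s2 * s4 / (s1 ^ 2 * s3) * (x ^ 2 * (1 - x)) = -(s2 ^ 2 * s4 ^ 2 / (s1 * s3 ^ 3 * s5)) * (x * y * (1 - x)) := by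
    simp only [h.hu]
    simp only [h.hx, h.hy]
    field_simp
  have hD : x ^ 2 * (1 - x) ≠ 0 := by
    have := h.nex; have := h.ney; have := h.neu; have := h.nev
    simp [*]
  refine mul_right_cancel₀ hD ?_
  unfold comp9 comp6 comp8 comp4 comp5 comp0 curveUnit
  linear_combination (-9 + 4 * y - 3 * x - 9 * x * y + 9 * x ^ 2) * t1 +
    (6 * y - 5 * y ^ 2 + 11 * x - 23 * x * y - 2 * x ^ 2 - 5 * x ^ 3) * t2 +
    (-15 * y - 4 * y ^ 2 - 11 * x - 3 * x * y - 6 * x ^ 2 + 7 * x ^ 3) * t3 +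
    (-2 - 4 * y - 11 * y ^ 2 + 3 * x - 2 * x * y + 2 * x ^ 2) * t4 +
    (-11 * y - 22 * x ^ 2) * t5 +
    -11 * (-1) * (1 + 2 * y + 4 * x + x * y - x ^ 2) * t6 +
    (s2 ^ 2 * s4 ^ 2 / (s1 * s3 ^ 3 * s5))
        * (6 * y - 5 * y ^ 2 + x - 63 * x * y - 21 * x * y ^ 2 - x ^ 2 + 31 * x ^ 2 * y) * h.curve

lemma comp_eq10 {s1 s2 s3 s4 s5 x y : ℂ} (h : Coords s1 s2 s3 s4 s5 x y) :
    comp10 s1 x y +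
    (s2 / s1) * comp7 s2 x y +
    (s4 / s2) * comp9 s1 s2 s3 s4 s5 x y +
    (-(s5 / s3)) * comp5 s1 s2 s3 x y +
    (-(s3 / s4)) * comp6 s4 x y +
    (-(s1 / s5)) * comp1 s2 s3 s5 x y
    = 0 := by
  have h1 := h.ne1
  have h2 := h.ne2
  have h3 := h.ne3
  have h4 := h.ne4
  have h5 := h.ne5
  have t1 : s2 / s1 * (1 / (s2)) * (y * (1 - x) * (1 + y)) = (1 / (s1)) * (y * (1 - x) * (1 + y)) := by
    field_simp
  have t2 : s4 / s2 * (s2 ^ 2 * s4 ^ 2 / (s1 * s3 ^ 3 * s5)) * (y * (1 - x) * (1 + y)) = -(1 / (s1)) * (x * (1 - x) ^ 2) := by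
    simp only [h.hu, h.hv]
    simp only [h.hx, h.hy]
    field_simp
  have t3 : (-(s5 / s3)) * (s2 / (s1 * s3)) * (y * (1 - x) * (1 + y)) = (1 / (s1)) * (x * y * (1 - x)) := by
    simp only [h.hu, h.hv]
    simp only [h.hx, h.hy]
    field_simp
  have t4 : (-(s3 / s4)) * (1 / (s4)) * (y * (1 - x) * (1 + y)) = -(1 / (s1)) * (y * (1 + y) ^ 2) := by
    simp only [h.hu, h.hv]
    simp only [h.hy]
    field_simp
  have t5 : (-(s1 / s5)) * (s5 / (s2 * s3)) * (y * (1 - x) * (1 + y)) = (1 / (s1)) * (x * y * (1 - x) * (1 + y)) := by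
    simp only [h.hu, h.hv]
    simp only [h.hx, h.hy]
    field_simp
  have hD : y * (1 - x) * (1 + y) ≠ 0 := by
    have := h.nex; have := h.ney; have := h.neu; have := h.nev
    simp [*]
  refine mul_right_cancel₀ hD ?_
  unfold comp10 comp7 comp9 comp5 comp6 comp1
  linear_combination (-7 - 3 * y - 6 * x + 4 * x * y - 4 * x ^ 2) * t1 +
    (1 - 13 * y - 5 * y ^ 2 - y ^ 3 + 2 * x * y - 19 * x * y ^ 2) * t2 +
    (-2 - 4 * y - 11 * y ^ 2 + 3 * x - 2 * x * y + 2 * x ^ 2) * t3 +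
    (-9 + 4 * y - 3 * x - 9 * x * y + 9 * x ^ 2) * t4 +
    (-19 - 16 * y + x - 8 * x * y - 3 * x ^ 2) * t5 +
    (1 / (s1)) * (-1 - 4 * y - 4 * y ^ 2 + 2 * x - 15 * x * y + 9 * x * y ^ 2 - x ^ 2
        + 22 * x ^ 2 * y) * h.curve

end Curve

section Duplication

lemma poch_mul_poch_neg {y : ℂ} (hy : ‖y‖ < 1) (x : ℂ) :
    poch y x * poch y (-x) = poch (y ^ 2) (x ^ 2) := by
  unfold poch
  rw [← (multipliable_poch hy x).tprod_mul (multipliable_poch hy (-x))]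
  refine tprod_congr fun m ↦ ?_
  ring

lemma poch_eq_mul_of_sq {y : ℂ} (hy : ‖y‖ < 1) (x : ℂ) :
    poch (y ^ 2) x * poch (y ^ 2) (x * y) = poch y x := by
  have hy2 : ‖y ^ 2‖ < 1 := by
    rw [norm_pow]; exact pow_lt_one₀ (norm_nonneg _) hy two_ne_zero
  have h1 := tendsto_fpoch hy2 x
  have h2 := tendsto_fpoch hy2 (x * y)
  have h3 := (tendsto_fpoch hy x).comp (tendsto_id.nsmul_atTop (zero_lt_two (α := ℕ)))
  refine tendsto_nhds_unique (h1.mul h2) (h3.congr fun n ↦ ?_)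
  simp only [Function.comp, id, smul_eq_mul]
  induction n with
  | zero => simp [fpoch_zero]
  | succ n ih =>
    rw [show 2 * (n + 1) = 2 * n + 1 + 1 by ring, fpoch_succ, fpoch_succ, fpoch_succ, fpoch_succ,
      ih]
    ring

lemma poch_four {y v : ℂ} (hv : v ^ 2 = y) (hy : ‖y‖ < 1) (x : ℂ) :
    poch y x * poch y (-x) * (poch y (x * v) * poch y (-(x * v))) = poch y (x ^ 2) := by
  rw [poch_mul_poch_neg hy, poch_mul_poch_neg hy, mul_pow, hv, poch_eq_mul_of_sq hy]

lemma theta_duplication {y v : ℂ} (hy0 : y ≠ 0) (hv : v ^ 2 = y) (hy : ‖y‖ < 1) {x : ℂ}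
    (hx : x ≠ 0) :
    theta y x * theta y (-x) * (theta y (x * v) * theta y (-(x * v)))
      = poch y y ^ 3 * theta y (x ^ 2) := by
  have hv0 : v ≠ 0 := by rintro rfl; exact hy0 (by simp [← hv])
  rw [theta_eq hy0 hy hx, theta_eq hy0 hy (neg_ne_zero.2 hx),
    theta_eq hy0 hy (mul_ne_zero hx hv0), theta_eq hy0 hy (neg_ne_zero.2 (mul_ne_zero hx hv0)),
    theta_eq hy0 hy (pow_ne_zero 2 hx), ← poch_four hv hy x,
    show y / x ^ 2 = (v / x) ^ 2 by rw [div_pow, hv], ← poch_four hv hy (v / x),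
    show v / x * v = y / x by rw [← hv]; ring,
    show y / (x * v) = v / x by rw [← hv]; field_simp,
    show y / -(x * v) = -(v / x) by rw [← hv]; field_simp, show y / -x = -(y / x) by ring]
  ring

lemma theta_two_torsion {y v : ℂ} (hy0 : y ≠ 0) (hv : v ^ 2 = y) (hy : ‖y‖ < 1) :
    theta y (-1) * (theta y v * theta y (-v)) = 2 * poch y y ^ 3 := by
  have hv0 : v ≠ 0 := by rintro rfl; exact hy0 (by simp [← hv])
  have h := poch_four hv hy v
  rw [show v * v = y by rw [← hv]; ring, hv] at h
  have h1 := poch_self_ne_zero hy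
  have h2 : poch y v * poch y (-v) * poch y (-y) = 1 := by
    refine mul_right_cancel₀ h1 ?_
    linear_combination h
  rw [theta_eq hy0 hy hv0, theta_eq hy0 hy (neg_ne_zero.2 hv0), theta_eq hy0 hy (by simp),
    show y / v = v by rw [← hv]; field_simp, show y / -v = -v by rw [← hv]; field_simp,
    poch_eq_mul hy (-1), show -1 * y = -y by ring, show y / -1 = -y by ring]
  linear_combination 2 * poch y y ^ 3 * (poch y v * poch y (-v) * poch y (-y) + 1) * h2

lemma evenTheta_neg (y x : ℂ) : evenTheta y (-x) = evenTheta y x :=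
  tsum_congr fun n ↦ by rw [(even_two_mul n).neg_zpow]

lemma oddTheta_neg (y x : ℂ) : oddTheta y (-x) = -oddTheta y x := by
  rw [oddTheta, oddTheta, ← tsum_neg]
  exact tsum_congr fun n ↦ by rw [(odd_two_mul_add_one n).neg_zpow]; ring

lemma evenTheta_half {y v : ℂ} (hy0 : y ≠ 0) (hv : v ^ 2 = y) :
    evenTheta y v = oddTheta y 1 :=
  tsum_congr fun n ↦ by rw [zpow_mul v, show v ^ (2 : ℤ) = y by exact_mod_cast hv,
    ← zpow_add₀ hy0, one_zpow, mul_one]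

lemma oddTheta_half {y v : ℂ} (hy0 : y ≠ 0) (hv : v ^ 2 = y) :
    v * oddTheta y v = evenTheta y 1 := by
  have hv0 : v ≠ 0 := by rintro rfl; exact hy0 (by simp [← hv])
  rw [oddTheta, evenTheta, ← tsum_mul_left,
    ← (Equiv.addRight (1 : ℤ)).tsum_eq fun n : ℤ ↦ y ^ (n * n) * (1 : ℂ) ^ (2 * n)]
  refine tsum_congr fun n ↦ ?_
  simp only [Equiv.coe_addRight, one_zpow, mul_one]
  rw [show v * (y ^ (n * n + n) * v ^ (2 * n + 1)) = y ^ (n * n + n) * (v ^ (2 * n) * v ^ 2) by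
    rw [zpow_add₀ hv0, zpow_one]; ring, zpow_mul v, show v ^ (2 : ℤ) = y by exact_mod_cast hv, hv,
    ← zpow_add_one₀ hy0, ← zpow_add₀ hy0]
  congr 1
  ring

/-- The quartic form vanishing at the two-torsion. -/
def quartic (y A B X Z : ℂ) : ℂ :=
  (A ^ 2 * X ^ 2 - B ^ 2 * Z ^ 2) * (A ^ 2 * Z ^ 2 - y * B ^ 2 * X ^ 2)

lemma theta_sq {y : ℂ} (hy0 : y ≠ 0) (hy : ‖y‖ < 1) {x : ℂ} (hx : x ≠ 0) :
    theta y x ^ 2 = x * (oddTheta y x * evenTheta y 1 - evenTheta y x * oddTheta y 1) := by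
  have h := theta_mul_theta hy0 hy hx one_ne_zero
  rw [mul_one, div_one] at h
  rw [sq, h, bracket]

lemma theta_mul_half_sq {y v : ℂ} (hy0 : y ≠ 0) (hv : v ^ 2 = y) (hy : ‖y‖ < 1) {x : ℂ}
    (hx : x ≠ 0) :
    theta y (x * v) ^ 2 = evenTheta y x * evenTheta y 1 - v * (oddTheta y x * oddTheta y 1) := by
  have hv0 : v ≠ 0 := by rintro rfl; exact hy0 (by simp [← hv])
  have h := theta_mul_theta hy0 hy hx hv0
  have h2 := theta_mul_self hy0 (div_ne_zero hx hv0)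
  rw [show x / v * y = x * v by rw [← hv]; field_simp] at h2
  rw [bracket, evenTheta_half hy0 hv] at h
  have h3 := oddTheta_half hy0 hv
  have h4 : x * theta y (x * v) = -(v * theta y (x / v)) := by
    field_simp at h2
    linear_combination h2
  refine mul_left_cancel₀ hx ?_
  linear_combination theta y (x * v) * h4 - v * h + x * evenTheta y x * h3

lemma two_mul_poch_pow_six {y v : ℂ} (hy0 : y ≠ 0) (hv : v ^ 2 = y) (hy : ‖y‖ < 1) :
    2 * poch y y ^ 6 = evenTheta y 1 * oddTheta y 1 *
      (evenTheta y 1 ^ 4 - y * oddTheta y 1 ^ 4) := by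
  have h := theta_two_torsion hy0 hv hy
  have h1 := theta_sq hy0 hy (x := -1) (by simp)
  have h2 := theta_mul_half_sq hy0 hv hy (x := 1) (by simp)
  have h3 := theta_mul_half_sq hy0 hv hy (x := -1) (by simp)
  rw [evenTheta_neg, oddTheta_neg] at h1 h3
  rw [one_mul] at h2
  rw [neg_one_mul] at h3
  have h4 : (theta y (-1) * (theta y v * theta y (-v))) ^ 2 = (2 * poch y y ^ 3) ^ 2 := by rw [h]
  rw [mul_pow, mul_pow, h1, h2, h3] at h4
  linear_combination -h4 / 2 - evenTheta y 1 * oddTheta y 1 ^ 5 * hv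

lemma theta_sq_duplication {y v : ℂ} (hy0 : y ≠ 0) (hv : v ^ 2 = y) (hy : ‖y‖ < 1) {x : ℂ}
    (hx : x ≠ 0) :
    poch y y ^ 6 * theta y (x ^ 2) ^ 2
      = x ^ 2 * quartic y (evenTheta y 1) (oddTheta y 1) (oddTheta y x) (evenTheta y x) := by
  have h := theta_duplication hy0 hv hy hx
  have hx' := neg_ne_zero.2 hx
  have h4 : (poch y y ^ 3 * theta y (x ^ 2)) ^ 2
    = (theta y x * theta y (-x) * (theta y (x * v) * theta y (-(x * v)))) ^ 2 := by rw [h]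
  have h3 := theta_mul_half_sq hy0 hv hy hx'
  rw [mul_pow (theta y x * _), mul_pow (theta y x), mul_pow (theta y (x * v)),
    theta_sq hy0 hy hx, theta_sq hy0 hy hx', theta_mul_half_sq hy0 hv hy hx,
    show -(x * v) = -x * v by ring, h3, evenTheta_neg, oddTheta_neg] at h4
  rw [quartic]
  linear_combination h4 - x ^ 2 * (oddTheta y x ^ 2 * evenTheta y 1 ^ 2
    - evenTheta y x ^ 2 * oddTheta y 1 ^ 2) * oddTheta y 1 ^ 2 * oddTheta y x ^ 2 * hv

end Duplication

section Discriminant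

/-- The leading coefficient of the discriminant of the Tate normal form, up to a power of `b`. -/
def tateFactor (b c : ℂ) : ℂ :=
  16 * b ^ 2 - 8 * b * c ^ 2 - 20 * b * c + b - c * (1 - c) ^ 3

lemma quartic_discriminant {y A B X Z D G c1 c2 c3 c0 : ℂ} (hD : D = A * X - B * Z)
    (hG : G = A ^ 4 - y * B ^ 4) (h3 : c3 = 2 * A * B * D * G)
    (h2 : c2 = D * (4 * A * B * (A ^ 3 * Z - y * B ^ 3 * X) + (A * X + B * Z) * G))
    (h1 : c1 = D * (2 * A * B * (A ^ 2 * Z ^ 2 - y * B ^ 2 * X ^ 2) +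
      2 * (A * X + B * Z) * (A ^ 3 * Z - y * B ^ 3 * X)))
    (h0 : c0 = D * (A * X + B * Z) * (A ^ 2 * Z ^ 2 - y * B ^ 2 * X ^ 2)) :
    c2 ^ 2 * c1 ^ 2 - 4 * c3 * c1 ^ 3 - 4 * c2 ^ 3 * c0 - 27 * c3 ^ 2 * c0 ^ 2
      + 18 * c3 * c2 * c1 * c0 = 4 * y * (A * B * G) ^ 2 * D ^ 10 := by
  have e1 : (A ^ 3 * Z - y * B ^ 3 * X) ^ 2 - G * (A ^ 2 * Z ^ 2 - y * B ^ 2 * X ^ 2)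
    = y * (A * B * D) ^ 2 := by rw [hD, hG]; ring
  have e2 : G * (A * X + B * Z) ^ 2 - 4 * A * B * (A * X + B * Z) * (A ^ 3 * Z - y * B ^ 3 * X)
      + 4 * A ^ 2 * B ^ 2 * (A ^ 2 * Z ^ 2 - y * B ^ 2 * X ^ 2) = G * D ^ 2 := by
    rw [hD, hG]; ring
  have e3 : ∀ a S G M N : ℂ, (D * (2 * a * M + S * G)) ^ 2 * (D * (a * N + 2 * S * M)) ^ 2
      - 4 * (a * D * G) * (D * (a * N + 2 * S * M)) ^ 3
      - 4 * (D * (2 * a * M + S * G)) ^ 3 * (D * S * N) - 27 * (a * D * G) ^ 2 * (D * S * N) ^ 2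
      + 18 * (a * D * G) * (D * (2 * a * M + S * G)) * (D * (a * N + 2 * S * M)) * (D * S * N)
      = 4 * D ^ 4 * (M ^ 2 - G * N) * (G * S ^ 2 - 2 * a * S * M + a ^ 2 * N) ^ 2 := by
    intros; ring
  have e4 := e3 (2 * A * B) (A * X + B * Z) G (A ^ 3 * Z - y * B ^ 3 * X)
    (A ^ 2 * Z ^ 2 - y * B ^ 2 * X ^ 2)
  rw [e1, show G * (A * X + B * Z) ^ 2 - 2 * (2 * A * B) * (A * X + B * Z)
      * (A ^ 3 * Z - y * B ^ 3 * X) + (2 * A * B) ^ 2 * (A ^ 2 * Z ^ 2 - y * B ^ 2 * X ^ 2)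
      = G * D ^ 2 by rw [← e2]; ring] at e4
  rw [h3, h2, h1, h0]
  linear_combination e4

lemma quartic_pencil {y A B X Z D G α β : ℂ} (hD : D = A * X - B * Z)
    (hG : G = A ^ 4 - y * B ^ 4) :
    quartic y A B (α * B + β * X) (α * A + β * Z) = β * (2 * A * B * D * G * α ^ 3 +
      D * (4 * A * B * (A ^ 3 * Z - y * B ^ 3 * X) + (A * X + B * Z) * G) * α ^ 2 * β +
      D * (2 * A * B * (A ^ 2 * Z ^ 2 - y * B ^ 2 * X ^ 2) +
        2 * (A * X + B * Z) * (A ^ 3 * Z - y * B ^ 3 * X)) * α * β ^ 2 +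
      D * (A * X + B * Z) * (A ^ 2 * Z ^ 2 - y * B ^ 2 * X ^ 2) * β ^ 3) := by
  rw [hD, hG, quartic]; ring

lemma cubic_coeff_unique {b c d e : ℂ} (hb : b ≠ 0) (hc : c ≠ 0) (hbc : b ≠ c)
    (h1 : 4 * b ^ 3 + d * b ^ 2 + e * b + b ^ 2 = b ^ 2 * c ^ 2)
    (h2 : 4 * c ^ 3 + d * c ^ 2 + e * c + b ^ 2 = (b - c - c ^ 2) ^ 2) :
    d = (1 - c) ^ 2 - 4 * b ∧ e = -2 * b * (1 - c) := by
  have h1' : b * (d - ((1 - c) ^ 2 - 4 * b)) + (e + 2 * b * (1 - c)) = 0 :=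
    mul_left_cancel₀ hb (by linear_combination h1)
  have h2' : c * (d - ((1 - c) ^ 2 - 4 * b)) + (e + 2 * b * (1 - c)) = 0 :=
    mul_left_cancel₀ hc (by linear_combination h2)
  have h3 : d - ((1 - c) ^ 2 - 4 * b) = 0 :=
    mul_left_cancel₀ (sub_ne_zero.2 hbc) (by linear_combination h1' - h2')
  exact ⟨by linear_combination h3, by linear_combination h1' - b * h3⟩

lemma tateFactor_curve {x y b c : ℂ} (hcurve : y ^ 2 + (x ^ 2 + 1) * y + x = 0)
    (hc : c = (1 - x) * x * y) (hb : b = c * (1 + x * y)) :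
    curveUnit x y * x ^ 4 * y * (1 + y) ^ 4 = tateFactor b c * (x - 1) := by
  subst hb hc
  rw [curveUnit, tateFactor]
  linear_combination (x^3*y+4*x^4*y+18*x^4*y^2+7*x^4*y^3+2*x^4*y^4-x^5*y-8*x^5*y^2+7*x^5*y^3
    +x^5*y^4+x^6*y^2-3*x^6*y^3-x^7*y^3) * hcurve

lemma quartic_homogeneous (y A B X Z t : ℂ) :
    quartic y A B (t * X) (t * Z) = t ^ 4 * quartic y A B X Z := by
  rw [quartic, quartic]; ring

lemma curveUnit_eq_of_quartic {s1 s2 s3 s4 s5 x y u J Y A B X1 Z1 X2 Z2 X3 Z3 : ℂ}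
    (h : Coords s1 s2 s3 s4 s5 x y) (hu : u ≠ 0) (hJ : J ≠ 0)
    (hAB : 2 * J ^ 2 = A * B * (A ^ 4 - Y * B ^ 4))
    (e1 : u * (X1 * A - Z1 * B) = s1 ^ 2) (e2 : u * (X2 * A - Z2 * B) = s2 ^ 2)
    (e3 : u * (X3 * A - Z3 * B) = s3 ^ 2) (e4 : u * (X2 * Z1 - Z2 * X1) = s3 * s1)
    (e5 : u * (X3 * Z1 - Z3 * X1) = s4 * s2) (f1 : J ^ 2 * s2 ^ 2 = u * quartic Y A B X1 Z1)
    (f2 : J ^ 2 * s4 ^ 2 = u * quartic Y A B X2 Z2)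
    (f3 : J ^ 2 * s5 ^ 2 = u * quartic Y A B X3 Z3) :
    curveUnit x y * u ^ 6 * J ^ 4 = Y * s1 ^ 5 * s3 ^ 2 * s4 ^ 3 * s5 ^ 2 := by
  have h1 := h.ne1
  have h2 := h.ne2
  have h3 := h.ne3
  have h4 := h.ne4
  have h5 := h.ne5
  obtain ⟨D, hD⟩ : ∃ D, D = A * X1 - B * Z1 := ⟨_, rfl⟩
  obtain ⟨G, hG⟩ : ∃ G, G = A ^ 4 - Y * B ^ 4 := ⟨_, rfl⟩
  have e1' : u * D = s1 ^ 2 := by rw [← e1, hD]; ring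
  have hX2 : s1 ^ 2 * X2 = -(s3 * s1) * B + s2 ^ 2 * X1 := by rw [← e1, ← e2, ← e4]; ring
  have hZ2 : s1 ^ 2 * Z2 = -(s3 * s1) * A + s2 ^ 2 * Z1 := by rw [← e1, ← e2, ← e4]; ring
  have hX3 : s1 ^ 2 * X3 = -(s4 * s2) * B + s3 ^ 2 * X1 := by rw [← e1, ← e3, ← e5]; ring
  have hZ3 : s1 ^ 2 * Z3 = -(s4 * s2) * A + s3 ^ 2 * Z1 := by rw [← e1, ← e3, ← e5]; ring
  obtain ⟨c1, hc1⟩ : ∃ c1, c1 = D * (2 * A * B * (A ^ 2 * Z1 ^ 2 - Y * B ^ 2 * X1 ^ 2) +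
        2 * (A * X1 + B * Z1) * (A ^ 3 * Z1 - Y * B ^ 3 * X1)) := ⟨_, rfl⟩
  obtain ⟨c2, hc2⟩ : ∃ c2, c2 = D * (4 * A * B * (A ^ 3 * Z1 - Y * B ^ 3 * X1) +
        (A * X1 + B * Z1) * G) := ⟨_, rfl⟩
  obtain ⟨c3, hc3⟩ : ∃ c3, c3 = 2 * A * B * D * G := ⟨_, rfl⟩
  obtain ⟨c0, hc0⟩ : ∃ c0, c0 = D * (A * X1 + B * Z1) *
        (A ^ 2 * Z1 ^ 2 - Y * B ^ 2 * X1 ^ 2) := ⟨_, rfl⟩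
  have hdisc := quartic_discriminant hD hG hc3 hc2 hc1 hc0
  have p2 := quartic_homogeneous Y A B X2 Z2 (s1 ^ 2)
  rw [hX2, hZ2, quartic_pencil hD hG, ← hc3, ← hc2, ← hc1, ← hc0] at p2
  have p3 := quartic_homogeneous Y A B X3 Z3 (s1 ^ 2)
  rw [hX3, hZ3, quartic_pencil hD hG, ← hc3, ← hc2, ← hc1, ← hc0] at p3
  have hABG : A * B * G = 2 * J ^ 2 := by rw [hAB, hG]
  have hC3 : u * c3 = 4 * J ^ 2 * s1 ^ 2 := by
    rw [hc3, ← e1']; linear_combination 2 * u * D * hABG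
  have hC0 : u * c0 = J ^ 2 * s2 ^ 2 := by rw [f1, hc0, quartic, hD]; ring
  obtain ⟨b, hb⟩ : ∃ b, b = -(s1 ^ 5 * s3 ^ 3 / s2 ^ 8) := ⟨_, rfl⟩
  obtain ⟨c, hc⟩ : ∃ c, c = -(s1 ^ 4 * s4 / s2 ^ 5) := ⟨_, rfl⟩
  have hcx : c = (1 - x) * x * y := by
    rw [h.hu, h.hy, h.hx, hc]; field_simp
  have hbc : b = c * (1 + x * y) := by rw [h.hw, hb, hc]; field_simp
  have hcc : b - c - c ^ 2 = c * x ^ 2 * y := by rw [hbc, hcx]; ring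
  obtain ⟨d, hd⟩ : ∃ d, d = u * c2 / J ^ 2 * (s1 ^ 2 * s3 ^ 2 / s2 ^ 6) := ⟨_, rfl⟩
  obtain ⟨e, he⟩ : ∃ e, e = u * c1 / J ^ 2 * (s1 ^ 6 * s3 ^ 4 / s2 ^ 12) := ⟨_, rfl⟩
  have hb0 : b ≠ 0 := by rw [hb]; simp [*]
  have hc0' : c ≠ 0 := by rw [hc]; simp [*]
  have hC2 : u * c2 = d * J ^ 2 * s2 ^ 6 / (s1 ^ 2 * s3 ^ 2) := by rw [hd]; field_simp
  have hC1 : u * c1 = e * J ^ 2 * s2 ^ 12 / (s1 ^ 6 * s3 ^ 4) := by rw [he]; field_simp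
  have q2 : 4 * b ^ 3 + d * b ^ 2 + e * b + b ^ 2 = b ^ 2 * c ^ 2 := by
    have : s2 ^ 2 * (u * c3 * (-(s3 * s1)) ^ 3 + u * c2 * (-(s3 * s1)) ^ 2 * s2 ^ 2
      + u * c1 * (-(s3 * s1)) * (s2 ^ 2) ^ 2 + u * c0 * (s2 ^ 2) ^ 3)
      = (s1 ^ 2) ^ 4 * (J ^ 2 * s4 ^ 2) := by rw [f2]; linear_combination u * p2
    rw [hC3, hC2, hC1, hC0] at this
    refine mul_left_cancel₀ (pow_ne_zero 2 hJ) ?_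
    rw [hb, hc]
    field_simp at this ⊢
    linear_combination this
  have q3 : 4 * c ^ 3 + d * c ^ 2 + e * c + b ^ 2 = (b - c - c ^ 2) ^ 2 := by
    have : s3 ^ 2 * (u * c3 * (-(s4 * s2)) ^ 3 + u * c2 * (-(s4 * s2)) ^ 2 * s3 ^ 2
      + u * c1 * (-(s4 * s2)) * (s3 ^ 2) ^ 2 + u * c0 * (s3 ^ 2) ^ 3)
      = (s1 ^ 2) ^ 4 * (J ^ 2 * s5 ^ 2) := by rw [f3]; linear_combination u * p3
    rw [hC3, hC2, hC1, hC0] at this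
    refine mul_left_cancel₀ (pow_ne_zero 2 hJ) ?_
    rw [hcc, h.hx, h.hy, hb, hc]
    field_simp at this ⊢
    linear_combination this
  have hne : b ≠ c := by
    have hr : 1 + x * y - 1 ≠ 0 := by simpa using ⟨h.nex, h.ney⟩
    rw [hbc]
    intro h'
    exact hr (mul_left_cancel₀ hc0' (by linear_combination h'))
  obtain ⟨hd', he'⟩ := cubic_coeff_unique hb0 hc0' hne q2 q3
  have disc2 : d ^ 2 * e ^ 2 - 16 * e ^ 3 - 4 * d ^ 3 * b ^ 2 - 432 * b ^ 4 + 72 * d * e * b ^ 2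
      = 16 * b ^ 3 * tateFactor b c := by
    rw [hd', he', tateFactor]; ring
  have disc1 : u ^ 6 * ((u * c2) ^ 2 * (u * c1) ^ 2 - 4 * (u * c3) * (u * c1) ^ 3
      - 4 * (u * c2) ^ 3 * (u * c0) - 27 * (u * c3) ^ 2 * (u * c0) ^ 2
      + 18 * (u * c3) * (u * c2) * (u * c1) * (u * c0)) = 16 * Y * J ^ 4 * s1 ^ 20 := by
    rw [show s1 ^ 20 = (u * D) ^ 10 by rw [e1']; ring]
    linear_combination u ^ 10 * hdisc + 4 * Y * D ^ 10 * u ^ 10 * (A * B * G + 2 * J ^ 2) * hABG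
  have hC0b : u * c0 = J ^ 2 * b ^ 2 * s2 ^ 18 / (s1 ^ 10 * s3 ^ 6) := by
    rw [hC0, hb]; field_simp
  rw [hC3, hC2, hC1, hC0b] at disc1
  have disc3 : u ^ 6 * J ^ 4 * b ^ 3 * tateFactor b c * s2 ^ 36 = Y * s1 ^ 36 * s3 ^ 12 := by
    field_simp at disc1
    refine mul_left_cancel₀ (by norm_num : (16 : ℂ) ≠ 0) ?_
    linear_combination disc1 - u ^ 6 * J ^ 4 * s2 ^ 36 * disc2
  have htf := tateFactor_curve h.curve hcx hbc
  have hx1 : x - 1 ≠ 0 := by rw [← neg_sub]; exact neg_ne_zero.2 h.neu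
  have hfin : curveUnit x y * u ^ 6 * J ^ 4 * (b ^ 3 * x ^ 4 * y * (1 + y) ^ 4 * s2 ^ 36)
      = Y * s1 ^ 36 * s3 ^ 12 * (-(1 - x)) := by
    linear_combination u ^ 6 * J ^ 4 * b ^ 3 * s2 ^ 36 * htf + (x - 1) * disc3
  have hnz : b ^ 3 * x ^ 4 * y * (1 + y) ^ 4 * s2 ^ 36 ≠ 0 := by
    have := h.nex
    have := h.ney
    have := h.nev
    simp [*]
  refine mul_right_cancel₀ hnz (hfin.trans ?_)
  rw [h.hu, h.hv, hb]
  have hx4 : x ^ 4 * y = s1 ^ 9 * s5 / (s2 ^ 6 * s3 ^ 3 * s4) := by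
    rw [h.hx, h.hy]; field_simp
  rw [mul_assoc _ (x ^ 4) y, hx4]
  field_simp

end Discriminant

section CurveUnit

variable {q : ℂ}

lemma poch_pow_six_mul_tau_sq (hq0 : q ≠ 0) (hq : ‖q‖ < 1) (a : ℤ) :
    poch (q ^ 121) (q ^ 121) ^ 6 * tau q (2 * a) ^ 2
      = q ^ 30 * quartic (q ^ 121) (evenTheta (q ^ 121) 1) (oddTheta (q ^ 121) 1)
          (q ^ (a * a) * oddTheta (q ^ 121) (q ^ (11 * a)))
          (q ^ (a * a) * evenTheta (q ^ 121) (q ^ (11 * a))) := by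
  obtain ⟨v, hv⟩ := IsAlgClosed.exists_pow_nat_eq (q ^ 121) (n := 2) (by norm_num)
  have h := theta_sq_duplication (pow_121_ne_zero hq0) hv (norm_pow_121 hq)
    (x := q ^ (11 * a)) (zpow_ne_zero _ hq0)
  have e : (q ^ texp (2 * a)) ^ 2 * (q ^ (11 * a)) ^ 2 = q ^ 30 * (q ^ (a * a)) ^ 4 := by
    rw [← zpow_natCast, ← zpow_natCast, ← zpow_natCast, ← zpow_natCast, ← zpow_mul, ← zpow_mul,
      ← zpow_mul, ← zpow_add₀ hq0, ← zpow_add₀ hq0]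
    congr 1
    push_cast
    linarith [two_mul_texp (2 * a)]
  rw [quartic_homogeneous, tau, show q ^ (11 * (2 * a)) = (q ^ (11 * a)) ^ 2 by
    rw [← zpow_natCast, ← zpow_mul]; congr 1; push_cast; ring]
  linear_combination (q ^ texp (2 * a)) ^ 2 * h + quartic (q ^ 121) (evenTheta (q ^ 121) 1)
    (oddTheta (q ^ 121) 1) (oddTheta (q ^ 121) (q ^ (11 * a)))
    (evenTheta (q ^ 121) (q ^ (11 * a))) * e

lemma curveUnit_tau (hq0 : q ≠ 0) (hq : ‖q‖ < 1) {z : ℤ} (hz : Even z) {x y : ℂ}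
    (h : Coords (tau q z) (tau q (2 * z)) (tau q (3 * z)) (tau q (4 * z)) (tau q (5 * z)) x y) :
    curveUnit x y * q ^ 59 * poch (q ^ 121) (q ^ 121) ^ 12
      = tau q z ^ 5 * tau q (3 * z) ^ 2 * tau q (4 * z) ^ 3 * tau q (5 * z) ^ 2 := by
  obtain ⟨v, hv⟩ := IsAlgClosed.exists_pow_nat_eq (q ^ 121) (n := 2) (by norm_num)
  have hY0 := pow_121_ne_zero hq0
  have hY := norm_pow_121 hq
  have hj : poch (q ^ 121) (q ^ 121) ≠ 0 := poch_self_ne_zero hY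
  have r := fun a b : ℤ ↦ tau_mul_tau hq0 hq (z * a) (z * b)
  have d := fun a : ℤ ↦ poch_pow_six_mul_tau_sq hq0 hq (z * a)
  have h65 : tau q (6 * z) ^ 2 = tau q (5 * z) ^ 2 := by
    obtain ⟨w, rfl⟩ := hz
    rw [show tau q (5 * (w + w)) = -tau q (6 * (w + w)) by
      rw [← tau_neg hq0, ← tau_add_mul hq0 (5 * (w + w)) (-w)]; congr 1; ring, neg_sq]
  have key := curveUnit_eq_of_quartic (u := q ^ 30) (J := poch (q ^ 121) (q ^ 121) ^ 3)
    (Y := q ^ 121) (A := evenTheta (q ^ 121) 1) (B := oddTheta (q ^ 121) 1)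
    (X1 := q ^ ((z * 1) * (z * 1)) * oddTheta (q ^ 121) (q ^ (11 * (z * 1))))
    (Z1 := q ^ ((z * 1) * (z * 1)) * evenTheta (q ^ 121) (q ^ (11 * (z * 1))))
    (X2 := q ^ ((z * 2) * (z * 2)) * oddTheta (q ^ 121) (q ^ (11 * (z * 2))))
    (Z2 := q ^ ((z * 2) * (z * 2)) * evenTheta (q ^ 121) (q ^ (11 * (z * 2))))
    (X3 := q ^ ((z * 3) * (z * 3)) * oddTheta (q ^ 121) (q ^ (11 * (z * 3))))
    (Z3 := q ^ ((z * 3) * (z * 3)) * evenTheta (q ^ 121) (q ^ (11 * (z * 3))))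
    h (pow_ne_zero _ hq0) (pow_ne_zero _ hj)
    (by rw [← two_mul_poch_pow_six hY0 hv hY]; ring) ?_ ?_ ?_ ?_ ?_ ?_ ?_ ?_
  · refine mul_left_cancel₀ hY0 ?_
    linear_combination key
  · have := r 1 0
    simp only [← mul_add, ← mul_sub, bracket] at this
    norm_num at this ⊢
    linear_combination -this
  · have := r 2 0
    simp only [← mul_add, ← mul_sub, bracket] at this
    norm_num [mul_comm 2 z] at this ⊢
    linear_combination -this
  · have := r 3 0
    simp only [← mul_add, ← mul_sub, bracket] at this
    norm_num [mul_comm 3 z] at this ⊢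
    linear_combination -this
  · have := r 2 1
    simp only [← mul_add, ← mul_sub, bracket] at this
    norm_num [mul_comm 3 z] at this ⊢
    linear_combination -this
  · have := r 3 1
    simp only [← mul_add, ← mul_sub, bracket] at this
    norm_num [mul_comm 4 z, mul_comm 2 z] at this ⊢
    linear_combination -this
  · rw [← d 1, mul_one]; ring
  · rw [← d 2, show 2 * (z * 2) = 4 * z by ring]; ring
  · rw [← d 3, show 2 * (z * 3) = 6 * z by ring, h65]; ring

end CurveUnit

section Rearrangement

lemma tsum_int_mod (N : ℕ) [NeZero N] {f : ℤ → ℂ} (hf : Summable f) :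
    ∑' n, f n = ∑ r ∈ Finset.range N, ∑' l : ℤ, f (N * l + r) := by
  rw [← (Int.divModEquiv N).symm.tsum_eq f, ← (Equiv.prodComm _ _).tsum_eq]
  have hs : Summable fun p : Fin N × ℤ ↦ f ((Int.divModEquiv N).symm (p.2, p.1)) :=
    ((Equiv.prodComm (Fin N) ℤ).summable_iff (f := fun p ↦ f ((Int.divModEquiv N).symm p))).2
      ((Int.divModEquiv N).symm.summable_iff.2 hf)
  have := hs.tsum_prod
  simp only [Equiv.prodComm_apply, Prod.swap]
  rw [this, tsum_fintype, Finset.sum_range]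
  refine Finset.sum_congr rfl fun r _ ↦ tsum_congr fun l ↦ ?_
  rw [Int.divModEquiv]
  simp [mul_comm]

/-- The shear `(m, l) ↦ (m + c l + d, l)` of `ℤ × ℤ`. -/
def shear (c d : ℤ) : ℤ × ℤ ≃ ℤ × ℤ where
  toFun p := (p.1 + c * p.2 + d, p.2)
  invFun p := (p.1 - c * p.2 - d, p.2)
  left_inv p := by ext <;> simp only <;> ring
  right_inv p := by ext <;> simp only <;> ring

lemma summable_shear {f g : ℤ → ℂ} (hf : Summable fun n ↦ ‖f n‖) (hg : Summable fun n ↦ ‖g n‖)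
    (c d : ℤ) : Summable fun p : ℤ × ℤ ↦ f (p.1 + c * p.2 + d) * g p.2 := by
  have h := (summable_mul_of_summable_norm hf hg).comp_injective (shear c d).injective
  simpa only [Function.comp_def, shear, Equiv.coe_fn_mk] using h

lemma tsum_mul_tsum_shear {f g : ℤ → ℂ} (hf : Summable fun n ↦ ‖f n‖)
    (hg : Summable fun n ↦ ‖g n‖) (c d : ℤ) :
    (∑' n, f n) * ∑' n, g n = ∑' m, ∑' l, f (m + c * l + d) * g l := by
  rw [tsum_mul_tsum_of_summable_norm hf hg, ← (shear c d).tsum_eq fun p ↦ f p.1 * g p.2]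
  exact (summable_shear hf hg c d).tsum_prod

end Rearrangement

section Quintuple

variable {y : ℂ}

lemma poch_eq_mul_of_cube (hy : ‖y‖ < 1) (x : ℂ) :
    poch (y ^ 3) x * poch (y ^ 3) (x * y) * poch (y ^ 3) (x * y ^ 2) = poch y x := by
  have hy3 : ‖y ^ 3‖ < 1 := by
    rw [norm_pow]; exact pow_lt_one₀ (norm_nonneg _) hy three_ne_zero
  have h0 := (tendsto_fpoch hy x).comp (tendsto_id.nsmul_atTop (zero_lt_three (α := ℕ)))
  refine tendsto_nhds_unique (((tendsto_fpoch hy3 x).mul (tendsto_fpoch hy3 (x * y))).mul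
    (tendsto_fpoch hy3 (x * y ^ 2))) (h0.congr fun n ↦ ?_)
  simp only [Function.comp, id, smul_eq_mul]
  induction n with
  | zero => simp [fpoch_zero]
  | succ n ih =>
    rw [show 3 * (n + 1) = 3 * n + 1 + 1 + 1 by ring, fpoch_succ, fpoch_succ, fpoch_succ,
      fpoch_succ, fpoch_succ, fpoch_succ, ih]
    ring

lemma theta_cube_sq (hy0 : y ≠ 0) (hy : ‖y‖ < 1) : theta (y ^ 3) (y ^ 2) = poch y y := by
  have hy3 : ‖y ^ 3‖ < 1 := by
    rw [norm_pow]; exact pow_lt_one₀ (norm_nonneg _) hy three_ne_zero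
  rw [theta_eq (pow_ne_zero 3 hy0) hy3 (pow_ne_zero 2 hy0), ← poch_eq_mul_of_cube hy y,
    show y ^ 3 / y ^ 2 = y by field_simp]
  ring_nf

lemma theta_cube_self (hy0 : y ≠ 0) (hy : ‖y‖ < 1) : theta (y ^ 3) y = poch y y := by
  have hy3 : ‖y ^ 3‖ < 1 := by
    rw [norm_pow]; exact pow_lt_one₀ (norm_nonneg _) hy three_ne_zero
  rw [theta_eq (pow_ne_zero 3 hy0) hy3 hy0, ← poch_eq_mul_of_cube hy y,
    show y ^ 3 / y = y ^ 2 by field_simp]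
  ring_nf

lemma cube_tri_mul (hy0 : y ≠ 0) (n a : ℤ) :
    (y ^ 3) ^ tri n * (y ^ a) ^ n = y ^ (3 * tri n + a * n) := by
  rw [← zpow_natCast, ← zpow_mul, ← zpow_mul, ← zpow_add₀ hy0]
  rfl

lemma summable_pentagonal (hy0 : y ≠ 0) (hy : ‖y‖ < 1) :
    Summable fun n : ℤ ↦ y ^ (3 * tri n + 2 * n) := by
  have hy3 : ‖y ^ 3‖ < 1 := by
    rw [norm_pow]; exact pow_lt_one₀ (norm_nonneg _) hy three_ne_zero
  refine (summable_norm_theta (pow_ne_zero 3 hy0) hy3 (y ^ (2 : ℤ))).of_norm.congr fun n ↦ ?_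
  rw [cube_tri_mul hy0]

lemma tsum_pentagonal_congr (r c : ℤ) :
    ∑' l : ℤ, y ^ (3 * tri (2 * l + r) + 2 * (2 * l + r)) =
      ∑' l : ℤ, y ^ (3 * tri (2 * l + (r - 2 * c)) + 2 * (2 * l + (r - 2 * c))) := by
  rw [← (Equiv.subRight c).tsum_eq
    fun l : ℤ ↦ y ^ (3 * tri (2 * l + r) + 2 * (2 * l + r))]
  refine tsum_congr fun l ↦ ?_
  rw [Equiv.subRight_apply, show 2 * (l - c) + r = 2 * l + (r - 2 * c) by ring]

lemma poch_eq_even_sub_odd (hy0 : y ≠ 0) (hy : ‖y‖ < 1) :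
    poch y y = ∑' l : ℤ, y ^ (3 * tri (2 * l + 0) + 2 * (2 * l + 0))
      - ∑' l : ℤ, y ^ (3 * tri (2 * l + 1) + 2 * (2 * l + 1)) := by
  have hs := summable_pentagonal hy0 hy
  have hs' : Summable fun n : ℤ ↦ (-1) ^ n * y ^ (3 * tri n + 2 * n) :=
    .of_norm (by simpa [norm_mul, norm_neg_one_zpow] using hs.norm)
  rw [← theta_cube_sq hy0 hy, theta]
  have h := tsum_int_mod 2 hs'
  rw [Finset.sum_range_succ, Finset.sum_range_one] at h
  have e : ∀ n : ℤ, (-1 : ℂ) ^ n * ((y ^ 3) ^ tri n * (y ^ 2) ^ n)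
      = (-1) ^ n * y ^ (3 * tri n + 2 * n) := fun n ↦ by
    rw [← cube_tri_mul hy0]; rfl
  rw [tsum_congr e, h, sub_eq_add_neg, ← tsum_neg]
  congr 1
  · refine tsum_congr fun l ↦ ?_
    push_cast
    rw [add_zero, zpow_mul]; simp
  · refine tsum_congr fun l ↦ ?_
    push_cast
    rw [zpow_add₀ (by norm_num), zpow_mul]; simp

lemma pentagonal_shifted (hy0 : y ≠ 0) (hy : ‖y‖ < 1) (k : ℤ) :
    ∑' l : ℤ, y ^ (3 * tri (2 * l + -k) + 2 * (2 * l + -k))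
      - ∑' l : ℤ, y ^ (3 * tri (2 * l + (k - 1)) + 2 * (2 * l + (k - 1)))
      = (-1) ^ k * poch y y := by
  rw [poch_eq_even_sub_odd hy0 hy]
  obtain ⟨c, rfl | rfl⟩ := Int.even_or_odd' k
  · rw [tsum_pentagonal_congr (-(2 * c)) (-c), tsum_pentagonal_congr (2 * c - 1) (c - 1),
      zpow_mul]
    simp only [show -(2 * c) - 2 * -c = 0 by ring, show 2 * c - 1 - 2 * (c - 1) = 1 by ring]
    simp
  · rw [tsum_pentagonal_congr (-(2 * c + 1)) (-c - 1),
      tsum_pentagonal_congr (2 * c + 1 - 1) c, zpow_add₀ (by norm_num), zpow_mul]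
    simp only [show -(2 * c + 1) - 2 * (-c - 1) = 1 by ring, show 2 * c + 1 - 1 - 2 * c = 0 by ring]
    simp

/-- The quintuple product identity. -/
theorem quintuple (hy0 : y ≠ 0) (hy : ‖y‖ < 1) {z : ℂ} (hz : z ≠ 0) :
    poch y y * theta y (z ^ 2)
      = theta y z * (theta (y ^ 3) (y * z ^ 3) + z * theta (y ^ 3) (y * (z ^ 3)⁻¹)) := by
  have hy3 : ‖y ^ 3‖ < 1 := by
    rw [norm_pow]; exact pow_lt_one₀ (norm_nonneg _) hy three_ne_zero
  have hy30 := pow_ne_zero 3 hy0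
  have neg1 : (-1 : ℂ) ≠ 0 := by norm_num
  have hf := summable_norm_theta' hy0 hy z
  have hg := summable_norm_theta' hy30 hy3
  rw [mul_add, mul_left_comm, theta.eq_1 y (z ^ 2), theta.eq_1 y z, theta.eq_1 (y ^ 3),
    theta.eq_1 (y ^ 3),
    tsum_mul_tsum_shear hf (hg _) (-3) 0, tsum_mul_tsum_shear hf (hg _) 3 (-1),
    ← tsum_mul_left (a := z), ← Summable.tsum_add (summable_shear hf (hg _) (-3) 0).prod
      ((summable_shear hf (hg _) 3 (-1)).prod.mul_left z)]
  have hc : ∀ l : ℤ, (y ^ 3) ^ tri l * y ^ l = y ^ (3 * tri l + l) := fun l ↦ by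
    simpa using cube_tri_mul hy0 l 1
  have e1 : ∀ m l : ℤ, (-1) ^ (m + -3 * l + 0) * (y ^ tri (m + -3 * l + 0) * z ^ (m + -3 * l + 0))
      * ((-1) ^ l * ((y ^ 3) ^ tri l * (y * z ^ 3) ^ l))
      = (-1) ^ m * z ^ m * y ^ (tri (m - 3 * l) + (3 * tri l + l)) := fun m l ↦ by
    rw [mul_zpow y, ← zpow_natCast z, ← zpow_mul, zpow_add₀ hy0, ← hc, add_zero, neg_mul,
        ← sub_eq_add_neg, zpow_sub₀ neg1, zpow_sub₀ hz]
    have h3 : (-1 : ℂ) ^ l = (-1) ^ (3 * l) := by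
      rw [show 3 * l = 2 * l + l by ring, zpow_add₀ neg1, zpow_mul]; simp
    have h4 := zpow_ne_zero (3 * l) hz
    push_cast
    rw [div_eq_mul_inv]
    field_simp
    linear_combination h3
  have e2 : ∀ m l : ℤ, z * ((-1) ^ (m + 3 * l + -1) * (y ^ tri (m + 3 * l + -1) *
      z ^ (m + 3 * l + -1)) * ((-1) ^ l * ((y ^ 3) ^ tri l * (y * (z ^ 3)⁻¹) ^ l)))
      = -((-1) ^ m * z ^ m * y ^ (tri (m + 3 * l - 1) + (3 * tri l + l))) := fun m l ↦ by
    rw [mul_zpow y, ← zpow_natCast z, inv_zpow, ← zpow_mul, zpow_add₀ hy0, ← hc, ← sub_eq_add_neg,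
        zpow_sub₀ neg1, zpow_sub₀ hz,
      zpow_add₀ neg1, zpow_add₀ hz]
    have h3 : (-1 : ℂ) ^ (3 * l) * (-1) ^ l = 1 := by
      rw [← zpow_add₀ neg1, show (3 * l) + l = 2 * (2 * l) by ring, zpow_mul]; simp
    have h4 := zpow_ne_zero (3 * l) hz
    push_cast
    rw [zpow_one, zpow_one]
    field_simp
    linear_combination -h3
  have key : ∀ m : ℤ, ∑' l, (-1) ^ (m + -3 * l + 0) * (y ^ tri (m + -3 * l + 0) *
      z ^ (m + -3 * l + 0)) * ((-1) ^ l * ((y ^ 3) ^ tri l * (y * z ^ 3) ^ l))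
      + z * ∑' l, (-1) ^ (m + 3 * l + -1) * (y ^ tri (m + 3 * l + -1) *
      z ^ (m + 3 * l + -1)) * ((-1) ^ l * ((y ^ 3) ^ tri l * (y * (z ^ 3)⁻¹) ^ l))
      = (-1) ^ m * z ^ m * (∑' l : ℤ, y ^ (tri (m - 3 * l) + (3 * tri l + l))
        - ∑' l : ℤ, y ^ (tri (m + 3 * l - 1) + (3 * tri l + l))) := fun m ↦ by
    rw [← tsum_mul_left, tsum_congr (e1 m), tsum_congr (e2 m), tsum_neg, tsum_mul_left,
      tsum_mul_left]
    ring
  have hsum := ((summable_shear hf (hg (y * z ^ 3)) (-3) 0).prod).add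
      ((summable_shear hf (hg (y * (z ^ 3)⁻¹)) 3 (-1)).prod.mul_left z)
  rw [tsum_congr key]
  simp only [key] at hsum
  rw [tsum_int_mod 2 hsum, Finset.sum_range_succ, Finset.sum_range_one]
  have odd : ∀ k : ℤ, ∑' l : ℤ, y ^ (tri (2 * k + 1 - 3 * l) + (3 * tri l + l))
        = ∑' l : ℤ, y ^ (tri (2 * k + 1 + 3 * l - 1) + (3 * tri l + l)) := fun k ↦ by
    rw [← (Equiv.subRight k).tsum_eq
      fun l ↦ y ^ (tri (2 * k + 1 + 3 * l - 1) + (3 * tri l + l))]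
    refine tsum_congr fun l ↦ ?_
    rw [Equiv.subRight_apply]
    congr 1
    linarith [two_mul_tri (2 * k + 1 - 3 * l), two_mul_tri l, two_mul_tri (l - k),
      two_mul_tri (2 * k + 1 + 3 * (l - k) - 1)]
  have even : ∀ k : ℤ, ∑' l : ℤ, y ^ (tri (2 * k - 3 * l) + (3 * tri l + l))
      - ∑' l : ℤ, y ^ (tri (2 * k + 3 * l - 1) + (3 * tri l + l))
        = y ^ tri k * ((-1) ^ k * poch y y) := fun k ↦ by
    rw [← pentagonal_shifted hy0 hy, mul_sub, ← tsum_mul_left, ← tsum_mul_left]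
    congr 1
    · refine tsum_congr fun l ↦ ?_
      rw [← zpow_add₀ hy0]
      congr 1
      linarith [two_mul_tri (2 * k - 3 * l), two_mul_tri l, two_mul_tri k,
        two_mul_tri (2 * l + -k)]
    · refine tsum_congr fun l ↦ ?_
      rw [← zpow_add₀ hy0]
      congr 1
      linarith [two_mul_tri (2 * k + 3 * l - 1), two_mul_tri l, two_mul_tri k,
        two_mul_tri (2 * l + (k - 1))]
  push_cast
  simp only [odd, add_zero, even, sub_self, mul_zero, tsum_zero]
  rw [← tsum_mul_left]
  refine tsum_congr fun k ↦ ?_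
  rw [← zpow_natCast z, ← zpow_mul, zpow_mul (-1 : ℂ)]
  push_cast
  norm_num
  ring

end Quintuple

section EulerDissection

variable {q : ℂ}

/-- The components of the dissection of the pentagonal series modulo eleven. -/
noncomputable def eulerPart (q : ℂ) (k : ℤ) : ℂ :=
  (-1) ^ k * q ^ (3 * tri (k - 2) + 2 * (k - 2)) * theta ((q ^ 121) ^ 3) (q ^ (121 + 33 * k))

lemma eulerPart_add (hq0 : q ≠ 0) (k : ℤ) : eulerPart q (k + 11) = eulerPart q k := by
  have h := theta_mul_self (y := (q ^ 121) ^ 3) (by simp [hq0])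
    (zpow_ne_zero (121 + 33 * k) hq0)
  have e : q ^ (121 + 33 * (k + 11)) = q ^ (121 + 33 * k) * (q ^ 121) ^ 3 := by
    rw [← pow_mul, ← zpow_natCast, ← zpow_add₀ hq0]; congr 1; push_cast; ring
  have e2 : 3 * tri (k + 11 - 2) + 2 * (k + 11 - 2)
      = 3 * tri (k - 2) + 2 * (k - 2) + (121 + 33 * k) := by
    linarith [two_mul_tri (k + 11 - 2), two_mul_tri (k - 2)]
  rw [eulerPart, eulerPart, e, e2, zpow_add₀ hq0 _ (121 + 33 * k), zpow_add₀ (by norm_num)]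
  norm_num
  linear_combination -(-1) ^ k * q ^ (3 * tri (k - 2) + 2 * (k - 2)) * h

lemma eulerPart_add_neg (hq0 : q ≠ 0) (hq : ‖q‖ < 1) {k : ℤ} (hk : ¬ (11 : ℤ) ∣ k) :
    eulerPart q k + eulerPart q (-k)
      = q ^ 5 * poch (q ^ 121) (q ^ 121) * ((-1) ^ k * (tau q (2 * k) / tau q k)) := by
  have hY0 := pow_121_ne_zero hq0
  have h := quintuple hY0 (norm_pow_121 hq) (zpow_ne_zero (11 * k) hq0)
  have ht : theta (q ^ 121) (q ^ (11 * k)) ≠ 0 := by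
    have := tau_ne_zero hq0 hq hk
    rw [tau] at this
    exact right_ne_zero_of_mul this
  have e1 : q ^ 121 * (q ^ (11 * k)) ^ 3 = q ^ (121 + 33 * k) := by
    rw [← zpow_natCast, ← zpow_natCast, ← zpow_mul, ← zpow_add₀ hq0]; congr 1; push_cast; ring
  have e2 : q ^ 121 * ((q ^ (11 * k)) ^ 3)⁻¹ = q ^ (121 + 33 * -k) := by
    rw [← zpow_natCast, ← zpow_natCast, ← zpow_mul, ← zpow_neg, ← zpow_add₀ hq0]
    congr 1; push_cast; ring
  have e3 : 3 * tri (-k - 2) + 2 * (-k - 2) = 3 * tri (k - 2) + 2 * (k - 2) + 11 * k := by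
    linarith [two_mul_tri (-k - 2), two_mul_tri (k - 2)]
  have e4 : q ^ 5 * q ^ texp (2 * k) = q ^ texp k * q ^ (3 * tri (k - 2) + 2 * (k - 2)) := by
    rw [← zpow_natCast, ← zpow_add₀ hq0, ← zpow_add₀ hq0]; congr 1; push_cast
    linarith [two_mul_texp (2 * k), two_mul_texp k, two_mul_tri (k - 2)]
  have e5 : (-1 : ℂ) ^ (-k) = (-1) ^ k := by rw [zpow_neg, ← inv_zpow]; norm_num
  have e6 : q ^ (11 * (2 * k)) = (q ^ (11 * k)) ^ 2 := by
    rw [← zpow_natCast, ← zpow_mul]; congr 1; push_cast; ring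
  rw [e1, e2] at h
  rw [eulerPart, eulerPart, e3, e5, zpow_add₀ hq0 _ (11 * k), tau, tau, e6]
  have := zpow_ne_zero (texp k) hq0
  generalize theta ((q ^ 121) ^ 3) (q ^ (121 + 33 * k)) = t₁ at *
  generalize theta ((q ^ 121) ^ 3) (q ^ (121 + 33 * -k)) = t₂ at *
  field_simp
  linear_combination -q ^ texp k * q ^ (3 * tri (k - 2) + 2 * (k - 2)) * h
    - poch (q ^ 121) (q ^ 121) * theta (q ^ 121) ((q ^ (11 * k)) ^ 2) * e4

lemma eulerPart_zero (hq0 : q ≠ 0) (hq : ‖q‖ < 1) :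
    eulerPart q 0 = q ^ 5 * poch (q ^ 121) (q ^ 121) := by
  rw [eulerPart, ← theta_cube_self (pow_121_ne_zero hq0) (norm_pow_121 hq)]
  norm_num [show tri (-2) = 3 from rfl]

lemma poch_eq_sum_eulerPart (hq0 : q ≠ 0) (hq : ‖q‖ < 1) :
    poch q q = ∑ r ∈ Finset.range 11, eulerPart q (r + 2) := by
  have hq3 : ‖q ^ 3‖ < 1 := by
    rw [norm_pow]; exact pow_lt_one₀ (norm_nonneg _) hq three_ne_zero
  rw [← theta_cube_sq hq0 hq, theta, tsum_int_mod 11 (summable_theta (pow_ne_zero 3 hq0) hq3 _)]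
  refine Finset.sum_congr rfl fun r _ ↦ ?_
  rw [eulerPart, theta, ← tsum_mul_left]
  refine tsum_congr fun l ↦ ?_
  have e : q ^ (3 * tri ((11 : ℕ) * l + r) + 2 * ((11 : ℕ) * l + r))
      = q ^ (3 * tri (r + 2 - 2) + 2 * (r + 2 - 2 : ℤ))
        * (((q ^ 121) ^ 3) ^ tri l * (q ^ (121 + 33 * (r + 2 : ℤ))) ^ l) := by
    rw [← pow_mul, ← zpow_natCast, ← zpow_mul, ← zpow_mul, ← zpow_add₀ hq0, ← zpow_add₀ hq0]
    congr 1
    push_cast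
    rw [add_sub_cancel_right]
    linarith [two_mul_tri (11 * l + r), two_mul_tri r, two_mul_tri l]
  have e2 : (-1 : ℂ) ^ ((11 : ℕ) * l + r : ℤ) = (-1) ^ (r + 2 : ℤ) * (-1) ^ l := by
    rw [← zpow_add₀ (by norm_num)]
    rw [show ((11 : ℕ) * l + r : ℤ) = r + 2 + l + 2 * (5 * l - 1) by push_cast; ring,
      zpow_add₀ (by norm_num) _ (2 * _), zpow_mul]
    simp
  have e3 := cube_tri_mul hq0 ((11 : ℕ) * l + r) 2
  rw [← e3, zpow_ofNat q 2] at e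
  rw [e2, mul_assoc, e]
  ring

/-- The pentagonal series divided by its component in `ℂ⟦q¹¹⟧`, in terms of theta quotients. -/
noncomputable def eulerQuot (s1 s2 s3 s4 s5 : ℂ) : ℂ :=
  1 + s2 / s1 + s4 / s2 - s5 / s3 - s3 / s4 - s1 / s5

lemma poch_eq_eulerQuot (hq0 : q ≠ 0) (hq : ‖q‖ < 1) :
    poch q q = q ^ 5 * poch (q ^ 121) (q ^ 121)
      * eulerQuot (tau q 2) (tau q 4) (tau q 5) (tau q 3) (tau q 1) := by
  have p := fun k : ℤ ↦ eulerPart_add hq0 k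
  have t : ∀ k l : ℤ, k + l = 11 → tau q k = tau q l := fun k l h ↦ by
    rw [show k = -l + 11 by omega, tau_add hq0, tau_neg hq0, neg_neg]
  have d := fun {k : ℤ} (hk) ↦ eulerPart_add_neg hq0 hq (k := k) hk
  have d1 := d (k := 1) (by norm_num)
  have d2 := d (k := 2) (by norm_num)
  have d3 := d (k := 3) (by norm_num)
  have d4 := d (k := 4) (by norm_num)
  have d5 := d (k := 5) (by norm_num)
  have p0 := p 0
  have p1 := p 1
  have p2 := p (-1)
  have p3 := p (-2)
  have p4 := p (-3)
  have p5 := p (-4)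
  have p6 := p (-5)
  rw [poch_eq_sum_eulerPart hq0 hq, eulerQuot]
  simp only [Finset.sum_range_succ, Finset.sum_range_zero]
  norm_num at *
  rw [p1, p2, p3, p4, p5, p6, p0, eulerPart_zero hq0 hq]
  have t6 := t 6 5 (by norm_num)
  have t8 := t 8 3 (by norm_num)
  have t10 := t 10 1 (by norm_num)
  rw [t6] at d3
  rw [t8] at d4
  rw [t10] at d5
  linear_combination d1 + d2 + d3 + d4 + d5

end EulerDissection

section PartialFractions

lemma prod_Ico_zero_natCast (f : ℤ → ℂ) (b : ℕ) :
    ∏ k ∈ Finset.Ico (0 : ℤ) b, f k = ∏ k ∈ Finset.range b, f k := by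
  induction b with
  | zero => simp
  | succ b ih =>
    rw [Finset.prod_range_succ, ← ih, Nat.cast_succ,
      ← Finset.insert_Ico_right_eq_Ico_add_one (by positivity), Finset.prod_insert (by simp),
      mul_comm]

lemma prod_Ico_neg_natCast {y u : ℂ} (hy0 : y ≠ 0) (hu : u ≠ 0) (a : ℕ) :
    ∏ k ∈ Finset.Ico (-(a : ℤ)) 0, (1 - u * y ^ k)
      = (-u) ^ (a : ℤ) * y ^ (-tri (a + 1)) * fpoch y (y / u) a := by
  induction a with
  | zero => simp [fpoch_zero, tri]
  | succ a ih =>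
    have h : Finset.Ico (-((a + 1 : ℕ) : ℤ)) 0
        = insert (-((a + 1 : ℕ) : ℤ)) (Finset.Ico (-(a : ℤ)) 0) := by
      ext k
      simp only [Finset.mem_Ico, Finset.mem_insert]
      push_cast
      omega
    rw [h, Finset.prod_insert (by simp), ih, fpoch_succ, Nat.cast_succ, tri_add_one (a + 1),
      neg_add (tri _), zpow_add₀ hy0, zpow_add_one₀ (neg_ne_zero.2 hu), zpow_neg y (a + 1),
      zpow_add_one₀ hy0, zpow_natCast]
    field_simp
    ring

lemma prod_Ico_one_sub {y u : ℂ} (hy0 : y ≠ 0) (hu : u ≠ 0) (a b : ℕ) :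
    ∏ k ∈ Finset.Ico (-(a : ℤ)) b, (1 - u * y ^ k)
      = (-u) ^ (a : ℤ) * y ^ (-tri (a + 1)) * (fpoch y u b * fpoch y (y / u) a) := by
  rw [← Finset.Ico_union_Ico_eq_Ico (show -(a : ℤ) ≤ 0 by simp) (show (0 : ℤ) ≤ b by simp),
    Finset.prod_union (Finset.Ico_disjoint_Ico_consecutive _ _ _), prod_Ico_neg_natCast hy0 hu,
        prod_Ico_zero_natCast]
  simp only [zpow_natCast, fpoch]
  ring

lemma prod_Ico_erase_one_sub {y : ℂ} (hy0 : y ≠ 0) (a b : ℕ) :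
    ∏ k ∈ (Finset.Ico (-(a : ℤ)) (b + 1 : ℕ)).erase 0, (1 - y ^ k)
      = (-1) ^ (a : ℤ) * y ^ (-tri (a + 1)) * (fpoch y y b * fpoch y y a) := by
  have h : (Finset.Ico (-(a : ℤ)) (b + 1 : ℕ)).erase 0
      = Finset.Ico (-(a : ℤ)) 0 ∪ (Finset.Ico (0 : ℤ) b).map (addRightEmbedding 1) := by
    ext k
    simp only [Finset.mem_erase, Finset.mem_Ico, Finset.mem_union, Finset.mem_map,
      addRightEmbedding_apply]
    push_cast
    constructor
    · intro hk
      by_cases hk0 : k < 0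
      · left; omega
      · right; exact ⟨k - 1, by omega, by omega⟩
    · rintro (hk | ⟨j, hj, rfl⟩) <;> omega
  have hd : Disjoint (Finset.Ico (-(a : ℤ)) 0)
      ((Finset.Ico (0 : ℤ) b).map (addRightEmbedding 1)) := by
    rw [Finset.disjoint_left]
    intro k hk hk'
    simp only [Finset.mem_map, Finset.mem_Ico, addRightEmbedding_apply] at hk hk'
    obtain ⟨j, hj, rfl⟩ := hk'
    omega
  have h1 := prod_Ico_neg_natCast hy0 one_ne_zero a
  simp only [one_mul, div_one] at h1
  rw [h, Finset.prod_union hd, h1, Finset.prod_map, mul_assoc, mul_assoc, mul_assoc,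
    mul_comm (fpoch y y b)]
  congr 3
  simp only [addRightEmbedding_apply]
  rw [prod_Ico_zero_natCast (fun k ↦ 1 - y ^ (k + 1))]
  refine Finset.prod_congr rfl fun k _ ↦ ?_
  rw [zpow_add_one₀ hy0, zpow_natCast, mul_comm]

lemma prod_Ico_shift (f : ℤ → ℂ) (N n : ℤ) :
    ∏ k ∈ Finset.Ico (-N) N, f k = ∏ k ∈ Finset.Ico (-(N + n)) (N - n), f (k + n) := by
  have h : Finset.Ico (-N) N = (Finset.Ico (-(N + n)) (N - n)).map (addRightEmbedding n) := by
    rw [Finset.map_add_right_Ico]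
    congr 1 <;> ring
  rw [h, Finset.prod_map]
  rfl

/-- Partial fractions of `z ^ m / ∏ (z - v i)`, evaluated at `z = 1`. -/
lemma one_eq_prod_mul_sum {ι : Type*} [DecidableEq ι] (s : Finset ι) (v : ι → ℂ) (m : ℕ)
    (hm : m < s.card) (hv : Set.InjOn v s) (h1 : ∀ i ∈ s, v i ≠ 1) :
    1 = (∏ i ∈ s, (1 - v i))
      * ∑ i ∈ s, v i ^ m / ((1 - v i) * ∏ j ∈ s.erase i, (v i - v j)) := by
  have h := Lagrange.eq_interpolate hv (f := (Polynomial.X ^ m : Polynomial ℂ))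
    (by simpa using hm)
  have h2 := congrArg (Polynomial.eval 1) h
  rw [Lagrange.eval_interpolate_not_at_node _ (fun i hi ↦ (h1 i hi).symm)] at h2
  simp only [Polynomial.eval_pow, Polynomial.eval_X, one_pow, Lagrange.eval_nodal,
    Lagrange.nodalWeight] at h2
  refine h2.trans ?_
  congr 1
  refine Finset.sum_congr rfl fun i _ ↦ ?_
  rw [Finset.prod_inv_distrib]
  field_simp

lemma prod_erase_pair {ι κ : Type*} [DecidableEq ι] [DecidableEq κ] (s : Finset ι) (t : Finset κ)
    (F : ι × κ → ℂ) {e : ι} {n : κ} (he : e ∈ s) :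
    ∏ j ∈ (s ×ˢ t).erase (e, n), F j
      = (∏ k ∈ t.erase n, F (e, k)) * ∏ f ∈ s.erase e, ∏ k ∈ t, F (f, k) := by
  have h : (s ×ˢ t).erase (e, n) = ({e} ×ˢ t.erase n) ∪ ((s.erase e) ×ˢ t) := by
    ext ⟨f, k⟩
    simp only [Finset.mem_erase, Finset.mem_product, Finset.mem_union, Finset.mem_singleton,
      Prod.mk.injEq, ne_eq]
    by_cases hf : f = e
    · subst hf; simp [he]
    · simp [hf]
  have hd : Disjoint ({e} ×ˢ t.erase n) ((s.erase e) ×ˢ t) := by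
    rw [Finset.disjoint_left]
    rintro ⟨f, k⟩ h1 h2
    simp only [Finset.mem_erase, Finset.mem_product, Finset.mem_singleton] at h1 h2
    exact h2.1.1 h1.1
  rw [h, Finset.prod_union hd, Finset.prod_product, Finset.prod_product, Finset.prod_singleton]

lemma prod_node_erase {y : ℂ} (hy0 : y ≠ 0) (x : ℂ) {N : ℕ} {n : ℤ}
    (hn : n ∈ Finset.Ico (-(N : ℤ)) N) :
    ∏ k ∈ (Finset.Ico (-(N : ℤ)) N).erase n, (x * y ^ n - x * y ^ k)
      = (x * y ^ n) ^ (2 * N - 1 : ℤ) * ((-1) ^ (N + n) * y ^ (-tri (N + n + 1))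
        * (fpoch y y (N - n - 1).toNat * fpoch y y (N + n).toNat)) := by
  rw [Finset.mem_Ico] at hn
  obtain ⟨a, ha⟩ := Int.eq_ofNat_of_zero_le (show (0 : ℤ) ≤ N + n by omega)
  obtain ⟨b, hb⟩ := Int.eq_ofNat_of_zero_le (show (0 : ℤ) ≤ N - n - 1 by omega)
  have h : (Finset.Ico (-(N : ℤ)) N).erase n
      = ((Finset.Ico (-(a : ℤ)) (b + 1 : ℕ)).erase 0).map (addRightEmbedding n) := by
    ext k
    simp only [Finset.mem_erase, Finset.mem_Ico, Finset.mem_map, addRightEmbedding_apply]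
    push_cast
    constructor
    · intro hk
      exact ⟨k - n, by omega, by omega⟩
    · rintro ⟨j, hj, rfl⟩; omega
  have hc : ((Finset.Ico (-(a : ℤ)) (b + 1 : ℕ)).erase 0).card = a + b := by
    rw [Finset.card_erase_of_mem (by simp), Int.card_Ico]
    omega
  have hN : (2 * N - 1 : ℤ) = (a + b : ℕ) := by push_cast; omega
  rw [h, Finset.prod_map, ha, hb, Int.toNat_natCast, Int.toNat_natCast,
    ← prod_Ico_erase_one_sub hy0, hN, zpow_natCast, ← hc, ← Finset.prod_const,
    ← Finset.prod_mul_distrib]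
  refine Finset.prod_congr rfl fun k _ ↦ ?_
  rw [addRightEmbedding_apply, zpow_add₀ hy0]
  ring

lemma prod_node_ne {y : ℂ} (hy0 : y ≠ 0) {x w : ℂ} (hx : x ≠ 0) (hw : w ≠ 0) {N : ℕ} {n : ℤ}
    (hn : n ∈ Finset.Ico (-(N : ℤ)) N) :
    ∏ k ∈ Finset.Ico (-(N : ℤ)) N, (x * y ^ n - w * y ^ k)
      = (x * y ^ n) ^ (2 * N : ℤ) * ((-1) ^ (N + n) * (w / x) ^ (N + n) * y ^ (-tri (N + n + 1))
        * (fpoch y (w / x) (N - n).toNat * fpoch y (y / (w / x)) (N + n).toNat)) := by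
  rw [Finset.mem_Ico] at hn
  obtain ⟨a, ha⟩ := Int.eq_ofNat_of_zero_le (show (0 : ℤ) ≤ N + n by omega)
  obtain ⟨b, hb⟩ := Int.eq_ofNat_of_zero_le (show (0 : ℤ) ≤ N - n by omega)
  have hN : (2 * N : ℤ) = (2 * N : ℕ) := by push_cast; rfl
  have hc : (Finset.Ico (-(a : ℤ)) b).card = 2 * N := by
    rw [Int.card_Ico]
    omega
  rw [prod_Ico_shift _ N n, ha, hb, Int.toNat_natCast, Int.toNat_natCast, ← mul_zpow, neg_one_mul,
    ← prod_Ico_one_sub hy0 (div_ne_zero hw hx), hN, zpow_natCast, ← hc, ← Finset.prod_const,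
    ← Finset.prod_mul_distrib]
  refine Finset.prod_congr rfl fun k _ ↦ ?_
  rw [zpow_add₀ hy0]
  field_simp

/-- The `n`-th summand attached to the node `x e` in the finite partial fraction identity, without
the exponential factors. -/
noncomputable def nodeFactor (y : ℂ) (x : Fin 3 → ℂ) (e : Fin 3) (a b c : ℕ) : ℂ :=
  (fpoch y y a * fpoch y y c)⁻¹ * ∏ f ∈ Finset.univ.erase e,
    (fpoch y (x f / x e) b * fpoch y (y / (x f / x e)) c)⁻¹

lemma finite_partial_fractions {y : ℂ} (hy0 : y ≠ 0) (hy : ‖y‖ < 1) {x : Fin 3 → ℂ}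
    (hx : ∀ e, x e ≠ 0) (hx1 : ∀ e, ∀ n : ℤ, x e * y ^ n ≠ 1)
    (hxx : ∀ e f, e ≠ f → ∀ n : ℤ, x f ≠ x e * y ^ n) {N : ℕ} (hN : N ≠ 0) :
    1 = (∏ e, fpoch y (x e) N * fpoch y (y / x e) N)
      * ∑ e, ∑ n ∈ Finset.Ico (-(N : ℤ)) N,
        (-1) ^ n * y ^ (3 * tri (n + 1)) * (x e ^ 3 / ∏ f, x f) ^ n / (1 - x e * y ^ n)
        * nodeFactor y x e (N - n - 1).toNat (N - n).toNat (N + n).toNat := by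
  have hX : (∏ f, x f) ≠ 0 := Finset.prod_ne_zero_iff.2 fun e _ ↦ hx e
  set v : Fin 3 × ℤ → ℂ := fun i ↦ x i.1 * y ^ i.2 with hv
  have hinj : Set.InjOn v (Finset.univ ×ˢ Finset.Ico (-(N : ℤ)) N : Finset (Fin 3 × ℤ)) := by
    rintro ⟨e, n⟩ - ⟨f, k⟩ - h
    simp only [hv] at h
    by_cases hef : e = f
    · subst hef
      rw [mul_right_inj' (hx e)] at h
      rw [zpow_injective_of_norm hy0 hy h]
    · refine absurd ?_ (hxx e f hef (n - k))
      rw [zpow_sub₀ hy0, mul_div_assoc', h, mul_div_cancel_right₀ _ (zpow_ne_zero _ hy0)]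
  have h := one_eq_prod_mul_sum (Finset.univ ×ˢ Finset.Ico (-(N : ℤ)) N) v (3 * N - 1)
    (by simp; omega) hinj (fun i _ ↦ hx1 _ _)
  rw [Finset.prod_product, Finset.sum_product] at h
  refine h.trans ?_
  have hP : ∏ e, ∏ k ∈ Finset.Ico (-(N : ℤ)) N, (1 - v (e, k))
      = (-1) ^ (N : ℤ) * (∏ e, x e) ^ (N : ℤ) * y ^ (-3 * tri (N + 1))
        * ∏ e, fpoch y (x e) N * fpoch y (y / x e) N := by
    simp only [hv, prod_Ico_one_sub hy0 (hx _), Finset.prod_mul_distrib, Finset.prod_const,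
      Finset.card_univ, Fintype.card_fin, Finset.prod_zpow]
    have h3 : (∏ i, -x i) = -∏ i, x i := by simp [Fin.prod_univ_three]
    rw [h3, neg_eq_neg_one_mul (∏ i, x i), mul_zpow, ← zpow_natCast (y ^ _), ← zpow_mul]
    congr 3
    push_cast
    ring
  rw [hP, mul_comm _ (∏ e, fpoch y (x e) N * fpoch y (y / x e) N), mul_assoc, Finset.mul_sum]
  congr 1
  refine Finset.sum_congr rfl fun e _ ↦ ?_
  rw [Finset.mul_sum]
  refine Finset.sum_congr rfl fun n hn ↦ ?_
  have hxe := hx e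
  have hr : ∏ f ∈ Finset.univ.erase e, x f / x e = (x e ^ 3 / ∏ f, x f)⁻¹ := by
    rw [Finset.prod_div_distrib, Finset.prod_const, Finset.card_erase_of_mem (Finset.mem_univ e),
      ← Finset.mul_prod_erase _ x (Finset.mem_univ e)]
    simp only [Finset.card_univ, Fintype.card_fin]
    have h0 : ∏ f ∈ Finset.univ.erase e, x f ≠ 0 := Finset.prod_ne_zero_iff.2 fun e _ ↦ hx e
    field_simp
  have hr' : ∏ f ∈ Finset.univ.erase e, (x f / x e) ^ (N + n)
      = (x e ^ 3 / ∏ f, x f)⁻¹ ^ (N + n) := by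
    rw [Finset.prod_zpow, hr]
  have hE : ∏ j ∈ (Finset.univ ×ˢ Finset.Ico (-(N : ℤ)) N).erase (e, n), (v (e, n) - v j)
      = (x e * y ^ n) ^ (6 * N - 1 : ℤ) * ((-1) ^ (N + n) * (x e ^ 3 / ∏ f, x f) ^ (-(N + n))
        * y ^ (-3 * tri (N + n + 1)))
        * (nodeFactor y x e (N - n - 1).toNat (N - n).toNat (N + n).toNat)⁻¹ := by
    rw [prod_erase_pair _ _ _ (Finset.mem_univ e)]
    simp only [hv]
    rw [prod_node_erase hy0 _ hn]
    simp only [prod_node_ne hy0 (hx e) (hx _) hn]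
    rw [Finset.prod_mul_distrib, Finset.prod_mul_distrib, Finset.prod_mul_distrib,
      Finset.prod_mul_distrib, hr', nodeFactor]
    simp only [Finset.prod_const, Finset.card_erase_of_mem (Finset.mem_univ e), Finset.card_univ,
      Fintype.card_fin, Finset.prod_inv_distrib]
    have e1 : (x e * y ^ n) ^ (6 * N - 1 : ℤ)
        = (x e * y ^ n) ^ (2 * N - 1 : ℤ) * ((x e * y ^ n) ^ (2 * N : ℤ)) ^ (3 - 1) := by
      rw [← zpow_natCast, ← zpow_mul, ← zpow_add₀ (mul_ne_zero hxe (zpow_ne_zero _ hy0))]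
      congr 1
      push_cast
      ring
    have e2 : y ^ (-3 * tri (N + n + 1))
        = y ^ (-tri (N + n + 1)) * (y ^ (-tri (N + n + 1))) ^ (3 - 1) := by
      rw [← zpow_natCast, ← zpow_mul, ← zpow_add₀ hy0]
      congr 1
      push_cast
      ring
    have e3 : (((-1 : ℂ) ^ (N + n)) ^ (3 - 1)) = 1 := by
      rw [← zpow_natCast, ← zpow_mul, mul_comm, zpow_mul]
      norm_num
    rw [e1, e2, e3, inv_zpow', mul_inv, inv_inv, inv_inv]
    ring
  rw [hE]
  have hn' : (1 - x e * y ^ n) ≠ 0 := sub_ne_zero.2 (hx1 e n).symm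
  have hc : (x e ^ 3 / ∏ f, x f) ≠ 0 := div_ne_zero (pow_ne_zero _ hxe) hX
  have e4 : (3 * N - 1 : ℕ) = (3 * N - 1 : ℤ) := by omega
  have e5 : (x e * y ^ n) ^ (3 * N - 1) = (x e * y ^ n) ^ (6 * N - 1 : ℤ)
      * (x e ^ (-3 * N : ℤ) * y ^ (-3 * N * n : ℤ)) := by
    rw [← zpow_natCast, e4, mul_comm (-3 * N : ℤ) n, zpow_mul y n, ← mul_zpow,
      ← zpow_add₀ (mul_ne_zero hxe (zpow_ne_zero _ hy0))]
    congr 1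
    ring
  have e6 : y ^ (3 * tri (n + 1)) = y ^ (-3 * tri (N + 1)) * y ^ (-3 * N * n : ℤ)
      * (y ^ (-3 * tri (N + n + 1)))⁻¹ := by
    rw [← zpow_neg, ← zpow_add₀ hy0, ← zpow_add₀ hy0]
    congr 1
    linarith [two_mul_tri (n + 1), two_mul_tri (N + 1), two_mul_tri (N + n + 1)]
  have e7 : (x e ^ 3 / ∏ f, x f) ^ n = (∏ e, x e) ^ (N : ℤ) * x e ^ (-3 * N : ℤ)
      * ((x e ^ 3 / ∏ f, x f) ^ (-(N + n)))⁻¹ := by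
    have e8 : x e ^ (-3 * N : ℤ) = ((x e ^ 3) ^ (N : ℤ))⁻¹ := by
      rw [← zpow_natCast, ← zpow_mul, ← zpow_neg]
      congr 1
    rw [e8, zpow_neg _ (N + n : ℤ), inv_inv, zpow_add₀ hc, div_zpow _ _ (N : ℤ)]
    generalize (x e ^ 3 / ∏ f, x f) ^ n = c
    field_simp
  have e9 : (-1 : ℂ) ^ n = (-1) ^ (N : ℤ) * ((-1) ^ (N + n))⁻¹ := by
    rw [← zpow_neg, ← zpow_add₀ (by norm_num), neg_add, add_neg_cancel_left, zpow_neg,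
      ← inv_zpow]
    norm_num
  rw [e5, e6, e7, e9]
  have h0 : (x e * y ^ n) ^ (6 * N - 1 : ℤ) ≠ 0 :=
    zpow_ne_zero _ (mul_ne_zero hxe (zpow_ne_zero _ hy0))
  generalize (x e * y ^ n) ^ (6 * N - 1 : ℤ) = A at h0 ⊢
  simp only [div_eq_mul_inv, mul_inv, inv_inv, hv]
  field_simp

end PartialFractions

section AppellSums

lemma tendsto_sum_Ico_mul {t : ℤ → ℂ} (ht : Summable fun n ↦ ‖t n‖) {F : ℕ → ℤ → ℂ} {C : ℝ} {l : ℂ}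
    (hC : ∀ N n, ‖F N n‖ ≤ C) (hF : ∀ n, Tendsto (fun N ↦ F N n) atTop (𝓝 l)) :
    Tendsto (fun N : ℕ ↦ ∑ n ∈ Finset.Ico (-(N : ℤ)) N, t n * F N n) atTop
      (𝓝 ((∑' n, t n) * l)) := by
  have h : ∀ N : ℕ, ∑ n ∈ Finset.Ico (-(N : ℤ)) N, t n * F N n
      = ∑' n : ℤ, if n ∈ Finset.Ico (-(N : ℤ)) N then t n * F N n else 0 := by
    intro N
    rw [tsum_eq_sum (s := Finset.Ico (-(N : ℤ)) N) (fun n hn ↦ by rw [if_neg hn])]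
    exact Finset.sum_congr rfl fun n hn ↦ by rw [if_pos hn]
  simp only [h]
  rw [← tsum_mul_right]
  refine tendsto_tsum_of_dominated_convergence (bound := fun n ↦ ‖t n‖ * C) (ht.mul_right C) ?_ ?_
  · intro n
    refine Tendsto.congr' ?_ ((hF n).const_mul (t n))
    filter_upwards [eventually_ge_atTop (n.natAbs + 1)] with N hN
    rw [if_pos (by rw [Finset.mem_Ico]; omega)]
  · refine Eventually.of_forall fun N n ↦ ?_
    split_ifs
    · rw [norm_mul]
      exact mul_le_mul_of_nonneg_left (hC N n) (norm_nonneg _)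
    · rw [norm_zero]
      exact mul_nonneg (norm_nonneg _) ((norm_nonneg _).trans (hC N n))

lemma exists_norm_le_of_tendsto {f : ℕ → ℂ} {l : ℂ} (h : Tendsto f atTop (𝓝 l)) :
    ∃ C, ∀ n, ‖f n‖ ≤ C := by
  obtain ⟨C, hC⟩ := h.norm.bddAbove_range
  exact ⟨C, fun n ↦ hC ⟨n, rfl⟩⟩

lemma tendsto_fpoch_inv {y u : ℂ} (hy : ‖y‖ < 1) (h : ∀ m : ℕ, u * y ^ m ≠ 1) :
    Tendsto (fun n ↦ (fpoch y u n)⁻¹) atTop (𝓝 (poch y u)⁻¹) :=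
  (tendsto_fpoch hy u).inv₀ (poch_ne_zero hy h)

lemma tendsto_nodeFactor {y : ℂ} (hy0 : y ≠ 0) (hy : ‖y‖ < 1) {x : Fin 3 → ℂ}
    (hx : ∀ e, x e ≠ 0) (hxx : ∀ e f, e ≠ f → ∀ n : ℤ, x f ≠ x e * y ^ n) (e : Fin 3) :
    (∃ C, ∀ a b c, ‖nodeFactor y x e a b c‖ ≤ C) ∧
    ∀ n : ℤ, Tendsto (fun N : ℕ ↦ nodeFactor y x e (N - n - 1 : ℤ).toNat (N - n : ℤ).toNat
      (N + n : ℤ).toNat) atTop (𝓝 (∏ f ∈ Finset.univ.erase e, (theta y (x f / x e))⁻¹)) := by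
  have h1 : ∀ f, f ∈ Finset.univ.erase e → ∀ m : ℕ, x f / x e * y ^ m ≠ 1 := by
    intro f hf m h
    refine hxx e f (Finset.ne_of_mem_erase hf).symm (-m) ?_
    rw [zpow_neg, zpow_natCast]
    have h0 := hx e
    field_simp at h ⊢
    exact h
  have h2 : ∀ f, f ∈ Finset.univ.erase e → ∀ m : ℕ, y / (x f / x e) * y ^ m ≠ 1 := by
    intro f hf m h
    refine hxx e f (Finset.ne_of_mem_erase hf).symm (m + 1 : ℕ) ?_
    rw [zpow_natCast]
    have h0 := hx e
    have h0 := hx f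
    field_simp at h
    rw [pow_succ', ← h]
    ring
  obtain ⟨C0, hC0⟩ := exists_norm_le_of_tendsto
      (tendsto_fpoch_inv hy (pow_ne_one_of_norm_lt_one hy))
  have hl : (∏ f ∈ Finset.univ.erase e, (theta y (x f / x e))⁻¹)
      = (poch y y * poch y y)⁻¹ * ∏ f ∈ Finset.univ.erase e,
        (poch y (x f / x e) * poch y (y / (x f / x e)))⁻¹ := by
    simp only [theta_eq hy0 hy (div_ne_zero (hx _) (hx e)), mul_assoc (poch y y), mul_inv,
      Finset.prod_mul_distrib, Finset.prod_const, Finset.card_erase_of_mem (Finset.mem_univ e),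
      Finset.card_univ, Fintype.card_fin]
    ring
  constructor
  · have h3 : ∀ f ∈ Finset.univ.erase e, ∃ C, ∀ b c,
        ‖(fpoch y (x f / x e) b * fpoch y (y / (x f / x e)) c)⁻¹‖ ≤ C := by
      intro f hf
      obtain ⟨C1, hC1⟩ := exists_norm_le_of_tendsto (tendsto_fpoch_inv hy (h1 f hf))
      obtain ⟨C2, hC2⟩ := exists_norm_le_of_tendsto (tendsto_fpoch_inv hy (h2 f hf))
      refine ⟨C1 * C2, fun b c ↦ ?_⟩
      rw [mul_inv, norm_mul]
      exact mul_le_mul (hC1 b) (hC2 c) (norm_nonneg _) ((norm_nonneg _).trans (hC1 0))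
    choose! C hC using h3
    refine ⟨C0 * C0 * ∏ f ∈ Finset.univ.erase e, C f, fun a b c ↦ ?_⟩
    rw [nodeFactor, norm_mul, norm_prod, mul_inv, norm_mul]
    have hC00 := (norm_nonneg _).trans (hC0 0)
    exact mul_le_mul (mul_le_mul (hC0 a) (hC0 c) (norm_nonneg _) hC00)
      (Finset.prod_le_prod (fun _ _ ↦ norm_nonneg _) fun f hf ↦ hC f hf b c)
      (Finset.prod_nonneg fun _ _ ↦ norm_nonneg _) (mul_nonneg hC00 hC00)
  · intro n
    rw [hl]
    have ha : Tendsto (fun N : ℕ ↦ ((N : ℤ) - n - 1).toNat) atTop atTop := by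
      simpa only [sub_eq_add_neg, add_assoc] using tendsto_toNat_add (-n + -1)
    have hb : Tendsto (fun N : ℕ ↦ ((N : ℤ) - n).toNat) atTop atTop := by
      simpa only [sub_eq_add_neg] using tendsto_toNat_add (-n)
    have hc := tendsto_toNat_add n
    have hpp : ∀ u, Tendsto (fpoch y u) atTop (𝓝 (poch y u)) := tendsto_fpoch hy
    refine Tendsto.mul (Tendsto.inv₀ (((hpp _).comp ha).mul ((hpp _).comp hc))
      (mul_ne_zero (poch_self_ne_zero hy) (poch_self_ne_zero hy)))
          (tendsto_finsetProd _ fun f hf ↦ ?_)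
    exact Tendsto.inv₀ (((hpp _).comp hb).mul ((hpp _).comp hc))
      (mul_ne_zero (poch_ne_zero hy (h1 f hf)) (poch_ne_zero hy (h2 f hf)))

/-- The Appell-Lerch sum of level three. -/
noncomputable def appell (y c x : ℂ) : ℂ :=
  ∑' n : ℤ, (-1) ^ n * y ^ (3 * tri (n + 1)) * c ^ n / (1 - x * y ^ n)

lemma exists_norm_inv_one_sub_le {y x : ℂ} (hy0 : y ≠ 0) (hy : ‖y‖ < 1) (hx : x ≠ 0) :
    ∃ C, ∀ n : ℤ, ‖(1 - x * y ^ n)⁻¹‖ ≤ C := by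
  have hp := tendsto_pow_atTop_nhds_zero_of_norm_lt_one hy
  have h1 : Tendsto (fun n : ℕ ↦ (1 - x * y ^ n)⁻¹) atTop (𝓝 1) := by
    have h := (tendsto_const_nhds (x := (1 : ℂ))).sub (hp.const_mul x)
    simpa using h.inv₀ (by simp)
  have h2 : Tendsto (fun n : ℕ ↦ y ^ n * (y ^ n - x)⁻¹) atTop (𝓝 0) := by
    have h := hp.sub (tendsto_const_nhds (x := x))
    simpa using hp.mul (h.inv₀ (by simpa using hx))
  obtain ⟨C1, hC1⟩ := exists_norm_le_of_tendsto h1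
  obtain ⟨C2, hC2⟩ := exists_norm_le_of_tendsto h2
  refine ⟨max C1 C2, fun n ↦ ?_⟩
  obtain ⟨m, rfl | rfl⟩ := n.eq_nat_or_neg
  · rw [zpow_natCast]
    exact (hC1 m).trans (le_max_left _ _)
  · have h3 : (1 - x * y ^ (-(m : ℤ)))⁻¹ = y ^ m * (y ^ m - x)⁻¹ := by
      rw [← div_eq_mul_inv, ← inv_div, sub_div, div_self (pow_ne_zero _ hy0), zpow_neg,
        zpow_natCast, div_eq_mul_inv x]
    rw [h3]
    exact (hC2 m).trans (le_max_right _ _)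

lemma summable_norm_appell {y : ℂ} (hy0 : y ≠ 0) (hy : ‖y‖ < 1) (c : ℂ) {x : ℂ} (hx : x ≠ 0) :
    Summable fun n : ℤ ↦ ‖(-1) ^ n * y ^ (3 * tri (n + 1)) * c ^ n / (1 - x * y ^ n)‖ := by
  obtain ⟨C, hC⟩ := exists_norm_inv_one_sub_le hy0 hy hx
  have hy3 : ‖y ^ 3‖ < 1 := by
    rw [norm_pow]
    exact pow_lt_one₀ (norm_nonneg _) hy (by norm_num)
  have h := (summable_norm_theta (pow_ne_zero 3 hy0) hy3 (y ^ 3 * c)).mul_right C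
  refine Summable.of_nonneg_of_le (fun _ ↦ norm_nonneg _) (fun n ↦ ?_) h
  rw [div_eq_mul_inv, norm_mul]
  refine mul_le_mul (le_of_eq ?_) (hC n) (norm_nonneg _) (norm_nonneg _)
  rw [mul_assoc, norm_mul, norm_neg_one_zpow, one_mul, mul_zpow, ← mul_assoc, tri_add_one,
    ← zpow_natCast, ← zpow_mul, ← zpow_mul, ← zpow_add₀ hy0]
  push_cast
  ring_nf

lemma summable_appell {y : ℂ} (hy0 : y ≠ 0) (hy : ‖y‖ < 1) (c : ℂ) {x : ℂ} (hx : x ≠ 0) :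
    Summable fun n : ℤ ↦ (-1) ^ n * y ^ (3 * tri (n + 1)) * c ^ n / (1 - x * y ^ n) :=
  (summable_norm_appell hy0 hy c hx).of_norm

/-- A product of three reciprocal theta functions as a combination of Appell-Lerch sums. -/
theorem theta_inv_eq_sum_appell {y : ℂ} (hy0 : y ≠ 0) (hy : ‖y‖ < 1) {x : Fin 3 → ℂ}
    (hx : ∀ e, x e ≠ 0) (hx1 : ∀ e, ∀ n : ℤ, x e * y ^ n ≠ 1)
    (hxx : ∀ e f, e ≠ f → ∀ n : ℤ, x f ≠ x e * y ^ n) :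
    poch y y ^ 3 * ∏ e, (theta y (x e))⁻¹
      = ∑ e, appell y (x e ^ 3 / ∏ f, x f) (x e)
        * ∏ f ∈ Finset.univ.erase e, (theta y (x f / x e))⁻¹ := by
  have h1 : ∀ e, ∀ m : ℕ, x e * y ^ m ≠ 1 := fun e m ↦ by simpa using hx1 e m
  have h2 : ∀ e, ∀ m : ℕ, y / x e * y ^ m ≠ 1 := fun e m h ↦ by
    refine hx1 e (-(m + 1 : ℕ)) ?_
    rw [zpow_neg, zpow_natCast]
    have := hx e
    field_simp at h ⊢
    rw [← h]
    ring
  have hL : Tendsto (fun N : ℕ ↦ ∏ e, fpoch y (x e) N * fpoch y (y / x e) N) atTop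
      (𝓝 (∏ e, poch y (x e) * poch y (y / x e))) :=
    tendsto_finsetProd _ fun e _ ↦ (tendsto_fpoch hy _).mul (tendsto_fpoch hy _)
  have hR := tendsto_finsetSum (Finset.univ : Finset (Fin 3)) fun e _ ↦
    tendsto_sum_Ico_mul (summable_norm_appell hy0 hy (x e ^ 3 / ∏ f, x f) (hx e))
      (F := fun N n ↦ nodeFactor y x e (N - n - 1 : ℤ).toNat (N - n : ℤ).toNat (N + n : ℤ).toNat)
      (fun N n ↦ (tendsto_nodeFactor hy0 hy hx hxx e).1.choose_spec _ _ _)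
      (tendsto_nodeFactor hy0 hy hx hxx e).2
  have h := tendsto_nhds_unique_of_eventuallyEq (hL.mul hR) (tendsto_const_nhds (x := (1 : ℂ))) (by
    filter_upwards [eventually_ne_atTop 0] with N hN
    exact (finite_partial_fractions hy0 hy hx hx1 hxx hN).symm)
  have hne : (∏ e, poch y (x e) * poch y (y / x e)) ≠ 0 :=
    Finset.prod_ne_zero_iff.2 fun e _ ↦
      mul_ne_zero (poch_ne_zero hy (h1 e)) (poch_ne_zero hy (h2 e))
  have hj := poch_self_ne_zero hy
  have h3 : (∏ e, theta y (x e)) = poch y y ^ 3 * ∏ e, poch y (x e) * poch y (y / x e) := by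
    simp only [theta_eq hy0 hy (hx _), mul_assoc (poch y y), Finset.prod_mul_distrib,
      Finset.prod_const, Finset.card_univ, Fintype.card_fin]
  rw [Finset.prod_inv_distrib, h3]
  have h4 := eq_inv_of_mul_eq_one_right h
  rw [mul_inv, mul_inv_cancel_left₀ (pow_ne_zero _ hj), ← h4]
  rfl

end AppellSums

section LogarithmicDerivative

lemma differentiable_poch {y : ℂ} (hy : ‖y‖ < 1) : Differentiable ℂ (poch y) := by
  intro z
  have hs : IsOpen (Metric.ball (0 : ℂ) (‖z‖ + 1)) := Metric.isOpen_ball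
  have h : DifferentiableOn ℂ (fun w ↦ ∑' n, eulerCoeff y n * w ^ n)
      (Metric.ball (0 : ℂ) (‖z‖ + 1)) := by
    refine Complex.differentiableOn_tsum_of_summable_norm
      (summable_norm_euler hy ((‖z‖ + 1 : ℝ) : ℂ)) (fun n ↦ ?_) hs fun n w hw ↦ ?_
    · exact ((differentiable_id.pow n).const_mul _).differentiableOn
    · rw [norm_mul, norm_mul, norm_pow, norm_pow, Complex.norm_real, Real.norm_eq_abs,
        abs_of_nonneg (by positivity)]
      have : ‖w‖ ≤ ‖z‖ + 1 := (mem_ball_zero_iff.1 hw).le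
      gcongr
  have h2 : poch y = fun w ↦ ∑' n, eulerCoeff y n * w ^ n := funext fun w ↦ (euler hy w).symm
  rw [h2]
  exact h.differentiableAt (hs.mem_nhds (by simp))

lemma differentiableAt_theta {y x : ℂ} (hy0 : y ≠ 0) (hy : ‖y‖ < 1) (hx : x ≠ 0) :
    DifferentiableAt ℂ (theta y) x := by
  have h : DifferentiableAt ℂ (fun x ↦ poch y y * poch y x * poch y (y / x)) x := by
    refine ((differentiable_poch hy x).const_mul _).mul ?_
    exact (differentiable_poch hy _).fun_comp' x
        ((differentiableAt_const y).div differentiableAt_id hx)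
  refine h.congr_of_eventuallyEq ?_
  filter_upwards [isOpen_ne.mem_nhds hx] with w hw
  exact theta_eq hy0 hy hw

/-- The theta function divided by `1 - x`. -/
noncomputable def thetaQuot (y x : ℂ) : ℂ := poch y y * poch y (x * y) * poch y (y / x)

lemma theta_eq_thetaQuot {y x : ℂ} (hy0 : y ≠ 0) (hy : ‖y‖ < 1) (hx : x ≠ 0) :
    theta y x = (1 - x) * thetaQuot y x := by
  rw [theta_eq hy0 hy hx, poch_eq_mul hy x, thetaQuot]
  ring

lemma thetaQuot_inv {y x : ℂ} : thetaQuot y x⁻¹ = thetaQuot y x := by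
  rw [thetaQuot, thetaQuot, div_inv_eq_mul, inv_mul_eq_div, mul_comm y x]
  ring

lemma thetaQuot_one {y : ℂ} : thetaQuot y 1 = poch y y ^ 3 := by
  rw [thetaQuot, one_mul, div_one]
  ring

lemma hasDerivAt_thetaQuot_one {y : ℂ} (hy : ‖y‖ < 1) : HasDerivAt (thetaQuot y) 0 1 := by
  have h : DifferentiableAt ℂ (thetaQuot y) 1 := by
    have h1 : DifferentiableAt ℂ (fun x : ℂ ↦ poch y (x * y)) 1 :=
      (differentiable_poch hy _).fun_comp' 1 (differentiableAt_id.mul_const y)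
    have h2 : DifferentiableAt ℂ (fun x : ℂ ↦ poch y (y / x)) 1 :=
      (differentiable_poch hy _).fun_comp' 1
        ((differentiableAt_const y).div differentiableAt_id one_ne_zero)
    exact (h1.const_mul _).mul h2
  have h0 := h.hasDerivAt
  have h3 : HasDerivAt (fun x : ℂ ↦ thetaQuot y x⁻¹) (deriv (thetaQuot y) 1 * -1) 1 := by
    have h4 : HasDerivAt (fun x : ℂ ↦ x⁻¹) (-1) 1 := by simpa using hasDerivAt_inv (one_ne_zero (α := ℂ))
    have h5 : HasDerivAt (thetaQuot y) (deriv (thetaQuot y) 1) (1 : ℂ)⁻¹ := by rwa [inv_one]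
    exact h5.comp 1 h4
  replace h3 : HasDerivAt (thetaQuot y) (deriv (thetaQuot y) 1 * -1) 1 :=
    h3.congr_of_eventuallyEq (Eventually.of_forall fun x ↦ thetaQuot_inv.symm)
  have h6 : deriv (thetaQuot y) 1 = 0 := by linear_combination (1 / 2) * h0.unique h3
  rwa [h6] at h0

lemma hasDerivAt_theta_one {y : ℂ} (hy0 : y ≠ 0) (hy : ‖y‖ < 1) :
    HasDerivAt (theta y) (-poch y y ^ 3) 1 := by
  have h : HasDerivAt (fun x ↦ (1 - x) * thetaQuot y x) (-poch y y ^ 3) 1 := by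
    have h1 := ((hasDerivAt_const (1 : ℂ) (1 : ℂ)).sub (hasDerivAt_id 1)).mul
      (hasDerivAt_thetaQuot_one hy)
    exact h1.congr_deriv (by simp [thetaQuot_one])
  refine h.congr_of_eventuallyEq ?_
  filter_upwards [isOpen_ne.mem_nhds (one_ne_zero (α := ℂ))] with w hw
  exact theta_eq_thetaQuot hy0 hy hw

/-- The logarithmic derivative `x θ'(x) / θ(x)` of the theta function. -/
noncomputable def thetaLog (y x : ℂ) : ℂ := x * deriv (theta y) x / theta y x

lemma hasDerivAt_theta {y x : ℂ} (hy0 : y ≠ 0) (hy : ‖y‖ < 1) (hx : x ≠ 0) (h : theta y x ≠ 0) :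
    HasDerivAt (theta y) (thetaLog y x * theta y x / x) x := by
  have h1 : thetaLog y x * theta y x / x = deriv (theta y) x := by
    rw [thetaLog]
    field_simp
  rw [h1]
  exact (differentiableAt_theta hy0 hy hx).hasDerivAt

lemma theta_mul_self_ne_zero {y x : ℂ} (hy0 : y ≠ 0) (hx : x ≠ 0) (h : theta y x ≠ 0) :
    theta y (x * y) ≠ 0 := fun h' ↦ h (by
  have := theta_mul_self hy0 hx
  rw [h', mul_zero] at this
  exact neg_eq_zero.1 this.symm)

lemma theta_inv_ne_zero {y x : ℂ} (hx : x ≠ 0) (h : theta y x ≠ 0) : theta y x⁻¹ ≠ 0 :=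
  fun h' ↦ h (by
    have := theta_inv (y := y) hx
    rw [h', mul_zero] at this
    exact neg_eq_zero.1 this.symm)

lemma thetaLog_mul_self {y x : ℂ} (hy0 : y ≠ 0) (hy : ‖y‖ < 1) (hx : x ≠ 0) (h : theta y x ≠ 0) :
    thetaLog y (x * y) = thetaLog y x - 1 := by
  have hxy := mul_ne_zero hx hy0
  have h0 := theta_mul_self_ne_zero hy0 hx h
  have h1 := (hasDerivAt_id x).mul
    ((hasDerivAt_theta hy0 hy hxy h0).comp x ((hasDerivAt_id x).mul_const y))
  have h2 := (hasDerivAt_theta hy0 hy hx h).neg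
  have h3 := (h1.congr_of_eventuallyEq (f₁ := -theta y) (by
    filter_upwards [isOpen_ne.mem_nhds hx] with w hw
    exact (theta_mul_self hy0 hw).symm)).unique h2
  have h4 := theta_mul_self hy0 hx
  have h5 : theta y x = -(x * theta y (x * y)) := by rw [h4, neg_neg]
  simp only [id, Function.comp_apply, one_mul] at h3
  rw [h5] at h3
  field_simp at h3
  linear_combination h3

lemma thetaLog_inv {y x : ℂ} (hy0 : y ≠ 0) (hy : ‖y‖ < 1) (hx : x ≠ 0) (h : theta y x ≠ 0) :
    thetaLog y x⁻¹ = 1 - thetaLog y x := by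
  have h0 := theta_inv_ne_zero hx h
  have h1 := (hasDerivAt_id x).mul
    ((hasDerivAt_theta hy0 hy (inv_ne_zero hx) h0).comp x (hasDerivAt_inv hx))
  have h2 := (hasDerivAt_theta hy0 hy hx h).neg
  have h3 := (h1.congr_of_eventuallyEq (f₁ := -theta y) (by
    filter_upwards [isOpen_ne.mem_nhds hx] with w hw
    exact (theta_inv hw).symm)).unique h2
  have h4 := theta_inv (y := y) hx
  have h5 : theta y x = -(x * theta y x⁻¹) := by rw [h4, neg_neg]
  simp only [id, Function.comp_apply, one_mul] at h3
  rw [h5] at h3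
  generalize theta y x⁻¹ = A, thetaLog y x⁻¹ = B at h3 h0 ⊢
  field_simp at h3
  linear_combination -h3

lemma thetaLog_add_sub {y a b : ℂ} (hy0 : y ≠ 0) (hy : ‖y‖ < 1) (ha : a ≠ 0) (hb : b ≠ 0)
    (hta : theta y a ≠ 0) (hab : theta y (a * b) ≠ 0) (hab' : theta y (a / b) ≠ 0) :
    thetaLog y (a * b) + thetaLog y (a / b) - 2 * thetaLog y a
      = -poch y y ^ 3 * (a / b) * theta y (a ^ 2) * theta y b ^ 2
        / (theta y (a * b) * theta y (a / b) * theta y a ^ 2) := by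
  have key : ∀ w : ℂ, w ≠ 0 → theta y (w * a ^ 2) * theta y w * (theta y b ^ 2 * (a / b))
      = theta y (w * (a * b)) * theta y (w * (a / b)) * theta y a ^ 2
        - theta y (w * a) ^ 2 * (theta y (a * b) * theta y (a / b)) := by
    intro w hw
    have hwa := mul_ne_zero hw ha
    have e1 := theta_mul_theta hy0 hy hwa ha
    have e2 := theta_mul_theta hy0 hy hb one_ne_zero
    have e3 := theta_mul_theta hy0 hy hwa hb
    have e4 := theta_mul_theta hy0 hy ha one_ne_zero
    have e5 := theta_mul_theta hy0 hy hwa one_ne_zero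
    have e6 := theta_mul_theta hy0 hy ha hb
    rw [mul_div_cancel_right₀ _ ha, mul_assoc, ← pow_two] at e1
    rw [mul_one, div_one, ← pow_two] at e2 e4 e5
    rw [mul_assoc, mul_div_assoc] at e3
    rw [e1, e2, e3, e4, e5, e6]
    have := bracket_relation y (w * a) a b 1
    field_simp
    linear_combination this
  have hc : ∀ c : ℂ, c ≠ 0 → theta y c ≠ 0 →
      HasDerivAt (fun w ↦ theta y (w * c)) (thetaLog y c * theta y c) 1 := by
    intro c hc0 hc
    have h1 : HasDerivAt (theta y) (thetaLog y c * theta y c / c) (1 * c) := by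
      rw [one_mul]
      exact hasDerivAt_theta hy0 hy hc0 hc
    have h2 := h1.comp 1 ((hasDerivAt_id (1 : ℂ)).mul_const c)
    rw [one_mul, div_mul_cancel₀ _ hc0] at h2
    exact h2
  have hL : HasDerivAt (fun w ↦ theta y (w * a ^ 2) * theta y w * (theta y b ^ 2 * (a / b)))
      (-poch y y ^ 3 * theta y (a ^ 2) * (theta y b ^ 2 * (a / b))) 1 := by
    have h1 : HasDerivAt (fun w ↦ theta y (w * a ^ 2)) (deriv (theta y) (a ^ 2) * a ^ 2) 1 := by
      have h2 := (differentiableAt_theta hy0 hy (pow_ne_zero 2 ha)).hasDerivAt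
      rw [← one_mul (a ^ 2)] at h2
      have h3 := h2.comp 1 ((hasDerivAt_id (1 : ℂ)).mul_const (a ^ 2))
      rw [one_mul] at h3
      exact h3
    refine ((h1.mul (hasDerivAt_theta_one hy0 hy)).mul_const
      (theta y b ^ 2 * (a / b))).congr_deriv ?_
    simp only [one_mul, theta_one]
    ring
  have hR := (((hc _ (mul_ne_zero ha hb) hab).mul (hc _ (div_ne_zero ha hb) hab')).mul_const
    (theta y a ^ 2)).sub (((hc a ha hta).pow 2).mul_const (theta y (a * b) * theta y (a / b)))
  have h := hL.unique (hR.congr_of_eventuallyEq (by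
    filter_upwards [isOpen_ne.mem_nhds (one_ne_zero (α := ℂ))] with w hw
    exact key w hw))
  simp only [one_mul] at h
  rw [eq_div_iff (mul_ne_zero (mul_ne_zero hab hab') (pow_ne_zero 2 hta))]
  norm_num at h
  linear_combination -h

end LogarithmicDerivative

section AppellLimit

lemma theta_zpow {y : ℂ} (hy0 : y ≠ 0) (n : ℤ) : theta y (y ^ n) = 0 := by
  induction n with
  | zero => rw [zpow_zero, theta_one]
  | succ n ih =>
    have h := theta_mul_self hy0 (zpow_ne_zero (n : ℤ) hy0)
    rw [ih, neg_zero, ← zpow_add_one₀ hy0] at h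
    exact (mul_eq_zero.1 h).resolve_left (zpow_ne_zero _ hy0)
  | pred n ih =>
    have h := theta_mul_self hy0 (zpow_ne_zero (-(n : ℤ) - 1) hy0)
    rw [← zpow_add_one₀ hy0, sub_add_cancel, ih, mul_zero] at h
    exact neg_eq_zero.1 h.symm

lemma ne_zpow_of_theta_ne_zero {y x : ℂ} (hy0 : y ≠ 0) (h : theta y x ≠ 0) (n : ℤ) : x ≠ y ^ n :=
  fun h' ↦ h (by rw [h', theta_zpow hy0])

/-- The three-term relation between Appell-Lerch sums. -/
lemma theta_inv_eq_appell {y : ℂ} (hy0 : y ≠ 0) (hy : ‖y‖ < 1) {x₁ x₂ x₃ : ℂ}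
    (h₁ : x₁ ≠ 0) (h₂ : x₂ ≠ 0) (h₃ : x₃ ≠ 0)
    (t₁ : theta y x₁ ≠ 0) (t₂ : theta y x₂ ≠ 0) (t₃ : ∀ n : ℤ, x₃ ≠ y ^ n)
    (t₁₂ : theta y (x₂ / x₁) ≠ 0) (t₁₃ : theta y (x₁ / x₃) ≠ 0) (t₂₃ : theta y (x₂ / x₃) ≠ 0) :
    poch y y ^ 3 / (theta y x₁ * theta y x₂ * theta y x₃)
      = appell y (x₁ ^ 2 / (x₂ * x₃)) x₁ / (theta y (x₂ / x₁) * theta y (x₃ / x₁))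
      + appell y (x₂ ^ 2 / (x₁ * x₃)) x₂ / (theta y (x₁ / x₂) * theta y (x₃ / x₂))
      + appell y (x₃ ^ 2 / (x₁ * x₂)) x₃ / (theta y (x₁ / x₃) * theta y (x₂ / x₃)) := by
  have hx : ∀ e, ![x₁, x₂, x₃] e ≠ 0 := by
    intro e; fin_cases e <;> assumption
  have hne : ∀ a b : ℂ, a ≠ 0 → theta y (b / a) ≠ 0 → ∀ n : ℤ, b ≠ a * y ^ n := by
    intro a b ha h n h'
    exact ne_zpow_of_theta_ne_zero hy0 h n (by rw [h', mul_div_cancel_left₀ _ ha])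
  have hinv : ∀ a b : ℂ, a ≠ 0 → b ≠ 0 → theta y (b / a) ≠ 0 → theta y (a / b) ≠ 0 := by
    intro a b ha hb h
    rw [← inv_div]
    exact theta_inv_ne_zero (div_ne_zero hb ha) h
  have h1 : ∀ e, ∀ n : ℤ, ![x₁, x₂, x₃] e * y ^ n ≠ 1 := by
    have h : ∀ a : ℂ, (∀ n : ℤ, a ≠ y ^ n) → ∀ n : ℤ, a * y ^ n ≠ 1 := by
      intro a ha n h
      refine ha (-n) ?_
      rw [zpow_neg]
      exact eq_inv_of_mul_eq_one_left h
    intro e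
    fin_cases e
    · exact h _ (ne_zpow_of_theta_ne_zero hy0 t₁)
    · exact h _ (ne_zpow_of_theta_ne_zero hy0 t₂)
    · exact h _ t₃
  have h2 : ∀ e f, e ≠ f → ∀ n : ℤ, ![x₁, x₂, x₃] f ≠ ![x₁, x₂, x₃] e * y ^ n := by
    intro e f hef
    fin_cases e <;> fin_cases f
    · exact absurd rfl hef
    · exact hne _ _ h₁ t₁₂
    · exact hne _ _ h₁ (hinv _ _ h₃ h₁ t₁₃)
    · exact hne _ _ h₂ (hinv _ _ h₁ h₂ t₁₂)
    · exact absurd rfl hef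
    · exact hne _ _ h₂ (hinv _ _ h₃ h₂ t₂₃)
    · exact hne _ _ h₃ t₁₃
    · exact hne _ _ h₃ t₂₃
    · exact absurd rfl hef
  have h := theta_inv_eq_sum_appell hy0 hy hx h1 h2
  have u0 : (Finset.univ : Finset (Fin 3)).erase 0 = {1, 2} := by decide
  have u1 : (Finset.univ : Finset (Fin 3)).erase 1 = {0, 2} := by decide
  have u2 : (Finset.univ : Finset (Fin 3)).erase 2 = {0, 1} := by decide
  simp only [Fin.sum_univ_three, Fin.prod_univ_three, u0, u1, u2] at h
  rw [Finset.prod_pair (by decide), Finset.prod_pair (by decide), Finset.prod_pair (by decide)] at h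
  simp only [Matrix.cons_val_zero, Matrix.cons_val_one, Matrix.cons_val_two, Matrix.head_cons,
    Matrix.tail_cons] at h
  have c1 : x₁ ^ 3 / (x₁ * x₂ * x₃) = x₁ ^ 2 / (x₂ * x₃) := by field_simp
  have c2 : x₂ ^ 3 / (x₁ * x₂ * x₃) = x₂ ^ 2 / (x₁ * x₃) := by field_simp
  have c3 : x₃ ^ 3 / (x₁ * x₂ * x₃) = x₃ ^ 2 / (x₁ * x₂) := by field_simp
  rw [c1, c2, c3] at h
  simp only [div_eq_mul_inv, mul_inv] at h ⊢
  exact h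

/-- The Appell-Lerch sum at the pole `x = 1`, with the singular term omitted. -/
noncomputable def appellReg (y c x : ℂ) : ℂ :=
  ∑' n : ℤ, if n = 0 then 0 else (-1) ^ n * y ^ (3 * tri (n + 1)) * c ^ n / (1 - x * y ^ n)

lemma appell_eq_appellReg {y c x : ℂ} (hy0 : y ≠ 0) (hy : ‖y‖ < 1) (hx : x ≠ 0) :
    appell y c x = 1 / (1 - x) + appellReg y c x := by
  rw [appell, (summable_appell hy0 hy c hx).tsum_eq_add_tsum_ite 0, appellReg]
  simp [tri]

lemma norm_zpow_le {c w : ℂ} (hc : c ≠ 0) (h1 : ‖w‖ ≤ 2 * ‖c‖) (h2 : ‖c‖ / 2 ≤ ‖w‖) (n : ℤ) :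
    ‖w ^ n‖ ≤ ‖(2 * c) ^ n‖ + ‖(c / 2) ^ n‖ := by
  have hc' : 0 < ‖c‖ / 2 := by positivity
  obtain ⟨m, rfl | rfl⟩ := n.eq_nat_or_neg
  · refine le_add_of_le_of_nonneg ?_ (norm_nonneg _)
    rw [zpow_natCast, zpow_natCast, norm_pow, norm_pow, norm_mul, RCLike.norm_ofNat]
    exact pow_le_pow_left₀ (norm_nonneg _) h1 m
  · refine le_add_of_nonneg_of_le (norm_nonneg _) ?_
    rw [zpow_neg, zpow_neg, zpow_natCast, zpow_natCast, norm_inv, norm_inv, norm_pow, norm_pow,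
      norm_div, RCLike.norm_ofNat]
    exact inv_anti₀ (pow_pos hc' m) (pow_le_pow_left₀ hc'.le h2 m)

lemma tendsto_tsum_appell {y : ℂ} (hy0 : y ≠ 0) (hy : ‖y‖ < 1) {l : Filter ℂ} {c : ℂ → ℂ} {c₀ : ℂ}
    (hc₀ : c₀ ≠ 0) (hc : Tendsto c l (𝓝 c₀)) {d : ℂ → ℤ → ℂ} {d₀ : ℤ → ℂ}
    (hd : ∀ n, Tendsto (fun w ↦ d w n) l (𝓝 (d₀ n))) {C : ℝ} (hC : ∀ᶠ w in l, ∀ n, ‖d w n‖ ≤ C) :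
    Tendsto (fun w ↦ ∑' n : ℤ, (-1) ^ n * y ^ (3 * tri (n + 1)) * c w ^ n * d w n) l
      (𝓝 (∑' n : ℤ, (-1) ^ n * y ^ (3 * tri (n + 1)) * c₀ ^ n * d₀ n)) := by
  have hs : ∀ a : ℂ, Summable fun n : ℤ ↦ ‖y ^ (3 * tri (n + 1)) * a ^ n‖ := by
    intro a
    have hy3 : ‖y ^ 3‖ < 1 := by
      rw [norm_pow]
      exact pow_lt_one₀ (norm_nonneg _) hy (by norm_num)
    refine (summable_norm_theta (pow_ne_zero 3 hy0) hy3 (y ^ 3 * a)).congr fun n ↦ ?_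
    rw [mul_zpow, ← mul_assoc, tri_add_one, ← zpow_natCast, ← zpow_mul, ← zpow_mul,
      ← zpow_add₀ hy0]
    push_cast
    ring_nf
  refine tendsto_tsum_of_dominated_convergence
    (bound := fun n ↦ (‖y ^ (3 * tri (n + 1)) * (2 * c₀) ^ n‖
      + ‖y ^ (3 * tri (n + 1)) * (c₀ / 2) ^ n‖) * C) (((hs _).add (hs _)).mul_right C) ?_ ?_
  · intro n
    exact ((hc.zpow₀ n (Or.inl hc₀)).const_mul _).mul (hd n)
  · have hn := hc.norm
    have hpos : 0 < ‖c₀‖ := norm_pos_iff.2 hc₀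
    filter_upwards [hC, hn.eventually (eventually_le_nhds (show ‖c₀‖ < 2 * ‖c₀‖ by linarith)),
      hn.eventually (eventually_ge_nhds (show ‖c₀‖ / 2 < ‖c₀‖ by linarith))] with w h1 h2 h3 n
    rw [norm_mul]
    refine mul_le_mul ?_ (h1 n) (norm_nonneg _) (by positivity)
    rw [mul_assoc, norm_mul, norm_neg_one_zpow, one_mul, norm_mul, norm_mul, norm_mul, ← mul_add]
    exact mul_le_mul_of_nonneg_left (norm_zpow_le hc₀ h2 h3 n) (norm_nonneg _)

lemma tendsto_appell {y : ℂ} (hy0 : y ≠ 0) (hy : ‖y‖ < 1) {l : Filter ℂ} {c : ℂ → ℂ} {c₀ : ℂ}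
    (hc₀ : c₀ ≠ 0) (hc : Tendsto c l (𝓝 c₀)) {x : ℂ} (hx : x ≠ 0) :
    Tendsto (fun w ↦ appell y (c w) x) l (𝓝 (appell y c₀ x)) := by
  obtain ⟨C, hC⟩ := exists_norm_inv_one_sub_le hy0 hy hx
  simp only [appell, div_eq_mul_inv]
  exact tendsto_tsum_appell hy0 hy hc₀ hc (d := fun _ n ↦ (1 - x * y ^ n)⁻¹)
    (fun n ↦ tendsto_const_nhds) (Eventually.of_forall fun _ ↦ hC)

lemma tendsto_appellReg {y : ℂ} (hy0 : y ≠ 0) (hy : ‖y‖ < 1) {c : ℂ → ℂ} {c₀ : ℂ}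
    (hc₀ : c₀ ≠ 0) (hc : Tendsto c (𝓝[≠] 1) (𝓝 c₀)) :
    Tendsto (fun w ↦ appellReg y (c w) w) (𝓝[≠] 1) (𝓝 (appellReg y c₀ 1)) := by
  have e : ∀ c w, appellReg y c w = ∑' n : ℤ, (-1) ^ n * y ^ (3 * tri (n + 1)) * c ^ n
      * (if n = 0 then 0 else (1 - w * y ^ n)⁻¹) := by
    intro c w
    refine tsum_congr fun n ↦ ?_
    split_ifs
    · simp
    · rw [div_eq_mul_inv]
  simp only [e]
  have hy1 : 0 < ‖y‖ := norm_pos_iff.2 hy0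
  have hd0 : 0 < (1 - ‖y‖) / 2 := by linarith
  have hone : ∀ n : ℤ, n ≠ 0 → 1 - 1 * y ^ n ≠ 0 := by
    intro n hn h
    refine hn (zpow_injective_of_norm hy0 hy (?_ : y ^ n = y ^ (0 : ℤ)))
    rw [zpow_zero]
    linear_combination -h
  have hlim : Tendsto (fun w : ℂ ↦ w) (𝓝[≠] 1) (𝓝 1) := tendsto_id.mono_left nhdsWithin_le_nhds
  refine tendsto_tsum_appell hy0 hy hc₀ hc (C := ((1 - ‖y‖) / 2)⁻¹) (fun n ↦ ?_) ?_
  · split_ifs with hn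
    · exact tendsto_const_nhds
    · exact ((tendsto_const_nhds).sub (hlim.mul_const _)).inv₀ (hone n hn)
  · have hn := hlim.norm
    rw [norm_one] at hn
    filter_upwards [hn.eventually (eventually_le_nhds (show (1 : ℝ) < (1 + ‖y‖) / (2 * ‖y‖) by
        rw [lt_div_iff₀ (by positivity)]; linarith)),
      hn.eventually (eventually_ge_nhds (show (1 + ‖y‖) / 2 < (1 : ℝ) by linarith))] with w h1 h2 n
    split_ifs with hn
    · rw [norm_zero]
      exact (inv_pos.2 hd0).le
    · rw [norm_inv]
      refine inv_anti₀ hd0 ?_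
      rw [le_div_iff₀ (by positivity)] at h1
      rcases lt_or_gt_of_ne hn with h | h
      · have h3 : ‖y‖⁻¹ ≤ ‖y ^ n‖ := by
          rw [norm_zpow, ← zpow_neg_one]
          exact zpow_le_zpow_right_of_le_one₀ hy1 hy.le (by omega)
        have h4 : 1 ≤ ‖y ^ n‖ := le_trans ((one_le_inv₀ hy1).2 hy.le) h3
        have h5 : ‖w * y ^ n‖ - 1 ≤ ‖1 - w * y ^ n‖ := by
          have := norm_sub_norm_le (w * y ^ n) 1
          rwa [norm_one, norm_sub_rev] at this
        have h6 : (1 + ‖y‖) / 2 * ‖y‖⁻¹ ≤ ‖w * y ^ n‖ := by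
          rw [norm_mul]
          exact mul_le_mul h2 h3 (by positivity) (norm_nonneg _)
        have h7 : 1 + (1 - ‖y‖) / 2 ≤ (1 + ‖y‖) / 2 * ‖y‖⁻¹ := by
          rw [← div_eq_mul_inv, le_div_iff₀ hy1]
          nlinarith
        linarith
      · have h3 : ‖y ^ n‖ ≤ ‖y‖ := by
          rw [norm_zpow]
          calc ‖y‖ ^ n ≤ ‖y‖ ^ (1 : ℤ) := zpow_le_zpow_right_of_le_one₀ hy1 hy.le (by omega)
            _ = ‖y‖ := zpow_one _
        have h5 : 1 - ‖w * y ^ n‖ ≤ ‖1 - w * y ^ n‖ := by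
          have := norm_sub_norm_le 1 (w * y ^ n)
          rwa [norm_one] at this
        have h6 : ‖w * y ^ n‖ ≤ ‖w‖ * ‖y‖ := by
          rw [norm_mul]
          exact mul_le_mul_of_nonneg_left h3 (norm_nonneg _)
        linarith

lemma thetaQuot_ne_zero_one {y : ℂ} (hy : ‖y‖ < 1) : thetaQuot y 1 ≠ 0 := by
  rw [thetaQuot_one]
  exact pow_ne_zero _ (poch_self_ne_zero hy)

/-- The limit of the three-term relation as one of the points tends to `1`. -/
theorem thetaLog_add {y : ℂ} (hy0 : y ≠ 0) (hy : ‖y‖ < 1) {a b : ℂ} (ha : a ≠ 0) (hb : b ≠ 0)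
    (ta : theta y a ≠ 0) (tb : theta y b ≠ 0) (tab : theta y (b / a) ≠ 0) :
    thetaLog y a + thetaLog y b = appellReg y (1 / (a * b)) 1
      - a * theta y b / theta y (b / a) * appell y (a ^ 2 / b) a
      - b * theta y a / theta y (a / b) * appell y (b ^ 2 / a) b := by
  have hj := poch_self_ne_zero hy
  have tba : theta y (a / b) ≠ 0 := by
    rw [← inv_div]
    exact theta_inv_ne_zero (div_ne_zero hb ha) tab
  have hlim : Tendsto (fun w : ℂ ↦ w) (𝓝[≠] 1) (𝓝 1) := tendsto_id.mono_left nhdsWithin_le_nhds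
  have hcont : ∀ x : ℂ, x ≠ 0 → Tendsto (fun w ↦ theta y (x / w)) (𝓝[≠] 1) (𝓝 (theta y x)) := by
    intro x hx
    have h1 : Tendsto (fun w : ℂ ↦ x / w) (𝓝[≠] 1) (𝓝 x) := by
      have h := (tendsto_const_nhds (x := x)).div hlim one_ne_zero
      rw [div_one] at h
      exact h
    exact (differentiableAt_theta hy0 hy hx).continuousAt.tendsto.comp h1
  have hcont' : ∀ x : ℂ, x ≠ 0 → Tendsto (fun w ↦ theta y (w / x)) (𝓝[≠] 1)
      (𝓝 (theta y x⁻¹)) := by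
    intro x hx
    have h1 : Tendsto (fun w : ℂ ↦ w / x) (𝓝[≠] 1) (𝓝 x⁻¹) := by
      simpa using hlim.div_const x
    exact (differentiableAt_theta hy0 hy (inv_ne_zero hx)).continuousAt.tendsto.comp h1
  have hder : ∀ x : ℂ, x ≠ 0 → theta y x ≠ 0 →
      HasDerivAt (fun w ↦ theta y (x / w)) (-(thetaLog y x * theta y x)) 1 := by
    intro x hx hxt
    have h1 : HasDerivAt (theta y) (thetaLog y x * theta y x / x) (x * 1⁻¹) := by
      rw [inv_one, mul_one]
      exact hasDerivAt_theta hy0 hy hx hxt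
    have h2 := h1.comp (1 : ℂ) ((hasDerivAt_inv (one_ne_zero (α := ℂ))).const_mul x)
    have e : thetaLog y x * theta y x / x * (x * -(1 ^ 2)⁻¹) = -(thetaLog y x * theta y x) := by
      field_simp
    rw [e] at h2
    exact h2
  set G : ℂ → ℂ := fun w ↦ poch y y ^ 3 / (theta y a * theta y b) * (thetaQuot y w)⁻¹
    - (theta y (a / w) * theta y (b / w))⁻¹ with hG
  have hG1 : G 1 = 0 := by
    simp only [hG, div_one, thetaQuot_one]
    field_simp
    ring
  have hGd : HasDerivAt G (-(thetaLog y a + thetaLog y b) / (theta y a * theta y b)) 1 := by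
    have h1 := ((hasDerivAt_thetaQuot_one hy).inv (thetaQuot_ne_zero_one hy)).const_mul
      (poch y y ^ 3 / (theta y a * theta y b))
    have h2 := ((hder a ha ta).mul (hder b hb tb)).inv (by simpa using ⟨ta, tb⟩)
    have h3 : HasDerivAt G _ 1 := h1.sub h2
    refine h3.congr_deriv ?_
    simp only [div_one, Pi.mul_apply]
    field_simp
    ring
  have hslope := (hasDerivAt_iff_tendsto_slope.1 hGd)
  have hR : Tendsto (fun w ↦ -(appell y (a ^ 2 / (b * w)) a / (theta y (b / a) * theta y (w / a))
      + appell y (b ^ 2 / (a * w)) b / (theta y (a / b) * theta y (w / b))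
      + appellReg y (w ^ 2 / (a * b)) w / (theta y (a / w) * theta y (b / w)))) (𝓝[≠] 1)
      (𝓝 (-(appell y (a ^ 2 / (b * 1)) a / (theta y (b / a) * theta y a⁻¹)
      + appell y (b ^ 2 / (a * 1)) b / (theta y (a / b) * theta y b⁻¹)
      + appellReg y (1 ^ 2 / (a * b)) 1 / (theta y a * theta y b)))) := by
    refine (((Tendsto.div (tendsto_appell hy0 hy ?_ ?_ ha) (tendsto_const_nhds.mul (hcont' a ha))
      ?_).add (Tendsto.div (tendsto_appell hy0 hy ?_ ?_ hb) (tendsto_const_nhds.mul (hcont' b hb))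
      ?_)).add (Tendsto.div (tendsto_appellReg hy0 hy ?_ ?_)
          ((hcont a ha).mul (hcont b hb)) ?_)).neg
    · simp [ha, hb]
    · exact tendsto_const_nhds.div (hlim.const_mul _) (by simpa using hb)
    · exact mul_ne_zero tab (theta_inv_ne_zero ha ta)
    · simp [ha, hb]
    · exact tendsto_const_nhds.div (hlim.const_mul _) (by simpa using ha)
    · exact mul_ne_zero tba (theta_inv_ne_zero hb tb)
    · simp [ha, hb]
    · exact (hlim.pow 2).div_const _
    · exact mul_ne_zero ta tb
  have hU := tendsto_nhds_unique_of_eventuallyEq hslope hR (by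
    have hy1 : 0 < ‖y‖ := norm_pos_iff.2 hy0
    have hn := hlim.norm
    rw [norm_one] at hn
    filter_upwards [self_mem_nhdsWithin, (hcont a ha).eventually_ne ta,
      (hcont b hb).eventually_ne tb, hlim.eventually_ne one_ne_zero,
      hn.eventually (eventually_lt_nhds ((one_lt_inv₀ hy1).2 hy)),
      hn.eventually (eventually_gt_nhds hy),
      ((hasDerivAt_thetaQuot_one hy).continuousAt.tendsto.mono_left
        nhdsWithin_le_nhds).eventually_ne (thetaQuot_ne_zero_one hy)]
      with w hw h1 h2 h3 h4 h5 h6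
    have hw1 : 1 - w ≠ 0 := sub_ne_zero.2 (Ne.symm hw)
    have hwy : ∀ n : ℤ, w ≠ y ^ n := by
      intro n h
      rcases lt_trichotomy n 0 with hn0 | rfl | hn0
      · refine absurd h4 (not_lt.2 ?_)
        rw [h, norm_zpow, ← zpow_neg_one]
        exact zpow_le_zpow_right_of_le_one₀ hy1 hy.le (by omega)
      · exact hw (by rw [h, zpow_zero]; rfl)
      · refine absurd h5 (not_lt.2 ?_)
        rw [h, norm_zpow]
        calc ‖y‖ ^ n ≤ ‖y‖ ^ (1 : ℤ) := zpow_le_zpow_right_of_le_one₀ hy1 hy.le (by omega)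
          _ = ‖y‖ := zpow_one _
    have h := theta_inv_eq_appell hy0 hy ha hb h3 ta tb hwy tab h1 h2
    rw [theta_eq_thetaQuot hy0 hy h3, appell_eq_appellReg (c := w ^ 2 / (a * b)) hy0 hy h3] at h
    rw [slope_def_field, hG1, sub_zero]
    have hw2 : w - 1 ≠ 0 := sub_ne_zero.2 hw
    rw [div_eq_iff hw2]
    have h7 : G w = (1 - w) * (poch y y ^ 3 / (theta y a * theta y b * ((1 - w) * thetaQuot y w))
        - 1 / (1 - w) / (theta y (a / w) * theta y (b / w))) := by
      simp only [hG]
      field_simp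
    rw [h7, h]
    ring)
  have i1 : theta y a⁻¹ = -theta y a / a := by
    rw [eq_div_iff ha, ← theta_inv ha, mul_comm]
  have i2 : theta y b⁻¹ = -theta y b / b := by
    rw [eq_div_iff hb, ← theta_inv hb, mul_comm]
  rw [i1, i2, mul_one, mul_one, one_pow, div_eq_iff (mul_ne_zero ta tb)] at hU
  generalize appell y (a ^ 2 / b) a = A, appell y (b ^ 2 / a) b = B,
    appellReg y (1 / (a * b)) 1 = R at hU ⊢
  rw [← neg_inj, hU]
  generalize theta y a = α, theta y b = β, theta y (b / a) = γ, theta y (a / b) = δ at *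
  field_simp
  ring

end AppellLimit

section RankSum

/-- The terms of the series `rankSum`. -/
noncomputable def rankTerm (q : ℂ) (b k : ℤ) : ℂ :=
  (-1) ^ k * q ^ (3 * tri (k + 1) + b * k) / (1 - q ^ (11 * k))

/-- The sum of `(-1) ^ k q ^ (3 k (k + 1) / 2 + b k) / (1 - q ^ (11 k))` over nonzero `k`. -/
noncomputable def rankSum (q : ℂ) (b : ℤ) : ℂ := ∑' k : ℤ, rankTerm q b k

noncomputable def rankClassSum (q : ℂ) (b c : ℤ) : ℂ := ∑' l : ℤ, rankTerm q b (11 * l + c)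

lemma norm_pow_eleven {q : ℂ} (hq : ‖q‖ < 1) : ‖q ^ 11‖ < 1 := by
  rw [norm_pow]
  exact pow_lt_one₀ (norm_nonneg _) hq (by norm_num)

lemma norm_pow_three {q : ℂ} (hq : ‖q‖ < 1) : ‖q ^ 3‖ < 1 := by
  rw [norm_pow]
  exact pow_lt_one₀ (norm_nonneg _) hq (by norm_num)

lemma summable_norm_rankTerm {q : ℂ} (hq0 : q ≠ 0) (hq : ‖q‖ < 1) (b : ℤ) :
    Summable fun k ↦ ‖rankTerm q b k‖ := by
  obtain ⟨C, hC⟩ := exists_norm_inv_one_sub_le (pow_ne_zero 11 hq0) (norm_pow_eleven hq)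
    (one_ne_zero (α := ℂ))
  refine Summable.of_nonneg_of_le (fun _ ↦ norm_nonneg _) (fun k ↦ ?_)
    ((summable_norm_theta (pow_ne_zero 3 hq0) (norm_pow_three hq) (q ^ (3 + b))).mul_right C)
  have h := hC k
  rw [one_mul, ← zpow_natCast, ← zpow_mul] at h
  rw [rankTerm, div_eq_mul_inv, norm_mul, norm_mul, norm_neg_one_zpow, one_mul]
  refine mul_le_mul (le_of_eq ?_) h (norm_nonneg _) (norm_nonneg _)
  rw [← zpow_natCast, ← zpow_mul, ← zpow_mul, ← zpow_add₀ hq0, tri_add_one]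
  push_cast
  ring_nf

lemma rankClassSum_add (q : ℂ) (b c w : ℤ) :
    rankClassSum q b (c + 11 * w) = rankClassSum q b c := by
  rw [rankClassSum, rankClassSum, ← (Equiv.addRight w).tsum_eq (fun l ↦ rankTerm q b (11 * l + c))]
  refine tsum_congr fun l ↦ ?_
  rw [Equiv.coe_addRight]
  congr 1
  ring

instance : Fact (Nat.Prime 11) := ⟨by norm_num⟩

lemma sum_range_eleven_mul {g : ℤ → ℂ} (hg : ∀ c w, g (c + 11 * w) = g c) {z : ℤ}
    (hz : ¬ (11 : ℤ) ∣ z) :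
    ∑ r ∈ Finset.range 11, g r = g z + (g 0 + g (2 * z)) + (g (-z) + g (3 * z))
      + (g (-(2 * z)) + g (4 * z)) + (g (-(3 * z)) + g (5 * z)) + (g (-(4 * z)) + g (6 * z)) := by
  have hz' : (z : ZMod 11) ≠ 0 := by
    intro h
    exact hz ((ZMod.intCast_zmod_eq_zero_iff_dvd z 11).1 h)
  have hc : ∀ c d : ℤ, (c : ZMod 11) = d → g c = g d := by
    intro c d h
    obtain ⟨w, hw⟩ := (ZMod.intCast_zmod_eq_zero_iff_dvd (c - d) 11).1
        (by push_cast; rw [h, sub_self])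
    rw [show c = d + 11 * w by push_cast at hw; linarith, hg]
  have h1 : ∑ r ∈ Finset.range 11, g r = ∑ x : ZMod 11, g (x.val : ℤ) :=
    (Fin.sum_univ_eq_sum_range (fun r ↦ g (r : ℤ)) 11).symm
  have h2 : ∀ (x : ZMod 11) (k : ℤ), (k : ZMod 11) = x →
      g (((z : ZMod 11) * x).val : ℤ) = g (z * k) := by
    intro x k hk
    refine hc _ _ ?_
    push_cast
    rw [ZMod.natCast_zmod_val, hk]
  have h4 : ∑ x : ZMod 11, g (((z : ZMod 11) * x).val : ℤ) = ∑ x : ZMod 11, g (x.val : ℤ) :=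
    Equiv.sum_comp (Equiv.mulLeft₀ (z : ZMod 11) hz') (fun x : ZMod 11 ↦ g (x.val : ℤ))
  rw [h1, ← h4]
  have h3 : ∀ f : ZMod 11 → ℂ, ∑ x, f x = f 0 + f 1 + f 2 + f 3 + f 4 + f 5 + f 6 + f 7 + f 8
      + f 9 + f 10 := by
    intro f
    have : ∀ f : Fin 11 → ℂ, ∑ x, f x = f 0 + f 1 + f 2 + f 3 + f 4 + f 5 + f 6 + f 7 + f 8
      + f 9 + f 10 := by
      intro f
      simp only [Fin.sum_univ_succ, Fin.sum_univ_zero]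
      simp only [Fin.reduceSucc]
      ring
    exact this f
  rw [h3, h2 0 0 (by decide), h2 1 1 (by decide), h2 2 2 (by decide), h2 3 3 (by decide),
    h2 4 4 (by decide), h2 5 5 (by decide), h2 6 6 (by decide), h2 7 (-4) (by decide),
    h2 8 (-3) (by decide), h2 9 (-2) (by decide), h2 10 (-1) (by decide)]
  ring_nf

lemma rankSum_eq_sum {q : ℂ} (hq0 : q ≠ 0) (hq : ‖q‖ < 1) (b : ℤ) :
    rankSum q b = ∑ r ∈ Finset.range 11, rankClassSum q b r := by
  rw [rankSum, tsum_int_mod 11 (summable_norm_rankTerm hq0 hq b).of_norm]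
  rfl

/-- The exponent of the leading term of a class sum. -/
def rexp (z c : ℤ) : ℤ := 3 * tri (c + 1) + (15 - 3 * z) * c

lemma rankClassSum_eq {q : ℂ} (hq0 : q ≠ 0) (z : ℤ) {c : ℤ} (hc : Even c) :
    rankClassSum q (15 - 3 * z) c
      = q ^ rexp z c * appell (q ^ 121) (q ^ (33 * (c - z))) (q ^ (11 * c)) := by
  rw [rankClassSum, appell, ← tsum_mul_left]
  refine tsum_congr fun l ↦ ?_
  rw [rankTerm, ← zpow_natCast, ← zpow_mul, ← zpow_mul, ← zpow_mul, ← zpow_add₀ hq0,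
    ← mul_div_assoc]
  have h1 : (-1 : ℂ) ^ (11 * l + c) = (-1) ^ l := by
    have h : Even (10 * l + c) := ((by decide : Even (10 : ℤ)).mul_right l).add hc
    rw [show 11 * l + c = l + (10 * l + c) by ring, zpow_add₀ (by norm_num), h.neg_one_zpow,
      mul_one]
  rw [h1, show (11 * (11 * l + c) : ℤ) = 11 * c + ((121 : ℕ) : ℤ) * l by push_cast; ring]
  congr 1
  rw [mul_assoc, mul_left_comm, ← zpow_add₀ hq0, ← zpow_add₀ hq0]
  congr 2
  rw [rexp]
  push_cast
  nlinarith [two_mul_tri (11 * l + c + 1), two_mul_tri (l + 1), two_mul_tri (c + 1)]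

lemma appell_one_eq (y c : ℂ) : appell y c 1 = appellReg y c 1 := by
  rw [appell, appellReg]
  refine tsum_congr fun n ↦ ?_
  split_ifs with h
  · simp [h]
  · rfl

end RankSum

section RankPairs

lemma theta_ne_zero_of_tau {q : ℂ} {k : ℤ} (h : tau q k ≠ 0) :
    theta (q ^ 121) (q ^ (11 * k)) ≠ 0 :=
  right_ne_zero_of_mul h

lemma theta_zpow_neg {q : ℂ} (hq0 : q ≠ 0) (k : ℤ) :
    theta (q ^ 121) (q ^ (-(11 * k))) = -theta (q ^ 121) (q ^ (11 * k)) / q ^ (11 * k) := by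
  rw [eq_div_iff (zpow_ne_zero _ hq0), zpow_neg, mul_comm, theta_inv (zpow_ne_zero _ hq0)]

lemma rankClassSum_pair {q : ℂ} (hq0 : q ≠ 0) (hq : ‖q‖ < 1) {z t : ℤ} (hz : Even z) (ht : Even t)
    (h1 : tau q z ≠ 0) (h2 : tau q t ≠ 0) (h3 : tau q (2 * t) ≠ 0) (h4 : tau q (z + t) ≠ 0)
    (h5 : tau q (z - t) ≠ 0) :
    rankClassSum q (15 - 3 * z) (z - t) + rankClassSum q (15 - 3 * z) (z + t)
      = rankClassSum q (15 - 3 * z) z * (tau q (2 * t) / tau q t)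
        + poch (q ^ 121) (q ^ 121) ^ 3 * q ^ 15
          * (tau q t * tau q (2 * t) / (tau q z * tau q (z + t) * tau q (z - t))) := by
  rw [rankClassSum_eq hq0 z hz, rankClassSum_eq hq0 z (hz.sub ht),
      rankClassSum_eq hq0 z (hz.add ht)]
  have p := fun n : ℤ ↦ zpow_ne_zero n hq0
  have d1 : q ^ (11 * (z + t)) / q ^ (11 * (z - t)) = q ^ (11 * (2 * t)) := by
    rw [← zpow_sub₀ hq0]; ring_nf
  have d1' : q ^ (11 * (z - t)) / q ^ (11 * (z + t)) = q ^ (-(11 * (2 * t))) := by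
    rw [← zpow_sub₀ hq0]; ring_nf
  have d2 : q ^ (11 * z) / q ^ (11 * (z - t)) = q ^ (11 * t) := by
    rw [← zpow_sub₀ hq0]; ring_nf
  have d2' : q ^ (11 * (z - t)) / q ^ (11 * z) = q ^ (-(11 * t)) := by
    rw [← zpow_sub₀ hq0]; ring_nf
  have d3 : q ^ (11 * z) / q ^ (11 * (z + t)) = q ^ (-(11 * t)) := by
    rw [← zpow_sub₀ hq0]; ring_nf
  have d3' : q ^ (11 * (z + t)) / q ^ (11 * z) = q ^ (11 * t) := by
    rw [← zpow_sub₀ hq0]; ring_nf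
  have c1 : (q ^ (11 * (z - t))) ^ 2 / (q ^ (11 * (z + t)) * q ^ (11 * z))
      = q ^ (33 * (z - t - z)) := by
    rw [← zpow_natCast, ← zpow_mul, ← zpow_add₀ hq0, ← zpow_sub₀ hq0]; push_cast; ring_nf
  have c2 : (q ^ (11 * (z + t))) ^ 2 / (q ^ (11 * (z - t)) * q ^ (11 * z))
      = q ^ (33 * (z + t - z)) := by
    rw [← zpow_natCast, ← zpow_mul, ← zpow_add₀ hq0, ← zpow_sub₀ hq0]; push_cast; ring_nf
  have c3 : (q ^ (11 * z)) ^ 2 / (q ^ (11 * (z - t)) * q ^ (11 * (z + t)))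
      = q ^ (33 * (z - z)) := by
    rw [← zpow_natCast, ← zpow_mul, ← zpow_add₀ hq0, ← zpow_sub₀ hq0]; push_cast; ring_nf
  have n1 := theta_ne_zero_of_tau h1
  have n2 := theta_ne_zero_of_tau h2
  have n3 := theta_ne_zero_of_tau h3
  have n4 := theta_ne_zero_of_tau h4
  have n5 := theta_ne_zero_of_tau h5
  have n2' : theta (q ^ 121) (q ^ (-(11 * t))) ≠ 0 := by
    rw [zpow_neg]; exact theta_inv_ne_zero (p _) n2
  have h := theta_inv_eq_appell (pow_121_ne_zero hq0) (norm_pow_121 hq) (p (11 * (z - t)))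
    (p (11 * (z + t))) (p (11 * z)) n5 n4
    (ne_zpow_of_theta_ne_zero (pow_121_ne_zero hq0) n1)
    (by rw [d1]; exact n3) (by rw [d2']; exact n2') (by rw [d3']; exact n2)
  rw [d1, d1', d2, d2', d3, d3', c1, c2, c3, theta_zpow_neg hq0, theta_zpow_neg hq0] at h
  rw [tau.eq_1 q z, tau.eq_1 q t, tau.eq_1 q (2 * t), tau.eq_1 q (z + t), tau.eq_1 q (z - t)]
  have e1 : q ^ rexp z (z + t) = q ^ rexp z (z - t) * q ^ (11 * (2 * t)) * q ^ (11 * t) := by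
    rw [← zpow_add₀ hq0, ← zpow_add₀ hq0]
    congr 1
    rw [rexp, rexp]
    linarith [two_mul_tri (z + t + 1), two_mul_tri (z - t + 1)]
  have e2 : q ^ rexp z z * q ^ texp (2 * t) = q ^ rexp z (z - t) * q ^ (11 * t) * q ^ texp t := by
    rw [← zpow_add₀ hq0, ← zpow_add₀ hq0, ← zpow_add₀ hq0]
    congr 1
    rw [rexp, rexp]
    linarith [two_mul_tri (z - t + 1), two_mul_tri (z + 1), two_mul_texp (2 * t), two_mul_texp t]
  have e3 : q ^ texp t * q ^ texp (2 * t) * q ^ 15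
      = q ^ rexp z (z - t) * (q ^ texp z * q ^ texp (z + t) * q ^ texp (z - t)) := by
    rw [← zpow_natCast, ← zpow_add₀ hq0, ← zpow_add₀ hq0, ← zpow_add₀ hq0, ← zpow_add₀ hq0,
      ← zpow_add₀ hq0]
    congr 1
    rw [rexp]
    push_cast
    linarith [two_mul_tri (z - t + 1), two_mul_texp (2 * t), two_mul_texp t, two_mul_texp z,
      two_mul_texp (z + t), two_mul_texp (z - t)]
  rw [e1]
  have p1 := p (11 * t)
  have p2 := p (11 * (2 * t))
  have p3 := p (texp z)
  have p4 := p (texp t)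
  have p5 := p (texp (2 * t))
  have p6 := p (texp (z + t))
  have p7 := p (texp (z - t))
  generalize theta (q ^ 121) (q ^ (11 * z)) = T1, theta (q ^ 121) (q ^ (11 * t)) = T2,
    theta (q ^ 121) (q ^ (11 * (2 * t))) = T3, theta (q ^ 121) (q ^ (11 * (z + t))) = T4,
    theta (q ^ 121) (q ^ (11 * (z - t))) = T5 at *
  generalize appell (q ^ 121) (q ^ (33 * (z - t - z))) (q ^ (11 * (z - t))) = A1,
    appell (q ^ 121) (q ^ (33 * (z + t - z))) (q ^ (11 * (z + t))) = A2,
    appell (q ^ 121) (q ^ (33 * (z - z))) (q ^ (11 * z)) = A3, poch (q ^ 121) (q ^ 121) = J at *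
  generalize q ^ rexp z z = R, q ^ rexp z (z - t) = R', q ^ 15 = q15, q ^ (11 * t) = w1,
    q ^ (11 * (2 * t)) = w2, q ^ texp z = a1, q ^ texp t = a2, q ^ texp (2 * t) = a3,
    q ^ texp (z + t) = a4, q ^ texp (z - t) = a5 at *
  have g1 : R * A3 * (a3 * T3 / (a2 * T2)) = R' * w1 * A3 * T3 / T2 := by
    field_simp
    linear_combination A3 * e2
  have g2 : J ^ 3 * q15 * (a2 * T2 * (a3 * T3) / (a1 * T1 * (a4 * T4) * (a5 * T5)))
      = R' * (T2 * T3) * (J ^ 3 / (T5 * T4 * T1)) := by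
    field_simp
    linear_combination J ^ 3 * e3
  rw [g1, g2, h]
  field_simp
  ring

lemma rankClassSum_zero_add {q : ℂ} (hq0 : q ≠ 0) (hq : ‖q‖ < 1) {z : ℤ} (hz : Even z)
    (h1 : tau q z ≠ 0) (h2 : tau q (2 * z) ≠ 0) :
    rankClassSum q (15 - 3 * z) 0 + rankClassSum q (15 - 3 * z) (2 * z)
      = rankClassSum q (15 - 3 * z) z * (tau q (2 * z) / tau q z)
        + thetaLog (q ^ 121) (q ^ (11 * z)) + thetaLog (q ^ 121) (q ^ (11 * (2 * z))) := by
  rw [rankClassSum_eq hq0 z hz, rankClassSum_eq hq0 z Even.zero,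
      rankClassSum_eq hq0 z (hz.mul_left 2)]
  have p := fun n : ℤ ↦ zpow_ne_zero n hq0
  have n1 := theta_ne_zero_of_tau h1
  have n2 := theta_ne_zero_of_tau h2
  have d1 : q ^ (11 * (2 * z)) / q ^ (11 * z) = q ^ (11 * z) := by
    rw [← zpow_sub₀ hq0]; ring_nf
  have d2 : q ^ (11 * z) / q ^ (11 * (2 * z)) = q ^ (-(11 * z)) := by
    rw [← zpow_sub₀ hq0]; ring_nf
  have c1 : (q ^ (11 * z)) ^ 2 / q ^ (11 * (2 * z)) = q ^ (33 * (z - z)) := by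
    rw [← zpow_natCast, ← zpow_mul, ← zpow_sub₀ hq0]; push_cast; ring_nf
  have c2 : (q ^ (11 * (2 * z))) ^ 2 / q ^ (11 * z) = q ^ (33 * (2 * z - z)) := by
    rw [← zpow_natCast, ← zpow_mul, ← zpow_sub₀ hq0]; push_cast; ring_nf
  have c3 : 1 / (q ^ (11 * z) * q ^ (11 * (2 * z))) = q ^ (33 * (0 - z)) := by
    rw [← zpow_add₀ hq0, one_div, ← zpow_neg]; ring_nf
  have h := thetaLog_add (pow_121_ne_zero hq0) (norm_pow_121 hq) (p (11 * z)) (p (11 * (2 * z)))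
    n1 n2 (by rw [d1]; exact n1)
  rw [d1, d2, c1, c2, c3, theta_zpow_neg hq0] at h
  rw [add_assoc, h, mul_zero, zpow_zero, appell_one_eq, tau.eq_1 q z, tau.eq_1 q (2 * z)]
  have e1 : q ^ rexp z (2 * z) = q ^ (11 * (2 * z)) * q ^ (11 * z) := by
    rw [← zpow_add₀ hq0]
    congr 1
    rw [rexp]
    linarith [two_mul_tri (2 * z + 1)]
  have e2 : q ^ rexp z z * q ^ texp (2 * z) = q ^ (11 * z) * q ^ texp z := by
    rw [← zpow_add₀ hq0, ← zpow_add₀ hq0]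
    congr 1
    rw [rexp]
    linarith [two_mul_tri (z + 1), two_mul_texp (2 * z), two_mul_texp z]
  have e3 : rexp z 0 = 0 := by
    rw [rexp]
    linarith [two_mul_tri (0 + 1)]
  rw [e1, e3, zpow_zero]
  have p1 := p (11 * z)
  have p2 := p (11 * (2 * z))
  have p3 := p (texp z)
  generalize theta (q ^ 121) (q ^ (11 * z)) = T1, theta (q ^ 121) (q ^ (11 * (2 * z))) = T2 at *
  generalize appellReg (q ^ 121) (q ^ (33 * (0 - z))) 1 = A1,
    appell (q ^ 121) (q ^ (33 * (2 * z - z))) (q ^ (11 * (2 * z))) = A2,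
    appell (q ^ 121) (q ^ (33 * (z - z))) (q ^ (11 * z)) = A3 at *
  generalize q ^ rexp z z = R, q ^ (11 * z) = w1,
    q ^ (11 * (2 * z)) = w2, q ^ texp z = a1, q ^ texp (2 * z) = a2 at *
  have g1 : R * A3 * (a2 * T2 / (a1 * T1)) = w1 * A3 * T2 / T1 := by
    field_simp
    linear_combination A3 * e2
  rw [g1]
  field_simp
  ring

end RankPairs

section RankDissection

/-- The odd, periodic normalization of the logarithmic derivative of the theta function. -/
noncomputable def oddLog (q : ℂ) (k : ℤ) : ℂ :=
  thetaLog (q ^ 121) (q ^ (11 * k)) - 1 / 2 + k / 11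

lemma oddLog_neg {q : ℂ} (hq0 : q ≠ 0) (hq : ‖q‖ < 1) {k : ℤ} (hk : tau q k ≠ 0) :
    oddLog q (-k) = -oddLog q k := by
  have h := thetaLog_inv (pow_121_ne_zero hq0) (norm_pow_121 hq) (zpow_ne_zero (11 * k) hq0)
    (theta_ne_zero_of_tau hk)
  rw [oddLog, oddLog, mul_neg, zpow_neg, h]
  push_cast
  ring

lemma oddLog_add {q : ℂ} (hq0 : q ≠ 0) (hq : ‖q‖ < 1) {k : ℤ} (hk : tau q k ≠ 0) :
    oddLog q (k + 11) = oddLog q k := by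
  have h := thetaLog_mul_self (pow_121_ne_zero hq0) (norm_pow_121 hq) (zpow_ne_zero (11 * k) hq0)
    (theta_ne_zero_of_tau hk)
  rw [← zpow_natCast q 121, ← zpow_add₀ hq0, zpow_natCast] at h
  rw [oddLog, oddLog, show (11 * (k + 11) : ℤ) = 11 * k + (121 : ℕ) by push_cast; ring, h]
  push_cast
  ring

lemma oddLog_add_mul {q : ℂ} (hq0 : q ≠ 0) (hq : ‖q‖ < 1) {k : ℤ} (hk : ¬ (11 : ℤ) ∣ k) (w : ℤ) :
    oddLog q (k + 11 * w) = oddLog q k := by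
  have hn : ∀ w : ℤ, tau q (k + 11 * w) ≠ 0 := fun w ↦ tau_ne_zero hq0 hq (by omega)
  induction w with
  | zero => simp
  | succ n ih =>
    rw [← ih, ← oddLog_add hq0 hq (hn n)]
    ring_nf
  | pred n ih =>
    rw [← ih, ← oddLog_add hq0 hq (hn _)]
    ring_nf

lemma oddLog_second_difference {q : ℂ} (hq0 : q ≠ 0) (hq : ‖q‖ < 1) {a b : ℤ}
    (h1 : tau q a ≠ 0) (h2 : tau q (a + b) ≠ 0) (h3 : tau q (a - b) ≠ 0) :
    oddLog q (a + b) + oddLog q (a - b) - 2 * oddLog q a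
      = -(poch (q ^ 121) (q ^ 121) ^ 3 * q ^ 15
        * (tau q (2 * a) * tau q b ^ 2 / (tau q a ^ 2 * tau q (a + b) * tau q (a - b)))) := by
  have p := fun n : ℤ ↦ zpow_ne_zero n hq0
  have n1 := theta_ne_zero_of_tau h1
  have n2 := theta_ne_zero_of_tau h2
  have n3 := theta_ne_zero_of_tau h3
  have c1 : q ^ (11 * a) * q ^ (11 * b) = q ^ (11 * (a + b)) := by
    rw [← zpow_add₀ hq0]; ring_nf
  have c2 : q ^ (11 * a) / q ^ (11 * b) = q ^ (11 * (a - b)) := by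
    rw [← zpow_sub₀ hq0]; ring_nf
  have c3 : (q ^ (11 * a)) ^ 2 = q ^ (11 * (2 * a)) := by
    rw [← zpow_natCast, ← zpow_mul]; push_cast; ring_nf
  have h := thetaLog_add_sub (pow_121_ne_zero hq0) (norm_pow_121 hq) (p (11 * a)) (p (11 * b))
    n1 (by rw [c1]; exact n2) (by rw [c2]; exact n3)
  rw [c1, c2, c3] at h
  have e1 : q ^ 15 * (q ^ texp (2 * a) * (q ^ texp b) ^ 2)
      = q ^ (11 * (a - b)) * ((q ^ texp a) ^ 2 * q ^ texp (a + b) * q ^ texp (a - b)) := by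
    rw [← zpow_natCast, ← zpow_natCast, ← zpow_natCast, ← zpow_mul, ← zpow_mul, ← zpow_add₀ hq0,
      ← zpow_add₀ hq0, ← zpow_add₀ hq0, ← zpow_add₀ hq0, ← zpow_add₀ hq0]
    congr 1
    push_cast
    linarith [two_mul_texp (2 * a), two_mul_texp b, two_mul_texp a, two_mul_texp (a + b),
      two_mul_texp (a - b)]
  have h' : oddLog q (a + b) + oddLog q (a - b) - 2 * oddLog q a
      = thetaLog (q ^ 121) (q ^ (11 * (a + b))) + thetaLog (q ^ 121) (q ^ (11 * (a - b)))
        - 2 * thetaLog (q ^ 121) (q ^ (11 * a)) := by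
    simp only [oddLog]
    push_cast
    ring
  rw [h', h, tau.eq_1 q a, tau.eq_1 q b, tau.eq_1 q (2 * a), tau.eq_1 q (a + b),
    tau.eq_1 q (a - b)]
  have p1 := p (texp a)
  have p2 := p (texp (a + b))
  have p3 := p (texp (a - b))
  generalize theta (q ^ 121) (q ^ (11 * a)) = T1, theta (q ^ 121) (q ^ (11 * b)) = T2,
    theta (q ^ 121) (q ^ (11 * (2 * a))) = T3, theta (q ^ 121) (q ^ (11 * (a + b))) = T4,
    theta (q ^ 121) (q ^ (11 * (a - b))) = T5, poch (q ^ 121) (q ^ 121) = J at *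
  generalize q ^ texp a = a1, q ^ texp (a + b) = a2, q ^ texp (a - b) = a3,
    q ^ (11 * (a - b)) = w, q ^ 15 = q15, q ^ texp b = b1, q ^ texp (2 * a) = b2 at *
  field_simp
  linear_combination J ^ 3 * T3 * T2 ^ 2 * e1

/-- The theta quotient in the sum of two values of `oddLog`. -/
noncomputable def logQuot (s1 s2 s3 s4 s5 : ℂ) : ℂ :=
  3 / 22 * (-9 * (s2 ^ 3 / (s1 ^ 3 * s3)) + 5 * (s1 * s4 / (s2 ^ 2 * s3))
    - 10 * (s1 ^ 2 * s5 / (s2 * s3 ^ 2 * s4)) - 6 * (s1 ^ 2 / (s4 ^ 2 * s5))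
    + 2 * (s1 ^ 3 / (s4 * s5 ^ 3))) + (s1 * s4 / (s2 ^ 2 * s3) + s2 ^ 3 / (s1 ^ 3 * s3)) / 2

lemma tau_eq_neg {q : ℂ} (hq0 : q ≠ 0) {z k l : ℤ} (hz : Even z) (h : k + l = 11 * z) :
    tau q k = -tau q l := by
  obtain ⟨w, rfl⟩ := hz
  rw [← tau_neg hq0, ← tau_add_mul hq0 (-l) w]
  congr 1
  linarith

lemma not_eleven_dvd_mul {z : ℤ} (hz : ¬ (11 : ℤ) ∣ z) {i : ℤ} (hi : ¬ (11 : ℤ) ∣ i) :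
    ¬ (11 : ℤ) ∣ i * z := by
  have h11 : Prime (11 : ℤ) := by norm_num
  intro h
  rcases h11.dvd_or_dvd h with h | h
  · exact hi h
  · exact hz h

lemma oddLog_add_oddLog {q : ℂ} (hq0 : q ≠ 0) (hq : ‖q‖ < 1) {z : ℤ} (hz : Even z)
    (hz' : ¬ (11 : ℤ) ∣ z) :
    oddLog q z + oddLog q (2 * z) = poch (q ^ 121) (q ^ 121) ^ 3 * q ^ 15
      * logQuot (tau q z) (tau q (2 * z)) (tau q (3 * z)) (tau q (4 * z)) (tau q (5 * z)) := by
  have t1 : tau q z ≠ 0 := tau_ne_zero hq0 hq hz'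
  have t2 : tau q (2 * z) ≠ 0 := tau_ne_zero hq0 hq (not_eleven_dvd_mul hz' (by decide))
  have t3 : tau q (3 * z) ≠ 0 := tau_ne_zero hq0 hq (not_eleven_dvd_mul hz' (by decide))
  have t4 : tau q (4 * z) ≠ 0 := tau_ne_zero hq0 hq (not_eleven_dvd_mul hz' (by decide))
  have t5 : tau q (5 * z) ≠ 0 := tau_ne_zero hq0 hq (not_eleven_dvd_mul hz' (by decide))
  have s6 : tau q (6 * z) = -tau q (5 * z) := tau_eq_neg hq0 hz (by ring)
  have s8 : tau q (8 * z) = -tau q (3 * z) := tau_eq_neg hq0 hz (by ring)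
  have s10 : tau q (10 * z) = -tau q z := tau_eq_neg hq0 hz (by ring)
  have t6 : tau q (6 * z) ≠ 0 := by rw [s6]; exact neg_ne_zero.2 t5
  have sm : tau q (-z) = -tau q z := tau_neg hq0 z
  have tm : tau q (-z) ≠ 0 := by rw [sm]; exact neg_ne_zero.2 t1
  have z6 : oddLog q (6 * z) = -oddLog q (5 * z) := by
    rw [← oddLog_neg hq0 hq t5,
      ← oddLog_add_mul hq0 hq (k := -(5 * z)) (by
        rw [dvd_neg]; exact not_eleven_dvd_mul hz' (by decide)) z]
    ring_nf
  have zm : oddLog q (-z) = -oddLog q z := oddLog_neg hq0 hq t1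
  have h12 := oddLog_second_difference hq0 hq (a := z) (b := 2 * z) t1 (by convert t3 using 2; ring)
    (by convert tm using 2; ring)
  have h21 := oddLog_second_difference hq0 hq (a := 2 * z) (b := z) t2 (by convert t3 using 2; ring)
    (by convert t1 using 2; ring)
  have h31 := oddLog_second_difference hq0 hq (a := 3 * z) (b := z) t3 (by convert t4 using 2; ring)
    (by convert t2 using 2; ring)
  have h41 := oddLog_second_difference hq0 hq (a := 4 * z) (b := z) t4 (by convert t5 using 2; ring)
    (by convert t3 using 2; ring)
  have h51 := oddLog_second_difference hq0 hq (a := 5 * z) (b := z) t5 (by convert t6 using 2; ring)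
    (by convert t4 using 2; ring)
  rw [show z + 2 * z = 3 * z by ring, show z - 2 * z = -z by ring, zm, sm] at h12
  rw [show 2 * z + z = 3 * z by ring, show 2 * z - z = z by ring,
    show 2 * (2 * z) = 4 * z by ring] at h21
  rw [show 3 * z + z = 4 * z by ring, show 3 * z - z = 2 * z by ring,
    show 2 * (3 * z) = 6 * z by ring, s6] at h31
  rw [show 4 * z + z = 5 * z by ring, show 4 * z - z = 3 * z by ring,
    show 2 * (4 * z) = 8 * z by ring, s8] at h41
  rw [show 5 * z + z = 6 * z by ring, show 5 * z - z = 4 * z by ring,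
    show 2 * (5 * z) = 10 * z by ring, s10, s6, z6] at h51
  rw [logQuot]
  generalize tau q z = s1, tau q (2 * z) = s2, tau q (3 * z) = s3, tau q (4 * z) = s4,
    tau q (5 * z) = s5, poch (q ^ 121) (q ^ 121) ^ 3 * q ^ 15 = c at *
  have e12 : s2 * s2 ^ 2 / (s1 ^ 2 * s3 * -s1) = -(s2 ^ 3 / (s1 ^ 3 * s3)) := by field_simp
  have e21 : s4 * s1 ^ 2 / (s2 ^ 2 * s3 * s1) = s1 * s4 / (s2 ^ 2 * s3) := by field_simp
  have e31 : -s5 * s1 ^ 2 / (s3 ^ 2 * s4 * s2) = -(s1 ^ 2 * s5 / (s2 * s3 ^ 2 * s4)) := by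
    field_simp
  have e41 : -s3 * s1 ^ 2 / (s4 ^ 2 * s5 * s3) = -(s1 ^ 2 / (s4 ^ 2 * s5)) := by field_simp
  have e51 : -s1 * s1 ^ 2 / (s5 ^ 2 * -s5 * s4) = s1 ^ 3 / (s4 * s5 ^ 3) := by field_simp
  rw [e12] at h12
  rw [e21] at h21
  rw [e31] at h31
  rw [e41] at h41
  rw [e51] at h51
  linear_combination (-3 / 22) * (9 * h12 + 5 * h21 + 10 * h31 + 6 * h41 + 2 * h51)
    - (h21 - h12) / 2

/-- The theta quotient part of the dissection of `rankSum`. -/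
noncomputable def rankQuot (s1 s2 s3 s4 s5 : ℂ) : ℂ :=
  -(s2 * s4 / (s1 ^ 2 * s3)) + s3 * s5 / (s1 * s2 * s4) + s4 / (s1 * s5) - 1 / s4
    + logQuot s1 s2 s3 s4 s5

theorem rankSum_dissection {q : ℂ} (hq0 : q ≠ 0) (hq : ‖q‖ < 1) {z : ℤ} (hz : Even z)
    (hz' : ¬ (11 : ℤ) ∣ z) :
    rankSum q (15 - 3 * z) = rankClassSum q (15 - 3 * z) z
        * eulerQuot (tau q z) (tau q (2 * z)) (tau q (3 * z)) (tau q (4 * z)) (tau q (5 * z))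
      + (1 - 3 * z / 11) + poch (q ^ 121) (q ^ 121) ^ 3 * q ^ 15
        * rankQuot (tau q z) (tau q (2 * z)) (tau q (3 * z)) (tau q (4 * z)) (tau q (5 * z)) := by
  have t1 : tau q z ≠ 0 := tau_ne_zero hq0 hq hz'
  have t2 : tau q (2 * z) ≠ 0 := tau_ne_zero hq0 hq (not_eleven_dvd_mul hz' (by decide))
  have t3 : tau q (3 * z) ≠ 0 := tau_ne_zero hq0 hq (not_eleven_dvd_mul hz' (by decide))
  have t4 : tau q (4 * z) ≠ 0 := tau_ne_zero hq0 hq (not_eleven_dvd_mul hz' (by decide))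
  have t5 : tau q (5 * z) ≠ 0 := tau_ne_zero hq0 hq (not_eleven_dvd_mul hz' (by decide))
  have s6 : tau q (6 * z) = -tau q (5 * z) := tau_eq_neg hq0 hz (by ring)
  have s8 : tau q (8 * z) = -tau q (3 * z) := tau_eq_neg hq0 hz (by ring)
  have s10 : tau q (10 * z) = -tau q z := tau_eq_neg hq0 hz (by ring)
  have t6 : tau q (6 * z) ≠ 0 := by rw [s6]; exact neg_ne_zero.2 t5
  have t8 : tau q (8 * z) ≠ 0 := by rw [s8]; exact neg_ne_zero.2 t3
  have t10 : tau q (10 * z) ≠ 0 := by rw [s10]; exact neg_ne_zero.2 t1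
  have hl := oddLog_add_oddLog hq0 hq hz hz'
  have h1 := rankClassSum_zero_add hq0 hq hz t1 t2
  have h2 := rankClassSum_pair hq0 hq (z := z) (t := 2 * z) hz (hz.mul_left 2) t1 t2
    (by convert t4 using 2; ring) (by convert t3 using 2; ring)
    (by rw [show z - 2 * z = -z by ring, tau_neg hq0]; exact neg_ne_zero.2 t1)
  have h3 := rankClassSum_pair hq0 hq (z := z) (t := 3 * z) hz (hz.mul_left 3) t1 t3
    (by convert t6 using 2; ring) (by convert t4 using 2; ring)
    (by rw [show z - 3 * z = -(2 * z) by ring, tau_neg hq0]; exact neg_ne_zero.2 t2)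
  have h4 := rankClassSum_pair hq0 hq (z := z) (t := 4 * z) hz (hz.mul_left 4) t1 t4
    (by convert t8 using 2; ring) (by convert t5 using 2; ring)
    (by rw [show z - 4 * z = -(3 * z) by ring, tau_neg hq0]; exact neg_ne_zero.2 t3)
  have h5 := rankClassSum_pair hq0 hq (z := z) (t := 5 * z) hz (hz.mul_left 5) t1 t5
    (by convert t10 using 2; ring) (by convert t6 using 2; ring)
    (by rw [show z - 5 * z = -(4 * z) by ring, tau_neg hq0]; exact neg_ne_zero.2 t4)
  rw [show z + 2 * z = 3 * z by ring, show z - 2 * z = -z by ring,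
    show 2 * (2 * z) = 4 * z by ring, tau_neg hq0] at h2
  rw [show z + 3 * z = 4 * z by ring, show z - 3 * z = -(2 * z) by ring,
    show 2 * (3 * z) = 6 * z by ring, tau_neg hq0, s6] at h3
  rw [show z + 4 * z = 5 * z by ring, show z - 4 * z = -(3 * z) by ring,
    show 2 * (4 * z) = 8 * z by ring, tau_neg hq0, s8] at h4
  rw [show z + 5 * z = 6 * z by ring, show z - 5 * z = -(4 * z) by ring,
    show 2 * (5 * z) = 10 * z by ring, tau_neg hq0, s10, s6] at h5
  rw [rankSum_eq_sum hq0 hq, sum_range_eleven_mul (rankClassSum_add q (15 - 3 * z)) hz',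
    h1, h2, h3, h4, h5, rankQuot]
  have hl' : thetaLog (q ^ 121) (q ^ (11 * z)) + thetaLog (q ^ 121) (q ^ (11 * (2 * z)))
      = oddLog q z + oddLog q (2 * z) + (1 - 3 * z / 11) := by
    simp only [oddLog]
    push_cast
    ring
  rw [hl] at hl'
  rw [eulerQuot]
  generalize tau q z = s1, tau q (2 * z) = s2, tau q (3 * z) = s3, tau q (4 * z) = s4,
    tau q (5 * z) = s5, poch (q ^ 121) (q ^ 121) ^ 3 * q ^ 15 = c at *
  have e2 : s2 * s4 / (s1 * s3 * -s1) = -(s2 * s4 / (s1 ^ 2 * s3)) := by field_simp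
  have e3 : s3 * -s5 / (s1 * s4 * -s2) = s3 * s5 / (s1 * s2 * s4) := by field_simp
  have e4 : s4 * -s3 / (s1 * s5 * -s3) = s4 / (s1 * s5) := by field_simp
  have e5 : s5 * -s1 / (s1 * -s5 * -s4) = -(1 / s4) := by field_simp
  rw [e2, e3, e4, e5]
  linear_combination hl'

end RankDissection

/-- The components of the dissected quotient, indexed by the residue of the exponent. -/
noncomputable def comp (k : Fin 11) (s1 s2 s3 s4 s5 x y : ℂ) : ℂ :=
  ![comp0 s2 s3 s4 x y, comp1 s2 s3 s5 x y, comp2 s3 x y, comp3 s1 s3 s4 x y,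
    comp4 s1 s2 s3 s4 s5 x y, comp5 s1 s2 s3 x y, comp6 s4 x y, comp7 s2 x y,
    comp8 s1 s2 s3 s5 x y, comp9 s1 s2 s3 s4 s5 x y, comp10 s1 x y] k

lemma sum_comp (s1 s2 s3 s4 s5 x y : ℂ) : ∑ k, comp k s1 s2 s3 s4 s5 x y =
    comp0 s2 s3 s4 x y + comp1 s2 s3 s5 x y + comp2 s3 x y + comp3 s1 s3 s4 x y
    + comp4 s1 s2 s3 s4 s5 x y + comp5 s1 s2 s3 x y + comp6 s4 x y + comp7 s2 x y
    + comp8 s1 s2 s3 s5 x y + comp9 s1 s2 s3 s4 s5 x y + comp10 s1 x y := by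
  simp [Fin.sum_univ_succ, comp]
  ring

lemma eulerQuot_mul_sum_comp {s1 s2 s3 s4 s5 x y : ℂ} (h : Coords s1 s2 s3 s4 s5 x y) :
    eulerQuot s1 s2 s3 s4 s5 * ∑ k, comp k s1 s2 s3 s4 s5 x y
      = 11 * curveUnit x y * rankQuot s1 s2 s3 s4 s5 := by
  rw [sum_comp, eulerQuot, rankQuot, logQuot]
  linear_combination comp_eq0 h + comp_eq1 h + comp_eq2 h + comp_eq3 h + comp_eq4 h + comp_eq5 h
    + comp_eq6 h + comp_eq7 h + comp_eq8 h + comp_eq9 h + comp_eq10 h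

lemma comp_scale (k : Fin 11) {β γ : ℂ} (hβ : β ^ 11 = 1) (hγ : γ ≠ 0) (s1 s2 s3 s4 s5 x y : ℂ) :
    comp k (γ * β * s1) (γ * β ^ 4 * s2) (γ * β ^ 9 * s3) (γ * β ^ 5 * s4) (γ * β ^ 3 * s5) x y
      = β ^ (k : ℕ) / γ * comp k s1 s2 s3 s4 s5 x y := by
  have hβ0 : β ≠ 0 := by
    rintro rfl
    norm_num at hβ
  have key : ∀ (N D N' D' P : ℂ) (m : ℕ) (μ : ℂ), μ ≠ 0 → D' = μ * D → N' = μ * (β ^ m / γ) * N →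
      N' / D' * P = β ^ m / γ * (N / D * P) := by
    intro N D N' D' P m μ hμ h1 h2
    rw [h1, h2, mul_assoc μ, mul_div_mul_left _ _ hμ]
    ring
  fin_cases k
  · refine key _ _ _ _ _ 0 (γ ^ 2 * β ^ 9) (by simp [*]) (by ring) ?_
    field_simp
  · refine key _ _ _ _ _ 1 (γ ^ 2 * β ^ 2) (by simp [*]) ?_ ?_
    · linear_combination γ ^ 2 * β ^ 2 * s2 * s3 * hβ
    · field_simp
  · refine key _ _ _ _ _ 2 (γ * β ^ 9) (by simp [*]) (by ring) ?_
    field_simp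
    linear_combination -hβ
  · refine key _ _ _ _ _ 3 (γ ^ 2 * β ^ 6) (by simp [*]) (by ring) ?_
    field_simp
  · refine key _ _ _ _ _ 4 (γ ^ 3 * β ^ 9) (by simp [*]) (by ring) ?_
    field_simp
  · refine key _ _ _ _ _ 5 (γ ^ 2 * β ^ 10) (by simp [*]) (by ring) ?_
    field_simp
    linear_combination -s2 * hβ
  · refine key _ _ _ _ _ 6 (γ * β ^ 5) (by simp [*]) (by ring) ?_
    field_simp
    linear_combination -hβ
  · refine key _ _ _ _ _ 7 (γ * β ^ 4) (by simp [*]) (by ring) ?_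
    field_simp
    linear_combination -hβ
  · refine key _ _ _ _ _ 8 (γ ^ 3 * β ^ 5) (by simp [*]) (by ring) ?_
    field_simp
  · refine key _ _ _ _ _ 9 (γ ^ 5 * β ^ 9) (by simp [*]) ?_ ?_
    · linear_combination γ ^ 5 * β ^ 9 * s1 * s3 ^ 3 * s5 * (β ^ 11 + 1) * hβ
    · field_simp
  · refine key _ _ _ _ _ 10 (γ * β) (by simp [*]) (by ring) ?_
    field_simp
    linear_combination -hβ

lemma comp6_mul_curveUnit {s1 s2 s3 s4 s5 x y x' y' : ℂ} (h : Coords s1 s2 s3 s4 s5 x y)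
    (h' : Coords s3 (-s5) (-s2) s1 s4 x' y') :
    comp6 s1 x' y' * curveUnit x y
      = 1 / s1 * (-9 - 3 * x - 7 * y - 9 * (x * y) - 13 * x ^ 2) * curveUnit x' y' := by
  have h1 := h.ne1
  have h2 := h.ne2
  have h3 := h.ne3
  have h4 := h.ne4
  have h5 := h.ne5
  have nx := h.nex
  have ny := h.ney
  have nu := h.neu
  have nv := h.nev
  have ex : x' = (1 + y) / x := by
    rw [h'.hx, h.hv, h.hx]
    field_simp
  have ey : y' = (1 + y) / (x * y) := by
    rw [h'.hy, h.hv, h.hx, h.hy]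
    field_simp
  have ef : curveUnit x' y' * (x ^ 2 * y * (1 - x)) = curveUnit x y * (1 + y) ^ 2 := by
    rw [ex, ey, curveUnit, curveUnit]
    field_simp
    linear_combination (-3 - 3 * y - x) * h.curve
  have eV : (-9 + 4 * y' - 3 * x' - 9 * x' * y' + 9 * x' ^ 2) * (x ^ 2 * y * (1 - x))
      = (-9 - 3 * x - 7 * y - 9 * (x * y) - 13 * x ^ 2) * (1 + y) ^ 2 := by
    rw [ex, ey]
    field_simp
    linear_combination (16 + 16 * y + 9 * x) * h.curve
  rw [comp6]
  have : x ^ 2 * y * (1 - x) ≠ 0 := by simp [*]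
  apply mul_right_cancel₀ this
  linear_combination 1 / s1 * curveUnit x y * eV
    - 1 / s1 * (-9 - 3 * x - 7 * y - 9 * (x * y) - 13 * x ^ 2) * ef

lemma comp7_mul_curveUnit {s1 s2 s3 s4 s5 x y x' y' : ℂ} (h : Coords s1 s2 s3 s4 s5 x y)
    (h' : Coords s5 (-s1) s4 (-s2) s3 x' y') :
    comp7 (-s1) x' y' * curveUnit x y
      = 1 / s1 * (-4 + 17 * x - 8 * y + 18 * (x * y) - 7 * x ^ 2) * curveUnit x' y' := by
  have h1 := h.ne1
  have h2 := h.ne2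
  have h3 := h.ne3
  have h4 := h.ne4
  have h5 := h.ne5
  have nx := h.nex
  have ny := h.ney
  have nu := h.neu
  have nv := h.nev
  have ex : x' = y / (1 + y) := by
    rw [h'.hx, h.hv, h.hy]
    field_simp
  have ey : y' = y * (1 - x) / (x * (1 + y)) := by
    rw [h'.hy, h.hv, h.hu, h.hx, h.hy]
    field_simp
  have ef : curveUnit x' y' * (x * (1 + y) ^ 2) = curveUnit x y * y := by
    rw [ex, ey, curveUnit, curveUnit]
    field_simp
    linear_combination h.curve
  have eV : (-7 - 3 * y' - 6 * x' + 4 * x' * y' - 4 * x' ^ 2) * (x * (1 + y) ^ 2)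
      = -(-4 + 17 * x - 8 * y + 18 * (x * y) - 7 * x ^ 2) * y := by
    rw [ex, ey]
    field_simp
    linear_combination -7 * h.curve
  rw [comp7]
  have : x * (1 + y) ^ 2 ≠ 0 := by simp [*]
  apply mul_right_cancel₀ this
  linear_combination 1 / (-s1) * curveUnit x y * eV
    - 1 / s1 * (-4 + 17 * x - 8 * y + 18 * (x * y) - 7 * x ^ 2) * ef

lemma comp2_mul_curveUnit {s1 s2 s3 s4 s5 x y x' y' : ℂ} (h : Coords s1 s2 s3 s4 s5 x y)
    (h' : Coords s4 (-s3) s1 s5 (-s2) x' y') :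
    comp2 s1 x' y' * curveUnit x y
      = 1 / s1 * (10 - 4 * x + 9 * y - x * y - 10 * x ^ 2) * curveUnit x' y' := by
  have h1 := h.ne1
  have h2 := h.ne2
  have h3 := h.ne3
  have h4 := h.ne4
  have h5 := h.ne5
  have nx := h.nex
  have ny := h.ney
  have nu := h.neu
  have nv := h.nev
  have ex : x' = (1 - x) / (1 + y) := by
    rw [h'.hx, h.hv, h.hu]
    field_simp
  have ey : y' = x / y := by
    rw [h'.hy, h.hx, h.hy]
    field_simp
  have ef : curveUnit x' y' * (y * (1 + y) ^ 2) = curveUnit x y * (1 - x) * y := by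
    rw [ex, ey, curveUnit, curveUnit]
    field_simp
    linear_combination (3 + y - x) * h.curve
  have eV : (-1 - 13 * y' + 7 * x' + 10 * x' * y' + x' ^ 2) * (y * (1 + y) ^ 2)
      = (10 - 4 * x + 9 * y - x * y - 10 * x ^ 2) * (1 - x) * y := by
    rw [ex, ey]
    field_simp
    linear_combination (-3 - y - 10 * x) * h.curve
  rw [comp2]
  have : y * (1 + y) ^ 2 ≠ 0 := by simp [*]
  apply mul_right_cancel₀ this
  linear_combination 1 / s1 * curveUnit x y * eV
    - 1 / s1 * (10 - 4 * x + 9 * y - x * y - 10 * x ^ 2) * ef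

lemma zpow_eq_zpow_of_dvd {ζ : ℂ} (hζ : ζ ^ 11 = 1) {a b : ℤ} (h : (11 : ℤ) ∣ a - b) :
    ζ ^ a = ζ ^ b := by
  have h0 : ζ ≠ 0 := by
    rintro rfl
    norm_num at hζ
  obtain ⟨c, hc⟩ := h
  rw [show a = 11 * c + b by linarith, zpow_add₀ h0, zpow_mul, zpow_ofNat ζ 11, hζ, one_zpow,
    one_mul]

/-- The function `F` on the punctured unit disc involves only exponents congruent to `r`
modulo `11`. -/
def HasClass (r : ℤ) (F : ℂ → ℂ) : Prop :=
  ∀ ⦃ζ q : ℂ⦄, ζ ^ 11 = 1 → q ≠ 0 → ‖q‖ < 1 → F (ζ * q) = ζ ^ r * F q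

lemma HasClass.mul {r s : ℤ} {F G : ℂ → ℂ} (hF : HasClass r F) (hG : HasClass s G) :
    HasClass (r + s) (fun q ↦ F q * G q) := by
  intro ζ q hζ hq0 hq
  have h0 : ζ ≠ 0 := by
    rintro rfl
    norm_num at hζ
  simp only [hF hζ hq0 hq, hG hζ hq0 hq, zpow_add₀ h0]
  ring

lemma HasClass.div {r s : ℤ} {F G : ℂ → ℂ} (hF : HasClass r F) (hG : HasClass s G) :
    HasClass (r - s) (fun q ↦ F q / G q) := by
  intro ζ q hζ hq0 hq
  have h0 : ζ ≠ 0 := by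
    rintro rfl
    norm_num at hζ
  simp only [hF hζ hq0 hq, hG hζ hq0 hq, zpow_sub₀ h0, div_mul_div_comm]

lemma HasClass.pow {r : ℤ} {F : ℂ → ℂ} (hF : HasClass r F) (n : ℕ) :
    HasClass (r * n) (fun q ↦ F q ^ n) := by
  intro ζ q hζ hq0 hq
  simp only [hF hζ hq0 hq, mul_pow, zpow_mul, zpow_natCast]

lemma HasClass.const_mul {r : ℤ} {F : ℂ → ℂ} (hF : HasClass r F) (c : ℂ) :
    HasClass r (fun q ↦ c * F q) := by
  intro ζ q hζ hq0 hq
  simp only [hF hζ hq0 hq]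
  ring

lemma HasClass.neg {r : ℤ} {F : ℂ → ℂ} (hF : HasClass r F) : HasClass r (fun q ↦ -F q) := by
  intro ζ q hζ hq0 hq
  simp only [hF hζ hq0 hq]
  ring

lemma HasClass.of_dvd {r s : ℤ} {F : ℂ → ℂ} (hF : HasClass r F) (h : (11 : ℤ) ∣ s - r) :
    HasClass s F := by
  intro ζ q hζ hq0 hq
  rw [hF hζ hq0 hq, zpow_eq_zpow_of_dvd hζ h]

lemma hasClass_const (c : ℂ) : HasClass 0 (fun _ ↦ c) := by
  intro ζ q hζ hq0 hq
  simp

lemma hasClass_pow (n : ℕ) : HasClass n (fun q ↦ q ^ n) := by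
  intro ζ q hζ hq0 hq
  simp only [mul_pow, zpow_natCast]

lemma mul_pow_of_dvd {ζ : ℂ} (hζ : ζ ^ 11 = 1) (q : ℂ) {n : ℕ} (hn : 11 ∣ n) :
    (ζ * q) ^ n = q ^ n := by
  obtain ⟨m, rfl⟩ := hn
  rw [mul_pow, pow_mul ζ, hζ, one_pow, one_mul]

lemma hasClass_comp_pow {n : ℕ} (hn : 11 ∣ n) (F : ℂ → ℂ) : HasClass 0 (fun q ↦ F (q ^ n)) := by
  intro ζ q hζ hq0 hq
  simp only [mul_pow_of_dvd hζ q hn, zpow_zero, one_mul]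

lemma hasClass_tau (k : ℤ) : HasClass (texp k) (fun q ↦ tau q k) := by
  intro ζ q hζ hq0 hq
  simp only [tau]
  rw [mul_pow_of_dvd hζ q (by norm_num), mul_zpow, mul_zpow,
    zpow_eq_zpow_of_dvd hζ (a := 11 * k) (b := 0) (by simp), zpow_zero, one_mul, mul_assoc]

lemma hasClass_rankClassSum (b c : ℤ) :
    HasClass (3 * tri (c + 1) + b * c) (fun q ↦ rankClassSum q b c) := by
  intro ζ q hζ hq0 hq
  simp only [rankClassSum]
  rw [← tsum_mul_left]
  refine tsum_congr fun l ↦ ?_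
  simp only [rankTerm]
  rw [mul_zpow, mul_zpow, zpow_eq_zpow_of_dvd hζ (a := 11 * _) (b := 0) (by simp), zpow_zero,
    one_mul, zpow_eq_zpow_of_dvd hζ (b := 3 * tri (c + 1) + b * c)]
  · ring
  · have h1 : (11 : ℤ) ∣ tri (11 * l) := by
      have h2 := two_mul_tri (11 * l)
      rw [mul_assoc] at h2
      generalize l * (11 * l - 1) = m at h2
      omega
    rw [show 11 * l + c + 1 = 11 * l + (c + 1) by ring, tri_add]
    obtain ⟨m, hm⟩ := h1
    exact ⟨3 * m + 3 * (l * (c + 1)) + b * l, by rw [hm]; ring⟩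

/-- A primitive eleventh root of unity. -/
noncomputable def omega : ℂ := Complex.exp (2 * Real.pi * Complex.I / (11 : ℕ))

lemma omega_isPrimitiveRoot : IsPrimitiveRoot omega 11 := Complex.isPrimitiveRoot_exp 11 (by simp)

lemma omega_ne_zero : omega ≠ 0 := omega_isPrimitiveRoot.ne_zero (by simp)

lemma omega_pow_pow (j : ℕ) : (omega ^ j) ^ 11 = 1 := by
  rw [← pow_mul, mul_comm, pow_mul, omega_isPrimitiveRoot.pow_eq_one, one_pow]

lemma sum_omega_zpow (r : ℤ) : ∑ j ∈ Finset.range 11, (omega ^ j) ^ r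
    = if (11 : ℤ) ∣ r then 11 else 0 := by
  have e : ∀ j : ℕ, (omega ^ j) ^ r = (omega ^ r) ^ j := fun j ↦ by
    rw [← zpow_natCast, ← zpow_natCast, ← zpow_mul, ← zpow_mul, mul_comm]
  simp only [e]
  split_ifs with h
  · rw [(omega_isPrimitiveRoot.zpow_eq_one_iff_dvd r).2 (by exact_mod_cast h)]
    simp
  · have h1 : omega ^ r ≠ 1 := fun h' ↦
      h (by exact_mod_cast (omega_isPrimitiveRoot.zpow_eq_one_iff_dvd r).1 h')
    rw [geom_sum_eq h1, ← e, omega_isPrimitiveRoot.pow_eq_one]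
    simp

/-- The part of `F` with exponents congruent to four modulo eleven. -/
noncomputable def sect (F : ℂ → ℂ) (q : ℂ) : ℂ :=
  (∑ j ∈ Finset.range 11, (omega ^ j) ^ (-4 : ℤ) * F (omega ^ j * q)) / 11

lemma sect_of_hasClass {r : ℤ} {F : ℂ → ℂ} (hF : HasClass r F) {q : ℂ} (hq0 : q ≠ 0)
    (hq : ‖q‖ < 1) : sect F q = if (11 : ℤ) ∣ r - 4 then F q else 0 := by
  have h : ∀ j : ℕ, (omega ^ j) ^ (-4 : ℤ) * F (omega ^ j * q) = (omega ^ j) ^ (r - 4) * F q :=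
    fun j ↦ by
      rw [hF (omega_pow_pow j) hq0 hq, ← mul_assoc, ← zpow_add₀ (pow_ne_zero _ omega_ne_zero)]
      congr 2
      ring
  simp only [sect, h, ← Finset.sum_mul, sum_omega_zpow]
  split_ifs <;> simp

lemma sect_add (F G : ℂ → ℂ) (q : ℂ) : sect (fun q ↦ F q + G q) q = sect F q + sect G q := by
  simp only [sect, mul_add, Finset.sum_add_distrib, add_div]

lemma sect_mul_left (c : ℂ) (F : ℂ → ℂ) (q : ℂ) : sect (fun q ↦ c * F q) q = c * sect F q := by
  simp only [sect, mul_left_comm _ c, ← Finset.mul_sum, mul_div_assoc]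

lemma sect_sum {ι : Type*} (s : Finset ι) (F : ι → ℂ → ℂ) (q : ℂ) :
    sect (fun q ↦ ∑ i ∈ s, F i q) q = ∑ i ∈ s, sect (F i) q := by
  simp only [sect, Finset.mul_sum]
  rw [Finset.sum_comm, Finset.sum_div]

lemma norm_omega_pow_mul (j : ℕ) (q : ℂ) : ‖omega ^ j * q‖ = ‖q‖ := by
  rw [norm_mul, norm_pow, omega_isPrimitiveRoot.norm'_eq_one (by simp), one_pow, one_mul]

lemma sect_congr {F G : ℂ → ℂ} (h : ∀ q, q ≠ 0 → ‖q‖ < 1 → F q = G q) {q : ℂ} (hq0 : q ≠ 0)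
    (hq : ‖q‖ < 1) : sect F q = sect G q := by
  simp only [sect]
  congr 1
  refine Finset.sum_congr rfl fun j _ ↦ ?_
  rw [h _ (mul_ne_zero (pow_ne_zero _ omega_ne_zero) hq0) (by rwa [norm_omega_pow_mul])]

/-- The first coordinate of the modular curve as a function of the nome. -/
noncomputable def coordX (z : ℤ) (q : ℂ) : ℂ := -tau q z ^ 2 / (tau q (2 * z) * tau q (3 * z))

/-- The second coordinate of the modular curve as a function of the nome. -/
noncomputable def coordY (z : ℤ) (q : ℂ) : ℂ :=
  tau q z * tau q (3 * z) * tau q (5 * z) / (tau q (2 * z) ^ 2 * tau q (4 * z))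

lemma coords_tau {q : ℂ} (hq0 : q ≠ 0) (hq : ‖q‖ < 1) {z : ℤ} (hz : Even z) (hz' : ¬ (11 : ℤ) ∣ z) :
    Coords (tau q z) (tau q (2 * z)) (tau q (3 * z)) (tau q (4 * z)) (tau q (5 * z))
      (coordX z q) (coordY z q) :=
  (levelEleven_tau hq0 hq hz hz').coords

lemma hasClass_coordX {z : ℤ} (hz : Even z) : HasClass 0 (coordX z) := by
  refine ((((hasClass_tau z).pow 2).neg).div ((hasClass_tau (2 * z)).mul
    (hasClass_tau (3 * z)))).of_dvd ?_
  obtain ⟨w, rfl⟩ := hz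
  have e1 := two_mul_texp (w + w)
  have e2 := two_mul_texp (2 * (w + w))
  have e3 := two_mul_texp (3 * (w + w))
  exact ⟨2 * w ^ 2 - 3 * w, by push_cast; linarith⟩

lemma hasClass_coordY {z : ℤ} (hz : Even z) : HasClass 0 (coordY z) := by
  refine ((((hasClass_tau z).mul (hasClass_tau (3 * z))).mul (hasClass_tau (5 * z))).div
    (((hasClass_tau (2 * z)).pow 2).mul (hasClass_tau (4 * z)))).of_dvd ?_
  obtain ⟨w, rfl⟩ := hz
  have e1 := two_mul_texp (w + w)
  have e2 := two_mul_texp (2 * (w + w))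
  have e3 := two_mul_texp (3 * (w + w))
  have e4 := two_mul_texp (4 * (w + w))
  have e5 := two_mul_texp (5 * (w + w))
  exact ⟨-2 * w ^ 2 + w, by push_cast; linarith⟩

/-- A component of the dissected quotient as a function of the nome. -/
noncomputable def compTau (k : Fin 11) (z : ℤ) (q : ℂ) : ℂ :=
  comp k (tau q z) (tau q (2 * z)) (tau q (3 * z)) (tau q (4 * z)) (tau q (5 * z))
    (coordX z q) (coordY z q)

lemma hasClass_compTau (k : Fin 11) (w : ℤ) :
    HasClass (2 * w ^ 2 * k - 4) (compTau k (2 * w)) := by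
  intro ζ q hζ hq0 hq
  have h0 : ζ ≠ 0 := by
    rintro rfl
    norm_num at hζ
  have key : ∀ (i : ℤ) (κ : ℕ), (11 : ℤ) ∣ i ^ 2 - κ →
      tau (ζ * q) (i * (2 * w)) = ζ ^ (4 : ℤ) * (ζ ^ (2 * w ^ 2)) ^ κ * tau q (i * (2 * w)) := by
    intro i κ h
    have h1 := hasClass_tau (i * (2 * w)) hζ hq0 hq
    simp only at h1
    rw [h1, ← zpow_natCast, ← zpow_mul, ← zpow_add₀ h0,
      zpow_eq_zpow_of_dvd hζ]
    obtain ⟨m, hm⟩ := h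
    have h2 := two_mul_texp (i * (2 * w))
    have h3 : 2 * w ^ 2 * (i ^ 2 - κ) = 2 * w ^ 2 * (11 * m) := by rw [hm]
    exact ⟨2 * w ^ 2 * m - w * i + 1, by linarith⟩
  have k1 := key 1 1 (by norm_num)
  have k2 := key 2 4 (by norm_num)
  have k3 := key 3 9 (by norm_num)
  have k4 := key 4 5 (by norm_num)
  have k5 := key 5 3 (by norm_num)
  rw [one_mul, pow_one] at k1
  simp only [compTau]
  rw [k1, k2, k3, k4, k5, comp_scale k (by rw [← zpow_natCast, ← zpow_mul,
    zpow_eq_zpow_of_dvd hζ (b := 0) (by simp), zpow_zero]) (zpow_ne_zero _ h0),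
    hasClass_coordX (even_two_mul w) hζ hq0 hq, hasClass_coordY (even_two_mul w) hζ hq0 hq,
    zpow_zero, one_mul, one_mul, ← zpow_natCast, ← zpow_mul, ← zpow_sub₀ h0]

/-- The unit of the modular curve as a function of the nome. -/
noncomputable def unitTau (z : ℤ) (q : ℂ) : ℂ := curveUnit (coordX z q) (coordY z q)

lemma hasClass_unitTau {z : ℤ} (hz : Even z) : HasClass 0 (unitTau z) := by
  intro ζ q hζ hq0 hq
  simp only [unitTau, hasClass_coordX hz hζ hq0 hq, hasClass_coordY hz hζ hq0 hq, zpow_zero,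
    one_mul]

lemma unitTau_ne_zero {q : ℂ} (hq0 : q ≠ 0) (hq : ‖q‖ < 1) {z : ℤ} (hz : Even z)
    (hz' : ¬ (11 : ℤ) ∣ z) : unitTau z q ≠ 0 := by
  have h := coords_tau hq0 hq hz hz'
  have h1 := curveUnit_tau hq0 hq hz h
  intro h2
  rw [unitTau] at h2
  rw [h2, zero_mul, zero_mul] at h1
  have := h.ne1
  have := h.ne3
  have := h.ne4
  have := h.ne5
  simp [*] at h1

/-- The section of the generalized Lambert quotient attached to the residue `z`. -/
lemma sect_rankSum_div {w : ℤ} (hw : ¬ (11 : ℤ) ∣ 2 * w) {k : Fin 11}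
    (hE : ∀ q : ℂ, q ≠ 0 → ‖q‖ < 1 → poch q q = q ^ 5 * poch (q ^ 121) (q ^ 121)
      * eulerQuot (tau q (2 * w)) (tau q (2 * (2 * w))) (tau q (3 * (2 * w)))
        (tau q (4 * (2 * w))) (tau q (5 * (2 * w))))
    (hk : ∀ l : Fin 11, (11 : ℤ) ∣ 6 + 2 * w ^ 2 * l - 4 ↔ l = k)
    (hm : ¬ (11 : ℤ) ∣ 3 * tri (2 * w + 1) + (15 - 3 * (2 * w)) * (2 * w) - 5 - 4)
    {q : ℂ} (hq0 : q ≠ 0) (hq : ‖q‖ < 1) :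
    sect (fun q ↦ (rankSum q (15 - 3 * (2 * w)) - (1 - 3 * ((2 * w : ℤ) : ℂ) / 11)) / poch q q) q
      = poch (q ^ 121) (q ^ 121) ^ 2 * q ^ 10 * compTau k (2 * w) q / (11 * unitTau (2 * w) q) := by
  have c1 : HasClass _ (fun q ↦ rankClassSum q (15 - 3 * (2 * w)) (2 * w)
      / (q ^ 5 * poch (q ^ 121) (q ^ 121))) :=
    (hasClass_rankClassSum _ _).div ((hasClass_pow 5).mul
      (hasClass_comp_pow (n := 121) (by norm_num) fun t ↦ poch t t))
  have c2 : ∀ l, HasClass _ (fun q ↦ poch (q ^ 121) (q ^ 121) ^ 2 * q ^ 10 * compTau l (2 * w) q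
      / (11 * unitTau (2 * w) q)) := fun l ↦
    ((((hasClass_comp_pow (n := 121) (by norm_num) fun t ↦ poch t t).pow 2).mul
      (hasClass_pow 10)).mul (hasClass_compTau l w)).div
      ((hasClass_unitTau (even_two_mul w)).const_mul 11)
  have e : ∀ q : ℂ, q ≠ 0 → ‖q‖ < 1 →
      (rankSum q (15 - 3 * (2 * w)) - (1 - 3 * ((2 * w : ℤ) : ℂ) / 11)) / poch q q
      = rankClassSum q (15 - 3 * (2 * w)) (2 * w) / (q ^ 5 * poch (q ^ 121) (q ^ 121))
        + ∑ l, poch (q ^ 121) (q ^ 121) ^ 2 * q ^ 10 * compTau l (2 * w) q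
          / (11 * unitTau (2 * w) q) := by
    intro q hq0 hq
    have h1 := eulerQuot_mul_sum_comp (coords_tau hq0 hq (even_two_mul w) hw)
    have h2 := hE q hq0 hq
    have h3 := rankSum_dissection hq0 hq (even_two_mul w) hw
    have h4 := unitTau_ne_zero hq0 hq (even_two_mul w) hw
    have h5 := poch_self_ne_zero hq
    have h6 := poch_self_ne_zero (norm_pow_121 hq)
    rw [← Finset.sum_div, ← Finset.mul_sum, h3, h2]
    rw [h2] at h5
    have h7 := right_ne_zero_of_mul h5
    change _ = 11 * unitTau (2 * w) q * _ at h1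
    change _ * ∑ l, compTau l (2 * w) q = _ at h1
    generalize eulerQuot _ _ _ _ _ = E at *
    generalize rankQuot _ _ _ _ _ = R at *
    generalize ∑ l, compTau l (2 * w) q = C at *
    generalize unitTau (2 * w) q = U at *
    generalize poch (q ^ 121) (q ^ 121) = J at *
    field_simp
    linear_combination -q ^ 15 * J ^ 3 * h1
  rw [sect_congr e hq0 hq, sect_add, sect_of_hasClass c1 hq0 hq, if_neg, zero_add, sect_sum]
  · rw [Finset.sum_congr rfl fun l _ ↦ sect_of_hasClass (c2 l) hq0 hq, Finset.sum_eq_single k]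
    · rw [if_pos]
      convert (hk k).2 rfl using 1
      push_cast
      ring
    · intro l _ hl
      rw [if_neg]
      intro h
      refine hl ((hk l).1 ?_)
      convert h using 1
      push_cast
      ring
    · simp
  · convert hm using 2
    push_cast
    ring

lemma tau_eq_of_sub {q : ℂ} (hq0 : q ≠ 0) {k l : ℤ} (h : (22 : ℤ) ∣ k - l) :
    tau q k = tau q l := by
  obtain ⟨m, hm⟩ := h
  rw [show k = l + 22 * m by linarith, tau_add_mul hq0]

lemma tau_eq_neg_of_add {q : ℂ} (hq0 : q ≠ 0) {k l : ℤ} (h : (22 : ℤ) ∣ k + l) :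
    tau q k = -tau q l := by
  rw [← tau_neg hq0, tau_eq_of_sub hq0]
  simpa using h

lemma tau_eleven_sub {q : ℂ} (hq0 : q ≠ 0) (k : ℤ) : tau q (11 - k) = tau q k := by
  rw [show 11 - k = -k + 11 by ring, tau_add hq0, tau_neg hq0, neg_neg]

lemma poch_eq_eulerQuot_two {q : ℂ} (hq0 : q ≠ 0) (hq : ‖q‖ < 1) :
    poch q q = q ^ 5 * poch (q ^ 121) (q ^ 121)
      * eulerQuot (tau q 2) (tau q 4) (tau q 6) (tau q 8) (tau q 10) := by
  rw [poch_eq_eulerQuot hq0 hq, ← tau_eleven_sub hq0 5, ← tau_eleven_sub hq0 3,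
    ← tau_eleven_sub hq0 1]
  norm_num

/-- The common factor of the sections of the rank functions. -/
noncomputable def unitFactor (q : ℂ) : ℂ :=
  poch (q ^ 121) (q ^ 121) ^ 2 * q ^ 10 / (unitTau 2 q * tau q 2)

lemma sect_rankSum_nine {q : ℂ} (hq0 : q ≠ 0) (hq : ‖q‖ < 1) :
    sect (fun q ↦ (rankSum q 9 - 5 / 11) / poch q q) q
      = unitFactor q / 11 * (-3 - coordX 2 q - 6 * coordY 2 q - 14 * (coordX 2 q * coordY 2 q)
        - 8 * coordX 2 q ^ 2) := by
  have h := sect_rankSum_div (w := 1) (by norm_num) (k := 10)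
    (by simpa using fun q ↦ poch_eq_eulerQuot_two) (by decide) (by decide) hq0 hq
  norm_num at h
  rw [h, compTau]
  change _ * comp10 _ _ _ / _ = _
  rw [comp10, unitFactor]
  ring

lemma sect_rankSum_neg_three {q : ℂ} (hq0 : q ≠ 0) (hq : ‖q‖ < 1) :
    sect (fun q ↦ (rankSum q (-3) + 7 / 11) / poch q q) q
      = unitFactor q / 11 * (-9 - 3 * coordX 2 q - 7 * coordY 2 q - 9 * (coordX 2 q * coordY 2 q)
        - 13 * coordX 2 q ^ 2) := by
  have e : ∀ q : ℂ, q ≠ 0 → tau q 12 = -tau q 10 ∧ tau q 18 = -tau q 4 ∧ tau q 24 = tau q 2 ∧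
      tau q 30 = tau q 8 := fun q hq0 ↦
    ⟨tau_eq_neg_of_add hq0 (by norm_num), tau_eq_neg_of_add hq0 (by norm_num),
      tau_eq_of_sub hq0 (by norm_num), tau_eq_of_sub hq0 (by norm_num)⟩
  have h := sect_rankSum_div (w := 3) (by norm_num) (k := 6) (by
    norm_num
    intro q hq0 hq
    obtain ⟨e1, e2, e3, e4⟩ := e q hq0
    rw [poch_eq_eulerQuot_two hq0 hq, e1, e2, e3, e4]
    simp only [eulerQuot, neg_div, div_neg]
    ring) (by decide) (by decide) hq0 hq
  norm_num at h
  obtain ⟨e1, e2, e3, e4⟩ := e q hq0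
  have k1 := coords_tau hq0 hq (z := 2) (by decide) (by decide)
  have k2 := coords_tau hq0 hq (z := 6) (by decide) (by decide)
  have u1 := unitTau_ne_zero hq0 hq (z := 2) (by decide) (by decide)
  have u2 := unitTau_ne_zero hq0 hq (z := 6) (by decide) (by decide)
  norm_num at k1 k2
  rw [e1, e2, e3, e4] at k2
  have k3 := comp6_mul_curveUnit k1 k2
  have k4 : compTau 6 6 q = comp6 (tau q 2) (coordX 6 q) (coordY 6 q) := by
    rw [← e3]
    rfl
  rw [← unitTau, ← unitTau, ← k4] at k3
  have k5 := eq_div_of_mul_eq u1 k3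
  rw [h, k5, unitFactor]
  field_simp

lemma sect_rankSum_neg_fifteen {q : ℂ} (hq0 : q ≠ 0) (hq : ‖q‖ < 1) :
    sect (fun q ↦ (rankSum q (-15) + 19 / 11) / poch q q) q
      = unitFactor q / 11 * (-4 + 17 * coordX 2 q - 8 * coordY 2 q
        + 18 * (coordX 2 q * coordY 2 q) - 7 * coordX 2 q ^ 2) := by
  have e : ∀ q : ℂ, q ≠ 0 → tau q 20 = -tau q 2 ∧ tau q 30 = tau q 8 ∧ tau q 40 = -tau q 4 ∧
      tau q 50 = tau q 6 := fun q hq0 ↦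
    ⟨tau_eq_neg_of_add hq0 (by norm_num), tau_eq_of_sub hq0 (by norm_num),
      tau_eq_neg_of_add hq0 (by norm_num), tau_eq_of_sub hq0 (by norm_num)⟩
  have h := sect_rankSum_div (w := 5) (by norm_num) (k := 7) (by
    norm_num
    intro q hq0 hq
    obtain ⟨e1, e2, e3, e4⟩ := e q hq0
    rw [poch_eq_eulerQuot_two hq0 hq, e1, e2, e3, e4]
    simp only [eulerQuot, neg_div, div_neg]
    ring) (by decide) (by decide) hq0 hq
  norm_num at h
  obtain ⟨e1, e2, e3, e4⟩ := e q hq0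
  have k1 := coords_tau hq0 hq (z := 2) (by decide) (by decide)
  have k2 := coords_tau hq0 hq (z := 10) (by decide) (by decide)
  have u1 := unitTau_ne_zero hq0 hq (z := 2) (by decide) (by decide)
  have u2 := unitTau_ne_zero hq0 hq (z := 10) (by decide) (by decide)
  norm_num at k1 k2
  rw [e1, e2, e3, e4] at k2
  have k3 := comp7_mul_curveUnit k1 k2
  have k4 : compTau 7 10 q = comp7 (-tau q 2) (coordX 10 q) (coordY 10 q) := by
    rw [← e1]
    rfl
  rw [← unitTau, ← unitTau, ← k4] at k3
  have k5 := eq_div_of_mul_eq u1 k3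
  rw [h, k5, unitFactor]
  field_simp

lemma sect_rankSum_neg_nine {q : ℂ} (hq0 : q ≠ 0) (hq : ‖q‖ < 1) :
    sect (fun q ↦ (rankSum q (-9) + 13 / 11) / poch q q) q
      = unitFactor q / 11 * (10 - 4 * coordX 2 q + 9 * coordY 2 q - coordX 2 q * coordY 2 q
        - 10 * coordX 2 q ^ 2) := by
  have e : ∀ q : ℂ, q ≠ 0 → tau q 16 = -tau q 6 ∧ tau q 24 = tau q 2 ∧ tau q 32 = tau q 10 ∧
      tau q 40 = -tau q 4 := fun q hq0 ↦
    ⟨tau_eq_neg_of_add hq0 (by norm_num), tau_eq_of_sub hq0 (by norm_num),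
      tau_eq_of_sub hq0 (by norm_num), tau_eq_neg_of_add hq0 (by norm_num)⟩
  have h := sect_rankSum_div (w := 4) (by norm_num) (k := 2) (by
    norm_num
    intro q hq0 hq
    obtain ⟨e1, e2, e3, e4⟩ := e q hq0
    rw [poch_eq_eulerQuot_two hq0 hq, e1, e2, e3, e4]
    simp only [eulerQuot, neg_div, div_neg]
    ring) (by decide) (by decide) hq0 hq
  norm_num at h
  obtain ⟨e1, e2, e3, e4⟩ := e q hq0
  have k1 := coords_tau hq0 hq (z := 2) (by decide) (by decide)
  have k2 := coords_tau hq0 hq (z := 8) (by decide) (by decide)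
  have u1 := unitTau_ne_zero hq0 hq (z := 2) (by decide) (by decide)
  have u2 := unitTau_ne_zero hq0 hq (z := 8) (by decide) (by decide)
  norm_num at k1 k2
  rw [e1, e2, e3, e4] at k2
  have k3 := comp2_mul_curveUnit k1 k2
  have k4 : compTau 2 8 q = comp2 (tau q 2) (coordX 8 q) (coordY 8 q) := by
    rw [← e2]
    rfl
  rw [← unitTau, ← unitTau, ← k4] at k3
  have k5 := eq_div_of_mul_eq u1 k3
  rw [h, k5, unitFactor]
  field_simp

section Crank

lemma crank_eq0 {s1 s2 s3 s4 s5 x y t : ℂ} (h : Coords s1 s2 s3 s4 s5 x y)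
    (ht : t ^ 5 + t ^ 4 - 4 * t ^ 3 - 3 * t ^ 2 + 3 * t + 1 = 0) :
    (s5 * (1 / (s5))) * (1) * (1 - 2 * t - 3 * t ^ 2 + t ^ 3 + t ^ 4) +
    (s1 * (1 / (s1))) * (1 - 3 * t ^ 2 + t ^ 4) * (1 + 2 * t - t ^ 2 - t ^ 3) +
    (s4 * (1 / (s4))) * (2 + t - 4 * t ^ 2 + t ^ 4) * (-1 + t + t ^ 2) +
    -(s2 * (1 / (s2))) * (3 - 4 * t ^ 2 + t ^ 4) * (-1 - t) +
    -(s3 * (1 / (s3))) * (-3 * t + t ^ 3) * (1)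
    = 1 * ((1 : ℂ) * (1)) := by
  have h1 := h.ne1
  have h2 := h.ne2
  have h3 := h.ne3
  have h4 := h.ne4
  have h5 := h.ne5
  have t0 : s5 * (1 / (s5)) * (1) = (1) * (1) := by
    field_simp
  have t1 : s1 * (1 / (s1)) * (1) = (1) * (1) := by
    field_simp
  have t2 : s4 * (1 / (s4)) * (1) = (1) * (1) := by
    field_simp
  have t3 : s2 * (1 / (s2)) * (1) = (1) * (1) := by
    field_simp
  have t4 : s3 * (1 / (s3)) * (1) = (1) * (1) := by
    field_simp
  have t5 : (1 : ℂ) * (1) * (1) = (1) * (1) := by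
    field_simp
  linear_combination (1) * (1 - 2 * t - 3 * t ^ 2 + t ^ 3 + t ^ 4) * t0 +
    (1 - 3 * t ^ 2 + t ^ 4) * (1 + 2 * t - t ^ 2 - t ^ 3) * t1 +
    (2 + t - 4 * t ^ 2 + t ^ 4) * (-1 + t + t ^ 2) * t2 +
    -(3 - 4 * t ^ 2 + t ^ 4) * (-1 - t) * t3 +
    -(-3 * t + t ^ 3) * (1) * t4 +
    -1 * t5 +
    (1) * ((2) + (1) * t + (-1) * t ^ 2) * ht

lemma crank_eq1 {s1 s2 s3 s4 s5 x y t : ℂ} (h : Coords s1 s2 s3 s4 s5 x y)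
    (ht : t ^ 5 + t ^ 4 - 4 * t ^ 3 - 3 * t ^ 2 + 3 * t + 1 = 0) :
    (s3 * (1 / (s5))) * (1) * (1) +
    -(s5 * (s3 / (s1 * s4))) * (1 - t) * (1 - 2 * t - 3 * t ^ 2 + t ^ 3 + t ^ 4) +
    -(s1 * (s2 / (s1 * s3))) * (-3 * t ^ 2 + t ^ 4) * (1 + 2 * t - t ^ 2 - t ^ 3) +
    (s4 * (s5 / (s2 * s3))) * (2 - 2 * t - 4 * t ^ 2 + t ^ 3 + t ^ 4) * (-1 + t + t ^ 2) +
    -(s2 * (1 / (s3))) * (-3 * t + t ^ 3) * (-1 - t)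
    = 1 * ((s2 / s1) * (s2 / s1)) + -2 * ((s4 / s2) * (s5 / s3)) := by
  have h1 := h.ne1
  have h2 := h.ne2
  have h3 := h.ne3
  have h4 := h.ne4
  have h5 := h.ne5
  have t0 : s3 * (1 / (s5)) * ((1 + y) ^ 2) = (s3 / (s5)) * ((1 + y) ^ 2) := by
    field_simp
  have t1 : s5 * (s3 / (s1 * s4)) * ((1 + y) ^ 2) = (s3 / (s5)) * (y * (1 + y)) := by
    simp only [h.hv]
    simp only [h.hy]
    field_simp
  have t2 : s1 * (s2 / (s1 * s3)) * ((1 + y) ^ 2) = -(s3 / (s5)) * (x * (1 + y)) := by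
    simp only [h.hv]
    simp only [h.hx]
    field_simp
  have t3 : s4 * (s5 / (s2 * s3)) * ((1 + y) ^ 2) = -(s3 / (s5)) * (x * y * (1 - x)) := by
    simp only [h.hu, h.hv]
    simp only [h.hx, h.hy]
    field_simp
  have t4 : s2 * (1 / (s3)) * ((1 + y) ^ 2) = -(s3 / (s5)) * (x * (1 + y)) := by
    simp only [h.hv]
    simp only [h.hx]
    field_simp
  have t5 : (s2 / s1) * (s2 / s1) * ((1 + y) ^ 2) = (s3 / (s5)) * ((1 + y)) := by
    simp only [h.hv]
    field_simp
  have t6 : (s4 / s2) * (s5 / s3) * ((1 + y) ^ 2) = -(s3 / (s5)) * (x * y * (1 - x)) := by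
    simp only [h.hu, h.hv]
    simp only [h.hx, h.hy]
    field_simp
  have hD : (1 + y) ^ 2 ≠ 0 := by
    have := h.nex; have := h.ney; have := h.neu; have := h.nev
    simp [*]
  refine mul_right_cancel₀ hD ?_
  linear_combination (1) * (1) * t0 +
    -(1 - t) * (1 - 2 * t - 3 * t ^ 2 + t ^ 3 + t ^ 4) * t1 +
    -(-3 * t ^ 2 + t ^ 4) * (1 + 2 * t - t ^ 2 - t ^ 3) * t2 +
    (2 - 2 * t - 4 * t ^ 2 + t ^ 3 + t ^ 4) * (-1 + t + t ^ 2) * t3 +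
    -(-3 * t + t ^ 3) * (-1 - t) * t4 +
    -1 * t5 +
    2 * t6 +
    (s3 / (s5)) * ((-1) + (4) * t ^ 2 + (-1) * t ^ 4) * h.curve +
    (s3 / (s5)) * ((y + y ^ 2 + x + x ^ 2 * y) + (-x * y + x ^ 2 * y) * t + (-x - x * y) * t ^ 2)
        * ht

lemma crank_eq2 {s1 s2 s3 s4 s5 x y t : ℂ} (h : Coords s1 s2 s3 s4 s5 x y) :
    (s2 * (1 / (s5))) * (1) * (-1 - t) +
    -(s3 * (s3 / (s1 * s4))) * (1 - t) * (1) +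
    (s5 * (s4 / (s2 * s5))) * (-2 + t ^ 2) * (1 - 2 * t - 3 * t ^ 2 + t ^ 3 + t ^ 4) +
    -(s4 * (1 / (s2))) * (3 - 4 * t ^ 2 + t ^ 4) * (-1 + t + t ^ 2)
    = 2 * ((1 : ℂ) * (s4 / s2)) + -2 * ((s2 / s1) * (s1 / s5)) := by
  have h1 := h.ne1
  have h2 := h.ne2
  have h3 := h.ne3
  have h4 := h.ne4
  have h5 := h.ne5
  have t0 : s2 * (1 / (s5)) * (x * (1 + y)) = (s2 / (s5)) * (x * (1 + y)) := by
    field_simp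
  have t1 : s3 * (s3 / (s1 * s4)) * (x * (1 + y)) = -(s2 / (s5)) * (y * (1 + y)) := by
    simp only [h.hv]
    simp only [h.hx, h.hy]
    field_simp
  have t2 : s5 * (s4 / (s2 * s5)) * (x * (1 + y)) = (s2 / (s5)) * (x * y * (1 - x)) := by
    simp only [h.hu, h.hv]
    simp only [h.hx, h.hy]
    field_simp
  have t3 : s4 * (1 / (s2)) * (x * (1 + y)) = (s2 / (s5)) * (x * y * (1 - x)) := by
    simp only [h.hu, h.hv]
    simp only [h.hx, h.hy]
    field_simp
  have t4 : (1 : ℂ) * (s4 / s2) * (x * (1 + y)) = (s2 / (s5)) * (x * y * (1 - x)) := by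
    simp only [h.hu, h.hv]
    simp only [h.hx, h.hy]
    field_simp
  have t5 : (s2 / s1) * (s1 / s5) * (x * (1 + y)) = (s2 / (s5)) * (x * (1 + y)) := by
    field_simp
  have hD : x * (1 + y) ≠ 0 := by
    have := h.nex; have := h.ney; have := h.neu; have := h.nev
    simp [*]
  refine mul_right_cancel₀ hD ?_
  linear_combination (1) * (-1 - t) * t0 +
    -(1 - t) * (1) * t1 +
    (-2 + t ^ 2) * (1 - 2 * t - 3 * t ^ 2 + t ^ 3 + t ^ 4) * t2 +
    -(3 - 4 * t ^ 2 + t ^ 4) * (-1 + t + t ^ 2) * t3 +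
    -2 * t4 +
    2 * t5 +
    (s2 / (s5)) * ((1) + (-1) * t) * h.curve

lemma crank_eq3 {s1 s2 s3 s4 s5 x y t : ℂ} (h : Coords s1 s2 s3 s4 s5 x y)
    (ht : t ^ 5 + t ^ 4 - 4 * t ^ 3 - 3 * t ^ 2 + 3 * t + 1 = 0) :
    -(s2 * (s3 / (s1 * s4))) * (1 - t) * (-1 - t) +
    (s3 * (s4 / (s2 * s5))) * (-2 + t ^ 2) * (1) +
    (s5 * (s1 / (s4 * s5))) * (1 - 3 * t + t ^ 3) * (1 - 2 * t - 3 * t ^ 2 + t ^ 3 + t ^ 4) +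
    (s1 * (1 / (s4))) * (2 + t - 4 * t ^ 2 + t ^ 4) * (1 + 2 * t - t ^ 2 - t ^ 3) +
    -(s4 * (1 / (s3))) * (-3 * t + t ^ 3) * (-1 + t + t ^ 2)
    = -2 * ((s2 / s1) * (s3 / s4)) + 1 * ((s1 / s5) * (s1 / s5)) := by
  have h1 := h.ne1
  have h2 := h.ne2
  have h3 := h.ne3
  have h4 := h.ne4
  have h5 := h.ne5
  have t0 : s2 * (s3 / (s1 * s4)) * (y * (1 + y)) = (s2 * s3 / (s1 * s4)) * (y * (1 + y)) := by
    field_simp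
  have t1 : s3 * (s4 / (s2 * s5)) * (y * (1 + y)) = (s2 * s3 / (s1 * s4)) * (y * (1 - x) * (1 + y)) := by
    simp only [h.hu, h.hv]
    simp only [h.hy]
    field_simp
  have t2 : s5 * (s1 / (s4 * s5)) * (y * (1 + y)) = -(s2 * s3 / (s1 * s4)) * (x * y * (1 + y)) := by
    simp only [h.hv]
    simp only [h.hx, h.hy]
    field_simp
  have t3 : s1 * (1 / (s4)) * (y * (1 + y)) = -(s2 * s3 / (s1 * s4)) * (x * y * (1 + y)) := by
    simp only [h.hv]
    simp only [h.hx, h.hy]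
    field_simp
  have t4 : s4 * (1 / (s3)) * (y * (1 + y)) = -(s2 * s3 / (s1 * s4)) * (x * y * (1 - x)) := by
    simp only [h.hu, h.hv]
    simp only [h.hx, h.hy]
    field_simp
  have t5 : (s2 / s1) * (s3 / s4) * (y * (1 + y)) = (s2 * s3 / (s1 * s4)) * (y * (1 + y)) := by
    field_simp
  have t6 : (s1 / s5) * (s1 / s5) * (y * (1 + y)) = -(s2 * s3 / (s1 * s4)) * (x * (1 + y) ^ 2) := by
    simp only [h.hv]
    simp only [h.hx, h.hy]
    field_simp
  have hD : y * (1 + y) ≠ 0 := by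
    have := h.nex; have := h.ney; have := h.neu; have := h.nev
    simp [*]
  refine mul_right_cancel₀ hD ?_
  linear_combination -(1 - t) * (-1 - t) * t0 +
    (-2 + t ^ 2) * (1) * t1 +
    (1 - 3 * t + t ^ 3) * (1 - 2 * t - 3 * t ^ 2 + t ^ 3 + t ^ 4) * t2 +
    (2 + t - 4 * t ^ 2 + t ^ 4) * (1 + 2 * t - t ^ 2 - t ^ 3) * t3 +
    -(-3 * t + t ^ 3) * (-1 + t + t ^ 2) * t4 +
    2 * t5 +
    -1 * t6 +
    (s2 * s3 / (s1 * s4)) * ((1)) * h.curve +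
    (s2 * s3 / (s1 * s4)) * ((x * y - x ^ 2 * y)) * ht

lemma crank_eq4 {s1 s2 s3 s4 s5 x y t : ℂ} (h : Coords s1 s2 s3 s4 s5 x y)
    (ht : t ^ 5 + t ^ 4 - 4 * t ^ 3 - 3 * t ^ 2 + 3 * t + 1 = 0) :
    (s4 * (1 / (s5))) * (1) * (-1 + t + t ^ 2) +
    (s2 * (s4 / (s2 * s5))) * (-2 + t ^ 2) * (-1 - t) +
    (s3 * (s1 / (s4 * s5))) * (1 - 3 * t + t ^ 3) * (1) +
    (s5 * (1 / (s1))) * (1 - 3 * t ^ 2 + t ^ 4) * (1 - 2 * t - 3 * t ^ 2 + t ^ 3 + t ^ 4) +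
    (s1 * (s5 / (s2 * s3))) * (2 - 2 * t - 4 * t ^ 2 + t ^ 3 + t ^ 4) * (1 + 2 * t - t ^ 2 - t ^ 3)
    = 1 * ((s4 / s2) * (s4 / s2)) + 2 * ((s3 / s4) * (s1 / s5)) := by
  have h1 := h.ne1
  have h2 := h.ne2
  have h3 := h.ne3
  have h4 := h.ne4
  have h5 := h.ne5
  have t0 : s4 * (1 / (s5)) * ((1 - x) * (1 + y)) = (s4 / (s5)) * ((1 - x) * (1 + y)) := by
    field_simp
  have t1 : s2 * (s4 / (s2 * s5)) * ((1 - x) * (1 + y)) = (s4 / (s5)) * ((1 - x) * (1 + y)) := by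
    field_simp
  have t2 : s3 * (s1 / (s4 * s5)) * ((1 - x) * (1 + y)) = (s4 / (s5)) * ((1 + y) ^ 2) := by
    simp only [h.hu, h.hv]
    field_simp
  have t3 : s5 * (1 / (s1)) * ((1 - x) * (1 + y)) = (s4 / (s5)) * (y * (1 - x)) := by
    simp only [h.hu, h.hv]
    simp only [h.hy]
    field_simp
  have t4 : s1 * (s5 / (s2 * s3)) * ((1 - x) * (1 + y)) = -(s4 / (s5)) * (x * y * (1 - x)) := by
    simp only [h.hu, h.hv]
    simp only [h.hx, h.hy]
    field_simp
  have t5 : (s4 / s2) * (s4 / s2) * ((1 - x) * (1 + y)) = (s4 / (s5)) * (y * (1 - x) ^ 2) := by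
    simp only [h.hu, h.hv]
    simp only [h.hy]
    field_simp
  have t6 : (s3 / s4) * (s1 / s5) * ((1 - x) * (1 + y)) = (s4 / (s5)) * ((1 + y) ^ 2) := by
    simp only [h.hu, h.hv]
    field_simp
  have hD : (1 - x) * (1 + y) ≠ 0 := by
    have := h.nex; have := h.ney; have := h.neu; have := h.nev
    simp [*]
  refine mul_right_cancel₀ hD ?_
  linear_combination (1) * (-1 + t + t ^ 2) * t0 +
    (-2 + t ^ 2) * (-1 - t) * t1 +
    (1 - 3 * t + t ^ 3) * (1) * t2 +
    (1 - 3 * t ^ 2 + t ^ 4) * (1 - 2 * t - 3 * t ^ 2 + t ^ 3 + t ^ 4) * t3 +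
    (2 - 2 * t - 4 * t ^ 2 + t ^ 3 + t ^ 4) * (1 + 2 * t - t ^ 2 - t ^ 3) * t4 +
    -1 * t5 +
    -2 * t6 +
    (s4 / (s5)) * ((-1) + (-3) * t + (1) * t ^ 3) * h.curve +
    (s4 / (s5)) * ((-2 * x * y + 2 * x ^ 2 * y) + (-2 * y + 3 * x * y - x ^ 2 * y) * t
        + (x * y - x ^ 2 * y) * t ^ 2 + (y - x * y) * t ^ 3) * ht

lemma crank_eq5 {s1 s2 s3 s4 s5 x y t : ℂ} (h : Coords s1 s2 s3 s4 s5 x y)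
    (ht : t ^ 5 + t ^ 4 - 4 * t ^ 3 - 3 * t ^ 2 + 3 * t + 1 = 0) :
    -(s4 * (s3 / (s1 * s4))) * (1 - t) * (-1 + t + t ^ 2) +
    (s2 * (s1 / (s4 * s5))) * (1 - 3 * t + t ^ 3) * (-1 - t) +
    (s3 * (1 / (s1))) * (1 - 3 * t ^ 2 + t ^ 4) * (1) +
    -(s5 * (s2 / (s1 * s3))) * (-3 * t ^ 2 + t ^ 4) * (1 - 2 * t - 3 * t ^ 2 + t ^ 3 + t ^ 4) +
    -(s1 * (1 / (s2))) * (3 - 4 * t ^ 2 + t ^ 4) * (1 + 2 * t - t ^ 2 - t ^ 3)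
    = -2 * ((s2 / s1) * (s5 / s3)) + 1 * ((s3 / s4) * (s3 / s4)) := by
  have h1 := h.ne1
  have h2 := h.ne2
  have h3 := h.ne3
  have h4 := h.ne4
  have h5 := h.ne5
  have t0 : s4 * (s3 / (s1 * s4)) * (y * (1 - x) * (1 + y)) = (s3 / (s1)) * (y * (1 - x) * (1 + y)) := by
    field_simp
  have t1 : s2 * (s1 / (s4 * s5)) * (y * (1 - x) * (1 + y)) = -(s3 / (s1)) * (x * (1 + y) ^ 2) := by
    simp only [h.hu, h.hv]
    simp only [h.hx, h.hy]
    field_simp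
  have t2 : s3 * (1 / (s1)) * (y * (1 - x) * (1 + y)) = (s3 / (s1)) * (y * (1 - x) * (1 + y)) := by
    field_simp
  have t3 : s5 * (s2 / (s1 * s3)) * (y * (1 - x) * (1 + y)) = -(s3 / (s1)) * (x * y * (1 - x)) := by
    simp only [h.hu, h.hv]
    simp only [h.hx, h.hy]
    field_simp
  have t4 : s1 * (1 / (s2)) * (y * (1 - x) * (1 + y)) = -(s3 / (s1)) * (x * y * (1 - x) * (1 + y)) := by
    simp only [h.hu, h.hv]
    simp only [h.hx, h.hy]
    field_simp
  have t5 : (s2 / s1) * (s5 / s3) * (y * (1 - x) * (1 + y)) = -(s3 / (s1)) * (x * y * (1 - x)) := by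
    simp only [h.hu, h.hv]
    simp only [h.hx, h.hy]
    field_simp
  have t6 : (s3 / s4) * (s3 / s4) * (y * (1 - x) * (1 + y)) = (s3 / (s1)) * (y * (1 + y) ^ 2) := by
    simp only [h.hu, h.hv]
    simp only [h.hy]
    field_simp
  have hD : y * (1 - x) * (1 + y) ≠ 0 := by
    have := h.nex; have := h.ney; have := h.neu; have := h.nev
    simp [*]
  refine mul_right_cancel₀ hD ?_
  linear_combination -(1 - t) * (-1 + t + t ^ 2) * t0 +
    (1 - 3 * t + t ^ 3) * (-1 - t) * t1 +
    (1 - 3 * t ^ 2 + t ^ 4) * (1) * t2 +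
    -(-3 * t ^ 2 + t ^ 4) * (1 - 2 * t - 3 * t ^ 2 + t ^ 3 + t ^ 4) * t3 +
    -(3 - 4 * t ^ 2 + t ^ 4) * (1 + 2 * t - t ^ 2 - t ^ 3) * t4 +
    2 * t5 +
    -1 * t6 +
    (s3 / (s1)) * ((1 - y) + (-2) * t + (-3) * t ^ 2 + (1) * t ^ 3 + (1) * t ^ 4) * h.curve +
    (s3 / (s1)) * ((2 * x * y + 2 * x * y ^ 2 - 2 * x ^ 2 * y - 2 * x ^ 2 * y ^ 2)
        + (-2 * x * y + 2 * x ^ 2 * y) * t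
        + (-x * y - x * y ^ 2 + x ^ 2 * y + x ^ 2 * y ^ 2) * t ^ 2 + (x * y - x ^ 2 * y) * t ^ 3)
        * ht

lemma crank_eq6 {s1 s2 s3 s4 s5 x y t : ℂ} (h : Coords s1 s2 s3 s4 s5 x y)
    (ht : t ^ 5 + t ^ 4 - 4 * t ^ 3 - 3 * t ^ 2 + 3 * t + 1 = 0) :
    (s4 * (s4 / (s2 * s5))) * (-2 + t ^ 2) * (-1 + t + t ^ 2) +
    (s2 * (1 / (s1))) * (1 - 3 * t ^ 2 + t ^ 4) * (-1 - t) +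
    -(s3 * (s2 / (s1 * s3))) * (-3 * t ^ 2 + t ^ 4) * (1) +
    -(s1 * (1 / (s3))) * (-3 * t + t ^ 3) * (1 + 2 * t - t ^ 2 - t ^ 3)
    = 2 * ((1 : ℂ) * (s2 / s1)) + 2 * ((s5 / s3) * (s1 / s5)) := by
  have h1 := h.ne1
  have h2 := h.ne2
  have h3 := h.ne3
  have h4 := h.ne4
  have h5 := h.ne5
  have t0 : s4 * (s4 / (s2 * s5)) * ((1 - x)) = (s4 ^ 2 / (s2 * s5)) * ((1 - x)) := by
    field_simp
  have t1 : s2 * (1 / (s1)) * ((1 - x)) = (s4 ^ 2 / (s2 * s5)) * (1) := by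
    simp only [h.hu]
    field_simp
  have t2 : s3 * (s2 / (s1 * s3)) * ((1 - x)) = (s4 ^ 2 / (s2 * s5)) * (1) := by
    simp only [h.hu]
    field_simp
  have t3 : s1 * (1 / (s3)) * ((1 - x)) = -(s4 ^ 2 / (s2 * s5)) * (x) := by
    simp only [h.hu]
    simp only [h.hx]
    field_simp
  have t4 : (1 : ℂ) * (s2 / s1) * ((1 - x)) = (s4 ^ 2 / (s2 * s5)) * (1) := by
    simp only [h.hu]
    field_simp
  have t5 : (s5 / s3) * (s1 / s5) * ((1 - x)) = -(s4 ^ 2 / (s2 * s5)) * (x) := by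
    simp only [h.hu]
    simp only [h.hx]
    field_simp
  have hD : (1 - x) ≠ 0 := by
    have := h.nex; have := h.ney; have := h.neu; have := h.nev
    simp [*]
  refine mul_right_cancel₀ hD ?_
  linear_combination (-2 + t ^ 2) * (-1 + t + t ^ 2) * t0 +
    (1 - 3 * t ^ 2 + t ^ 4) * (-1 - t) * t1 +
    -(-3 * t ^ 2 + t ^ 4) * (1) * t2 +
    -(-3 * t + t ^ 3) * (1 + 2 * t - t ^ 2 - t ^ 3) * t3 +
    -2 * t4 +
    -2 * t5 +
    (s4 ^ 2 / (s2 * s5)) * ((-1) + (-x) * t) * ht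

lemma crank_eq7 {s1 s2 s3 s4 s5 x y t : ℂ} (h : Coords s1 s2 s3 s4 s5 x y)
    (ht : t ^ 5 + t ^ 4 - 4 * t ^ 3 - 3 * t ^ 2 + 3 * t + 1 = 0) :
    (s1 * (1 / (s5))) * (1) * (1 + 2 * t - t ^ 2 - t ^ 3) +
    (s4 * (s1 / (s4 * s5))) * (1 - 3 * t + t ^ 3) * (-1 + t + t ^ 2) +
    -(s2 * (s2 / (s1 * s3))) * (-3 * t ^ 2 + t ^ 4) * (-1 - t) +
    (s5 * (1 / (s4))) * (2 + t - 4 * t ^ 2 + t ^ 4) * (1 - 2 * t - 3 * t ^ 2 + t ^ 3 + t ^ 4)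
    = -2 * ((1 : ℂ) * (s1 / s5)) + 2 * ((s5 / s3) * (s3 / s4)) := by
  have h1 := h.ne1
  have h2 := h.ne2
  have h3 := h.ne3
  have h4 := h.ne4
  have h5 := h.ne5
  have t0 : s1 * (1 / (s5)) * ((1 + y)) = (s1 / (s5)) * ((1 + y)) := by
    field_simp
  have t1 : s4 * (s1 / (s4 * s5)) * ((1 + y)) = (s1 / (s5)) * ((1 + y)) := by
    field_simp
  have t2 : s2 * (s2 / (s1 * s3)) * ((1 + y)) = (s1 / (s5)) * (1) := by
    simp only [h.hv]
    field_simp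
  have t3 : s5 * (1 / (s4)) * ((1 + y)) = (s1 / (s5)) * (y) := by
    simp only [h.hv]
    simp only [h.hy]
    field_simp
  have t4 : (1 : ℂ) * (s1 / s5) * ((1 + y)) = (s1 / (s5)) * ((1 + y)) := by
    field_simp
  have t5 : (s5 / s3) * (s3 / s4) * ((1 + y)) = (s1 / (s5)) * (y) := by
    simp only [h.hv]
    simp only [h.hy]
    field_simp
  have hD : (1 + y) ≠ 0 := by
    have := h.nex; have := h.ney; have := h.neu; have := h.nev
    simp [*]
  refine mul_right_cancel₀ hD ?_
  linear_combination (1) * (1 + 2 * t - t ^ 2 - t ^ 3) * t0 +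
    (1 - 3 * t + t ^ 3) * (-1 + t + t ^ 2) * t1 +
    -(-3 * t ^ 2 + t ^ 4) * (-1 - t) * t2 +
    (2 + t - 4 * t ^ 2 + t ^ 4) * (1 - 2 * t - 3 * t ^ 2 + t ^ 3 + t ^ 4) * t3 +
    2 * t4 +
    -2 * t5 +
    (s1 / (s5)) * ((2 + 2 * y) + (-3 * y) * t + (y) * t ^ 3) * ht

lemma crank_eq8 {s1 s2 s3 s4 s5 x y t : ℂ} (h : Coords s1 s2 s3 s4 s5 x y)
    (ht : t ^ 5 + t ^ 4 - 4 * t ^ 3 - 3 * t ^ 2 + 3 * t + 1 = 0) :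
    -(s1 * (s3 / (s1 * s4))) * (1 - t) * (1 + 2 * t - t ^ 2 - t ^ 3) +
    (s4 * (1 / (s1))) * (1 - 3 * t ^ 2 + t ^ 4) * (-1 + t + t ^ 2) +
    (s3 * (1 / (s4))) * (2 + t - 4 * t ^ 2 + t ^ 4) * (1) +
    (s5 * (s5 / (s2 * s3))) * (2 - 2 * t - 4 * t ^ 2 + t ^ 3 + t ^ 4)
        * (1 - 2 * t - 3 * t ^ 2 + t ^ 3 + t ^ 4)
    = -2 * ((1 : ℂ) * (s3 / s4)) + 2 * ((s2 / s1) * (s4 / s2)) := by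
  have h1 := h.ne1
  have h2 := h.ne2
  have h3 := h.ne3
  have h4 := h.ne4
  have h5 := h.ne5
  have t0 : s1 * (s3 / (s1 * s4)) * ((1 + y) ^ 2) = (s3 / (s4)) * ((1 + y) ^ 2) := by
    field_simp
  have t1 : s4 * (1 / (s1)) * ((1 + y) ^ 2) = (s3 / (s4)) * ((1 - x) * (1 + y)) := by
    simp only [h.hu, h.hv]
    field_simp
  have t2 : s3 * (1 / (s4)) * ((1 + y) ^ 2) = (s3 / (s4)) * ((1 + y) ^ 2) := by
    field_simp
  have t3 : s5 * (s5 / (s2 * s3)) * ((1 + y) ^ 2) = -(s3 / (s4)) * (x * y * (1 - x)) := by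
    simp only [h.hu, h.hv]
    simp only [h.hx, h.hy]
    field_simp
  have t4 : (1 : ℂ) * (s3 / s4) * ((1 + y) ^ 2) = (s3 / (s4)) * ((1 + y) ^ 2) := by
    field_simp
  have t5 : (s2 / s1) * (s4 / s2) * ((1 + y) ^ 2) = (s3 / (s4)) * ((1 - x) * (1 + y)) := by
    simp only [h.hu, h.hv]
    field_simp
  have hD : (1 + y) ^ 2 ≠ 0 := by
    have := h.nex; have := h.ney; have := h.neu; have := h.nev
    simp [*]
  refine mul_right_cancel₀ hD ?_
  linear_combination -(1 - t) * (1 + 2 * t - t ^ 2 - t ^ 3) * t0 +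
    (1 - 3 * t ^ 2 + t ^ 4) * (-1 + t + t ^ 2) * t1 +
    (2 + t - 4 * t ^ 2 + t ^ 4) * (1) * t2 +
    (2 - 2 * t - 4 * t ^ 2 + t ^ 3 + t ^ 4) * (1 - 2 * t - 3 * t ^ 2 + t ^ 3 + t ^ 4) * t3 +
    2 * t4 +
    -2 * t5 +
    (s3 / (s4)) * ((3) + (-1) * t ^ 2) * h.curve +
    (s3 / (s4)) * ((x * y - x ^ 2 * y) + (1 + y - x + 2 * x * y - 3 * x ^ 2 * y) * t
        + (-x * y + x ^ 2 * y) * t ^ 2 + (-x * y + x ^ 2 * y) * t ^ 3) * ht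

lemma crank_eq9 {s1 s2 s3 s4 s5 x y t : ℂ} (h : Coords s1 s2 s3 s4 s5 x y)
    (ht : t ^ 5 + t ^ 4 - 4 * t ^ 3 - 3 * t ^ 2 + 3 * t + 1 = 0) :
    (s1 * (s4 / (s2 * s5))) * (-2 + t ^ 2) * (1 + 2 * t - t ^ 2 - t ^ 3) +
    -(s4 * (s2 / (s1 * s3))) * (-3 * t ^ 2 + t ^ 4) * (-1 + t + t ^ 2) +
    (s2 * (1 / (s4))) * (2 + t - 4 * t ^ 2 + t ^ 4) * (-1 - t) +
    (s3 * (s5 / (s2 * s3))) * (2 - 2 * t - 4 * t ^ 2 + t ^ 3 + t ^ 4) * (1) +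
    -(s5 * (1 / (s2))) * (3 - 4 * t ^ 2 + t ^ 4) * (1 - 2 * t - 3 * t ^ 2 + t ^ 3 + t ^ 4)
    = -2 * ((s4 / s2) * (s1 / s5)) + 1 * ((s5 / s3) * (s5 / s3)) := by
  have h1 := h.ne1
  have h2 := h.ne2
  have h3 := h.ne3
  have h4 := h.ne4
  have h5 := h.ne5
  have t0 : s1 * (s4 / (s2 * s5)) * ((1 - x) * (1 + y) ^ 2) = (s1 * s4 / (s2 * s5)) * ((1 - x) * (1 + y) ^ 2) := by
    field_simp
  have t1 : s4 * (s2 / (s1 * s3)) * ((1 - x) * (1 + y) ^ 2) = (s1 * s4 / (s2 * s5)) * ((1 - x) * (1 + y)) := by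
    simp only [h.hu, h.hv]
    field_simp
  have t2 : s2 * (1 / (s4)) * ((1 - x) * (1 + y) ^ 2) = (s1 * s4 / (s2 * s5)) * ((1 + y) ^ 2) := by
    simp only [h.hu, h.hv]
    field_simp
  have t3 : s3 * (s5 / (s2 * s3)) * ((1 - x) * (1 + y) ^ 2) = (s1 * s4 / (s2 * s5)) * (y * (1 - x) * (1 + y)) := by
    simp only [h.hu, h.hv]
    simp only [h.hy]
    field_simp
  have t4 : s5 * (1 / (s2)) * ((1 - x) * (1 + y) ^ 2) = (s1 * s4 / (s2 * s5)) * (y * (1 - x) * (1 + y)) := by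
    simp only [h.hu, h.hv]
    simp only [h.hy]
    field_simp
  have t5 : (s4 / s2) * (s1 / s5) * ((1 - x) * (1 + y) ^ 2) = (s1 * s4 / (s2 * s5)) * ((1 - x) * (1 + y) ^ 2) := by
    field_simp
  have t6 : (s5 / s3) * (s5 / s3) * ((1 - x) * (1 + y) ^ 2) = -(s1 * s4 / (s2 * s5)) * (x * y * (1 - x)) := by
    simp only [h.hu, h.hv]
    simp only [h.hx, h.hy]
    field_simp
  have hD : (1 - x) * (1 + y) ^ 2 ≠ 0 := by
    have := h.nex; have := h.ney; have := h.neu; have := h.nev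
    simp [*]
  refine mul_right_cancel₀ hD ?_
  linear_combination (-2 + t ^ 2) * (1 + 2 * t - t ^ 2 - t ^ 3) * t0 +
    -(-3 * t ^ 2 + t ^ 4) * (-1 + t + t ^ 2) * t1 +
    (2 + t - 4 * t ^ 2 + t ^ 4) * (-1 - t) * t2 +
    (2 - 2 * t - 4 * t ^ 2 + t ^ 3 + t ^ 4) * (1) * t3 +
    -(3 - 4 * t ^ 2 + t ^ 4) * (1 - 2 * t - 3 * t ^ 2 + t ^ 3 + t ^ 4) * t4 +
    2 * t5 +
    -1 * t6 +
    (s1 * s4 / (s2 * s5)) * ((-1)) * h.curve +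
    (s1 * s4 / (s2 * s5)) * ((-2 - 4 * y - 2 * y ^ 2 + x + 2 * x * y + x * y ^ 2)
        + (-1 + 2 * y + 3 * y ^ 2 + x - 2 * x * y - 3 * x * y ^ 2) * t
        + (-y - y ^ 2 + x * y + x * y ^ 2) * t ^ 3) * ht

lemma crank_eq10 {s1 s2 s3 s4 s5 x y t : ℂ} (h : Coords s1 s2 s3 s4 s5 x y)
    (ht : t ^ 5 + t ^ 4 - 4 * t ^ 3 - 3 * t ^ 2 + 3 * t + 1 = 0) :
    (s1 * (s1 / (s4 * s5))) * (1 - 3 * t + t ^ 3) * (1 + 2 * t - t ^ 2 - t ^ 3) +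
    (s2 * (s5 / (s2 * s3))) * (2 - 2 * t - 4 * t ^ 2 + t ^ 3 + t ^ 4) * (-1 - t) +
    -(s3 * (1 / (s2))) * (3 - 4 * t ^ 2 + t ^ 4) * (1) +
    -(s5 * (1 / (s3))) * (-3 * t + t ^ 3) * (1 - 2 * t - 3 * t ^ 2 + t ^ 3 + t ^ 4)
    = -2 * ((1 : ℂ) * (s5 / s3)) + -2 * ((s4 / s2) * (s3 / s4)) := by
  have h1 := h.ne1
  have h2 := h.ne2
  have h3 := h.ne3
  have h4 := h.ne4
  have h5 := h.ne5
  have t0 : s1 * (s1 / (s4 * s5)) * (x * (1 + y) ^ 2) = (s1 ^ 2 / (s4 * s5)) * (x * (1 + y) ^ 2) := by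
    field_simp
  have t1 : s2 * (s5 / (s2 * s3)) * (x * (1 + y) ^ 2) = (s1 ^ 2 / (s4 * s5)) * (x * y * (1 - x)) := by
    simp only [h.hu, h.hv]
    simp only [h.hx, h.hy]
    field_simp
  have t2 : s3 * (1 / (s2)) * (x * (1 + y) ^ 2) = -(s1 ^ 2 / (s4 * s5)) * (y * (1 - x) * (1 + y)) := by
    simp only [h.hu, h.hv]
    simp only [h.hx, h.hy]
    field_simp
  have t3 : s5 * (1 / (s3)) * (x * (1 + y) ^ 2) = (s1 ^ 2 / (s4 * s5)) * (x * y * (1 - x)) := by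
    simp only [h.hu, h.hv]
    simp only [h.hx, h.hy]
    field_simp
  have t4 : (1 : ℂ) * (s5 / s3) * (x * (1 + y) ^ 2) = (s1 ^ 2 / (s4 * s5)) * (x * y * (1 - x)) := by
    simp only [h.hu, h.hv]
    simp only [h.hx, h.hy]
    field_simp
  have t5 : (s4 / s2) * (s3 / s4) * (x * (1 + y) ^ 2) = -(s1 ^ 2 / (s4 * s5)) * (y * (1 - x) * (1 + y)) := by
    simp only [h.hu, h.hv]
    simp only [h.hx, h.hy]
    field_simp
  have hD : x * (1 + y) ^ 2 ≠ 0 := by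
    have := h.nex; have := h.ney; have := h.neu; have := h.nev
    simp [*]
  refine mul_right_cancel₀ hD ?_
  linear_combination (1 - 3 * t + t ^ 3) * (1 + 2 * t - t ^ 2 - t ^ 3) * t0 +
    (2 - 2 * t - 4 * t ^ 2 + t ^ 3 + t ^ 4) * (-1 - t) * t1 +
    -(3 - 4 * t ^ 2 + t ^ 4) * (1) * t2 +
    -(-3 * t + t ^ 3) * (1 - 2 * t - 3 * t ^ 2 + t ^ 3 + t ^ 4) * t3 +
    2 * t4 +
    2 * t5 +
    (s1 ^ 2 / (s4 * s5)) * ((1) + (-4) * t ^ 2 + (1) * t ^ 4) * h.curve +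
    (s1 ^ 2 / (s4 * s5)) * ((x * y - x ^ 2 * y) + (-x - 2 * x * y - x * y ^ 2) * t
        + (-x * y + x ^ 2 * y) * t ^ 2) * ht

/-- The dissected crank generating function, up to a common factor. -/
noncomputable def crankQuot (s1 s2 s3 s4 s5 t : ℂ) : ℂ :=
  (1 / (s5)) * (1)
    + -(s3 / (s1 * s4)) * (1 - t)
    + (s4 / (s2 * s5)) * (-2 + t ^ 2)
    + (s1 / (s4 * s5)) * (1 - 3 * t + t ^ 3)
    + (1 / (s1)) * (1 - 3 * t ^ 2 + t ^ 4)
    + -(s2 / (s1 * s3)) * (-3 * t ^ 2 + t ^ 4)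
    + (1 / (s4)) * (2 + t - 4 * t ^ 2 + t ^ 4)
    + (s5 / (s2 * s3)) * (2 - 2 * t - 4 * t ^ 2 + t ^ 3 + t ^ 4)
    + -(1 / (s2)) * (3 - 4 * t ^ 2 + t ^ 4)
    + -(1 / (s3)) * (-3 * t + t ^ 3)

lemma crankQuot_mul {s1 s2 s3 s4 s5 x y t : ℂ} (h : Coords s1 s2 s3 s4 s5 x y)
    (ht : t ^ 5 + t ^ 4 - 4 * t ^ 3 - 3 * t ^ 2 + 3 * t + 1 = 0) :
    crankQuot s1 s2 s3 s4 s5 t * (s1 * (1 + 2 * t - t ^ 2 - t ^ 3)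
      + s2 * (-1 - t)
      + s3 * (1)
      + s4 * (-1 + t + t ^ 2)
      + s5 * (1 - 2 * t - 3 * t ^ 2 + t ^ 3 + t ^ 4))
    = eulerQuot s1 s2 s3 s4 s5 ^ 2 := by
  rw [crankQuot, eulerQuot]
  linear_combination crank_eq0 h ht + crank_eq1 h ht + crank_eq2 (t := t) h + crank_eq3 h ht
      + crank_eq4 h ht + crank_eq5 h ht + crank_eq6 h ht + crank_eq7 h ht + crank_eq8 h ht
      + crank_eq9 h ht + crank_eq10 h ht

end Crank

section CrankSection

lemma theta_root_of_unity {ζ q : ℂ} (hζ : ζ ^ 11 = 1) (hq0 : q ≠ 0) (hq : ‖q‖ < 1) :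
    theta q ζ = ∑ c ∈ Finset.range 11, (-1) ^ c * ζ ^ c * tau q (5 + c) := by
  have hζ0 : ζ ≠ 0 := by
    rintro rfl
    norm_num at hζ
  rw [theta, tsum_int_mod 11 (summable_theta hq0 hq _)]
  refine Finset.sum_congr rfl fun c _ ↦ ?_
  rw [tau, theta, ← tsum_mul_left, ← tsum_mul_left]
  refine tsum_congr fun l ↦ ?_
  have e1 : q ^ tri ((11 : ℕ) * l + c)
      = q ^ texp (5 + c) * ((q ^ 121) ^ tri l * (q ^ (11 * (5 + c : ℤ))) ^ l) := by
    rw [← zpow_natCast q 121, ← zpow_mul, ← zpow_mul, ← zpow_add₀ hq0, ← zpow_add₀ hq0]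
    congr 1
    push_cast
    linarith [two_mul_tri (11 * l + c), two_mul_texp (5 + c), two_mul_tri l]
  have e2 : (-1 : ℂ) ^ ((11 : ℕ) * l + c : ℤ) = (-1) ^ c * (-1) ^ l := by
    rw [zpow_add₀ (by norm_num), zpow_mul, zpow_natCast, zpow_natCast]
    norm_num
    ring
  have e3 : ζ ^ ((11 : ℕ) * l + c : ℤ) = ζ ^ c := by
    rw [zpow_add₀ hζ0, zpow_mul, zpow_natCast, hζ, one_zpow, one_mul, zpow_natCast]
  rw [e1, e2, e3]
  ring

lemma root_of_unity_trace {ζ : ℂ} (hζ : ζ ^ 11 = 1) (h1 : ζ ≠ 1) :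
    (ζ + ζ⁻¹) ^ 5 + (ζ + ζ⁻¹) ^ 4 - 4 * (ζ + ζ⁻¹) ^ 3 - 3 * (ζ + ζ⁻¹) ^ 2 + 3 * (ζ + ζ⁻¹) + 1
      = 0 := by
  have hζ0 : ζ ≠ 0 := by
    rintro rfl
    norm_num at hζ
  have h2 : 1 + ζ + ζ ^ 2 + ζ ^ 3 + ζ ^ 4 + ζ ^ 5 + ζ ^ 6 + ζ ^ 7 + ζ ^ 8 + ζ ^ 9 + ζ ^ 10 = 0 :=
    mul_left_cancel₀ (sub_ne_zero.2 h1) (by linear_combination hζ)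
  field_simp
  linear_combination h2

/-- The generating function of the crank. -/
noncomputable def crankGF (ζ q : ℂ) : ℂ := poch q q / (poch q (ζ * q) * poch q (q / ζ))

lemma poch_root_ne_zero {ζ q : ℂ} (hζ : ζ ^ 11 = 1) (hq : ‖q‖ < 1) : poch q (ζ * q) ≠ 0 := by
  refine poch_ne_zero hq fun m h ↦ ?_
  have : (q ^ (m + 1)) ^ 11 = 1 := by
    linear_combination (exp := 1) (congrArg (· ^ 11) h) - q ^ (m * 11 + 11) * hζ
  exact pow_ne_one_of_norm_lt_one hq (m * 11 + 10) (by rw [← this]; ring)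

lemma crankGF_eq {ζ q : ℂ} (hζ : ζ ^ 11 = 1) (h1 : ζ ≠ 1) (hq0 : q ≠ 0) (hq : ‖q‖ < 1) :
    crankGF ζ q = q ^ 10 * poch (q ^ 121) (q ^ 121) ^ 2
      * crankQuot (tau q 2) (tau q 4) (tau q 6) (tau q 8) (tau q 10) (ζ + ζ⁻¹) := by
  have hζ0 : ζ ≠ 0 := by
    rintro rfl
    norm_num at hζ
  have hP := poch_self_ne_zero hq
  have hA := poch_root_ne_zero hζ hq
  have hB : poch q (q / ζ) ≠ 0 := by
    have := poch_root_ne_zero (ζ := ζ⁻¹) (by rw [inv_pow, hζ, inv_one]) hq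
    rwa [inv_mul_eq_div] at this
  have hT := theta_eq hq0 hq hζ0
  rw [poch_eq_mul hq ζ, theta_root_of_unity hζ hq0 hq] at hT
  have e5 : tau q 5 = tau q 6 := by rw [← tau_eleven_sub hq0 5]; norm_num
  have e7 : tau q 7 = tau q 4 := by rw [← tau_eleven_sub hq0 7]; norm_num
  have e9 : tau q 9 = tau q 2 := by rw [← tau_eleven_sub hq0 9]; norm_num
  have e11 : tau q 11 = 0 := by
    have := tau_eq_neg_of_add hq0 (k := 11) (l := 11) (by norm_num)
    linear_combination this / 2
  have e12 : tau q 12 = -tau q 10 := tau_eq_neg_of_add hq0 (by norm_num)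
  have e13 : tau q 13 = -tau q 2 := by
    rw [tau_eq_neg_of_add hq0 (l := 9) (by norm_num), e9]
  have e14 : tau q 14 = -tau q 8 := tau_eq_neg_of_add hq0 (by norm_num)
  have e15 : tau q 15 = -tau q 4 := by
    rw [tau_eq_neg_of_add hq0 (l := 7) (by norm_num), e7]
  simp only [Finset.sum_range_succ, Finset.sum_range_zero] at hT
  norm_num at hT
  rw [e5, e7, e9, e11, e12, e13, e14, e15] at hT
  have hc := coords_tau hq0 hq (z := 2) (by decide) (by decide)
  norm_num at hc
  have ht := root_of_unity_trace hζ h1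
  have h3 := crankQuot_mul hc ht
  have h4 := poch_eq_eulerQuot_two hq0 hq
  have h5 : (1 - ζ) * (tau q 2 * (1 + 2 * (ζ + ζ⁻¹) - (ζ + ζ⁻¹) ^ 2 - (ζ + ζ⁻¹) ^ 3)
      + tau q 4 * (-1 - (ζ + ζ⁻¹)) + tau q 6 * 1 + tau q 8 * (-1 + (ζ + ζ⁻¹) + (ζ + ζ⁻¹) ^ 2)
      + tau q 10 * (1 - 2 * (ζ + ζ⁻¹) - 3 * (ζ + ζ⁻¹) ^ 2 + (ζ + ζ⁻¹) ^ 3 + (ζ + ζ⁻¹) ^ 4))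
      = poch q q * ((1 - ζ) * poch q (ζ * q)) * poch q (q / ζ) := by
    rw [← hT]
    have hi : ζ⁻¹ = ζ ^ 10 := by
      field_simp
      linear_combination -hζ
    rw [hi]
    linear_combination (tau q 2
        * ((-1) * ζ ^ 0 + (-1) * ζ ^ 1 + (3) * ζ ^ 2 + (-1) * ζ ^ 8 + (-2) * ζ ^ 10 + (3) * ζ ^ 11
        + (-1) * ζ ^ 19 + (1) * ζ ^ 20)
      + tau q 4 * ((1) * ζ ^ 0)
      + tau q 8 * ((1) * ζ ^ 0 + (-2) * ζ ^ 1 + (1) * ζ ^ 9 + (-1) * ζ ^ 10)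
      + tau q 10 * ((-1) * ζ ^ 0 + (3) * ζ ^ 1 + (1) * ζ ^ 2 + (-4) * ζ ^ 3 + (1) * ζ ^ 7
          + (2) * ζ ^ 10 + (3) * ζ ^ 11 + (-6) * ζ ^ 12 + (1) * ζ ^ 18 + (3) * ζ ^ 20
          + (-4) * ζ ^ 21 + (1) * ζ ^ 29 + (-1) * ζ ^ 30)) * hζ
  have h6 : tau q 2 * (1 + 2 * (ζ + ζ⁻¹) - (ζ + ζ⁻¹) ^ 2 - (ζ + ζ⁻¹) ^ 3)
      + tau q 4 * (-1 - (ζ + ζ⁻¹)) + tau q 6 * 1 + tau q 8 * (-1 + (ζ + ζ⁻¹) + (ζ + ζ⁻¹) ^ 2)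
      + tau q 10 * (1 - 2 * (ζ + ζ⁻¹) - 3 * (ζ + ζ⁻¹) ^ 2 + (ζ + ζ⁻¹) ^ 3 + (ζ + ζ⁻¹) ^ 4)
      = poch q q * poch q (ζ * q) * poch q (q / ζ) :=
    mul_left_cancel₀ (sub_ne_zero.2 h1.symm) (by linear_combination h5)
  rw [h6] at h3
  rw [crankGF, div_eq_iff (mul_ne_zero hA hB)]
  refine mul_left_cancel₀ hP ?_
  linear_combination (-q ^ 10 * poch (q ^ 121) (q ^ 121) ^ 2) * h3
    + (poch q q + q ^ 5 * poch (q ^ 121) (q ^ 121)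
      * eulerQuot (tau q 2) (tau q 4) (tau q 6) (tau q 8) (tau q 10)) * h4

/-- The section of the crank generating function in the residue class `4`. -/
lemma sect_crankGF {ζ q : ℂ} (hζ : ζ ^ 11 = 1) (h1 : ζ ≠ 1) (hq0 : q ≠ 0) (hq : ‖q‖ < 1) :
    sect (crankGF ζ) q = q ^ 10 * poch (q ^ 121) (q ^ 121) ^ 2 / tau q 2
      * (1 - 3 * (ζ + ζ⁻¹) ^ 2 + (ζ + ζ⁻¹) ^ 4) := by
  set t := ζ + ζ⁻¹
  have hJ : HasClass 10 fun q ↦ q ^ 10 * poch (q ^ 121) (q ^ 121) ^ 2 :=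
    ((hasClass_pow 10).mul ((hasClass_comp_pow (n := 121) (by norm_num)
      fun q ↦ poch q q ^ 2))).of_dvd (by norm_num)
  have e2 : texp 2 = 6 := by decide
  have e4 : texp 4 = 1 := by decide
  have e6 : texp 6 = 0 := by decide
  have e8 : texp 8 = 3 := by decide
  have e10 : texp 10 = 10 := by decide
  have h2 := hasClass_tau 2
  have h4 := hasClass_tau 4
  have h6 := hasClass_tau 6
  have h8 := hasClass_tau 8
  have h10 := hasClass_tau 10
  rw [e2] at h2; rw [e4] at h4; rw [e6] at h6; rw [e8] at h8; rw [e10] at h10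
  have key : ∀ {r : ℤ} {F : ℂ → ℂ} (c : ℂ), HasClass r F → ¬ (11 : ℤ) ∣ 10 + r - 4 →
      sect (fun q ↦ q ^ 10 * poch (q ^ 121) (q ^ 121) ^ 2 * F q * c) q = 0 := fun {r F} c hF hr ↦ by
    have h := sect_of_hasClass ((hJ.mul hF).mul (hasClass_const c)) hq0 hq
    rw [if_neg (by rwa [add_zero])] at h
    exact h
  have key' := sect_of_hasClass ((hJ.mul ((hasClass_const 1).div h2)).mul
    (hasClass_const (1 - 3 * t ^ 2 + t ^ 4))) hq0 hq
  rw [if_pos (by norm_num)] at key'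
  have k1 := key 1 ((hasClass_const 1).div h10) (by norm_num)
  have k2 := key (-(1 - t)) (h6.div (h2.mul h8)) (by norm_num)
  have k3 := key (-2 + t ^ 2) (h8.div (h4.mul h10)) (by norm_num)
  have k4 := key (1 - 3 * t + t ^ 3) (h2.div (h8.mul h10)) (by norm_num)
  have k5 := key (-(-3 * t ^ 2 + t ^ 4)) (h4.div (h2.mul h6)) (by norm_num)
  have k6 := key (2 + t - 4 * t ^ 2 + t ^ 4) ((hasClass_const 1).div h8) (by norm_num)
  have k7 := key (2 - 2 * t - 4 * t ^ 2 + t ^ 3 + t ^ 4) (h10.div (h4.mul h6)) (by norm_num)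
  have k8 := key (-(3 - 4 * t ^ 2 + t ^ 4)) ((hasClass_const 1).div h4) (by norm_num)
  have k9 := key (-(-3 * t + t ^ 3)) ((hasClass_const 1).div h6) (by norm_num)
  rw [sect_congr (G := fun q ↦
      q ^ 10 * poch (q ^ 121) (q ^ 121) ^ 2 * (1 / tau q 2) * (1 - 3 * t ^ 2 + t ^ 4)
    + (q ^ 10 * poch (q ^ 121) (q ^ 121) ^ 2 * (1 / tau q 10) * 1
    + (q ^ 10 * poch (q ^ 121) (q ^ 121) ^ 2 * (tau q 6 / (tau q 2 * tau q 8)) * -(1 - t)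
    + (q ^ 10 * poch (q ^ 121) (q ^ 121) ^ 2 * (tau q 8 / (tau q 4 * tau q 10)) * (-2 + t ^ 2)
    + (q ^ 10 * poch (q ^ 121) (q ^ 121) ^ 2 * (tau q 2 / (tau q 8 * tau q 10))
        * (1 - 3 * t + t ^ 3)
    + (q ^ 10 * poch (q ^ 121) (q ^ 121) ^ 2 * (tau q 4 / (tau q 2 * tau q 6))
        * -(-3 * t ^ 2 + t ^ 4)
    + (q ^ 10 * poch (q ^ 121) (q ^ 121) ^ 2 * (1 / tau q 8) * (2 + t - 4 * t ^ 2 + t ^ 4)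
    + (q ^ 10 * poch (q ^ 121) (q ^ 121) ^ 2 * (tau q 10 / (tau q 4 * tau q 6))
        * (2 - 2 * t - 4 * t ^ 2 + t ^ 3 + t ^ 4)
    + (q ^ 10 * poch (q ^ 121) (q ^ 121) ^ 2 * (1 / tau q 4) * -(3 - 4 * t ^ 2 + t ^ 4)
    + q ^ 10 * poch (q ^ 121) (q ^ 121) ^ 2 * (1 / tau q 6) * -(-3 * t + t ^ 3)))))))))) ?_ hq0 hq,
    sect_add, sect_add, sect_add, sect_add, sect_add, sect_add, sect_add, sect_add, sect_add,
    k1, k2, k3, k4, k5, k6, k7, k8, k9, key']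
  · ring
  · intro q h0 h
    rw [crankGF_eq hζ h1 h0 h, crankQuot]
    ring

/-- The generating function of the difference of two crank counting functions. -/
noncomputable def crankDiffGF (q : ℂ) : ℂ :=
  (∑ j ∈ Finset.range 11, (1 - (omega ^ j)⁻¹) * crankGF (omega ^ j) q) / 11

lemma sect_crankDiffGF {q : ℂ} (hq0 : q ≠ 0) (hq : ‖q‖ < 1) :
    sect crankDiffGF q = unitFactor q * unitTau 2 q := by
  have h1 : ∀ j : ℕ, omega ^ j ≠ 0 := fun j ↦ pow_ne_zero j omega_ne_zero
  have h2 : sect crankDiffGF q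
      = 1 / 11 * ∑ j ∈ Finset.range 11, (1 - (omega ^ j)⁻¹) * sect (crankGF (omega ^ j)) q := by
    simp only [← sect_mul_left]
    rw [← sect_sum, ← sect_mul_left]
    refine sect_congr (fun q _ _ ↦ ?_) hq0 hq
    rw [crankDiffGF]
    ring
  have h3 : ∀ j ∈ Finset.range 11, (1 - (omega ^ j)⁻¹) * sect (crankGF (omega ^ j)) q
      = q ^ 10 * poch (q ^ 121) (q ^ 121) ^ 2 / tau q 2
        * ((omega ^ j) ^ (0 : ℤ) + (omega ^ j) ^ (2 : ℤ) + (omega ^ j) ^ (-2 : ℤ)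
          + (omega ^ j) ^ (4 : ℤ) + (omega ^ j) ^ (-4 : ℤ) - (omega ^ j) ^ (-1 : ℤ)
          - (omega ^ j) ^ (1 : ℤ) - (omega ^ j) ^ (-3 : ℤ) - (omega ^ j) ^ (3 : ℤ)
          - (omega ^ j) ^ (-5 : ℤ)) := fun j hj ↦ by
    by_cases h : omega ^ j = 1
    · rw [h]
      norm_num
    · rw [sect_crankGF (omega_pow_pow j) h hq0 hq]
      have h4 := h1 j
      generalize omega ^ j = w at *
      simp only [zpow_neg, zpow_ofNat]
      field_simp
      ring
  rw [h2, Finset.sum_congr rfl h3, ← Finset.mul_sum]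
  simp only [Finset.sum_sub_distrib, Finset.sum_add_distrib, sum_omega_zpow]
  norm_num
  have h5 := unitTau_ne_zero hq0 hq (z := 2) (by decide) (by decide)
  have h6 : tau q 2 ≠ 0 := tau_ne_zero hq0 hq (by norm_num)
  rw [unitFactor]
  field_simp

end CrankSection

section RankRelations

lemma one_sub_zpow_ne_zero {q : ℂ} (hq0 : q ≠ 0) (hq : ‖q‖ < 1) {m : ℤ} (hm : m ≠ 0) :
    1 - q ^ m ≠ 0 := by
  rw [sub_ne_zero]
  intro h
  exact hm (zpow_injective_of_norm hq0 hq (by simpa using h.symm))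

lemma rankSum_reflect {q : ℂ} (hq0 : q ≠ 0) (hq : ‖q‖ < 1) (b : ℤ) :
    rankSum q b = -rankSum q (8 - b) := by
  rw [rankSum, rankSum, ← (Equiv.neg ℤ).tsum_eq, ← tsum_neg]
  refine tsum_congr fun k ↦ ?_
  rw [Equiv.neg_apply, rankTerm, rankTerm]
  rcases eq_or_ne k 0 with rfl | hk
  · simp
  have h1 := one_sub_zpow_ne_zero hq0 hq (m := 11 * k) (by omega)
  have h2 := one_sub_zpow_ne_zero hq0 hq (m := 11 * -k) (by omega)
  have h3 : (-1 : ℂ) ^ (-k) = (-1) ^ k := by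
    rw [zpow_neg, ← inv_zpow]
    norm_num
  have h4 : q ^ (3 * tri (k + 1) + (8 - b) * k)
      = q ^ (3 * tri (-k + 1) + b * -k) * q ^ (11 * k) := by
    rw [← zpow_add₀ hq0]
    congr 1
    rw [show -k + 1 = 1 - k by ring, tri_one_sub, tri_add_one]
    ring
  have h5 : q ^ (11 * -k) * q ^ (11 * k) = 1 := by
    rw [← zpow_add₀ hq0, mul_neg, neg_add_cancel, zpow_zero]
  rw [h3, h4, ← neg_div, div_eq_div_iff h2 h1]
  linear_combination (-(-1 : ℂ) ^ k * q ^ (3 * tri (-k + 1) + b * -k)) * h5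

lemma rankSum_add_eleven {q : ℂ} (hq0 : q ≠ 0) (hq : ‖q‖ < 1) (b : ℤ) :
    rankSum q b = rankSum q (b + 11) + theta (q ^ 3) (q ^ (3 + b)) - 1 := by
  have hq3 : ‖q ^ 3‖ < 1 := by
    rw [norm_pow]; exact pow_lt_one₀ (norm_nonneg _) hq three_ne_zero
  have e : ∀ k : ℤ, rankTerm q b k = rankTerm q (b + 11) k
      + (-1 : ℂ) ^ k * ((q ^ 3) ^ tri k * (q ^ (3 + b)) ^ k) - if k = 0 then 1 else 0 := fun k ↦ by
    rcases eq_or_ne k 0 with rfl | hk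
    · simp [rankTerm, tri_zero]
    have h1 := one_sub_zpow_ne_zero hq0 hq (m := 11 * k) (by omega)
    have h2 : (q ^ 3) ^ tri k * (q ^ (3 + b)) ^ k = q ^ (3 * tri (k + 1) + b * k) := by
      rw [← zpow_natCast, ← zpow_mul, ← zpow_mul, ← zpow_add₀ hq0, tri_add_one]
      congr 1
      push_cast
      ring
    have h3 : q ^ (3 * tri (k + 1) + (b + 11) * k)
        = q ^ (3 * tri (k + 1) + b * k) * q ^ (11 * k) := by
      rw [← zpow_add₀ hq0]
      ring_nf
    rw [if_neg hk, rankTerm, rankTerm, h2, h3]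
    field_simp
    ring
  have s1 := (summable_norm_rankTerm hq0 hq (b + 11)).of_norm
  have s2 := summable_theta (pow_ne_zero 3 hq0) hq3 (q ^ (3 + b))
  have s3 : HasSum (fun k : ℤ ↦ if k = 0 then (1 : ℂ) else 0) 1 := hasSum_ite_eq 0 1
  rw [rankSum, tsum_congr e, (s1.add s2).tsum_sub s3.summable, s1.tsum_add s2, s3.tsum_eq, rankSum,
    theta]

lemma theta_cube_add {q : ℂ} (hq0 : q ≠ 0) (k : ℤ) :
    theta (q ^ 3) (q ^ (k + 3)) = -(q ^ (-k) * theta (q ^ 3) (q ^ k)) := by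
  have h := theta_mul_self (pow_ne_zero 3 hq0) (zpow_ne_zero k hq0)
  rw [zpow_add₀ hq0, zpow_neg, ← mul_neg, ← h, zpow_ofNat q 3,
    inv_mul_cancel_left₀ (zpow_ne_zero k hq0)]

lemma theta_cube_mul_three {q : ℂ} (hq0 : q ≠ 0) (k : ℕ) :
    theta (q ^ 3) (q ^ (3 * k : ℤ)) = 0 ∧ theta (q ^ 3) (q ^ (-3 * k : ℤ)) = 0 := by
  induction k with
  | zero => simp [theta_one]
  | succ k ih =>
    constructor
    · rw [show (3 * (k + 1 : ℕ) : ℤ) = 3 * k + 3 by push_cast; ring, theta_cube_add hq0, ih.1]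
      simp
    · have h := theta_cube_add hq0 (-3 * (k + 1 : ℕ))
      rw [show (-3 * (k + 1 : ℕ) + 3 : ℤ) = -3 * k by push_cast; ring, ih.2] at h
      simpa [hq0, zpow_ne_zero] using h.symm

lemma rankSum_neg_one {q : ℂ} (hq0 : q ≠ 0) (hq : ‖q‖ < 1) :
    rankSum q (-1) = -rankSum q 9 := by
  rw [rankSum_reflect hq0 hq]
  norm_num

lemma rankSum_zero {q : ℂ} (hq0 : q ≠ 0) (hq : ‖q‖ < 1) :
    rankSum q 0 = -rankSum q (-3) - 1 := by
  have h1 := rankSum_reflect hq0 hq (-3)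
  have h2 := rankSum_add_eleven hq0 hq 0
  have h3 := (theta_cube_mul_three hq0 1).1
  norm_num at h1 h2 h3
  rw [h2, h3, h1]
  ring

lemma rankSum_two {q : ℂ} (hq0 : q ≠ 0) (hq : ‖q‖ < 1) :
    rankSum q 2 = rankSum q (-9) + 1 := by
  have h2 := rankSum_add_eleven hq0 hq (-9)
  have h3 := (theta_cube_mul_three hq0 2).2
  norm_num at h2 h3
  rw [h2, h3]
  ring

lemma rankSum_one {q : ℂ} (hq0 : q ≠ 0) (hq : ‖q‖ < 1) :
    rankSum q 1 = -rankSum q (-15) - 2 - q⁻¹ * poch q q := by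
  have h1 := rankSum_reflect hq0 hq (-15)
  have h2 := rankSum_add_eleven hq0 hq 1
  have h3 := rankSum_add_eleven hq0 hq 12
  have h4 := (theta_cube_mul_three hq0 5).1
  have h5 := theta_cube_add hq0 1
  norm_num at h1 h2 h3 h4 h5
  rw [h2, h3, h1, h4, h5, theta_cube_self hq0 hq]
  ring

/-- The reflected antisymmetry of the rank sums at `b = 4`. -/
lemma rankSum_four {q : ℂ} (hq0 : q ≠ 0) (hq : ‖q‖ < 1) : rankSum q 4 = 0 := by
  have h := rankSum_reflect hq0 hq 4
  norm_num at h
  linear_combination h / 2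

lemma rankSum_neg_two {q : ℂ} (hq0 : q ≠ 0) (hq : ‖q‖ < 1) :
    rankSum q (-2) = -rankSum q (-1) - 1 + poch q q := by
  have h1 := rankSum_reflect hq0 hq (-1)
  have h2 := rankSum_add_eleven hq0 hq (-2)
  norm_num at h1 h2
  rw [h2, h1, theta_cube_self hq0 hq]
  ring

end RankRelations

section Combinations

/-- The generating function of the partitions whose rank is congruent to `m` modulo `11`,
for `0 ≤ m ≤ 5`. -/
noncomputable def rankClassGF (m : ℤ) (q : ℂ) : ℂ :=
  (rankSum q (m - 1) - rankSum q (m - 2)) / poch q q + if m = 0 then 1 else 0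

lemma sect_inv {q : ℂ} (hq0 : q ≠ 0) (hq : ‖q‖ < 1) : sect (fun q ↦ q⁻¹) q = 0 := by
  have h := sect_of_hasClass ((hasClass_const 1).div (hasClass_pow 1)) hq0 hq
  rw [if_neg (by norm_num)] at h
  rw [← h]
  exact sect_congr (fun q _ _ ↦ by rw [pow_one, one_div]) hq0 hq

lemma sect_rank_combination (a b c d e : ℂ) {q : ℂ} (hq0 : q ≠ 0) (hq : ‖q‖ < 1) :
    sect (fun q ↦ (a * (rankSum q 0 + 4 / 11) + b * (rankSum q (-1) + 5 / 11)
      + c * (rankSum q 2 + 2 / 11) + d * (rankSum q 1 + 3 / 11)) / poch q q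
      + e * crankDiffGF q) q
    = unitFactor q * (
      (a * (9 + 3 * coordX 2 q + 7 * coordY 2 q + 9 * (coordX 2 q * coordY 2 q)
        + 13 * coordX 2 q ^ 2)
      + b * (3 + coordX 2 q + 6 * coordY 2 q + 14 * (coordX 2 q * coordY 2 q)
        + 8 * coordX 2 q ^ 2)
      + c * (10 - 4 * coordX 2 q + 9 * coordY 2 q - coordX 2 q * coordY 2 q
        - 10 * coordX 2 q ^ 2)
      + d * (4 - 17 * coordX 2 q + 8 * coordY 2 q - 18 * (coordX 2 q * coordY 2 q)
        + 7 * coordX 2 q ^ 2)) / 11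
      + e * (1 + 2 * coordY 2 q + 4 * coordX 2 q + coordX 2 q * coordY 2 q
        - coordX 2 q ^ 2)) := by
  rw [sect_congr (G := fun q ↦ -a * ((rankSum q (-3) + 7 / 11) / poch q q)
    + (-b * ((rankSum q 9 - 5 / 11) / poch q q)
    + (c * ((rankSum q (-9) + 13 / 11) / poch q q)
    + (-d * ((rankSum q (-15) + 19 / 11) / poch q q)
    + (-d * q⁻¹ + e * crankDiffGF q))))) ?_ hq0 hq, sect_add, sect_add, sect_add, sect_add,
    sect_add, sect_mul_left, sect_mul_left, sect_mul_left, sect_mul_left, sect_mul_left,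
    sect_mul_left, sect_inv hq0 hq, sect_rankSum_nine hq0 hq, sect_rankSum_neg_three hq0 hq,
    sect_rankSum_neg_nine hq0 hq, sect_rankSum_neg_fifteen hq0 hq, sect_crankDiffGF hq0 hq,
    unitTau, curveUnit]
  · ring
  · intro q h0 h
    have hP := poch_self_ne_zero h
    rw [rankSum_neg_one h0 h, rankSum_zero h0 h, rankSum_two h0 h, rankSum_one h0 h]
    field_simp
    ring

/-- An infinite product with exponents depending on the residue classes modulo `11`. -/
noncomputable def residueProd (e1 e2 e3 e4 e5 : ℕ) (q : ℂ) : ℂ :=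
  poch (q ^ 11) (q ^ 11) / ((poch (q ^ 11) q * poch (q ^ 11) (q ^ 10)) ^ e1
    * (poch (q ^ 11) (q ^ 2) * poch (q ^ 11) (q ^ 9)) ^ e2
    * (poch (q ^ 11) (q ^ 3) * poch (q ^ 11) (q ^ 8)) ^ e3
    * (poch (q ^ 11) (q ^ 4) * poch (q ^ 11) (q ^ 7)) ^ e4
    * (poch (q ^ 11) (q ^ 5) * poch (q ^ 11) (q ^ 6)) ^ e5)

lemma tau_eq_poch {q : ℂ} (hq0 : q ≠ 0) (hq : ‖q‖ < 1) {k l : ℕ} (h : k + l = 11) :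
    tau q k = q ^ texp k * (poch (q ^ 121) (q ^ 121)
      * (poch (q ^ 121) ((q ^ 11) ^ k) * poch (q ^ 121) ((q ^ 11) ^ l))) := by
  have h1 : (q ^ 11) ^ l = q ^ 121 / (q ^ 11) ^ k := by
    rw [eq_div_iff (pow_ne_zero _ (pow_ne_zero _ hq0)), ← pow_add, add_comm, h, ← pow_mul]
  have h2 : q ^ (11 * (k : ℤ)) = (q ^ 11) ^ k := by
    rw [← pow_mul, ← zpow_natCast]
    push_cast
    rfl
  rw [tau, theta_eq (pow_121_ne_zero hq0) (norm_pow_121 hq) (zpow_ne_zero _ hq0), h2, h1]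
  ring

lemma sections_eq_residueProd {q : ℂ} (hq0 : q ≠ 0) (hq : ‖q‖ < 1) :
    unitFactor q * -(coordX 2 q + coordY 2 q) = q ^ 26 * residueProd 1 4 2 3 3 (q ^ 11) ∧
    unitFactor q * coordY 2 q = q ^ 15 * residueProd 1 5 4 2 1 (q ^ 11) ∧
    unitFactor q * -(coordX 2 q * coordY 2 q) = q ^ 26 * residueProd 1 3 4 3 2 (q ^ 11) ∧
    unitFactor q * (coordX 2 q * (coordX 2 q + coordY 2 q))
      = q ^ 37 * residueProd 1 2 2 4 4 (q ^ 11) := by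
  have hc := coords_tau hq0 hq (z := 2) (by decide) (by decide)
  have hu := curveUnit_tau hq0 hq (by decide) hc
  have hu0 := unitTau_ne_zero hq0 hq (z := 2) (by decide) (by decide)
  rw [← unitTau] at hu
  have hP : poch (q ^ 121) (q ^ 121) ≠ 0 := poch_self_ne_zero (norm_pow_121 hq)
  norm_num at hu
  have e9 : tau q 9 = tau q 2 := by rw [← tau_eleven_sub hq0 9]; norm_num
  have e1 : tau q 1 = tau q 10 := by rw [← tau_eleven_sub hq0 1]; norm_num
  have e3 : tau q 3 = tau q 8 := by rw [← tau_eleven_sub hq0 3]; norm_num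
  have e5 : tau q 5 = tau q 6 := by rw [← tau_eleven_sub hq0 5]; norm_num
  have e7 : tau q 7 = tau q 4 := by rw [← tau_eleven_sub hq0 7]; norm_num
  have hr := tau_relation hq0 hq 0 3 4 5
  norm_num [tau_neg hq0] at hr
  rw [e9, e1, e3, e5, e7] at hr
  have t2 := tau_eq_poch hq0 hq (k := 2) (l := 9) (by norm_num)
  have t4 := tau_eq_poch hq0 hq (k := 4) (l := 7) (by norm_num)
  have t6 := tau_eq_poch hq0 hq (k := 6) (l := 5) (by norm_num)
  have t8 := tau_eq_poch hq0 hq (k := 8) (l := 3) (by norm_num)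
  have t10 := tau_eq_poch hq0 hq (k := 10) (l := 1) (by norm_num)
  have x2 : texp ((2 : ℕ) : ℤ) = (6 : ℕ) := by decide
  have x4 : texp ((4 : ℕ) : ℤ) = (1 : ℕ) := by decide
  have x6 : texp ((6 : ℕ) : ℤ) = (0 : ℕ) := by decide
  have x8 : texp ((8 : ℕ) : ℤ) = (3 : ℕ) := by decide
  have x10 : texp ((10 : ℕ) : ℤ) = (10 : ℕ) := by decide
  rw [x2, zpow_natCast] at t2
  rw [x4, zpow_natCast] at t4
  rw [x6, zpow_natCast] at t6
  rw [x8, zpow_natCast] at t8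
  rw [x10, zpow_natCast] at t10
  have n2 : tau q 2 ≠ 0 := tau_ne_zero hq0 hq (by norm_num)
  have n4 : tau q 4 ≠ 0 := tau_ne_zero hq0 hq (by norm_num)
  have n6 : tau q 6 ≠ 0 := tau_ne_zero hq0 hq (by norm_num)
  have n8 : tau q 8 ≠ 0 := tau_ne_zero hq0 hq (by norm_num)
  have n10 : tau q 10 ≠ 0 := tau_ne_zero hq0 hq (by norm_num)
  norm_num at t2 t4 t6 t8 t10
  simp only [residueProd, coordX, coordY, unitFactor, show (2 * 2 : ℤ) = 4 from rfl,
    show (3 * 2 : ℤ) = 6 from rfl, show (4 * 2 : ℤ) = 8 from rfl, show (5 * 2 : ℤ) = 10 from rfl]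
  rw [show (q ^ 11) ^ 11 = q ^ 121 by ring]
  generalize poch (q ^ 121) ((q ^ 11) ^ 2) = a2 at *
  generalize poch (q ^ 121) ((q ^ 11) ^ 9) = a9 at *
  generalize poch (q ^ 121) ((q ^ 11) ^ 4) = a4 at *
  generalize poch (q ^ 121) ((q ^ 11) ^ 7) = a7 at *
  generalize poch (q ^ 121) ((q ^ 11) ^ 6) = a6 at *
  generalize poch (q ^ 121) ((q ^ 11) ^ 5) = a5 at *
  generalize poch (q ^ 121) ((q ^ 11) ^ 8) = a8 at *
  generalize poch (q ^ 121) ((q ^ 11) ^ 3) = a3 at *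
  generalize poch (q ^ 121) ((q ^ 11) ^ 10) = a10 at *
  generalize poch (q ^ 121) (q ^ 11) = a1 at *
  generalize poch (q ^ 121) (q ^ 121) = P at *
  have hU : P ^ 2 * q ^ 10 / (unitTau 2 q * tau q 2) = P ^ 14 * q ^ 69
      / (tau q 2 ^ 6 * tau q 6 ^ 2 * tau q 8 ^ 3 * tau q 10 ^ 2) := by
    rw [div_eq_div_iff (mul_ne_zero hu0 n2) (by simp [n2, n6, n8, n10])]
    linear_combination -P ^ 2 * q ^ 10 * tau q 2 * hu
  have hxy : -tau q 2 ^ 2 / (tau q 4 * tau q 6)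
      + tau q 2 * tau q 6 * tau q 10 / (tau q 4 ^ 2 * tau q 8)
      = -(tau q 2 ^ 2 * tau q 8 * tau q 10 / (tau q 4 ^ 3 * tau q 6)) := by
    field_simp
    linear_combination hr
  rw [hU, hxy]
  generalize tau q 2 = b2 at *
  generalize tau q 4 = b4 at *
  generalize tau q 6 = b6 at *
  generalize tau q 8 = b8 at *
  generalize tau q 10 = b10 at *
  clear hu hr hU hxy hc hu0
  subst t2 t4 t6 t8 t10
  simp only [mul_ne_zero_iff] at n2 n4 n6 n8 n10
  obtain ⟨-, -, m2, m9⟩ := n2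
  obtain ⟨-, -, m4, m7⟩ := n4
  obtain ⟨-, m6, m5⟩ := n6
  obtain ⟨-, -, m8, m3⟩ := n8
  obtain ⟨-, -, m10, m1⟩ := n10
  refine ⟨?_, ?_, ?_, ?_⟩ <;> field_simp

end Combinations

section MultisetSums

/-- A multiset is determined by the multiplicity of `a` and by its other elements. -/
def splitEquiv (a : ℕ) : Multiset ℕ ≃ ℕ × {s : Multiset ℕ // a ∉ s} where
  toFun s := (s.count a, ⟨s.filter (¬ · = a), by simp⟩)
  invFun p := Multiset.replicate p.1 a + p.2.1
  left_inv s := by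
    simp only [← Multiset.filter_eq']
    exact Multiset.filter_add_not _ s
  right_inv := by
    rintro ⟨k, s, hs⟩
    have h1 : s.filter (¬ · = a) = s :=
      Multiset.filter_eq_self.2 fun b hb h ↦ hs (h ▸ hb)
    have h2 : (Multiset.replicate k a).filter (¬ · = a) = 0 :=
      Multiset.filter_eq_nil.2 fun b hb h ↦ h (Multiset.eq_of_mem_replicate hb)
    simp [Multiset.count_eq_zero_of_notMem hs, h1, h2, Multiset.filter_add]

variable {𝕜 : Type*} [NormedField 𝕜] [CompleteSpace 𝕜]

/-- The product of weights of a multiset whose elements are all smaller than `m`. -/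
noncomputable def boundedWeight (w : ℕ → 𝕜) (m : ℕ) (s : Multiset ℕ) : 𝕜 :=
  open Classical in if ∀ i ∈ s, i < m then (s.map w).prod else 0

lemma boundedWeight_split (w : ℕ → 𝕜) (m : ℕ) (p : ℕ × {s : Multiset ℕ // m ∉ s}) :
    boundedWeight w (m + 1) ((splitEquiv m).symm p) = w m ^ p.1 * boundedWeight w m p.2 := by
  obtain ⟨k, s, hs⟩ := p
  change boundedWeight w (m + 1) (Multiset.replicate k m + s) = w m ^ k * boundedWeight w m s
  have h : (∀ i ∈ Multiset.replicate k m + s, i < m + 1) ↔ ∀ i ∈ s, i < m := by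
    constructor
    · intro h i hi
      have h1 := h i (Multiset.mem_add.2 (Or.inr hi))
      have h2 : i ≠ m := fun h ↦ hs (h ▸ hi)
      omega
    · intro h i hi
      rcases Multiset.mem_add.1 hi with hi | hi
      · rw [Multiset.eq_of_mem_replicate hi]; omega
      · exact (h i hi).trans (by omega)
  rw [boundedWeight, boundedWeight]
  simp only [h]
  split_ifs <;> simp

lemma hasSum_boundedWeight {w : ℕ → 𝕜} (h : ∀ i, ‖w i‖ < 1) (m : ℕ) :
    (Summable fun s ↦ ‖boundedWeight w m s‖) ∧
      HasSum (boundedWeight w m) (∏ i ∈ Finset.range m, (1 - w i)⁻¹) := by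
  induction m with
  | zero =>
    have e : ∀ s : Multiset ℕ, boundedWeight w 0 s = if s = 0 then 1 else 0 := fun s ↦ by
      rcases eq_or_ne s 0 with rfl | hs
      · simp [boundedWeight]
      · rw [if_neg hs, boundedWeight, if_neg]
        intro h
        obtain ⟨a, ha⟩ := Multiset.exists_mem_of_ne_zero hs
        exact absurd (h a ha) (by omega)
    constructor
    · refine summable_of_ne_finset_zero (s := {0}) fun s hs ↦ ?_
      rw [e, if_neg (by simpa using hs), norm_zero]
    · rw [Finset.prod_range_zero, funext e]
      exact hasSum_ite_eq 0 1
  | succ m ih =>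
    have hsup : Function.support (boundedWeight w m) ⊆ {s | m ∉ s} := by
      intro s hs hm
      apply hs
      rw [boundedWeight, if_neg]
      intro h
      exact lt_irrefl _ (h m hm)
    have h1 : HasSum (fun s : {s : Multiset ℕ // m ∉ s} ↦ boundedWeight w m s)
        (∏ i ∈ Finset.range m, (1 - w i)⁻¹) :=
      (hasSum_subtype_iff_of_support_subset hsup).2 ih.2
    have h2 : Summable (fun s : {s : Multiset ℕ // m ∉ s} ↦ ‖boundedWeight w m s‖) :=
      ih.1.subtype _
    have h3 : Summable fun k : ℕ ↦ ‖w m ^ k‖ := by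
      simpa using summable_geometric_of_lt_one (norm_nonneg (w m)) (h m)
    have h4 := h3.mul_norm h2
    constructor
    · rw [← (splitEquiv m).symm.summable_iff]
      simpa only [Function.comp_def, boundedWeight_split] using h4
    · rw [← (splitEquiv m).symm.hasSum_iff]
      simp only [Function.comp_def, boundedWeight_split]
      rw [Finset.prod_range_succ, mul_comm (∏ i ∈ Finset.range m, (1 - w i)⁻¹)]
      have h5 : Summable fun p : ℕ × {s : Multiset ℕ // m ∉ s} ↦
          w m ^ p.1 * boundedWeight w m p.2 := Summable.of_norm h4
      have h6 : HasSum (fun k : ℕ ↦ w m ^ k) (1 - w m)⁻¹ :=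
        hasSum_geometric_of_norm_lt_one (h m)
      have h7 := HasSum.mul h6 h1 h5
      exact h7

lemma exists_bound_of_finset (T : Finset (Multiset ℕ)) : ∃ m : ℕ, ∀ s ∈ T, ∀ i ∈ s, i < m := by
  classical
  induction T using Finset.induction_on with
  | empty => exact ⟨0, fun s hs ↦ absurd hs (Finset.notMem_empty s)⟩
  | insert t T _ ih =>
    obtain ⟨m, hm⟩ := ih
    refine ⟨m + t.sum + 1, fun s hs i hi ↦ ?_⟩
    rcases Finset.mem_insert.1 hs with rfl | hs
    · have := Multiset.le_sum_of_mem hi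
      omega
    · have := hm s hs i hi
      omega

lemma prod_range_shift (w : ℕ → 𝕜) (h0 : w 0 = 0) (m : ℕ) :
    ∏ i ∈ Finset.range (m + 1), (1 - w i)⁻¹ = ∏ i ∈ Finset.range m, (1 - w (i + 1))⁻¹ := by
  rw [Finset.prod_range_succ', h0, sub_zero, inv_one, mul_one]

lemma summable_pow_multiset {r : ℝ} (hr0 : 0 ≤ r) (hr : r < 1) :
    Summable fun s : Multiset ℕ ↦ (s.map fun i ↦ if i = 0 then 0 else r ^ i).prod := by
  have hn : ‖r‖ < 1 := by rwa [Real.norm_of_nonneg hr0]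
  set v : ℕ → ℝ := fun i ↦ if i = 0 then 0 else r ^ i with hv
  have hv0 : ∀ i, 0 ≤ v i := fun i ↦ by
    rw [hv]
    dsimp only
    split_ifs <;> positivity
  have hv1 : ∀ i, ‖v i‖ < 1 := fun i ↦ by
    rw [Real.norm_of_nonneg (hv0 i), hv]
    dsimp only
    split_ifs with h
    · exact one_pos
    · exact pow_lt_one₀ hr0 hr h
  have hpos : ∀ s : Multiset ℕ, 0 ≤ (s.map v).prod := fun s ↦
    Multiset.prod_nonneg fun a ha ↦ by
      obtain ⟨i, -, rfl⟩ := Multiset.mem_map.1 ha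
      exact hv0 i
  have hlim : Tendsto (fun m ↦ (fpoch r r m)⁻¹) atTop (𝓝 (poch r r)⁻¹) :=
    (tendsto_fpoch hn r).inv₀ (poch_self_ne_zero hn)
  obtain ⟨C, hC⟩ := hlim.bddAbove_range
  refine summable_of_sum_le hpos (c := C) fun T ↦ ?_
  obtain ⟨m, hm⟩ := exists_bound_of_finset T
  have h1 := hasSum_boundedWeight hv1 (m + 1)
  calc ∑ s ∈ T, (s.map v).prod = ∑ s ∈ T, boundedWeight v (m + 1) s :=
        Finset.sum_congr rfl fun s hs ↦ by
          rw [boundedWeight, if_pos fun i hi ↦ (hm s hs i hi).trans (by omega)]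
    _ ≤ ∏ i ∈ Finset.range (m + 1), (1 - v i)⁻¹ := by
        refine sum_le_hasSum T (fun s _ ↦ ?_) h1.2
        rw [boundedWeight]
        split_ifs
        exacts [hpos s, le_rfl]
    _ = (fpoch r r m)⁻¹ := by
        rw [prod_range_shift v rfl, fpoch, ← Finset.prod_inv_distrib]
        refine Finset.prod_congr rfl fun i _ ↦ ?_
        rw [hv]
        simp [pow_succ']
    _ ≤ C := hC ⟨m, rfl⟩

lemma norm_prod_map_le {w : ℕ → 𝕜} {v : ℕ → ℝ} (h : ∀ i, ‖w i‖ ≤ v i) (s : Multiset ℕ) :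
    ‖(s.map w).prod‖ ≤ (s.map v).prod := by
  induction s using Multiset.induction_on with
  | empty => simp
  | cons a s ih =>
    rw [Multiset.map_cons, Multiset.map_cons, Multiset.prod_cons, Multiset.prod_cons, norm_mul]
    exact mul_le_mul (h a) ih (norm_nonneg _) ((norm_nonneg _).trans (h a))

lemma summable_norm_prod_map {w : ℕ → 𝕜} {r : ℝ} (hr0 : 0 ≤ r) (hr : r < 1) (h0 : w 0 = 0)
    (h : ∀ i, ‖w i‖ ≤ r ^ i) : Summable fun s : Multiset ℕ ↦ ‖(s.map w).prod‖ := by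
  refine Summable.of_nonneg_of_le (fun _ ↦ norm_nonneg _) (fun s ↦ norm_prod_map_le (fun i ↦ ?_) s)
    (summable_pow_multiset hr0 hr)
  split_ifs with hi
  · rw [hi, h0, norm_zero]
  · exact h i

/-- The sum of multiplicative weights over all multisets is an infinite product. -/
lemma tendsto_prod_tsum_multiset {w : ℕ → 𝕜} {r : ℝ} (hr0 : 0 ≤ r) (hr : r < 1) (h0 : w 0 = 0)
    (h : ∀ i, ‖w i‖ ≤ r ^ i) :
    Tendsto (fun m ↦ ∏ i ∈ Finset.range m, (1 - w (i + 1))⁻¹) atTop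
      (𝓝 (∑' s : Multiset ℕ, (s.map w).prod)) := by
  have h1 : ∀ i, ‖w i‖ < 1 := fun i ↦ by
    rcases eq_or_ne i 0 with rfl | hi
    · rw [h0, norm_zero]; exact one_pos
    · exact (h i).trans_lt (pow_lt_one₀ hr0 hr hi)
  have h2 : Tendsto (fun m ↦ ∑' s, boundedWeight w (m + 1) s) atTop
      (𝓝 (∑' s : Multiset ℕ, (s.map w).prod)) := by
    refine tendsto_tsum_of_dominated_convergence (summable_norm_prod_map hr0 hr h0 h)
      (fun s ↦ ?_) (Eventually.of_forall fun m s ↦ ?_)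
    · refine tendsto_const_nhds.congr' ?_
      obtain ⟨m, hm⟩ := exists_bound_of_finset {s}
      filter_upwards [eventually_ge_atTop m] with k hk
      rw [boundedWeight, if_pos fun i hi ↦ (hm s (Finset.mem_singleton_self s) i hi).trans_le
        (hk.trans (Nat.le_succ k))]
    · rw [boundedWeight]
      split_ifs
      · exact le_rfl
      · rw [norm_zero]; exact norm_nonneg _
  refine h2.congr fun m ↦ ?_
  rw [(hasSum_boundedWeight h1 (m + 1)).2.tsum_eq, prod_range_shift w h0]

end MultisetSums

section PartitionSums

/-- The weight `q ^ |s|` of a multiset of positive integers. -/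
noncomputable def wt (q : ℂ) (s : Multiset ℕ) : ℂ := if 0 ∈ s then 0 else q ^ s.sum

lemma prod_map_eq_wt (q : ℂ) (s : Multiset ℕ) :
    (s.map fun i ↦ if i = 0 then 0 else q ^ i).prod = wt q s := by
  induction s using Multiset.induction_on with
  | empty => simp [wt]
  | cons a s ih =>
    rw [Multiset.map_cons, Multiset.prod_cons, ih, wt, wt]
    rcases eq_or_ne a 0 with rfl | ha
    · simp
    · by_cases h : 0 ∈ s <;> simp [h, ha, ha.symm, pow_add]

lemma norm_weight_le (q : ℂ) (i : ℕ) : ‖(if i = 0 then 0 else q ^ i : ℂ)‖ ≤ ‖q‖ ^ i := by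
  split_ifs
  · rw [norm_zero]; positivity
  · rw [norm_pow]

lemma summable_norm_wt {q : ℂ} (hq : ‖q‖ < 1) : Summable fun s ↦ ‖wt q s‖ := by
  have h := summable_norm_prod_map (w := fun i ↦ if i = 0 then 0 else q ^ i) (norm_nonneg q) hq rfl
    (norm_weight_le q)
  simpa only [prod_map_eq_wt] using h

lemma summable_norm_mul_wt {q : ℂ} (hq : ‖q‖ < 1) {g : Multiset ℕ → ℂ} (hg : ∀ s, ‖g s‖ ≤ 1) :
    Summable fun s ↦ ‖g s * wt q s‖ := by
  refine Summable.of_nonneg_of_le (fun _ ↦ norm_nonneg _) (fun s ↦ ?_) (summable_norm_wt hq)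
  rw [norm_mul]
  exact mul_le_of_le_one_left (norm_nonneg _) (hg s)

lemma summable_mul_wt {q : ℂ} (hq : ‖q‖ < 1) {g : Multiset ℕ → ℂ} (hg : ∀ s, ‖g s‖ ≤ 1) :
    Summable fun s ↦ g s * wt q s := Summable.of_norm (summable_norm_mul_wt hq hg)

lemma norm_tsum_mul_wt_le {q : ℂ} (hq : ‖q‖ < 1) {g : Multiset ℕ → ℂ} (hg : ∀ s, ‖g s‖ ≤ 1) :
    ‖∑' s, g s * wt q s‖ ≤ ∑' s, ‖wt q s‖ := by
  refine (norm_tsum_le_tsum_norm (summable_norm_mul_wt hq hg)).trans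
    ((summable_norm_mul_wt hq hg).tsum_le_tsum (fun s ↦ ?_) (summable_norm_wt hq))
  rw [norm_mul]
  exact mul_le_of_le_one_left (norm_nonneg _) (hg s)

lemma tsum_wt {q : ℂ} (hq : ‖q‖ < 1) : ∑' s, wt q s = (poch q q)⁻¹ := by
  have h := tendsto_prod_tsum_multiset (w := fun i ↦ if i = 0 then 0 else q ^ i) (norm_nonneg q) hq
    rfl (norm_weight_le q)
  simp only [prod_map_eq_wt] at h
  refine tendsto_nhds_unique h
    (((tendsto_fpoch hq q).inv₀ (poch_self_ne_zero hq)).congr fun m ↦ ?_)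
  rw [fpoch, ← Finset.prod_inv_distrib]
  refine Finset.prod_congr rfl fun i _ ↦ ?_
  simp [pow_succ']

lemma hasSum_partition {q : ℂ} (hq : ‖q‖ < 1) {g : Multiset ℕ → ℂ} (hg : ∀ s, ‖g s‖ ≤ 1) :
    HasSum (fun n ↦ (∑ π : Nat.Partition n, g π.parts) * q ^ n) (∑' s, g s * wt q s) := by
  have h := (summable_mul_wt hq hg).hasSum
  set i : (Σ n, Nat.Partition n) → Multiset ℕ := fun p ↦ p.2.parts with hi
  have hinj : Function.Injective i := by
    rintro ⟨n, π⟩ ⟨m, π'⟩ h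
    have h : π.parts = π'.parts := h
    have e : n = m := by rw [← π.parts_sum, ← π'.parts_sum, h]
    subst e
    rw [Nat.Partition.ext h]
  have hrange : ∀ s ∉ Set.range i, g s * wt q s = 0 := by
    intro s hs
    by_cases h0 : 0 ∈ s
    · rw [wt, if_pos h0, mul_zero]
    · exact absurd ⟨⟨s.sum, ⟨s, fun {a} ha ↦ Nat.pos_of_ne_zero fun e ↦ h0 (e ▸ ha), rfl⟩⟩, rfl⟩ hs
  rw [← hinj.hasSum_iff hrange] at h
  refine h.sigma fun n ↦ ?_
  have h1 := hasSum_fintype fun π : Nat.Partition n ↦ g π.parts * wt q π.parts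
  have h2 : ∀ π : Nat.Partition n, wt q π.parts = q ^ n := fun π ↦ by
    rw [wt, if_neg fun h ↦ lt_irrefl 0 (π.parts_pos h), π.parts_sum]
  simp only [h2, ← Finset.sum_mul] at h1
  simpa only [hi, Function.comp_def, h2] using h1

end PartitionSums

section DysonMap

/-- Largest element minus cardinality. -/
def multisetRank (s : Multiset ℕ) : ℤ := (s.sup : ℤ) - (Multiset.card s : ℤ)

lemma multiset_sup_mem {s : Multiset ℕ} (hs : s ≠ 0) : s.sup ∈ s := by
  induction s using Multiset.induction_on with
  | empty => exact absurd rfl hs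
  | cons a s ih =>
    rw [Multiset.sup_cons]
    rcases eq_or_ne s 0 with rfl | h
    · simp
    · rcases le_total a s.sup with h1 | h1
      · rw [sup_eq_right.2 h1]; exact Multiset.mem_cons_of_mem (ih h)
      · rw [sup_eq_left.2 h1]; exact Multiset.mem_cons_self _ _

/-- Decrease every element by one and drop the zeros. -/
def lower (s : Multiset ℕ) : Multiset ℕ := (s.map fun i ↦ i - 1).filter fun i ↦ i ≠ 0

lemma lower_spec {s : Multiset ℕ} (h : 0 ∉ s) :
    (lower s).map (· + 1) + Multiset.replicate (s.count 1) 1 = s := by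
  induction s using Multiset.induction_on with
  | empty => rfl
  | cons a s ih =>
    have h1 : 0 ∉ s := fun hs ↦ h (Multiset.mem_cons_of_mem hs)
    have ha : a ≠ 0 := fun e ↦ h (e ▸ Multiset.mem_cons_self _ _)
    have ih := ih h1
    rw [lower] at ih ⊢
    rcases eq_or_ne a 1 with rfl | ha1
    · rw [Multiset.map_cons, Multiset.filter_cons_of_neg _ (by simp), Multiset.count_cons_self,
        Multiset.replicate_succ, Multiset.add_cons, ih]
    · rw [Multiset.map_cons, Multiset.filter_cons_of_pos _ (by omega), Multiset.map_cons,
        Multiset.count_cons_of_ne ha1.symm, Multiset.cons_add, ih]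
      congr 1
      omega

lemma card_lower {s : Multiset ℕ} (h : 0 ∉ s) :
    (lower s).card + s.count 1 = s.card := by
  have h1 := congrArg Multiset.card (lower_spec h)
  simpa using h1

lemma sum_lower {s : Multiset ℕ} (h : 0 ∉ s) : (lower s).sum + s.card = s.sum := by
  have h1 := congrArg Multiset.sum (lower_spec h)
  rw [Multiset.sum_add, Multiset.sum_map_add] at h1
  simp only [Multiset.map_id', Multiset.map_const', Multiset.sum_replicate, smul_eq_mul,
    mul_one] at h1
  have h2 := card_lower h
  omega

lemma lower_raise {t : Multiset ℕ} (h : 0 ∉ t) (k : ℕ) :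
    lower (t.map (· + 1) + Multiset.replicate k 1) = t := by
  rw [lower, Multiset.map_add, Multiset.map_map, Multiset.filter_add]
  have h1 : (Multiset.replicate k 1 |>.map fun i ↦ i - 1).filter (fun i ↦ i ≠ 0) = 0 := by
    rw [Multiset.map_replicate]
    exact Multiset.filter_eq_nil.2 fun b hb h ↦ h (Multiset.eq_of_mem_replicate hb)
  rw [h1, add_zero]
  have h2 : (t.map ((fun i ↦ i - 1) ∘ (· + 1))) = t := by
    rw [show ((fun i ↦ i - 1) ∘ (· + 1) : ℕ → ℕ) = id from funext fun i ↦ Nat.add_sub_cancel i 1,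
      Multiset.map_id]
  rw [h2]
  exact Multiset.filter_eq_self.2 fun b hb e ↦ h (e ▸ hb)

/-- Insert `L`, unless it is zero. -/
def insertPos (L : ℕ) (t : Multiset ℕ) : Multiset ℕ := if L = 0 then t else L ::ₘ t

lemma insertPos_spec {L : ℕ} {t : Multiset ℕ} (h0 : 0 ∉ t) (h : ∀ i ∈ t, i ≤ L) :
    0 ∉ insertPos L t ∧ (insertPos L t).sup = L ∧ (insertPos L t).erase L = t ∧
      (insertPos L t).sum = L + t.sum := by
  rw [insertPos]
  split_ifs with hL
  · have ht : t = 0 := Multiset.eq_zero_of_forall_notMem fun i hi ↦ by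
      have h1 := h i hi
      have h2 : i = 0 := by omega
      exact h0 (h2 ▸ hi)
    subst ht hL
    simp
  · refine ⟨?_, ?_, Multiset.erase_cons_head _ _, Multiset.sum_cons _ _⟩
    · rw [Multiset.mem_cons, not_or]
      exact ⟨Ne.symm hL, h0⟩
    · rw [Multiset.sup_cons, sup_eq_left]
      exact Multiset.sup_le.2 h

lemma insertPos_erase_sup {s : Multiset ℕ} (h0 : 0 ∉ s) :
    insertPos s.sup (s.erase s.sup) = s := by
  rcases eq_or_ne s 0 with rfl | hs
  · rfl
  · have h1 := multiset_sup_mem hs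
    rw [insertPos, if_neg fun e : s.sup = 0 ↦ h0 (e ▸ h1), Multiset.cons_erase h1]

/-- Domain of Dyson's map. -/
def dysonSource (r : ℤ) : Set (Multiset ℕ) :=
  {s | 0 ∉ s ∧ multisetRank s ≤ r + 2 ∧ 0 ≤ (s.card : ℤ) + r + 1}

/-- Range of Dyson's map. -/
def dysonTarget (r : ℤ) : Set (Multiset ℕ) :=
  {s | 0 ∉ s ∧ 0 ≤ (s.sup : ℤ) - r - 1 - ((s.erase s.sup).card : ℤ)}

lemma lower_le {r : ℤ} {s : Multiset ℕ} (hs : s ∈ dysonSource r) :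
    0 ∉ lower s ∧ ∀ i ∈ lower s, i ≤ ((s.card : ℤ) + r + 1).toNat := by
  refine ⟨fun h ↦ (Multiset.mem_filter.1 h).2 rfl, fun i hi ↦ ?_⟩
  obtain ⟨j, hj, rfl⟩ := Multiset.mem_map.1 (Multiset.mem_filter.1 hi).1
  have h1 : j ≤ s.sup := Multiset.le_sup hj
  have h2 := hs.2.1
  have h3 := hs.2.2
  rw [multisetRank] at h2
  omega

/-- Dyson's adjoint map. -/
def dysonEquiv (r : ℤ) : dysonSource r ≃ dysonTarget r where
  toFun s := ⟨insertPos (((s.1.card : ℤ) + r + 1).toNat) (lower s.1), by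
    have h := insertPos_spec (lower_le s.2).1 (lower_le s.2).2
    have h1 := card_lower s.2.1
    have h2 := s.2.2.2
    refine ⟨h.1, ?_⟩
    rw [h.2.1, h.2.2.1]
    omega⟩
  invFun t := ⟨(t.1.erase t.1.sup).map (· + 1) + Multiset.replicate
      (((t.1.sup : ℤ) - r - 1 - ((t.1.erase t.1.sup).card : ℤ)).toNat) 1, by
    have h := t.2.2
    refine ⟨?_, ?_, ?_⟩
    · intro h0
      rcases Multiset.mem_add.1 h0 with h0 | h0
      · obtain ⟨j, -, hj⟩ := Multiset.mem_map.1 h0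
        omega
      · exact absurd (Multiset.eq_of_mem_replicate h0) (by omega)
    · have h1 : ((t.1.erase t.1.sup).map (· + 1) + Multiset.replicate
          (((t.1.sup : ℤ) - r - 1 - ((t.1.erase t.1.sup).card : ℤ)).toNat) 1).sup
            ≤ t.1.sup + 1 := by
        refine Multiset.sup_le.2 fun i hi ↦ ?_
        rcases Multiset.mem_add.1 hi with hi | hi
        · obtain ⟨j, hj, rfl⟩ := Multiset.mem_map.1 hi
          exact Nat.succ_le_succ (Multiset.le_sup (Multiset.mem_of_mem_erase hj))
        · rw [Multiset.eq_of_mem_replicate hi]; omega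
      rw [multisetRank, Multiset.card_add, Multiset.card_map, Multiset.card_replicate]
      omega
    · rw [Multiset.card_add, Multiset.card_map, Multiset.card_replicate]
      omega⟩
  left_inv s := by
    apply Subtype.ext
    have h := insertPos_spec (lower_le s.2).1 (lower_le s.2).2
    have h1 := card_lower s.2.1
    have h2 := s.2.2.2
    dsimp only
    rw [h.2.1, h.2.2.1]
    have h3 : (((((s.1.card : ℤ) + r + 1).toNat : ℕ) : ℤ) - r - 1 - ((lower s.1).card : ℤ)).toNat
        = s.1.count 1 := by omega
    rw [h3]
    exact lower_spec s.2.1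
  right_inv t := by
    apply Subtype.ext
    have h := t.2.2
    have h0 : 0 ∉ t.1.erase t.1.sup := fun h ↦ t.2.1 (Multiset.mem_of_mem_erase h)
    dsimp only
    rw [lower_raise h0, Multiset.card_add, Multiset.card_map, Multiset.card_replicate]
    have h3 : (((((t.1.erase t.1.sup).card + ((t.1.sup : ℤ) - r - 1 -
        ((t.1.erase t.1.sup).card : ℤ)).toNat : ℕ) : ℤ)) + r + 1).toNat = t.1.sup := by omega
    rw [h3]
    exact insertPos_erase_sup t.2.1

lemma sum_dysonEquiv {r : ℤ} (s : dysonSource r) :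
    ((dysonEquiv r s).1.sum : ℤ) = s.1.sum + (r + 1) := by
  have h := insertPos_spec (lower_le s.2).1 (lower_le s.2).2
  have h1 := sum_lower s.2.1
  have h2 := s.2.2.2
  change (((insertPos (((s.1.card : ℤ) + r + 1).toNat) (lower s.1)).sum : ℕ) : ℤ) = _
  rw [h.2.2.2]
  omega

lemma tsum_dyson {q : ℂ} (hq0 : q ≠ 0) (r : ℤ) :
    ∑' s, (dysonTarget r).indicator (wt q) s
      = q ^ (r + 1) * ∑' s, (dysonSource r).indicator (wt q) s := by
  rw [← tsum_subtype, ← tsum_subtype, ← tsum_mul_left, ← (dysonEquiv r).tsum_eq]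
  refine tsum_congr fun s ↦ ?_
  rw [wt, wt, if_neg (dysonEquiv r s).2.1, if_neg s.2.1, ← zpow_natCast, sum_dysonEquiv,
    zpow_add₀ hq0, mul_comm, zpow_natCast]

end DysonMap

section RankSeries

/-- Half of the Appell-type series. -/
noncomputable def halfTerm (q : ℂ) (c k : ℕ) : ℂ :=
  (-1) ^ (k + 1) * q ^ (3 * (k + 1).choose 2 + c * (k + 1)) / (1 - q ^ (11 * (k + 1)))

/-- Half of the Appell-type series. -/
noncomputable def halfSum (q : ℂ) (c : ℕ) : ℂ := ∑' k, halfTerm q c k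

variable {q : ℂ}

lemma norm_halfTerm_le (hq : ‖q‖ < 1) (c k : ℕ) :
    ‖halfTerm q c k‖ ≤ (‖q‖ ^ c) ^ (k + 1) * (1 - ‖q‖)⁻¹ := by
  have h0 : 0 < 1 - ‖q‖ := by linarith
  have h1 : 1 - ‖q‖ ≤ ‖1 - q ^ (11 * (k + 1))‖ := by
    have h2 : ‖q‖ ^ (11 * (k + 1)) ≤ ‖q‖ := pow_le_of_le_one (norm_nonneg q) hq.le (by omega)
    have h3 := norm_sub_norm_le 1 (q ^ (11 * (k + 1)))
    rw [norm_one, norm_pow] at h3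
    linarith
  rw [halfTerm, norm_div, norm_mul, norm_pow, norm_neg, norm_one, one_pow, one_mul, norm_pow,
    div_eq_mul_inv]
  refine mul_le_mul ?_ (inv_anti₀ h0 h1) (by positivity) (by positivity)
  rw [← pow_mul]
  exact pow_le_pow_of_le_one (norm_nonneg q) hq.le (Nat.le_add_left _ _)

lemma summable_halfBound (hq : ‖q‖ < 1) {c : ℕ} (hc : 1 ≤ c) :
    Summable fun k ↦ (‖q‖ ^ c) ^ (k + 1) * (1 - ‖q‖)⁻¹ :=
  ((summable_nat_add_iff 1).2 (summable_geometric_of_lt_one (by positivity)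
    (pow_lt_one₀ (norm_nonneg q) hq (by omega)))).mul_right _

lemma summable_halfTerm (hq : ‖q‖ < 1) {c : ℕ} (hc : 1 ≤ c) : Summable (halfTerm q c) :=
  Summable.of_norm_bounded (summable_halfBound hq hc) (norm_halfTerm_le hq c)

lemma tendsto_halfSum (hq : ‖q‖ < 1) : Tendsto (halfSum q) atTop (𝓝 0) := by
  have h := tendsto_tsum_of_dominated_convergence (f := halfTerm q) (g := fun _ ↦ 0)
    (summable_halfBound hq le_rfl) (fun k ↦ ?_)
    ((eventually_ge_atTop 1).mono fun c hc k ↦ (norm_halfTerm_le hq c k).trans ?_)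
  · simp only [tsum_zero] at h
    exact h
  · refine squeeze_zero_norm (norm_halfTerm_le hq · k) ?_
    have h1 : Tendsto (fun c : ℕ ↦ ‖q‖ ^ c) atTop (𝓝 0) :=
      tendsto_pow_atTop_nhds_zero_of_lt_one (norm_nonneg q) hq
    simpa using (h1.pow (k + 1)).mul_const (1 - ‖q‖)⁻¹
  · have h0 : 0 < 1 - ‖q‖ := by linarith
    refine mul_le_mul_of_nonneg_right (pow_le_pow_left₀ (by positivity) ?_ _) (by positivity)
    exact pow_le_pow_of_le_one (norm_nonneg q) hq.le hc

/-- The partial theta series. -/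
noncomputable def partialTheta (q : ℂ) (c : ℕ) : ℂ := halfSum q (c + 11) - halfSum q c

lemma halfTerm_sub (hq : ‖q‖ < 1) (c k : ℕ) :
    halfTerm q (c + 11) k - halfTerm q c k
      = (-1) ^ k * q ^ (3 * (k + 1).choose 2 + c * (k + 1)) := by
  have h : 1 - q ^ (11 * (k + 1)) ≠ 0 := by
    rw [sub_ne_zero]
    intro h
    have h1 := congrArg norm h
    rw [norm_one, norm_pow] at h1
    exact absurd (pow_lt_one₀ (norm_nonneg q) hq (by omega : 11 * (k + 1) ≠ 0)) (by linarith)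
  rw [halfTerm, halfTerm, ← sub_div, div_eq_iff h]
  ring

lemma hasSum_partialTheta (hq : ‖q‖ < 1) {c : ℕ} (hc : 1 ≤ c) :
    HasSum (fun k ↦ (-1) ^ k * q ^ (3 * (k + 1).choose 2 + c * (k + 1))) (partialTheta q c) := by
  have h := (summable_halfTerm hq (show 1 ≤ c + 11 by omega)).hasSum.sub
    (summable_halfTerm hq hc).hasSum
  simp only [halfTerm_sub hq] at h
  exact h

lemma partialTheta_rec (hq : ‖q‖ < 1) {c : ℕ} (hc : 1 ≤ c) :
    partialTheta q c = q ^ c * (1 - partialTheta q (c + 3)) := by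
  have h1 := hasSum_partialTheta hq hc
  have h2 := hasSum_partialTheta hq (show 1 ≤ c + 3 by omega)
  have h3 := (hasSum_nat_add_iff' 1).2 h1
  have h4 := h2.mul_left (-q ^ c)
  have h5 : ∀ k : ℕ, (-1) ^ (k + 1) * q ^ (3 * (k + 1 + 1).choose 2 + c * (k + 1 + 1))
      = -q ^ c * ((-1) ^ k * q ^ (3 * (k + 1).choose 2 + (c + 3) * (k + 1))) := fun k ↦ by
    have h6 : (k + 1 + 1).choose 2 = (k + 1) + (k + 1).choose 2 := by
      rw [Nat.choose_succ_succ' (k + 1) 1, Nat.choose_one_right]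
    rw [h6]
    ring
  simp only [h5] at h3
  have h7 := h3.unique h4
  simp only [Finset.sum_range_one] at h7
  simp at h7
  linear_combination h7

lemma eq_partialTheta (hq : ‖q‖ < 1) {X : ℕ → ℂ} {P : ℂ} {B : ℝ}
    (hB : ∀ r, ‖X r‖ ≤ B) (h : ∀ r, 1 ≤ r → X r = q ^ (r + 1) * (P - X (r + 3)))
    {r : ℕ} (hr : 1 ≤ r) : X r = P * partialTheta q (r + 1) := by
  have hlim : Tendsto (fun r ↦ ‖partialTheta q (r + 1)‖) atTop (𝓝 0) := by
    have h1 := tendsto_halfSum hq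
    have h2 := ((tendsto_add_atTop_iff_nat 12).2 h1).sub ((tendsto_add_atTop_iff_nat 1).2 h1)
    have h3 := h2.norm
    rw [sub_zero, norm_zero] at h3
    exact h3
  obtain ⟨C, hC⟩ := hlim.bddAbove_range
  set D : ℕ → ℂ := fun r ↦ X r - P * partialTheta q (r + 1) with hD
  have h1 : ∀ r, ‖D r‖ ≤ B + ‖P‖ * C := fun r ↦ by
    refine (norm_sub_le _ _).trans (add_le_add (hB r) ?_)
    rw [norm_mul]
    exact mul_le_mul_of_nonneg_left (hC ⟨r, rfl⟩) (norm_nonneg P)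
  have h2 : ∀ r, 1 ≤ r → D r = -q ^ (r + 1) * D (r + 3) := fun r hr ↦ by
    simp only [hD]
    rw [partialTheta_rec hq (show 1 ≤ r + 1 by omega), show r + 3 + 1 = r + 1 + 3 by ring]
    linear_combination h r hr
  have h3 : ∀ n : ℕ, ∀ r, 1 ≤ r → ‖D r‖ ≤ ‖q‖ ^ n * (B + ‖P‖ * C) := fun n ↦ by
    induction n with
    | zero => intro r _; simpa using h1 r
    | succ n ih =>
      intro r hr
      rw [h2 r hr, norm_mul, norm_neg, norm_pow, pow_succ' ‖q‖ n, mul_assoc]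
      exact mul_le_mul (pow_le_of_le_one (norm_nonneg q) hq.le (by omega)) (ih _ (by omega))
        (norm_nonneg _) (norm_nonneg _)
  have h4 : Tendsto (fun n : ℕ ↦ ‖q‖ ^ n * (B + ‖P‖ * C)) atTop (𝓝 0) := by
    simpa using (tendsto_pow_atTop_nhds_zero_of_lt_one (norm_nonneg q) hq).mul_const
      (B + ‖P‖ * C)
  have h5 : ‖D r‖ ≤ 0 := ge_of_tendsto' h4 fun n ↦ h3 n r hr
  exact sub_eq_zero.1 (norm_le_zero_iff.1 h5)

/-- The generating function of the partitions whose rank satisfies `p`. -/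
noncomputable def rankGF (p : ℤ → Prop) (q : ℂ) : ℂ :=
  open Classical in ∑' s, (if p (multisetRank s) then 1 else 0) * wt q s

lemma norm_ite_le (p : Prop) [Decidable p] : ‖(if p then 1 else 0 : ℂ)‖ ≤ 1 := by
  split_ifs <;> simp

lemma norm_rankGF_le (hq : ‖q‖ < 1) (p : ℤ → Prop) : ‖rankGF p q‖ ≤ ∑' s, ‖wt q s‖ := by
  classical
  exact norm_tsum_mul_wt_le hq fun s ↦ norm_ite_le _

lemma rankGF_or (hq : ‖q‖ < 1) {p p₁ p₂ : ℤ → Prop} (h : ∀ x, p x ↔ p₁ x ∨ p₂ x)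
    (h' : ∀ x, ¬(p₁ x ∧ p₂ x)) : rankGF p q = rankGF p₁ q + rankGF p₂ q := by
  classical
  rw [rankGF, rankGF, rankGF,
    ← (summable_mul_wt hq fun s ↦ norm_ite_le _).tsum_add
        (summable_mul_wt hq fun s ↦ norm_ite_le _)]
  refine tsum_congr fun s ↦ ?_
  rw [← add_mul]
  congr 1
  have h1 := h (multisetRank s)
  have h2 := h' (multisetRank s)
  by_cases a : p₁ (multisetRank s) <;> by_cases b : p₂ (multisetRank s) <;> simp_all

lemma rankGF_true (hq : ‖q‖ < 1) : rankGF (fun _ ↦ True) q = (poch q q)⁻¹ := by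
  rw [rankGF, ← tsum_wt hq]
  simp

lemma indicator_wt {A : Set (Multiset ℕ)} {p : ℤ → Prop}
    (h : ∀ s : Multiset ℕ, 0 ∉ s → (s ∈ A ↔ p (multisetRank s))) :
    ∑' s, A.indicator (wt q) s = rankGF p q := by
  classical
  rw [rankGF]
  refine tsum_congr fun s ↦ ?_
  rw [Set.indicator_apply]
  by_cases h0 : 0 ∈ s
  · rw [wt, if_pos h0]; simp
  · simp [h s h0]

lemma card_erase_sup {s : Multiset ℕ} (hs : s ≠ 0) : (s.erase s.sup).card + 1 = s.card := by
  rw [Multiset.card_erase_add_one (multiset_sup_mem hs)]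

lemma rankGF_ge_rec (hq0 : q ≠ 0) (hq : ‖q‖ < 1) {r : ℕ} (hr : 1 ≤ r) :
    rankGF (fun x ↦ (r : ℤ) ≤ x) q
      = q ^ (r + 1) * ((poch q q)⁻¹ - rankGF (fun x ↦ ((r + 3 : ℕ) : ℤ) ≤ x) q) := by
  have h1 := tsum_dyson hq0 (r : ℤ)
  rw [indicator_wt (p := fun x ↦ (r : ℤ) ≤ x), indicator_wt (p := fun x ↦ x ≤ (r : ℤ) + 2)] at h1
  · rw [h1, ← rankGF_true hq, rankGF_or hq (p := fun _ ↦ True) (p₁ := fun x ↦ x ≤ (r : ℤ) + 2)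
      (p₂ := fun x ↦ ((r + 3 : ℕ) : ℤ) ≤ x) (fun x ↦ ⟨fun _ ↦ by push_cast; omega, fun _ ↦ trivial⟩)
      (fun x ↦ by push_cast; omega), add_sub_cancel_right]
    norm_cast
  · intro s h0
    simp only [dysonSource, Set.mem_ofPred_eq, h0, not_false_eq_true, true_and]
    omega
  · intro s h0
    simp only [dysonTarget, Set.mem_ofPred_eq, h0, not_false_eq_true, true_and, multisetRank]
    rcases eq_or_ne s 0 with rfl | hs
    · simp; omega
    · have := card_erase_sup hs
      omega

lemma rankGF_le_rec (hq0 : q ≠ 0) (hq : ‖q‖ < 1) {r : ℕ} (hr : 1 ≤ r) :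
    rankGF (fun x ↦ x ≤ -(r : ℤ)) q
      = q ^ (r + 1) * ((poch q q)⁻¹ - rankGF (fun x ↦ x ≤ -((r + 3 : ℕ) : ℤ)) q) := by
  have h1 := tsum_dyson hq0 (-(r : ℤ) - 2)
  rw [indicator_wt (p := fun x ↦ -(r : ℤ) - 2 ≤ x), indicator_wt (p := fun x ↦ x ≤ -(r : ℤ))] at h1
  · have h2 : rankGF (fun x ↦ -(r : ℤ) - 2 ≤ x) q
        = (poch q q)⁻¹ - rankGF (fun x ↦ x ≤ -((r + 3 : ℕ) : ℤ)) q := by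
      rw [← rankGF_true hq, rankGF_or hq (p := fun _ ↦ True) (p₁ := fun x ↦ -(r : ℤ) - 2 ≤ x)
        (p₂ := fun x ↦ x ≤ -((r + 3 : ℕ) : ℤ))
        (fun x ↦ ⟨fun _ ↦ by push_cast; omega, fun _ ↦ trivial⟩)
        (fun x ↦ by push_cast; omega), add_sub_cancel_right]
    rw [← h2, h1, ← mul_assoc, ← zpow_natCast, ← zpow_add₀ hq0]
    have h3 : ((r + 1 : ℕ) : ℤ) + (-(r : ℤ) - 2 + 1) = 0 := by push_cast; ring
    rw [h3, zpow_zero, one_mul]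
  · intro s h0
    simp only [dysonSource, Set.mem_ofPred_eq, h0, not_false_eq_true, true_and, multisetRank]
    rcases eq_or_ne s 0 with rfl | hs
    · simp; omega
    · have : s.sup ≠ 0 := fun e ↦ h0 (e ▸ multiset_sup_mem hs)
      omega
  · intro s h0
    simp only [dysonTarget, Set.mem_ofPred_eq, h0, not_false_eq_true, true_and, multisetRank]
    rcases eq_or_ne s 0 with rfl | hs
    · simp; omega
    · have := card_erase_sup hs
      omega

lemma rankGF_ge (hq0 : q ≠ 0) (hq : ‖q‖ < 1) {r : ℕ} (hr : 1 ≤ r) :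
    rankGF (fun x ↦ (r : ℤ) ≤ x) q = (poch q q)⁻¹ * partialTheta q (r + 1) :=
  eq_partialTheta hq (X := fun r ↦ rankGF (fun x ↦ (r : ℤ) ≤ x) q)
    (fun _ ↦ norm_rankGF_le hq _) (fun _ hr ↦ rankGF_ge_rec hq0 hq hr) hr

lemma rankGF_le (hq0 : q ≠ 0) (hq : ‖q‖ < 1) {r : ℕ} (hr : 1 ≤ r) :
    rankGF (fun x ↦ x ≤ -(r : ℤ)) q = (poch q q)⁻¹ * partialTheta q (r + 1) :=
  eq_partialTheta hq (X := fun r ↦ rankGF (fun x ↦ x ≤ -(r : ℤ)) q)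
    (fun _ ↦ norm_rankGF_le hq _) (fun _ hr ↦ rankGF_le_rec hq0 hq hr) hr

lemma tendsto_rankGF (hq : ‖q‖ < 1) {p : ℕ → ℤ → Prop}
    (h : ∀ x, ∀ᶠ n in atTop, ¬ p n x) : Tendsto (fun n ↦ rankGF (p n) q) atTop (𝓝 0) := by
  classical
  have h1 := tendsto_tsum_of_dominated_convergence (β := Multiset ℕ) (𝓕 := atTop)
    (f := fun n s ↦ (if p n (multisetRank s) then 1 else 0) * wt q s) (g := fun _ ↦ 0)
    (summable_norm_wt hq) (fun s ↦ ?_) (Eventually.of_forall fun n s ↦ ?_)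
  · simp only [tsum_zero] at h1
    exact h1.congr fun n ↦ by rw [rankGF]
  · refine tendsto_const_nhds.congr' ?_
    filter_upwards [h (multisetRank s)] with n hn
    rw [if_neg hn, zero_mul]
  · rw [norm_mul]
    exact mul_le_of_le_one_left (norm_nonneg _) (norm_ite_le _)

lemma eq_of_progression (hq : ‖q‖ < 1) {Y : ℕ → ℂ} {P : ℂ}
    (hlim : ∀ a, Tendsto (fun n : ℕ ↦ Y (a + 11 * n)) atTop (𝓝 0))
    (h : ∀ a, 1 ≤ a → Y a - Y (a + 11) = P * partialTheta q (a + 1) - P * partialTheta q (a + 2))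
    {a : ℕ} (ha : 1 ≤ a) : Y a = P * (halfSum q (a + 2) - halfSum q (a + 1)) := by
  set D : ℕ → ℂ := fun a ↦ Y a - P * (halfSum q (a + 2) - halfSum q (a + 1)) with hD
  have h1 : ∀ a, 1 ≤ a → D (a + 11) = D a := fun a ha ↦ by
    have h2 := h a ha
    simp only [partialTheta] at h2
    simp only [hD]
    rw [show a + 11 + 2 = a + 2 + 11 by ring, show a + 11 + 1 = a + 1 + 11 by ring]
    linear_combination -h2
  have h2 : ∀ n : ℕ, D (a + 11 * n) = D a := fun n ↦ by
    induction n with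
    | zero => rfl
    | succ n ih => rw [← ih, ← h1 (a + 11 * n) (by omega)]; rfl
  have h3 : Tendsto (fun n : ℕ ↦ a + 11 * n) atTop atTop :=
    tendsto_atTop_mono (fun n ↦ by simp only [id]; omega) tendsto_id
  have h4 := tendsto_halfSum hq
  have h5 : Tendsto (fun n : ℕ ↦ D (a + 11 * n)) atTop (𝓝 0) := by
    have h6 := (((tendsto_add_atTop_iff_nat 2).2 h4).sub
      ((tendsto_add_atTop_iff_nat 1).2 h4)).comp h3
    have h7 := (hlim a).sub (h6.const_mul P)
    simpa [Function.comp_def, hD] using h7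
  simp only [h2] at h5
  exact sub_eq_zero.1 (tendsto_nhds_unique tendsto_const_nhds h5)

lemma rankGF_progression_ge (hq0 : q ≠ 0) (hq : ‖q‖ < 1) {a : ℕ} (ha : 1 ≤ a) :
    rankGF (fun x ↦ (a : ℤ) ≤ x ∧ x % 11 = (a : ℤ) % 11) q
      = (poch q q)⁻¹ * (halfSum q (a + 2) - halfSum q (a + 1)) := by
  refine eq_of_progression hq
    (Y := fun a : ℕ ↦ rankGF (fun x ↦ (a : ℤ) ≤ x ∧ x % 11 = (a : ℤ) % 11) q)
    (fun a ↦ tendsto_rankGF hq fun x ↦ ?_) (fun a ha ↦ ?_) ha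
  · filter_upwards [eventually_gt_atTop x.toNat] with n hn
    omega
  · rw [← rankGF_ge hq0 hq ha, ← rankGF_ge hq0 hq (show 1 ≤ a + 1 by omega),
      rankGF_or hq (p := fun x ↦ (a : ℤ) ≤ x ∧ x % 11 = (a : ℤ) % 11) (p₁ := fun x ↦ x = (a : ℤ))
      (p₂ := fun x ↦ ((a + 11 : ℕ) : ℤ) ≤ x ∧ x % 11 = ((a + 11 : ℕ) : ℤ) % 11)
      (fun x ↦ by push_cast; omega) (fun x ↦ by push_cast; omega),
      rankGF_or hq (p := fun x ↦ (a : ℤ) ≤ x) (p₁ := fun x ↦ x = (a : ℤ))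
      (p₂ := fun x ↦ ((a + 1 : ℕ) : ℤ) ≤ x)
      (fun x ↦ by push_cast; omega) (fun x ↦ by push_cast; omega)]
    ring

lemma rankGF_progression_le (hq0 : q ≠ 0) (hq : ‖q‖ < 1) {a : ℕ} (ha : 1 ≤ a) :
    rankGF (fun x ↦ x ≤ -(a : ℤ) ∧ x % 11 = -(a : ℤ) % 11) q
      = (poch q q)⁻¹ * (halfSum q (a + 2) - halfSum q (a + 1)) := by
  refine eq_of_progression hq
    (Y := fun a : ℕ ↦ rankGF (fun x ↦ x ≤ -(a : ℤ) ∧ x % 11 = -(a : ℤ) % 11) q)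
    (fun a ↦ tendsto_rankGF hq fun x ↦ ?_) (fun a ha ↦ ?_) ha
  · filter_upwards [eventually_gt_atTop (-x).toNat] with n hn
    omega
  · rw [← rankGF_le hq0 hq ha, ← rankGF_le hq0 hq (show 1 ≤ a + 1 by omega),
      rankGF_or hq (p := fun x ↦ x ≤ -(a : ℤ) ∧ x % 11 = -(a : ℤ) % 11) (p₁ := fun x ↦ x = -(a : ℤ))
      (p₂ := fun x ↦ x ≤ -((a + 11 : ℕ) : ℤ) ∧ x % 11 = -((a + 11 : ℕ) : ℤ) % 11)
      (fun x ↦ by push_cast; omega) (fun x ↦ by push_cast; omega),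
      rankGF_or hq (p := fun x ↦ x ≤ -(a : ℤ)) (p₁ := fun x ↦ x = -(a : ℤ))
      (p₂ := fun x ↦ x ≤ -((a + 1 : ℕ) : ℤ))
      (fun x ↦ by push_cast; omega) (fun x ↦ by push_cast; omega)]
    ring

end RankSeries

section RankClasses

variable {q : ℂ}

lemma rankTerm_add_one (b : ℤ) {c : ℕ} (hc : (c : ℤ) = 3 + b) (k : ℕ) :
    rankTerm q b (k + 1) = halfTerm q c k := by
  rw [rankTerm, halfTerm, ← Nat.cast_succ, zpow_natCast, Nat.succ_eq_add_one, tri_add_one,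
    tri_natCast]
  have h : (3 * (((k + 1).choose 2 : ℕ) + ((k + 1 : ℕ) : ℤ)) + b * ((k + 1 : ℕ) : ℤ))
      = ((3 * (k + 1).choose 2 + c * (k + 1) : ℕ) : ℤ) := by
    push_cast
    rw [hc]
    ring
  rw [h, zpow_natCast, show (11 * ((k + 1 : ℕ) : ℤ)) = ((11 * (k + 1) : ℕ) : ℤ) by push_cast; ring,
    zpow_natCast]

lemma rankTerm_neg_add_one (hq0 : q ≠ 0) (hq : ‖q‖ < 1) (b : ℤ) {d : ℕ} (hd : (d : ℤ) = 11 - b)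
    (k : ℕ) : rankTerm q b (-(k + 1)) = -halfTerm q d k := by
  have hm : (11 * (k + 1) : ℤ) ≠ 0 := by omega
  have h1 := one_sub_zpow_ne_zero hq0 hq hm
  have h2 := one_sub_zpow_ne_zero hq0 hq (neg_ne_zero.2 hm)
  rw [rankTerm, halfTerm, ← zpow_natCast, ← zpow_natCast, ← zpow_natCast,
    show (-((k : ℤ) + 1) + 1) = 1 - ((k + 1 : ℕ) : ℤ) by push_cast; ring, tri_one_sub, tri_natCast]
  have h3 : (((11 * (k + 1) : ℕ)) : ℤ) = 11 * (k + 1) := by push_cast; ring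
  rw [h3, show 11 * -((k : ℤ) + 1) = -(11 * (k + 1)) by ring, ← neg_div, div_eq_div_iff h2 h1]
  have h4 : (((3 * (k + 1).choose 2 + d * (k + 1) : ℕ)) : ℤ)
      = (3 * ((k + 1).choose 2 : ℕ) + b * -((k : ℤ) + 1)) + 11 * (k + 1) := by
    push_cast
    rw [hd]
    ring
  have h5 : (-1 : ℂ) ^ (-((k : ℤ) + 1)) = (-1) ^ (((k + 1 : ℕ)) : ℤ) := by
    rw [zpow_neg, ← inv_zpow]
    push_cast
    norm_num
  rw [h4, h5, zpow_add₀ hq0 _ (11 * ((k : ℤ) + 1)), zpow_neg q (11 * ((k : ℤ) + 1))]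
  have h6 : q ^ (11 * ((k : ℤ) + 1)) ≠ 0 := zpow_ne_zero _ hq0
  generalize q ^ (11 * ((k : ℤ) + 1)) = y at h6
  field_simp
  ring

lemma rankSum_eq_halfSum (hq0 : q ≠ 0) (hq : ‖q‖ < 1) (b : ℤ) {c d : ℕ} (hc : (c : ℤ) = 3 + b)
    (hd : (d : ℤ) = 11 - b) (hc1 : 1 ≤ c) (hd1 : 1 ≤ d) :
    rankSum q b = halfSum q c - halfSum q d := by
  have h1 : HasSum (fun n : ℕ ↦ rankTerm q b (n + 1)) (halfSum q c) := by
    simp only [rankTerm_add_one b hc]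
    exact (summable_halfTerm hq hc1).hasSum
  have h2 : HasSum (fun n : ℕ ↦ rankTerm q b (-(n + 1))) (-halfSum q d) := by
    simp only [rankTerm_neg_add_one hq0 hq b hd]
    exact (summable_halfTerm hq hd1).hasSum.neg
  have h3 := (h1.of_add_one_of_neg_add_one h2).tsum_eq
  have h4 : rankTerm q b 0 = 0 := by simp [rankTerm]
  rw [rankSum, h3, h4]
  ring

lemma rankGF_class (hq0 : q ≠ 0) (hq : ‖q‖ < 1) {a : ℕ} (h1 : 1 ≤ a) (h2 : a ≤ 10) :
    rankGF (fun x ↦ x % 11 = a) q = rankClassGF a q := by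
  obtain ⟨a', ha⟩ : ∃ a', a + a' = 11 := ⟨11 - a, by omega⟩
  have h := rankGF_or hq (p := fun x ↦ x % 11 = a)
    (p₁ := fun x ↦ (a : ℤ) ≤ x ∧ x % 11 = (a : ℤ) % 11)
    (p₂ := fun x ↦ x ≤ -(a' : ℤ) ∧ x % 11 = -(a' : ℤ) % 11) (fun x ↦ by omega) (fun x ↦ by omega)
  rw [h, rankGF_progression_ge hq0 hq h1, rankGF_progression_le hq0 hq (by omega), rankClassGF,
    if_neg (by omega),
    rankSum_eq_halfSum hq0 hq (a - 1) (c := a + 2) (d := a' + 1) (by push_cast; ring)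
      (by push_cast; omega) (by omega) (by omega),
    rankSum_eq_halfSum hq0 hq (a - 2) (c := a + 1) (d := a' + 2) (by push_cast; ring)
      (by push_cast; omega) (by omega) (by omega)]
  rw [div_eq_mul_inv]
  ring

lemma rankGF_class_zero (hq0 : q ≠ 0) (hq : ‖q‖ < 1) :
    rankGF (fun x ↦ x % 11 = 0) q = rankClassGF 0 q := by
  have h := rankGF_or hq (p := fun x ↦ x % 11 = 0)
    (p₁ := fun x ↦ ((11 : ℕ) : ℤ) ≤ x ∧ x % 11 = ((11 : ℕ) : ℤ) % 11)
    (p₂ := fun x ↦ x ≤ 0 ∧ x % 11 = 0) (fun x ↦ by push_cast; omega) (fun x ↦ by push_cast; omega)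
  have h' := rankGF_or hq (p := fun x ↦ x ≤ 0 ∧ x % 11 = 0)
    (p₁ := fun x ↦ x ≤ -((11 : ℕ) : ℤ) ∧ x % 11 = -((11 : ℕ) : ℤ) % 11)
    (p₂ := fun x ↦ x = 0) (fun x ↦ by push_cast; omega) (fun x ↦ by push_cast; omega)
  have h1 := rankGF_or hq (p := fun _ ↦ True) (p₁ := fun x ↦ ((1 : ℕ) : ℤ) ≤ x)
    (p₂ := fun x ↦ x ≤ 0) (fun x ↦ ⟨fun _ ↦ by push_cast; omega, fun _ ↦ trivial⟩)
    (fun x ↦ by push_cast; omega)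
  have h2 := rankGF_or hq (p := fun x ↦ x ≤ 0) (p₁ := fun x ↦ x ≤ -((1 : ℕ) : ℤ))
    (p₂ := fun x ↦ x = 0) (fun x ↦ by push_cast; omega) (fun x ↦ by push_cast; omega)
  rw [rankGF_true hq, rankGF_ge hq0 hq le_rfl] at h1
  rw [rankGF_le hq0 hq le_rfl] at h2
  rw [h, h', rankGF_progression_ge hq0 hq (by norm_num), rankGF_progression_le hq0 hq (by norm_num)]
  have h3 := rankSum_neg_two hq0 hq
  have h4 := rankSum_eq_halfSum hq0 hq (-1) (c := 2) (d := 12) (by norm_num) (by norm_num)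
    (by norm_num) (by norm_num)
  have h5 := poch_self_ne_zero hq
  rw [rankClassGF, if_pos rfl, show (0 - 1 : ℤ) = -1 from rfl, show (0 - 2 : ℤ) = -2 from rfl, h3,
    h4]
  rw [partialTheta] at h1 h2
  norm_num only at h1 h2 ⊢
  have h6 : rankGF (fun x ↦ x = 0) q = (poch q q)⁻¹ - (poch q q)⁻¹ * (halfSum q 13 - halfSum q 2)
      - (poch q q)⁻¹ * (halfSum q 13 - halfSum q 2) := by linear_combination -h1 - h2
  rw [h6]
  field_simp
  ring

end RankClasses

section CrankSeries

/-- The crank, extended to all multisets. -/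
def multisetCrank (s : Multiset ℕ) : ℤ :=
  if s.count 1 = 0 then (s.sup : ℤ)
  else ((s.filter fun x ↦ s.count 1 < x).card : ℤ) - (s.count 1 : ℤ)

/-- Weights marking the parts larger than `j` in partitions without ones. -/
noncomputable def crankWeight (z q : ℂ) (j i : ℕ) : ℂ :=
  if i ≤ 1 then 0 else if i ≤ j then q ^ i else z * q ^ i

variable {z q : ℂ}

lemma prod_crankWeight (z q : ℂ) (j : ℕ) (s : Multiset ℕ) :
    (s.map (crankWeight z q j)).prod
      = if 1 ∈ s then 0 else z ^ (s.filter fun x ↦ j < x).card * wt q s := by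
  induction s using Multiset.induction_on with
  | empty => simp [wt]
  | cons a s ih =>
    rw [Multiset.map_cons, Multiset.prod_cons, ih]
    by_cases h1 : 1 ∈ s
    · simp [h1]
    · rw [if_neg h1]
      rcases eq_or_ne a 1 with rfl | ha1
      · simp [crankWeight]
      · rw [if_neg (by rw [Multiset.mem_cons, not_or]; exact ⟨ha1.symm, h1⟩)]
        rcases eq_or_ne a 0 with rfl | ha0
        · simp [crankWeight, wt]
        · have hw : wt q (a ::ₘ s) = q ^ a * wt q s := by
            by_cases h : 0 ∈ s <;> simp [wt, h, ha0.symm, pow_add]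
          rw [hw, crankWeight, if_neg (by omega)]
          by_cases haj : j < a
          · rw [if_neg (by omega), Multiset.filter_cons_of_pos _ haj, Multiset.card_cons]
            ring
          · rw [if_pos (by omega), Multiset.filter_cons_of_neg _ haj]
            ring

lemma norm_crankWeight_le (hz : ‖z‖ = 1) (j i : ℕ) : ‖crankWeight z q j i‖ ≤ ‖q‖ ^ i := by
  rw [crankWeight]
  split_ifs
  · rw [norm_zero]; positivity
  · rw [norm_pow]
  · rw [norm_mul, hz, one_mul, norm_pow]

lemma norm_crankWeight_lt_one (hz : ‖z‖ = 1) (hq : ‖q‖ < 1) (j i : ℕ) :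
    ‖crankWeight z q j i‖ < 1 := by
  rcases Nat.lt_or_ge 1 i with h | h
  · exact (norm_crankWeight_le hz j i).trans_lt (pow_lt_one₀ (norm_nonneg q) hq (by omega))
  · rw [crankWeight, if_pos h, norm_zero]
    exact one_pos

lemma one_sub_ne_zero_of_norm_lt_one (hq : ‖q‖ < 1) : 1 - q ≠ 0 := by
  intro h
  rw [← sub_eq_zero.1 h, norm_one] at hq
  exact lt_irrefl _ hq

lemma prod_inv_one_sub_weight (hq : ‖q‖ < 1) {w : ℕ → ℂ} (h1 : w 1 = 0) {j : ℕ}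
    (h : ∀ i, 2 ≤ i → i ≤ j → w i = q ^ i) {m : ℕ} (hm : 1 ≤ m) (hmj : m ≤ j) :
    ∏ i ∈ Finset.range m, (1 - w (i + 1))⁻¹ = (1 - q) / fpoch q q m := by
  induction m, hm using Nat.le_induction with
  | base =>
    have := one_sub_ne_zero_of_norm_lt_one hq
    rw [Finset.prod_range_one, fpoch_succ, fpoch_zero, h1, pow_zero, mul_one, one_mul, sub_zero,
      inv_one, div_self this]
  | succ m hm ih =>
    rw [Finset.prod_range_succ, ih (by omega), fpoch_succ, h (m + 1) (by omega) hmj, pow_succ',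
      div_mul_eq_div_div, div_eq_mul_inv _ (1 - q * q ^ m)]

lemma mul_pow_ne_one (hz : ‖z‖ = 1) (hq : ‖q‖ < 1) (m : ℕ) : z * q * q ^ m ≠ 1 := by
  intro h
  have h1 := congrArg norm h
  rw [norm_mul, norm_mul, hz, one_mul, norm_pow, norm_one, ← pow_succ'] at h1
  exact absurd (pow_lt_one₀ (norm_nonneg q) hq (Nat.succ_ne_zero m)) (by rw [h1]; exact lt_irrefl _)

lemma prod_inv_crankWeight (hz : ‖z‖ = 1) (hq : ‖q‖ < 1) {j : ℕ} (hj : 1 ≤ j) (n : ℕ) :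
    ∏ i ∈ Finset.range (n + j), (1 - crankWeight z q j (i + 1))⁻¹
      = (1 - q) / fpoch q q j * (fpoch q (z * q) j / fpoch q (z * q) (n + j)) := by
  induction n with
  | zero =>
    rw [zero_add, div_self (fpoch_ne_zero (mul_pow_ne_one hz hq) j), mul_one]
    refine prod_inv_one_sub_weight hq (by simp [crankWeight]) (fun i h1 h2 ↦ ?_) hj le_rfl
    rw [crankWeight, if_neg (by omega), if_pos h2]
  | succ n ih =>
    rw [show n + 1 + j = (n + j) + 1 by ring, Finset.prod_range_succ, ih, fpoch_succ, crankWeight,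
      if_neg (by omega), if_neg (by omega), pow_succ', ← mul_assoc z,
      div_mul_eq_div_div _ _ (1 - z * q * q ^ (n + j)), div_eq_mul_inv _ (1 - z * q * q ^ (n + j))]
    ring

lemma hasSum_crankWeight (hz : ‖z‖ = 1) (hq : ‖q‖ < 1) {j : ℕ} (hj : 1 ≤ j) :
    HasSum (fun s : Multiset ℕ ↦ (s.map (crankWeight z q j)).prod)
      ((1 - q) / poch q (z * q) * (fpoch q (z * q) j / fpoch q q j)) := by
  have h1 : ∀ i, ‖crankWeight z q j i‖ ≤ ‖q‖ ^ i := norm_crankWeight_le hz j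
  have h0 : crankWeight z q j 0 = 0 := by simp [crankWeight]
  have h2 := (summable_norm_prod_map (norm_nonneg q) hq h0 h1).of_norm.hasSum
  have h3 := tendsto_prod_tsum_multiset (norm_nonneg q) hq h0 h1
  have h4 := (tendsto_add_atTop_iff_nat j).2 h3
  simp only [prod_inv_crankWeight hz hq hj] at h4
  have h5 : Tendsto (fun n ↦ (1 - q) / fpoch q q j * (fpoch q (z * q) j / fpoch q (z * q) (n + j)))
      atTop (𝓝 ((1 - q) / fpoch q q j * (fpoch q (z * q) j / poch q (z * q)))) :=
    (tendsto_const_nhds.div ((tendsto_add_atTop_iff_nat j).2 (tendsto_fpoch hq (z * q)))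
      (poch_ne_zero hq (mul_pow_ne_one hz hq))).const_mul _
  rw [tendsto_nhds_unique h4 h5] at h2
  rw [show (1 - q) / poch q (z * q) * (fpoch q (z * q) j / fpoch q q j)
    = (1 - q) / fpoch q q j * (fpoch q (z * q) j / poch q (z * q)) by ring]
  exact h2

/-- Sum over partitions without ones with a given largest part. -/
lemma hasSum_noOnes (hz : ‖z‖ = 1) (hq : ‖q‖ < 1) :
    HasSum (fun s : Multiset ℕ ↦ z ^ s.sup * (s.map (crankWeight 1 q 0)).prod)
      ((1 - q) / poch q (z * q) + q - z * q) := by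
  classical
  set w := crankWeight 1 q 0 with hw
  have hw1 : ∀ i, ‖w i‖ < 1 := norm_crankWeight_lt_one norm_one hq 0
  have hn : Summable fun s : Multiset ℕ ↦ ‖(s.map w).prod‖ :=
    summable_norm_prod_map (norm_nonneg q) hq (by simp [hw, crankWeight])
      (norm_crankWeight_le norm_one 0)
  have h1 : Summable fun s : Multiset ℕ ↦ z ^ s.sup * (s.map w).prod := by
    refine Summable.of_norm (hn.congr fun s ↦ ?_)
    rw [norm_mul, norm_pow, hz, one_pow, one_mul]
  have h2 := h1.hasSum.tsum_fiberwise fun s ↦ s.sup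
  set A := ∑' s : Multiset ℕ, z ^ s.sup * (s.map w).prod with hA
  have hlt : ∀ (m : ℕ) (s : Multiset ℕ), (∀ i ∈ s, i < m + 1) ↔ s.sup ≤ m := fun m s ↦ by
    rw [Multiset.sup_le]
    exact forall₂_congr fun i _ ↦ Nat.lt_succ_iff
  have hb : ∀ (m : ℕ) (s : Multiset ℕ),
      boundedWeight w (m + 1) s = if s.sup ≤ m then (s.map w).prod else 0 := fun m s ↦ by
    rw [boundedWeight]
    simp only [hlt]
  have h3 : ∀ m, ∑' s : (fun s : Multiset ℕ ↦ s.sup) ⁻¹' {m + 1},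
      z ^ s.1.sup * (s.1.map w).prod
        = z ^ (m + 1) * (w (m + 1) * ∏ i ∈ Finset.range (m + 1), (1 - w (i + 1))⁻¹) := fun m ↦ by
    rw [tsum_subtype ((fun s : Multiset ℕ ↦ s.sup) ⁻¹' {m + 1})
      (fun s ↦ z ^ s.sup * (s.map w).prod)]
    have h4 := ((hasSum_boundedWeight hw1 (m + 2)).2.sub
      (hasSum_boundedWeight hw1 (m + 1)).2).mul_left (z ^ (m + 1))
    rw [tsum_congr fun s ↦ ?_, h4.tsum_eq]
    · rw [← prod_range_shift w (by simp [hw, crankWeight]), Finset.prod_range_succ _ (m + 1)]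
      have h5 : 1 - w (m + 1) ≠ 0 := one_sub_ne_zero_of_norm_lt_one (hw1 _)
      field_simp
      ring
    · rw [Set.indicator_apply, hb (m + 1), hb m]
      simp only [Set.mem_preimage, Set.mem_singleton_iff]
      by_cases e : s.sup = m + 1
      · rw [if_pos e, if_pos (by omega), if_neg (by omega), sub_zero, e]
      · rw [if_neg e]
        by_cases e' : s.sup ≤ m
        · rw [if_pos (by omega), if_pos e', sub_self, mul_zero]
        · rw [if_neg (by omega), if_neg e', sub_self, mul_zero]
  have h30 : ∑' s : (fun s : Multiset ℕ ↦ s.sup) ⁻¹' {0}, z ^ s.1.sup * (s.1.map w).prod = 1 := by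
    rw [tsum_subtype ((fun s : Multiset ℕ ↦ s.sup) ⁻¹' {0}) (fun s ↦ z ^ s.sup * (s.map w).prod)]
    have h4 := (hasSum_boundedWeight hw1 1).2
    rw [tsum_congr fun s ↦ ?_, h4.tsum_eq]
    · simp [hw, crankWeight]
    · rw [Set.indicator_apply, hb 0]
      simp only [Set.mem_preimage, Set.mem_singleton_iff, nonpos_iff_eq_zero]
      split_ifs with e
      · rw [e, pow_zero, one_mul]
      · rfl
  have hzq : ‖z * q‖ < 1 := by rwa [norm_mul, hz, one_mul]
  have h6 : HasSum (fun n ↦ 1 / fpoch q q n * (z * q) ^ n) (1 / poch q (z * q)) := by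
    have h7 := (summable_norm_euler_inv hq hzq).of_norm.hasSum
    have h8 : ∑' n, 1 / fpoch q q n * (z * q) ^ n = 1 / poch q (z * q) :=
      eq_div_of_mul_eq (poch_ne_zero hq (mul_pow_ne_one hz hq)) (by
        rw [mul_comm]
        exact euler_inv hq hzq)
    rwa [h8] at h7
  have h9 := (h6.mul_left (1 - q)).sub h2
  have hq1 := one_sub_ne_zero_of_norm_lt_one hq
  have h10 := hasSum_sum_of_ne_finset_zero (s := Finset.range 2)
    (f := fun n ↦ (1 - q) * (1 / fpoch q q n * (z * q) ^ n)
      - ∑' s : (fun s : Multiset ℕ ↦ s.sup) ⁻¹' {n}, z ^ s.1.sup * (s.1.map w).prod)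
    (L := SummationFilter.unconditional ℕ) (fun n hn ↦ by
      obtain ⟨k, rfl⟩ : ∃ k, n = k + 1 + 1 := ⟨n - 2, by simp at hn; omega⟩
      rw [h3, prod_inv_one_sub_weight hq (j := k + 2) (by simp [hw, crankWeight])
        (fun i hi _ ↦ by rw [hw, crankWeight, if_neg (by omega), if_neg (by omega), one_mul])
        (by omega) le_rfl, hw, crankWeight, if_neg (by omega), if_neg (by omega)]
      ring)
  have h11 := h9.unique h10
  rw [Finset.sum_range_succ, Finset.sum_range_one, h30, h3] at h11
  have h12 : w (0 + 1) = 0 := by simp [hw, crankWeight]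
  rw [h12, fpoch_succ, fpoch_zero] at h11
  have h13 : A = (1 - q) / poch q (z * q) + q - z * q := by
    have h14 : (1 - q) * (1 / (1 * (1 - q * q ^ 0)) * (z * q) ^ 1) = z * q := by
      rw [pow_zero, mul_one, one_mul, pow_one]
      field_simp
    linear_combination -h11 - h14
  rw [← h13]
  exact h1.hasSum

end CrankSeries

section CrankGeneratingFunction

variable {z q : ℂ}

lemma wt_replicate_one_add (q : ℂ) (j : ℕ) (s : Multiset ℕ) :
    wt q (Multiset.replicate j 1 + s) = q ^ j * wt q s := by
  have h : 0 ∈ Multiset.replicate j 1 + s ↔ 0 ∈ s := by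
    rw [Multiset.mem_add]
    exact or_iff_right fun h ↦ absurd (Multiset.eq_of_mem_replicate h) (by omega)
  simp only [wt, h, Multiset.sum_add, Multiset.sum_replicate, smul_eq_mul, mul_one, pow_add]
  split_ifs <;> ring

lemma multisetCrank_replicate_one_add {j : ℕ} (hj : 1 ≤ j) {s : Multiset ℕ} (hs : 1 ∉ s) :
    multisetCrank (Multiset.replicate j 1 + s) = (s.filter fun x ↦ j < x).card - (j : ℤ) := by
  have h1 : (Multiset.replicate j 1 + s).count 1 = j := by
    rw [Multiset.count_add, Multiset.count_replicate_self, Multiset.count_eq_zero_of_notMem hs,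
      add_zero]
  have h2 : (Multiset.replicate j 1).filter (fun x ↦ j < x) = 0 :=
    Multiset.filter_eq_nil.2 fun b hb ↦ by rw [Multiset.eq_of_mem_replicate hb]; omega
  rw [multisetCrank, h1, if_neg (by omega), Multiset.filter_add, h2, zero_add]

lemma multisetCrank_of_notMem {s : Multiset ℕ} (hs : 1 ∉ s) : multisetCrank s = s.sup := by
  rw [multisetCrank, if_pos (Multiset.count_eq_zero_of_notMem hs)]

lemma norm_zpow_of_norm_one (hz : ‖z‖ = 1) (n : ℤ) : ‖z ^ n‖ = 1 := by
  rw [norm_zpow, hz, one_zpow]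

lemma hasSum_crank_fiber (hz : ‖z‖ = 1) (hq : ‖q‖ < 1) (j : ℕ) :
    HasSum (fun s : {s : Multiset ℕ // 1 ∉ s} ↦
        z ^ multisetCrank (Multiset.replicate j 1 + s.1) * wt q (Multiset.replicate j 1 + s.1))
      ((1 - q) / poch q (z * q) * (fpoch q (z * q) j / fpoch q q j * (q / z) ^ j)
        + if j = 0 then q - z * q else 0) := by
  have hz0 : z ≠ 0 := fun h ↦ by rw [h, norm_zero] at hz; exact zero_ne_one hz
  rcases Nat.eq_zero_or_pos j with rfl | hj
  · have h1 := hasSum_noOnes hz hq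
    rw [← hasSum_subtype_iff_of_support_subset (s := {s : Multiset ℕ | 1 ∉ s}) fun s hs h ↦
      hs (by rw [prod_crankWeight, if_pos h, mul_zero])] at h1
    rw [if_pos rfl, fpoch_zero, fpoch_zero, div_one, pow_zero, mul_one, mul_one, ← add_sub_assoc]
    refine h1.congr_fun fun s ↦ ?_
    have hs : 1 ∉ s.1 := s.2
    rw [Function.comp_apply, Multiset.replicate_zero, zero_add, multisetCrank_of_notMem hs,
      prod_crankWeight, if_neg hs, one_pow, one_mul, zpow_natCast]
  · have h1 := (hasSum_crankWeight hz hq hj).mul_left ((q / z) ^ j)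
    rw [← hasSum_subtype_iff_of_support_subset (s := {s : Multiset ℕ | 1 ∉ s}) fun s hs h ↦
      hs (by rw [prod_crankWeight, if_pos h, mul_zero])] at h1
    rw [if_neg (by omega), add_zero, show (1 - q) / poch q (z * q)
        * (fpoch q (z * q) j / fpoch q q j
      * (q / z) ^ j) = (q / z) ^ j * ((1 - q) / poch q (z * q) * (fpoch q (z * q) j / fpoch q q j))
      by ring]
    refine h1.congr_fun fun s ↦ ?_
    have hs : 1 ∉ s.1 := s.2
    rw [Function.comp_apply, multisetCrank_replicate_one_add hj hs, wt_replicate_one_add,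
      prod_crankWeight, if_neg hs, zpow_sub₀ hz0, zpow_natCast, zpow_natCast, div_pow]
    ring

/-- The generating function of the crank. -/
lemma tsum_crank (hz : ‖z‖ = 1) (hq : ‖q‖ < 1) :
    ∑' s, z ^ multisetCrank s * wt q s = crankGF z q + (q - z * q) := by
  have hz0 : z ≠ 0 := fun h ↦ by rw [h, norm_zero] at hz; exact zero_ne_one hz
  have h := (summable_mul_wt hq fun s ↦ (norm_zpow_of_norm_one hz (multisetCrank s)).le).hasSum
  set A := ∑' s, z ^ multisetCrank s * wt q s
  rw [← (splitEquiv 1).symm.hasSum_iff] at h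
  have h1 := h.prod_fiberwise (hasSum_crank_fiber hz hq)
  have h2 := h1.sub (hasSum_ite_eq 0 (q - z * q))
  simp only [add_sub_cancel_right] at h2
  have h3 := h2.tsum_eq
  rw [tsum_mul_left] at h3
  have hqz : ‖q / z‖ < 1 := by rwa [norm_div, hz, div_one]
  have h4 := qbinomial hq (z * q) hqz
  have h5 : z * q * (q / z) = q * q := by field_simp
  have h6 := poch_eq_mul hq q
  rw [h5] at h4
  have h7 := poch_ne_zero hq (mul_pow_ne_one hz hq)
  have h8 : poch q (q / z) ≠ 0 := by
    have h9 : ‖z⁻¹‖ = 1 := by rw [norm_inv, hz, inv_one]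
    rw [div_eq_inv_mul]
    exact poch_ne_zero hq (mul_pow_ne_one h9 hq)
  rw [crankGF, h6, ← h4, ← sub_eq_iff_eq_add, ← h3]
  field_simp

end CrankGeneratingFunction

section Nonnegativity

/-- Functions on the unit disc with nonnegative power series coefficients. -/
def HasNonnegCoeffs (W : ℂ → ℂ) : Prop :=
  ∃ w : ℕ → ℝ, (∀ n, 0 ≤ w n) ∧ ∀ q : ℂ, ‖q‖ < 1 → HasSum (fun n ↦ (w n : ℂ) * q ^ n) (W q)

lemma HasNonnegCoeffs.congr {W V : ℂ → ℂ} (hW : HasNonnegCoeffs W)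
    (h : ∀ q, ‖q‖ < 1 → V q = W q) : HasNonnegCoeffs V := by
  obtain ⟨w, h0, h1⟩ := hW
  exact ⟨w, h0, fun q hq ↦ h q hq ▸ h1 q hq⟩

lemma hasNonnegCoeffs_pow (k : ℕ) : HasNonnegCoeffs fun q ↦ q ^ k := by
  refine ⟨fun n ↦ if n = k then 1 else 0, fun n ↦ ?_, fun q _ ↦ ?_⟩
  · dsimp only
    split_ifs <;> norm_num
  · convert hasSum_ite_eq k (q ^ k) using 2 with n
    split_ifs with h
    · rw [h]; simp
    · simp [h]

lemma summable_norm_coeff {w : ℕ → ℝ} {W : ℂ → ℂ} (h0 : ∀ n, 0 ≤ w n)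
    (h : ∀ q : ℂ, ‖q‖ < 1 → HasSum (fun n ↦ (w n : ℂ) * q ^ n) (W q)) {q : ℂ} (hq : ‖q‖ < 1) :
    HasSum (fun n ↦ ‖(w n : ℂ) * q ^ n‖) ‖W (‖q‖ : ℝ)‖ := by
  have h1 := h ((‖q‖ : ℝ) : ℂ) (by rwa [Complex.norm_real, norm_norm])
  have h2 : ∀ n, (w n : ℂ) * ((‖q‖ : ℝ) : ℂ) ^ n = ((‖(w n : ℂ) * q ^ n‖ : ℝ) : ℂ) := fun n ↦ by
    rw [norm_mul, norm_pow, Complex.norm_real, Real.norm_of_nonneg (h0 n)]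
    push_cast
    rfl
  simp only [h2] at h1
  have h3 : Summable fun n ↦ ‖(w n : ℂ) * q ^ n‖ := Complex.summable_ofReal.1 h1.summable
  have h4 := h1.unique (Complex.hasSum_ofReal.2 h3.hasSum)
  rw [h4, Complex.norm_real, Real.norm_of_nonneg (tsum_nonneg fun _ ↦ norm_nonneg _)]
  exact h3.hasSum

lemma HasNonnegCoeffs.mul {W V : ℂ → ℂ} (hW : HasNonnegCoeffs W) (hV : HasNonnegCoeffs V) :
    HasNonnegCoeffs fun q ↦ W q * V q := by
  obtain ⟨w, hw0, hw⟩ := hW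
  obtain ⟨v, hv0, hv⟩ := hV
  refine ⟨fun n ↦ ∑ p ∈ Finset.HasAntidiagonal.antidiagonal n, w p.1 * v p.2,
    fun n ↦ Finset.sum_nonneg fun p _ ↦ mul_nonneg (hw0 _) (hv0 _), fun q hq ↦ ?_⟩
  have h1 := (summable_norm_coeff hw0 hw hq).summable
  have h2 := (summable_norm_coeff hv0 hv hq).summable
  have h3 := tsum_mul_tsum_eq_tsum_sum_antidiagonal_of_summable_norm h1 h2
  have h4 := (summable_norm_sum_mul_antidiagonal_of_summable_norm h1 h2).of_norm.hasSum
  rw [← h3, (hw q hq).tsum_eq, (hv q hq).tsum_eq] at h4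
  refine h4.congr_fun fun n ↦ ?_
  push_cast
  rw [Finset.sum_mul]
  refine Finset.sum_congr rfl fun p hp ↦ ?_
  rw [← Finset.HasAntidiagonal.mem_antidiagonal.1 hp, pow_add]
  ring

lemma HasNonnegCoeffs.pow {W : ℂ → ℂ} (hW : HasNonnegCoeffs W) (k : ℕ) :
    HasNonnegCoeffs fun q ↦ W q ^ k := by
  induction k with
  | zero => simpa using hasNonnegCoeffs_pow 0
  | succ k ih => simpa only [pow_succ] using ih.mul hW

lemma HasNonnegCoeffs.tsum {ι : Type*} {W : ι → ℂ → ℂ} (hW : ∀ i, HasNonnegCoeffs (W i))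
    (h : ∀ q : ℂ, ‖q‖ < 1 → Summable fun i ↦ ‖W i q‖) :
    HasNonnegCoeffs fun q ↦ ∑' i, W i q := by
  choose w hw0 hw using hW
  have hs : ∀ q : ℂ, ‖q‖ < 1 → Summable fun p : ι × ℕ ↦ ‖(w p.1 p.2 : ℂ) * q ^ p.2‖ :=
    fun q hq ↦ by
      refine (summable_prod_of_nonneg fun _ ↦ norm_nonneg _).2
        ⟨fun i ↦ (summable_norm_coeff (hw0 i) (hw i) hq).summable, ?_⟩
      have h1 := h (‖q‖ : ℝ) (by rwa [Complex.norm_real, norm_norm])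
      refine h1.congr fun i ↦ ?_
      exact (summable_norm_coeff (hw0 i) (hw i) hq).tsum_eq.symm
  refine ⟨fun n ↦ ∑' i, w i n, fun n ↦ tsum_nonneg fun i ↦ hw0 i n, fun q hq ↦ ?_⟩
  have h2 := (hs q hq).of_norm.hasSum
  have h3 := h2.prod_fiberwise fun i ↦ hw i q hq
  dsimp only
  rw [h3.tsum_eq]
  have h4 := (Equiv.prodComm ℕ ι).hasSum_iff.2 h2
  refine h4.prod_fiberwise fun n ↦ ?_
  have h5 : Summable fun i ↦ w i n := by
    have h6 := ((hs (1 / 2) (by norm_num)).comp_injective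
      (Prod.mk_left_injective n : Function.Injective fun i : ι ↦ (i, n)))
    have h7 := h6.mul_right (2 ^ n)
    refine h7.congr fun i ↦ ?_
    rw [Function.comp_apply, norm_mul, Complex.norm_real, Real.norm_of_nonneg (hw0 i n), norm_pow]
    norm_num [mul_assoc, ← mul_pow]
  rw [Complex.ofReal_tsum]
  exact ((Complex.summable_ofReal.2 h5).hasSum).mul_right (q ^ n)

lemma hasNonnegCoeffs_inv_one_sub {m : ℕ} (hm : 1 ≤ m) :
    HasNonnegCoeffs fun q ↦ (1 - q ^ m)⁻¹ := by
  have h1 : ∀ q : ℂ, ‖q‖ < 1 → ‖q ^ m‖ < 1 := fun q hq ↦ by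
    rw [norm_pow]; exact pow_lt_one₀ (norm_nonneg q) hq (by omega)
  refine (HasNonnegCoeffs.tsum (fun n : ℕ ↦ hasNonnegCoeffs_pow (m * n)) fun q hq ↦ ?_).congr
    fun q hq ↦ ?_
  · simp only [pow_mul, norm_pow _ (_ : ℕ)]
    exact summable_geometric_of_lt_one (by positivity) (by simpa using h1 q hq)
  · simp only [pow_mul]
    exact (tsum_geometric_of_norm_lt_one (h1 q hq)).symm

lemma hasNonnegCoeffs_inv_fpoch {a : ℕ} (ha : 1 ≤ a) (n : ℕ) :
    HasNonnegCoeffs fun q ↦ (fpoch (q ^ a) (q ^ a) n)⁻¹ := by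
  induction n with
  | zero => simpa [fpoch_zero] using hasNonnegCoeffs_pow 0
  | succ n ih =>
    refine (ih.mul (hasNonnegCoeffs_inv_one_sub (m := a + a * n) (by omega))).congr fun q _ ↦ ?_
    rw [fpoch_succ, mul_inv, pow_add q a (a * n), pow_mul]

lemma norm_pow_lt_one {q : ℂ} (hq : ‖q‖ < 1) {a : ℕ} (ha : 1 ≤ a) : ‖q ^ a‖ < 1 := by
  rw [norm_pow]
  exact pow_lt_one₀ (norm_nonneg q) hq (by omega)

lemma poch_pow_ne_zero {q : ℂ} (hq : ‖q‖ < 1) {a b : ℕ} (ha : 1 ≤ a) (hb : 1 ≤ b) :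
    poch (q ^ a) (q ^ b) ≠ 0 := by
  refine poch_ne_zero (norm_pow_lt_one hq ha) fun m h ↦ ?_
  rw [← pow_mul, ← pow_add] at h
  have h1 := norm_pow_lt_one hq (show 1 ≤ b + a * m by omega)
  rw [h, norm_one] at h1
  exact lt_irrefl _ h1

lemma hasNonnegCoeffs_inv_poch {a b : ℕ} (ha : 1 ≤ a) (hb : 1 ≤ b) :
    HasNonnegCoeffs fun q ↦ (poch (q ^ a) (q ^ b))⁻¹ := by
  refine (HasNonnegCoeffs.tsum (fun n : ℕ ↦ (hasNonnegCoeffs_inv_fpoch ha n).mul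
    (hasNonnegCoeffs_pow (b * n))) fun q hq ↦ ?_).congr fun q hq ↦ ?_
  · have h1 := summable_norm_euler_inv (norm_pow_lt_one hq ha) (norm_pow_lt_one hq hb)
    simpa only [one_div, pow_mul] using h1
  · have h1 := euler_inv (norm_pow_lt_one hq ha) (norm_pow_lt_one hq hb)
    rw [← eq_inv_of_mul_eq_one_right h1]
    simp only [one_div, pow_mul]

/-- The quotient of theta type with one factor in the numerator. -/
lemma hasNonnegCoeffs_poch_quotient {a b : ℕ} (ha : 1 ≤ a) (hb : 1 ≤ b) :
    HasNonnegCoeffs fun q ↦ poch (q ^ (a + b)) (q ^ (a + b))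
      / (poch (q ^ (a + b)) (q ^ a) * poch (q ^ (a + b)) (q ^ b)) := by
  have hab : 1 ≤ a + b := by omega
  have key : ∀ q : ℂ, ‖q‖ < 1 → ∀ n : ℕ, (fpoch (q ^ (a + b)) (q ^ (a + b)) n)⁻¹ * q ^ (b * n)
      * (poch (q ^ (a + b)) (q ^ (a + (a + b) * n)))⁻¹
      = (poch (q ^ (a + b)) (q ^ a))⁻¹ * (fpoch (q ^ (a + b)) (q ^ a) n
        / fpoch (q ^ (a + b)) (q ^ (a + b)) n * (q ^ b) ^ n) := fun q hq n ↦ by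
    have h1 := poch_eq_fpoch_mul (norm_pow_lt_one hq hab) (q ^ a) n
    have h2 := poch_pow_ne_zero hq hab (show 1 ≤ a + (a + b) * n by omega)
    have h3 := poch_pow_ne_zero hq hab ha
    have h4 := fpoch_self_ne_zero (norm_pow_lt_one hq hab) n
    rw [← pow_mul, ← pow_add] at h1
    rw [pow_mul q b n]
    rw [h1] at h3 ⊢
    have h5 := left_ne_zero_of_mul h3
    generalize fpoch (q ^ (a + b)) (q ^ (a + b)) n = x at *
    generalize fpoch (q ^ (a + b)) (q ^ a) n = y at *
    generalize poch (q ^ (a + b)) (q ^ (a + (a + b) * n)) = z at *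
    field_simp
  refine (HasNonnegCoeffs.tsum (fun n : ℕ ↦ ((hasNonnegCoeffs_inv_fpoch hab n).mul
    (hasNonnegCoeffs_pow (b * n))).mul (hasNonnegCoeffs_inv_poch hab
      (show 1 ≤ a + (a + b) * n by omega))) fun q hq ↦ ?_).congr fun q hq ↦ ?_
  · simp only [key q hq]
    have h1 := summable_norm_of_qrec (norm_pow_lt_one hq hab) (α := q ^ a) (β := 1)
      (c := fun n ↦ fpoch (q ^ (a + b)) (q ^ a) n / fpoch (q ^ (a + b)) (q ^ (a + b)) n)
      (by simpa only [one_mul] using qbinomial_rec (norm_pow_lt_one hq hab) (q ^ a)) (z := q ^ b)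
      (by rw [norm_one, one_mul]; exact norm_pow_lt_one hq hb)
    simpa only [norm_mul] using h1.mul_left ‖(poch (q ^ (a + b)) (q ^ a))⁻¹‖
  · simp only [key q hq]
    have h1 := qbinomial (norm_pow_lt_one hq hab) (q ^ a) (norm_pow_lt_one hq hb)
    have h2 := poch_pow_ne_zero hq hab ha
    have h3 := poch_pow_ne_zero hq hab hb
    rw [tsum_mul_left]
    rw [← pow_add] at h1
    rw [← h1]
    field_simp

lemma hasNonnegCoeffs_residueProd (e₂ e₃ e₄ e₅ : ℕ) :
    HasNonnegCoeffs (residueProd 1 e₂ e₃ e₄ e₅) := by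
  have h : ∀ b c : ℕ, 1 ≤ b → 1 ≤ c → ∀ e : ℕ, HasNonnegCoeffs fun q ↦
      ((poch (q ^ 11) (q ^ b))⁻¹ * (poch (q ^ 11) (q ^ c))⁻¹) ^ e := fun b c hb hc e ↦
    ((hasNonnegCoeffs_inv_poch (by norm_num) hb).mul
      (hasNonnegCoeffs_inv_poch (by norm_num) hc)).pow e
  refine (((((hasNonnegCoeffs_poch_quotient (a := 1) (b := 10) le_rfl (by norm_num)).mul
    (h 2 9 (by norm_num) (by norm_num) e₂)).mul (h 3 8 (by norm_num) (by norm_num) e₃)).mul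
    (h 4 7 (by norm_num) (by norm_num) e₄)).mul (h 5 6 (by norm_num) (by norm_num) e₅)).congr
    fun q _ ↦ ?_
  rw [residueProd]
  simp only [← mul_inv, inv_pow, pow_one, Nat.reduceAdd]
  simp only [div_eq_mul_inv, mul_inv]
  ring

end Nonnegativity

section Coefficients

lemma HasNonnegCoeffs.comp_pow {W : ℂ → ℂ} (hW : HasNonnegCoeffs W) {k : ℕ} (hk : 1 ≤ k) :
    HasNonnegCoeffs fun q ↦ W (q ^ k) := by
  obtain ⟨w, h0, h⟩ := hW
  have hinj : Function.Injective fun n : ℕ ↦ k * n := fun a b hab ↦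
    Nat.eq_of_mul_eq_mul_left (by omega) hab
  refine ⟨fun n ↦ if k ∣ n then w (n / k) else 0, fun n ↦ ?_, fun q hq ↦ ?_⟩
  · dsimp only
    split_ifs
    exacts [h0 _, le_rfl]
  · refine (hinj.hasSum_iff fun n hn ↦ ?_).1 ?_
    · dsimp only
      rw [if_neg fun ⟨m, hm⟩ ↦ hn ⟨m, hm.symm⟩, Complex.ofReal_zero, zero_mul]
    · refine (h (q ^ k) (norm_pow_lt_one hq hk)).congr_fun fun n ↦ ?_
      dsimp only [Function.comp_apply]
      rw [if_pos (dvd_mul_right k n), Nat.mul_div_cancel_left n (by omega),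
        pow_mul]

lemma coeff_unique {a b : ℕ → ℂ} {F : ℂ → ℂ}
    (ha : ∀ q : ℂ, q ≠ 0 → ‖q‖ < 1 → HasSum (fun n ↦ a n * q ^ n) (F q))
    (hb : ∀ q : ℂ, q ≠ 0 → ‖q‖ < 1 → HasSum (fun n ↦ b n * q ^ n) (F q)) : a = b := by
  let c : ℕ → ℂ := fun n ↦ if n = 0 then 0 else a (n - 1) - b (n - 1)
  have h : HasFPowerSeriesAt (fun _ ↦ (0 : ℂ)) (FormalMultilinearSeries.ofScalars ℂ c) 0 := by
    rw [hasFPowerSeriesAt_iff]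
    filter_upwards [Metric.ball_mem_nhds (0 : ℂ) one_pos] with q hq
    rw [mem_ball_zero_iff] at hq
    simp only [FormalMultilinearSeries.coeff_ofScalars, smul_eq_mul]
    rw [← hasSum_nat_add_iff' 1]
    rcases eq_or_ne q 0 with rfl | hq0
    · simp [c, hasSum_zero]
    · have h1 := ((ha q hq0 hq).sub (hb q hq0 hq)).mul_left q
      rw [sub_self, mul_zero] at h1
      simp only [Finset.range_one, Finset.sum_singleton, c, if_true, mul_zero, sub_zero]
      refine h1.congr_fun fun n ↦ ?_
      rw [if_neg n.succ_ne_zero, Nat.add_sub_cancel]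
      ring
  funext n
  have h1 := congrArg (fun p ↦ p.coeff (n + 1)) h.eq_zero
  simp only [FormalMultilinearSeries.coeff_ofScalars, c, if_neg n.succ_ne_zero,
    Nat.add_sub_cancel] at h1
  exact sub_eq_zero.1 (h1.trans (by simp [FormalMultilinearSeries.coeff]))

/-- Taking the section of a power series keeps the exponents congruent to `4` modulo `11`. -/
lemma hasSum_sect {a : ℕ → ℂ} {F : ℂ → ℂ}
    (ha : ∀ q : ℂ, q ≠ 0 → ‖q‖ < 1 → HasSum (fun n ↦ a n * q ^ n) (F q)) {q : ℂ} (hq0 : q ≠ 0)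
    (hq : ‖q‖ < 1) :
    HasSum (fun n : ℕ ↦ (if (11 : ℤ) ∣ n - 4 then a n else 0) * q ^ n) (sect F q) := by
  have h : ∀ j ∈ Finset.range 11, HasSum (fun n : ℕ ↦ (omega ^ j) ^ (-4 : ℤ)
      * (a n * (omega ^ j * q) ^ n)) ((omega ^ j) ^ (-4 : ℤ) * F (omega ^ j * q)) := fun j _ ↦
    (ha _ (mul_ne_zero (pow_ne_zero _ omega_ne_zero) hq0)
      (by rwa [norm_omega_pow_mul])).mul_left _
  refine ((hasSum_sum h).div_const 11).congr_fun fun n ↦ ?_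
  have h1 : ∀ j : ℕ, (omega ^ j) ^ (-4 : ℤ) * (a n * (omega ^ j * q) ^ n)
      = (omega ^ j) ^ ((n : ℤ) - 4) * (a n * q ^ n) := fun j ↦ by
    rw [sub_eq_add_neg, zpow_add₀ (pow_ne_zero _ omega_ne_zero), zpow_natCast, mul_pow]
    ring
  simp only [h1]
  rw [← Finset.sum_mul, sum_omega_zpow]
  split_ifs <;> ring

lemma hasSum_rankCount {q : ℂ} (hq0 : q ≠ 0) (hq : ‖q‖ < 1) {a : ℕ} (ha : a ≤ 10) :
    HasSum (fun n ↦ (rankCount a 11 n : ℂ) * q ^ n) (rankClassGF a q) := by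
  have h1 : rankClassGF a q = rankGF (fun x ↦ x % 11 = a) q := by
    rcases Nat.eq_zero_or_pos a with rfl | h
    · exact (rankGF_class_zero hq0 hq).symm
    · exact (rankGF_class hq0 hq h ha).symm
  rw [h1, show rankGF (fun x ↦ x % 11 = a) q
    = ∑' s, (if multisetRank s % 11 = a then 1 else 0) * wt q s by rw [rankGF]; congr!]
  refine (hasSum_partition hq (g := fun s ↦ if multisetRank s % 11 = a then 1 else 0)
    fun s ↦ norm_ite_le _).congr_fun fun n ↦ ?_
  rw [Finset.sum_boole, rankCount]
  simp only [partitionRank, multisetRank, show (a : ℤ) % 11 = a by omega]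
  congr!

/-- The coefficient of `q ^ n` in the generating function of the crank at the argument `z`. -/
noncomputable def crankCoeff (z : ℂ) (n : ℕ) : ℂ :=
  ∑ π : Nat.Partition n, z ^ multisetCrank π.parts + if n = 1 then z - 1 else 0

lemma hasSum_crankCoeff {z q : ℂ} (hz : ‖z‖ = 1) (hq : ‖q‖ < 1) :
    HasSum (fun n ↦ crankCoeff z n * q ^ n) (crankGF z q) := by
  have h1 := hasSum_partition hq fun s ↦ (norm_zpow_of_norm_one hz (multisetCrank s)).le
  rw [tsum_crank hz hq] at h1
  have h2 := h1.add (hasSum_ite_eq 1 ((z - 1) * q))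
  rw [show crankGF z q + (q - z * q) + (z - 1) * q = crankGF z q by ring] at h2
  refine h2.congr_fun fun n ↦ ?_
  rw [crankCoeff, add_mul]
  congr 1
  split_ifs with h
  · rw [h, pow_one]
  · rw [zero_mul]

lemma sum_crankCoeff (n : ℕ) :
    (∑ j ∈ Finset.range 11, (1 - (omega ^ j)⁻¹) * crankCoeff (omega ^ j) n) / 11
      = ((crankCount 0 n - crankCount 1 n : ℤ) : ℂ) := by
  have h0 : ∀ j : ℕ, omega ^ j ≠ 0 := fun j ↦ pow_ne_zero _ omega_ne_zero
  rcases eq_or_ne n 1 with rfl | hn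
  · have h1 : ∀ j : ℕ, (1 - (omega ^ j)⁻¹) * crankCoeff (omega ^ j) 1
        = (omega ^ j) ^ (1 : ℤ) + 2 * (omega ^ j) ^ (-1 : ℤ) - (omega ^ j) ^ (-2 : ℤ)
          - 2 * (omega ^ j) ^ (0 : ℤ) := fun j ↦ by
      have h2 : multisetCrank (default : Nat.Partition 1).parts = -1 := by decide
      rw [crankCoeff, Fintype.sum_unique, h2, if_pos rfl,
        show (-2 : ℤ) = -1 + -1 by norm_num, zpow_add₀ (h0 j), zpow_neg_one, zpow_one, zpow_zero]
      have := h0 j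
      field_simp
      ring
    simp only [h1, Finset.sum_add_distrib, Finset.sum_sub_distrib, ← Finset.mul_sum,
      sum_omega_zpow]
    norm_num [crankCount]
  · have h1 : ∀ j : ℕ, (1 - (omega ^ j)⁻¹) * crankCoeff (omega ^ j) n
        = ∑ π : Nat.Partition n, ((omega ^ j) ^ multisetCrank π.parts
          - (omega ^ j) ^ (multisetCrank π.parts - 1)) := fun j ↦ by
      rw [crankCoeff, if_neg hn, add_zero, Finset.mul_sum]
      refine Finset.sum_congr rfl fun π _ ↦ ?_
      rw [zpow_sub_one₀ (h0 j)]
      ring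
    have h2 : ∀ r : ℤ, (∑ j ∈ Finset.range 11, ∑ π : Nat.Partition n,
        (omega ^ j) ^ (multisetCrank π.parts - r)) = 11 * crankCount r n := fun r ↦ by
      rw [Finset.sum_comm]
      simp only [sum_omega_zpow, crankCount, if_neg hn]
      rw [← Finset.sum_filter, Finset.sum_const, nsmul_eq_mul, mul_comm, Int.cast_natCast]
      congr 4
      ext π
      change (11 : ℤ) ∣ partitionCrank π - r ↔ _
      omega
    simp only [h1, Finset.sum_sub_distrib]
    have h3 := h2 0
    simp only [sub_zero] at h3
    rw [h3, h2 1]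
    push_cast
    ring

lemma hasSum_crankCount {q : ℂ} (hq : ‖q‖ < 1) :
    HasSum (fun n ↦ ((crankCount 0 n - crankCount 1 n : ℤ) : ℂ) * q ^ n) (crankDiffGF q) := by
  have hw : ∀ j : ℕ, ‖omega ^ j‖ = 1 := fun j ↦ by simpa using norm_omega_pow_mul j 1
  have h := (hasSum_sum fun (j : ℕ) (_ : j ∈ Finset.range 11) ↦
    (hasSum_crankCoeff (hw j) hq).mul_left (1 - (omega ^ j)⁻¹)).div_const 11
  rw [crankDiffGF]
  refine h.congr_fun fun n ↦ ?_
  rw [← sum_crankCoeff, div_mul_eq_mul_div, Finset.sum_mul]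
  simp only [mul_assoc]

/-- If the section of the generating function of a combination of ranks and cranks is an infinite
product with nonnegative coefficients, then the combination is nonnegative at `11 * n + 4`. -/
lemma combination_nonneg {r₀ r₁ r₂ r₃ r₄ e : ℤ} (hr : r₀ + r₁ + r₂ + r₃ + 2 * r₄ = 0)
    (k e₂ e₃ e₄ e₅ : ℕ)
    (h : ∀ q : ℂ, q ≠ 0 → ‖q‖ < 1 → sect (fun q ↦ (((r₁ - r₂ : ℤ) : ℂ) * (rankSum q 0 + 4 / 11)
      + ((2 * r₀ - r₁ : ℤ) : ℂ) * (rankSum q (-1) + 5 / 11)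
      + ((r₃ - r₄ : ℤ) : ℂ) * (rankSum q 2 + 2 / 11)
      + ((r₂ - r₃ : ℤ) : ℂ) * (rankSum q 1 + 3 / 11)) / poch q q + (e : ℂ) * crankDiffGF q) q
      = 11 * (q ^ k * residueProd 1 e₂ e₃ e₄ e₅ (q ^ 11))) (n : ℕ) :
    0 ≤ r₀ * rankCount 0 11 (11 * n + 4) + r₁ * rankCount 1 11 (11 * n + 4)
      + r₂ * rankCount 2 11 (11 * n + 4) + r₃ * rankCount 3 11 (11 * n + 4)
      + r₄ * (rankCount 4 11 (11 * n + 4) + rankCount 5 11 (11 * n + 4))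
      + e * (crankCount 0 (11 * n + 4) - crankCount 1 (11 * n + 4)) := by
  let D : ℕ → ℤ := fun n ↦ r₀ * rankCount 0 11 n + r₁ * rankCount 1 11 n
    + r₂ * rankCount 2 11 n + r₃ * rankCount 3 11 n
    + r₄ * (rankCount 4 11 n + rankCount 5 11 n) + e * (crankCount 0 n - crankCount 1 n)
  have hD : ∀ q : ℂ, q ≠ 0 → ‖q‖ < 1 → HasSum (fun n ↦ (D n : ℂ) * q ^ n)
      ((((r₁ - r₂ : ℤ) : ℂ) * (rankSum q 0 + 4 / 11)
      + ((2 * r₀ - r₁ : ℤ) : ℂ) * (rankSum q (-1) + 5 / 11)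
      + ((r₃ - r₄ : ℤ) : ℂ) * (rankSum q 2 + 2 / 11)
      + ((r₂ - r₃ : ℤ) : ℂ) * (rankSum q 1 + 3 / 11)) / poch q q + (e : ℂ) * crankDiffGF q) :=
    fun q hq0 hq ↦ by
      have hN := fun (a : ℕ) (ha : a ≤ 10) ↦ hasSum_rankCount hq0 hq ha
      have hs := ((((((hN 0 (by norm_num)).mul_left (r₀ : ℂ)).add
        ((hN 1 (by norm_num)).mul_left (r₁ : ℂ))).add
        ((hN 2 (by norm_num)).mul_left (r₂ : ℂ))).add
        ((hN 3 (by norm_num)).mul_left (r₃ : ℂ))).add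
        (((hN 4 (by norm_num)).add (hN 5 (by norm_num))).mul_left (r₄ : ℂ))).add
        ((hasSum_crankCount hq).mul_left (e : ℂ))
      have hp : poch q q ≠ 0 := by
        simpa only [pow_one] using poch_pow_ne_zero hq le_rfl le_rfl
      have hv : (r₀ : ℂ) = -r₁ - r₂ - r₃ - 2 * r₄ := by
        have := congrArg (Int.cast : ℤ → ℂ) hr
        push_cast at this
        linear_combination this
      have hs' : HasSum (fun n ↦ (D n : ℂ) * q ^ n) _ := hs.congr_fun fun n ↦ by
        simp only [D]
        push_cast
        ring
      convert hs' using 1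
      simp only [rankClassGF]
      norm_num [rankSum_neg_two hq0 hq, rankSum_four hq0 hq]
      rw [hv]
      field_simp
      ring
  have hW : HasNonnegCoeffs fun q ↦ 11 * (q ^ k * residueProd 1 e₂ e₃ e₄ e₅ (q ^ 11)) := by
    have h1 := (hasNonnegCoeffs_pow k).mul
      ((hasNonnegCoeffs_residueProd e₂ e₃ e₄ e₅).comp_pow (k := 11) (by norm_num))
    obtain ⟨w, hw0, hw⟩ := h1
    refine ⟨fun n ↦ 11 * w n, fun n ↦ mul_nonneg (by norm_num) (hw0 n), fun q hq ↦ ?_⟩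
    refine ((hw q hq).mul_left 11).congr_fun fun n ↦ ?_
    push_cast
    ring
  obtain ⟨w, hw0, hw⟩ := hW
  have h1 := coeff_unique (fun q hq0 hq ↦ hasSum_sect hD hq0 hq)
    (fun q hq0 hq ↦ by rw [h q hq0 hq]; exact hw q hq)
  have h2 := congrFun h1 (11 * n + 4)
  rw [if_pos (by push_cast; omega)] at h2
  have h3 : ((D (11 * n + 4) : ℤ) : ℝ) = w (11 * n + 4) := by exact_mod_cast h2
  have h4 := hw0 (11 * n + 4)
  rw [← h3] at h4
  exact_mod_cast h4

end Coefficients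

end RankCrank

/-- Rank-crank inequalities for the residue 4 modulo 11. -/
theorem rank_crank_inequalities_residue_four (n : ℕ) :
    (4 * (rankCount 1 11 (11  *  n  +  4) : ℤ)  +  3 * (rankCount 3 11 (11  *  n  +  4) : ℤ)  +  5 * crankCount 1 (11  *  n  +  4) ≥ 2 * (rankCount 0 11 (11  *  n  +  4) : ℤ)  +  3 * (rankCount 2 11 (11  *  n  +  4) : ℤ)  +  (rankCount 4 11 (11  *  n  +  4) : ℤ)  +  (rankCount 5 11 (11  *  n  +  4) : ℤ)  +  5 * crankCount 0 (11  *  n  +  4))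
    ∧ (4 * (rankCount 0 11 (11  *  n  +  4) : ℤ)  +  5 * (rankCount 2 11 (11  *  n  +  4) : ℤ)  +  3 * crankCount 0 (11  *  n  +  4) ≥ 5 * (rankCount 1 11 (11  *  n  +  4) : ℤ)  +  2 * (rankCount 3 11 (11  *  n  +  4) : ℤ)  +  (rankCount 4 11 (11  *  n  +  4) : ℤ)  +  (rankCount 5 11 (11  *  n  +  4) : ℤ)  +  3 * crankCount 1 (11  *  n  +  4))
    ∧ (3 * (rankCount 1 11 (11  *  n  +  4) : ℤ)  +  (rankCount 2 11 (11  *  n  +  4) : ℤ)  +  crankCount 0 (11  *  n  +  4) ≥ 2 * (rankCount 0 11 (11  *  n  +  4) : ℤ)  +  2 * (rankCount 3 11 (11  *  n  +  4) : ℤ)  +  crankCount 1 (11  *  n  +  4))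
    ∧ (3 * (rankCount 0 11 (11  *  n  +  4) : ℤ)  +  (rankCount 4 11 (11  *  n  +  4) : ℤ)  +  (rankCount 5 11 (11  *  n  +  4) : ℤ)  +  crankCount 1 (11  *  n  +  4) ≥ 3 * (rankCount 2 11 (11  *  n  +  4) : ℤ)  +  2 * (rankCount 3 11 (11  *  n  +  4) : ℤ)  +  crankCount 0 (11  *  n  +  4)) := by
  refine ⟨?_, ?_, ?_, ?_⟩
  · have h := RankCrank.combination_nonneg (r₀ := -2) (r₁ := 4) (r₂ := -3) (r₃ := 3) (r₄ := -1)
      (e := -5) (by norm_num) 26 4 2 3 3 (fun q hq0 hq ↦ by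
        rw [RankCrank.sect_rank_combination _ _ _ _ _ hq0 hq,
          ← (RankCrank.sections_eq_residueProd hq0 hq).1]
        push_cast
        ring) n
    linarith
  · have h := RankCrank.combination_nonneg (r₀ := 4) (r₁ := -5) (r₂ := 5) (r₃ := -2) (r₄ := -1)
      (e := 3) (by norm_num) 15 5 4 2 1 (fun q hq0 hq ↦ by
        rw [RankCrank.sect_rank_combination _ _ _ _ _ hq0 hq,
          ← (RankCrank.sections_eq_residueProd hq0 hq).2.1]
        push_cast
        ring) n
    linarith
  · have h := RankCrank.combination_nonneg (r₀ := -2) (r₁ := 3) (r₂ := 1) (r₃ := -2) (r₄ := 0)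
      (e := 1) (by norm_num) 26 3 4 3 2 (fun q hq0 hq ↦ by
        rw [RankCrank.sect_rank_combination _ _ _ _ _ hq0 hq,
          ← (RankCrank.sections_eq_residueProd hq0 hq).2.2.1]
        push_cast
        ring) n
    linarith
  · have h := RankCrank.combination_nonneg (r₀ := 3) (r₁ := 0) (r₂ := -3) (r₃ := -2) (r₄ := 1)
      (e := -1) (by norm_num) 37 2 2 4 4 (fun q hq0 hq ↦ by
        rw [RankCrank.sect_rank_combination _ _ _ _ _ hq0 hq,
          ← (RankCrank.sections_eq_residueProd hq0 hq).2.2.2]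
        push_cast
        ring) n
    linarith
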